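/- Let φ : ∂𝔻 → ℝ be bounded and lower semicontinuous, and let ψ : 𝔻 → ℝ be a smooth function with a ≤ ψ(z) ≤ b for all z ∈ 𝔻, where 0 < a ≤ b < +∞. Then there exists a unique smooth convex function f : ℝ² → ℝ such that: (i) ‖∇f(p)‖ < 1 for every p ∈ ℝ²; (ii) det D²f(p) = ψ(∇f(p))·(1 − ‖∇f(p)‖²)² for every p ∈ ℝ² (i.e. the graph of f is a spacelike entire graph in Minkowski space whose Gauss curvature at the point with Gauss-map image x ∈ 𝔻 equals −ψ(x)); and (iii) for every z ∈ ∂𝔻, lim_{r→+∞}(r − f(rz)) = φ(z). -/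

import Mathlib

open Metric Filter
open scoped RealInnerProductSpace Topology

noncomputable section

/-- The plane `ℝ²`, as a Euclidean space. -/
abbrev E2 : Type := EuclideanSpace ℝ (Fin 2)

/-- The Hessian of `f : ℝ² → ℝ` at `p`, evaluated as a bilinear form on `(v, w)`. -/
def hess (f : E2 → ℝ) (p v w : E2) : ℝ := fderiv ℝ (fderiv ℝ f) p v w

/-- The determinant of the Hessian of `f : ℝ² → ℝ` at `p`. -/
def detHess (f : E2 → ℝ) (p : E2) : ℝ :=
  hess f p (EuclideanSpace.single 0 1) (EuclideanSpace.single 0 1) *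
    hess f p (EuclideanSpace.single 1 1) (EuclideanSpace.single 1 1) -
  hess f p (EuclideanSpace.single 0 1) (EuclideanSpace.single 1 1) *
    hess f p (EuclideanSpace.single 1 1) (EuclideanSpace.single 0 1)

set_option linter.all false
set_option linter.deprecated false

section A1
open Complex MeasureTheory
open scoped ContDiff

/-- integration by parts against a compactly supported function -/
lemma ibp_aux {f g : ℂ → ℂ} {U : Set ℂ} (hU : IsOpen U) (hf : ∀ z ∈ U, DifferentiableAt ℝ f z)
    (v : ℂ) (hf' : ContinuousOn (fun z => fderiv ℝ f z v) U)
    (hg : ContDiff ℝ 1 g) (hgc : HasCompactSupport g) (hgU : tsupport g ⊆ U) :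
    Integrable (fun z => fderiv ℝ f z v * g z) ∧ Integrable (fun z => f z * fderiv ℝ g z v) ∧
    ∫ z, f z * fderiv ℝ g z v = - ∫ z, fderiv ℝ f z v * g z := by
  have key : ∀ (a b : ℂ → ℂ), ContinuousOn a U → Continuous b → tsupport b ⊆ tsupport g →
      Integrable (fun z => a z * b z) := by
    intro a b ha hb hbs
    have hcs : HasCompactSupport b := hgc.of_isClosed_subset (isClosed_tsupport _) hbs
    apply Continuous.integrable_of_hasCompactSupport
    · rw [continuous_iff_continuousAt]
      intro z
      by_cases hz : z ∈ U
      · exact (ha.continuousAt (hU.mem_nhds hz)).mul hb.continuousAt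
      · have : (fun z => a z * b z) =ᶠ[𝓝 z] fun _ => 0 := by
          have h1 : z ∉ tsupport b := fun h => hz (hgU (hbs h))
          filter_upwards [(isClosed_tsupport b).isOpen_compl.mem_nhds h1] with w hw
          rw [image_eq_zero_of_notMem_tsupport hw, mul_zero]
        exact (continuousAt_const).congr this.symm
    · exact hcs.mul_left
  have hgd : Continuous (fun z => fderiv ℝ g z v) :=
    (hg.continuous_fderiv (by norm_num)).clm_apply continuous_const
  have hfc : ContinuousOn f U := fun z hz => (hf z hz).continuousAt.continuousWithinAt
  have hs : tsupport (fun z => fderiv ℝ g z v) ⊆ tsupport g :=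
    tsupport_fderiv_apply_subset ℝ v
  refine ⟨key _ _ hf' hg.continuous subset_rfl, key _ _ hfc hgd hs, ?_⟩
  exact integral_mul_fderiv_eq_neg_fderiv_mul_of_integrable (key _ _ hf' hg.continuous subset_rfl)
    (key _ _ hfc hgd hs) (key _ _ hfc hg.continuous subset_rfl)
    (fun x hx => hf x (hgU hx)) (fun x _ => (hg.differentiable (by norm_num)) x)

/-- test functions -/
structure Tst (η : ℂ → ℂ) (U : Set ℂ) : Prop where
  smooth : ContDiff ℝ ∞ η
  cpt : HasCompactSupport η
  supp : tsupport η ⊆ U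

lemma Tst.mono {η : ℂ → ℂ} {U V : Set ℂ} (h : Tst η U) (hUV : U ⊆ V) : Tst η V :=
  ⟨h.smooth, h.cpt, h.supp.trans hUV⟩

lemma Tst.der {η : ℂ → ℂ} {U : Set ℂ} (h : Tst η U) (v : ℂ) :
    Tst (fun z => fderiv ℝ η z v) U := by
  refine ⟨?_, h.cpt.fderiv_apply ℝ v, (tsupport_fderiv_apply_subset ℝ v).trans h.supp⟩
  exact (h.smooth.fderiv_right (m := ∞) (by simp)).clm_apply contDiff_const

lemma Tst.diff {η : ℂ → ℂ} {U : Set ℂ} (h : Tst η U) : Differentiable ℝ η :=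
  h.smooth.differentiable (by simp)

lemma Tst.cont {η : ℂ → ℂ} {U : Set ℂ} (h : Tst η U) : Continuous η := h.smooth.continuous

lemma Tst.integrable {η : ℂ → ℂ} {U : Set ℂ} (h : Tst η U) : Integrable η :=
  h.cont.integrable_of_hasCompactSupport h.cpt

lemma Tst.integral_der {η : ℂ → ℂ} {U : Set ℂ} (h : Tst η U) (v : ℂ) :
    ∫ z, fderiv ℝ η z v = 0 := by
  have := (ibp_aux (f := fun _ => 1) isOpen_univ (fun z _ => differentiableAt_const _) v
    (by simp only [fderiv_fun_const]; exact continuousOn_const) (h.smooth.of_le (by simp)) h.cpt (Set.subset_univ _)).2.2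
  simpa using this

lemma Tst.memLp {η : ℂ → ℂ} {U : Set ℂ} (h : Tst η U) : MemLp η 2 volume :=
  h.cont.memLp_of_hasCompactSupport h.cpt

lemma Tst.add {η ζ : ℂ → ℂ} {U : Set ℂ} (h : Tst η U) (h' : Tst ζ U) :
    Tst (fun z => η z + ζ z) U :=
  ⟨h.smooth.add h'.smooth, h.cpt.add h'.cpt, (tsupport_add _ _).trans (Set.union_subset h.supp h'.supp)⟩

lemma Tst.const_mul {η : ℂ → ℂ} {U : Set ℂ} (h : Tst η U) (c : ℂ) :
    Tst (fun z => c * η z) U :=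
  ⟨contDiff_const.mul h.smooth, h.cpt.mul_left, (tsupport_mul_subset_right).trans h.supp⟩

lemma Tst.comp_clm {η : ℂ → ℂ} {U : Set ℂ} (h : Tst η U) (L : ℂ →L[ℝ] ℂ) :
    Tst (fun z => L (η z)) U :=
  ⟨L.contDiff.comp h.smooth, h.cpt.comp_left (g := L) (map_zero L),
    (closure_mono (Function.support_comp_subset (map_zero L) η)).trans h.supp⟩

/-- the symmetric IBP identity -/
lemma Tst.curl {α β : ℂ → ℂ} {U : Set ℂ} (h : Tst α U) (h' : Tst β U) (v w : ℂ) :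
    ∫ z, fderiv ℝ α z v * fderiv ℝ β z w = ∫ z, fderiv ℝ α z w * fderiv ℝ β z v := by
  have e1 := (ibp_aux isOpen_univ (fun z _ => (h.der v).diff z) w
    ((h.der v).der w).cont.continuousOn (h'.smooth.of_le (by simp)) h'.cpt (Set.subset_univ _)).2.2
  have e2 := (ibp_aux isOpen_univ (fun z _ => (h.der w).diff z) v
    ((h.der w).der v).cont.continuousOn (h'.smooth.of_le (by simp)) h'.cpt (Set.subset_univ _)).2.2
  rw [e1, e2]
  congr 1
  apply integral_congr_ae
  filter_upwards with z
  congr 1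
  have hd : DifferentiableAt ℝ (fderiv ℝ α) z :=
    ((h.smooth.fderiv_right (m := ∞) (by simp)).differentiable (by simp)) z
  rw [fderiv_clm_apply hd (differentiableAt_const _), fderiv_clm_apply hd (differentiableAt_const _)]
  simp only [ContinuousLinearMap.add_apply, ContinuousLinearMap.comp_apply,
    ContinuousLinearMap.flip_apply, fderiv_const, Pi.zero_apply, fderiv_fun_const]
  simp only [ContinuousLinearMap.zero_apply, map_zero, zero_add]
  have := (h.smooth.contDiffAt (x := z)).isSymmSndFDerivAt (by simp; exact WithTop.coe_le_coe.2 le_top)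
  exact this w v

/-- `∂_p + i ∂_y` -/
def db (η : ℂ → ℂ) (z : ℂ) : ℂ := fderiv ℝ η z 1 + I * fderiv ℝ η z I

lemma Tst.db {η : ℂ → ℂ} {U : Set ℂ} (h : Tst η U) : Tst (db η) U :=
  (h.der 1).add ((h.der I).const_mul I)

/-- the weak equation -/
def Wk (F : ℂ → ℂ) (E : ℂ → ℝ) (U : Set ℂ) : Prop :=
  ∀ η : ℂ → ℂ, Tst η U → ∫ z, (F z * db η z + (E z : ℂ) * fderiv ℝ η z 1) = 0

lemma Wk.mono {F : ℂ → ℂ} {E : ℂ → ℝ} {U V : Set ℂ} (h : Wk F E V) (hUV : U ⊆ V) : Wk F E U :=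
  fun η hη => h η (hη.mono hUV)

end A1

section A2
open Complex MeasureTheory
open scoped ContDiff

def Mt (t : ℝ) : ℝ := Real.smoothTransition (2 * t - 1)

lemma Mt_smooth : ContDiff ℝ ∞ Mt :=
  Real.smoothTransition.contDiff.comp ((contDiff_const.mul contDiff_id).sub contDiff_const)

lemma Mt_zero {t : ℝ} (h : t ≤ 1/2) : Mt t = 0 :=
  Real.smoothTransition.zero_of_nonpos (by linarith)

lemma Mt_one {t : ℝ} (h : 1 ≤ t) : Mt t = 1 :=
  Real.smoothTransition.one_of_one_le (by linarith)

lemma Mt_mono : Monotone Mt := fun a b h => Real.smoothTransition.monotone (by linarith)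

attribute [irreducible] Mt

def K1 (z : ℂ) : ℝ := 2 * deriv Mt (normSq z)

lemma normSq_smooth : ContDiff ℝ ∞ (fun z : ℂ => normSq z) := by
  have : (fun z : ℂ => normSq z) = fun z => z.re * z.re + z.im * z.im := by
    ext z; rw [normSq_apply]
  rw [this]
  exact (reCLM.contDiff.mul reCLM.contDiff).add (imCLM.contDiff.mul imCLM.contDiff)

lemma K1_smooth : ContDiff ℝ ∞ K1 := by
  have : ContDiff ℝ ∞ (deriv Mt) := by
    have := (contDiff_infty_iff_deriv.1 Mt_smooth).2
    exact this
  exact contDiff_const.mul (this.comp normSq_smooth)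

lemma K1_nonneg (z : ℂ) : 0 ≤ K1 z := mul_nonneg two_pos.le (Mt_mono.deriv_nonneg)

lemma K1_supp : Function.support K1 ⊆ closedBall 0 1 := by
  intro z hz
  by_contra h
  apply hz
  have h1 : 1 < ‖z‖ := by simpa using h
  have h2 : 1 < normSq z := by rw [normSq_eq_norm_sq]; nlinarith
  have : Mt =ᶠ[𝓝 (normSq z)] fun _ => 1 := by
    filter_upwards [lt_mem_nhds h2] with t ht using Mt_one ht.le
  simp [K1, this.deriv_eq]

lemma K1_tsupp : tsupport K1 ⊆ closedBall 0 1 := closure_minimal K1_supp isClosed_closedBall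

lemma K1_cpt : HasCompactSupport K1 :=
  HasCompactSupport.of_support_subset_isCompact (isCompact_closedBall _ _) K1_supp

lemma K1_int_pos : 0 < ∫ z, K1 z := by
  obtain ⟨t, ht, hd⟩ := exists_deriv_eq_slope Mt (zero_lt_one) Mt_smooth.continuous.continuousOn
    (Mt_smooth.differentiable (by simp)).differentiableOn
  have h1 : deriv Mt t = 1 := by rw [hd, Mt_one le_rfl, Mt_zero (by norm_num)]; norm_num
  refine K1_smooth.continuous.integral_pos_of_hasCompactSupport_nonneg_nonzero
    (x := (Real.sqrt t : ℂ)) K1_cpt K1_nonneg ?_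
  have : normSq (Real.sqrt t : ℂ) = t := by
    rw [normSq_ofReal, Real.mul_self_sqrt ht.1.le]
  rw [K1, this, h1]; norm_num

lemma taylor2_aux {f : ℂ → ℝ} (h1 : Differentiable ℝ f) (h2 : Differentiable ℝ (fderiv ℝ f))
    {C2 : ℝ} (hC2 : ∀ z, ‖fderiv ℝ (fderiv ℝ f) z‖ ≤ C2) (l2 : 0 ≤ C2) (x h : ℂ) :
    |f (x - h) - f x + fderiv ℝ f x h| ≤ C2 * ‖h‖ * ‖h‖ := by
  have hlip : ∀ y, ‖fderiv ℝ f y - fderiv ℝ f x‖ ≤ C2 * ‖y - x‖ := fun y =>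
    convex_univ.norm_image_sub_le_of_norm_fderiv_le (𝕜 := ℝ)
      (fun z _ => h2 z) (fun z _ => hC2 z) trivial trivial
  have := (convex_closedBall x ‖h‖).norm_image_sub_le_of_norm_fderiv_le' (𝕜 := ℝ) (f := f)
    (φ := fderiv ℝ f x) (C := C2 * ‖h‖) (x := x) (y := x - h)
      (fun z _ => h1 z) (fun z hz => ?_)
      (mem_closedBall_self (norm_nonneg _)) (by simp [dist_eq_norm])
  · have e : x - h - x = -h := by ring
    rw [e, map_neg, sub_neg_eq_add, norm_neg, Real.norm_eq_abs] at this
    exact this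
  · refine (hlip z).trans ?_
    have : ‖z - x‖ ≤ ‖h‖ := by simpa [dist_eq_norm] using hz
    gcongr

lemma bd_aux {E G : Type*} [NormedAddCommGroup E] [NormedSpace ℝ E] [NormedAddCommGroup G]
    [NormedSpace ℝ G] (g : E → G) (h : HasCompactSupport g) (hg : ContDiff ℝ ∞ g) :
    ∃ C, ∀ x, ‖fderiv ℝ g x‖ ≤ C :=
  (h.fderiv ℝ).exists_bound_of_continuous (hg.continuous_fderiv (by simp))

lemma bounds_aux (f : ℂ → ℝ) (f_cpt : HasCompactSupport f) (f_smooth : ContDiff ℝ ∞ f) :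
    ∃ C : ℝ, 0 < C ∧ (∀ x, |f x| ≤ C) ∧ (∀ x, ‖fderiv ℝ f x‖ ≤ C) ∧
    (∀ x h, |f (x - h) - f x + fderiv ℝ f x h| ≤ C * ‖h‖ ^ 2) := by
  have hc1 : ContDiff ℝ ∞ (fderiv ℝ f) := f_smooth.fderiv_right (by simp)
  have B0 : ∃ C, ∀ x, |f x| ≤ C := f_cpt.exists_bound_of_continuous f_smooth.continuous
  have B1 : ∃ C, ∀ x, ‖fderiv ℝ f x‖ ≤ C :=
    (f_cpt.fderiv ℝ).exists_bound_of_continuous hc1.continuous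
  have B2 : ∃ C, ∀ x, ‖fderiv ℝ (fderiv ℝ f) x‖ ≤ C :=
    bd_aux _ (f_cpt.fderiv ℝ) hc1
  obtain ⟨C0, hC0⟩ := B0
  obtain ⟨C1, hC1⟩ := B1
  obtain ⟨C2, hC2⟩ := B2
  have l0 : 0 ≤ C0 := (abs_nonneg _).trans (hC0 0)
  have l1 : 0 ≤ C1 := (norm_nonneg _).trans (hC1 0)
  have l2 : 0 ≤ C2 := (norm_nonneg (fderiv ℝ (fderiv ℝ f) 0)).trans (hC2 0)
  have m0 : C0 ≤ C0 + C1 + C2 + 1 := by linarith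
  have m1 : C1 ≤ C0 + C1 + C2 + 1 := by linarith
  have m2 : C2 ≤ C0 + C1 + C2 + 1 := by linarith
  have mp : 0 < C0 + C1 + C2 + 1 := by linarith
  generalize C0 + C1 + C2 + 1 = C at *
  refine ⟨C, mp, fun x => (hC0 x).trans m0, fun x => (hC1 x).trans m1, fun x h => ?_⟩
  have := taylor2_aux (f_smooth.differentiable (by simp)) (hc1.differentiable (by simp)) hC2 l2 x h
  calc _ ≤ C2 * ‖h‖ * ‖h‖ := this
    _ = C2 * ‖h‖ ^ 2 := by ring
    _ ≤ C * ‖h‖ ^ 2 := by gcongr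

lemma K1_bounds : ∃ C : ℝ, 0 < C ∧ (∀ x, |K1 x| ≤ C) ∧ (∀ x, ‖fderiv ℝ K1 x‖ ≤ C) ∧
    (∀ x h, |K1 (x - h) - K1 x + fderiv ℝ K1 x h| ≤ C * ‖h‖ ^ 2) :=
  bounds_aux K1 K1_cpt K1_smooth

/-- scaled kernel -/
def Kd (δ : ℝ) (z : ℂ) : ℝ := (δ⁻¹) ^ 2 * K1 ((δ⁻¹ : ℝ) * z)

lemma Kd_supp {δ : ℝ} (hδ : 0 < δ) {z : ℂ} (hz : δ < ‖z‖) : Kd δ z = 0 := by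
  have : K1 ((δ⁻¹ : ℝ) * z) = 0 := by
    by_contra h
    have := K1_supp h
    simp only [mem_closedBall, dist_zero_right, norm_mul, norm_real, norm_inv,
      Real.norm_of_nonneg hδ.le] at this
    rw [inv_mul_le_iff₀ hδ] at this
    linarith
  rw [Kd, this, mul_zero]

lemma Kd_cont (δ : ℝ) : Continuous (Kd δ) :=
  continuous_const.mul (K1_smooth.continuous.comp (continuous_const.mul continuous_id))

def Om (δ : ℝ) (z : ℂ) : ℂ := (Mt (normSq z * (δ⁻¹) ^ 2) : ℂ) * z⁻¹

lemma Om_zero {δ : ℝ} (hδ : 0 < δ) : Om δ =ᶠ[𝓝 0] fun _ => 0 := by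
  have : ∀ᶠ z : ℂ in 𝓝 0, normSq z * (δ⁻¹) ^ 2 < 1/2 := by
    have hc : Continuous (fun z : ℂ => normSq z * (δ⁻¹) ^ 2) :=
      normSq_smooth.continuous.mul continuous_const
    exact hc.continuousAt.eventually (gt_mem_nhds (by simp))
  filter_upwards [this] with z hz
  rw [Om, Mt_zero hz.le]; simp

lemma Om_smooth {δ : ℝ} (hδ : 0 < δ) : ContDiff ℝ ∞ (Om δ) := by
  rw [contDiff_iff_contDiffAt]
  intro z
  by_cases hz : z = 0
  · rw [hz]; exact contDiffAt_const.congr_of_eventuallyEq (Om_zero hδ)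
  · apply ContDiffAt.mul
    · exact (ofRealCLM.contDiff.comp (Mt_smooth.comp (normSq_smooth.mul contDiff_const))).contDiffAt
    · exact (contDiffAt_inv ℝ hz)

lemma db_Om {δ : ℝ} (hδ : 0 < δ) (z : ℂ) : db (Om δ) z = Kd δ z := by
  by_cases hz : z = 0
  · subst hz
    have h1 : deriv Mt 0 = 0 := by
      have : Mt =ᶠ[𝓝 0] fun _ => 0 := by
        filter_upwards [gt_mem_nhds (show (0:ℝ) < 1/2 by norm_num)] with t ht using Mt_zero ht.le
      simp [this.deriv_eq]
    simp [db, (Om_zero hδ).fderiv_eq, Kd, K1, h1]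
  · have hn : HasFDerivAt (fun z : ℂ => normSq z * (δ⁻¹) ^ 2)
        ((δ⁻¹ ^ 2) • ((2 * z.re) • reCLM + (2 * z.im) • imCLM)) z := by
      have : (fun z : ℂ => normSq z) = fun z => z.re * z.re + z.im * z.im := by
        ext z; rw [normSq_apply]
      have h := (reCLM.hasFDerivAt (x := z)).mul (reCLM.hasFDerivAt (x := z)) |>.add
        ((imCLM.hasFDerivAt (x := z)).mul (imCLM.hasFDerivAt (x := z)))
      have h2 := h.mul_const (δ⁻¹ ^ 2)
      refine (h2.congr_fderiv ?_).congr_of_eventuallyEq (Eventually.of_forall fun w => ?_)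
      · ext <;> simp <;> ring
      · simp [normSq_apply]
    have hM : HasFDerivAt (fun z : ℂ => ((Mt (normSq z * (δ⁻¹) ^ 2) : ℝ) : ℂ)) _ z :=
      (ofRealCLM.hasFDerivAt).comp z
        (((Mt_smooth.differentiable (by simp)) (normSq z * (δ⁻¹) ^ 2)).hasDerivAt.hasFDerivAt.comp z hn)
    have hi : HasFDerivAt (fun z : ℂ => z⁻¹) _ z :=
      ((hasDerivAt_inv hz).hasFDerivAt).restrictScalars ℝ
    have h := hM.mul hi
    have hh : fderiv ℝ (Om δ) z = _ := h.fderiv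
    have hk : K1 ((δ⁻¹ : ℝ) * z) = 2 * deriv Mt (normSq z * (δ⁻¹) ^ 2) := by
      rw [K1, normSq_mul, normSq_ofReal]; ring_nf
    rw [db, hh, Kd, hk]
    simp
    field_simp
    ring_nf
    simp only [I_sq]
    have hz2 : (z.re : ℂ) + z.im * I = z := re_add_im z
    linear_combination (2 * ((deriv Mt (normSq z * (δ⁻¹) ^ 2) : ℝ) : ℂ) * (δ : ℂ)⁻¹ ^ 2 * z) * hz2

lemma Om_far {δ : ℝ} (hδ : 0 < δ) {z : ℂ} (h : δ ≤ ‖z‖) : Om δ z = z⁻¹ := by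
  have : 1 ≤ normSq z * (δ⁻¹) ^ 2 := by
    rw [normSq_eq_norm_sq, ← mul_pow]
    have : 1 ≤ ‖z‖ * δ⁻¹ := by rwa [← div_eq_mul_inv, one_le_div hδ]
    nlinarith
  rw [Om, Mt_one this]; simp

/-- test function connecting two kernels -/
lemma Tst_Om {δ δ' : ℝ} (hδ' : 0 < δ') (h : δ' ≤ δ) (z : ℂ) {U : Set ℂ} (hU : closedBall z δ ⊆ U) :
    Tst (fun w => Om δ (w - z) - Om δ' (w - z)) U := by
  have hδ : 0 < δ := hδ'.trans_le h
  have hs : Function.support (fun w => Om δ (w - z) - Om δ' (w - z)) ⊆ closedBall z δ := by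
    intro w hw
    by_contra hc
    apply hw
    have : δ < ‖w - z‖ := by simpa [dist_eq_norm] using hc
    simp only [Om_far hδ this.le, Om_far hδ' (h.trans this.le), sub_self]
  refine ⟨?_, HasCompactSupport.of_support_subset_isCompact (isCompact_closedBall _ _) hs,
    (closure_minimal hs isClosed_closedBall).trans hU⟩
  exact ((Om_smooth hδ).comp (contDiff_id.sub contDiff_const)).sub
    ((Om_smooth hδ').comp (contDiff_id.sub contDiff_const))

lemma db_Tst_Om {δ δ' : ℝ} (hδ' : 0 < δ') (h : δ' ≤ δ) (z w : ℂ) :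
    db (fun w => Om δ (w - z) - Om δ' (w - z)) w = Kd δ (w - z) - Kd δ' (w - z) := by
  have hδ : 0 < δ := hδ'.trans_le h
  have d : ∀ {δ : ℝ}, 0 < δ → HasFDerivAt (fun w => Om δ (w - z)) (fderiv ℝ (Om δ) (w - z)) w := by
    intro δ hδ
    have := ((Om_smooth hδ).differentiable (by simp) (w - z)).hasFDerivAt.comp w
      ((hasFDerivAt_id w).sub_const z)
    refine (this.congr_fderiv ?_)
    ext <;> simp
  rw [← db_Om hδ, ← db_Om hδ', db, ((d hδ).fun_sub (d hδ')).fderiv, db, db]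
  simp
  ring

end A2

section A3
open Complex MeasureTheory
open scoped ContDiff

def lfc (α β h : ℂ) : ℂ := (h.re : ℂ) * α + (h.im : ℂ) * β

lemma Kd_one : Kd 1 = K1 := by ext z; simp [Kd]

lemma Kd_bound {C : ℝ} (hC : ∀ x, |K1 x| ≤ C) {δ : ℝ} (z : ℂ) : |Kd δ z| ≤ C * (δ⁻¹) ^ 2 := by
  rw [Kd, abs_mul, abs_of_nonneg (sq_nonneg _), mul_comm]
  exact mul_le_mul_of_nonneg_right (hC _) (sq_nonneg _)

lemma Kd_cpt {δ : ℝ} (hδ : 0 < δ) (z : ℂ) : HasCompactSupport (fun w => Kd δ (w - z)) := by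
  refine HasCompactSupport.of_support_subset_isCompact (isCompact_closedBall z δ) ?_
  intro w hw
  by_contra h
  exact hw (Kd_supp hδ (by simpa [dist_eq_norm] using h))

lemma Kd_shift_integrable {δ : ℝ} (hδ : 0 < δ) (z : ℂ) : Integrable (fun w => Kd δ (w - z)) :=
  ((Kd_cont δ).comp (continuous_id.sub continuous_const)).integrable_of_hasCompactSupport
    (Kd_cpt hδ z)

lemma Kd_integral_aux {δ δ' : ℝ} (hδ' : 0 < δ') (h : δ' ≤ δ) (z : ℂ) :
    ∫ w, Kd δ (w - z) = ∫ w, Kd δ' (w - z) := by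
  have hT := Tst_Om hδ' h z (Set.subset_univ _)
  have h0 : ∫ w, db (fun w => Om δ (w - z) - Om δ' (w - z)) w = 0 := by
    unfold db
    rw [integral_add (hT.der 1).integrable ((hT.der I).const_mul I).integrable,
      integral_const_mul, hT.integral_der, hT.integral_der]
    simp
  simp only [db_Tst_Om hδ' h] at h0
  have h1 : ∫ w, (Kd δ (w - z) - Kd δ' (w - z)) = 0 := by
    have : ((∫ w, (Kd δ (w - z) - Kd δ' (w - z)) : ℝ) : ℂ) = 0 := by
      rw [← h0, ← integral_complex_ofReal]; simp
    exact_mod_cast this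
  rw [integral_sub (Kd_shift_integrable (hδ'.trans_le h) z) (Kd_shift_integrable hδ' z)] at h1
  linarith

lemma Kd_integral {δ : ℝ} (hδ : 0 < δ) (z : ℂ) : ∫ w, Kd δ (w - z) = ∫ w, K1 w := by
  have h1 : ∫ w, Kd 1 (w - z) = ∫ w, K1 w := by
    rw [Kd_one]; exact integral_sub_right_eq_self (fun w => K1 w) z
  rw [← h1]
  rcases le_total δ 1 with h | h
  · exact (Kd_integral_aux hδ h z).symm
  · exact Kd_integral_aux one_pos h z

lemma Kd_mul_integrable {H : ℂ → ℂ} (hH : Integrable H) {δ : ℝ} (z : ℂ) :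
    Integrable (fun w => H w * (Kd δ (w - z) : ℂ)) := by
  obtain ⟨C, -, hC, -⟩ := K1_bounds
  refine hH.mul_bdd (c := C * (δ⁻¹) ^ 2) ?_ ?_
  · exact (continuous_ofReal.comp ((Kd_cont δ).comp
      (continuous_id.sub continuous_const))).aestronglyMeasurable
  · filter_upwards with w
    rw [norm_real]; exact Kd_bound hC _

lemma hol_const {H : ℂ → ℂ} (hH : Integrable H) {U : Set ℂ} (hW : Wk H 0 U) {δ δ' : ℝ}
    (hδ' : 0 < δ') (h : δ' ≤ δ) {z : ℂ} (hU : closedBall z δ ⊆ U) :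
    ∫ w, H w * (Kd δ (w - z) : ℂ) = ∫ w, H w * (Kd δ' (w - z) : ℂ) := by
  have := hW _ (Tst_Om hδ' h z hU)
  simp only [db_Tst_Om hδ' h, Pi.zero_apply, ofReal_zero, zero_mul, add_zero, mul_sub] at this
  rw [integral_sub (Kd_mul_integrable hH z) (Kd_mul_integrable hH z)] at this
  exact sub_eq_zero.1 this

lemma mollify_lim {H : ℂ → ℂ} (hH : Integrable H) : ∀ᵐ z, ∀ δ : ℕ → ℝ, (∀ n, 0 < δ n) →
    Tendsto δ atTop (𝓝 0) →
    Tendsto (fun n => ∫ w, H w * (Kd (δ n) (w - z) : ℂ)) atTop (𝓝 ((∫ w, K1 w : ℝ) * H z)) := by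
  obtain ⟨C, hCp, hC, -⟩ := K1_bounds
  filter_upwards [IsUnifLocDoublingMeasure.ae_tendsto_average_norm_sub volume
    hH.locallyIntegrable 1] with z hz δ hδ hlim
  have h1 := hz (fun _ => z) δ (tendsto_nhdsWithin_iff.2 ⟨hlim, Eventually.of_forall hδ⟩)
    (Eventually.of_forall fun n => mem_closedBall_self (by simpa using (hδ n).le))
  rw [tendsto_iff_norm_sub_tendsto_zero]
  have h2 : Tendsto (fun n => (C * Real.pi) * ⨍ y in closedBall z (δ n), ‖H y - H z‖) atTop (𝓝 0) := by
    simpa using h1.const_mul (C * Real.pi)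
  refine squeeze_zero (fun _ => norm_nonneg _) (fun n => ?_) h2
  have e1 : (∫ w, H w * (Kd (δ n) (w - z) : ℂ)) - (∫ w, K1 w : ℝ) * H z
      = ∫ w, (H w - H z) * (Kd (δ n) (w - z) : ℂ) := by
    have : ((∫ w, K1 w : ℝ) : ℂ) * H z = ∫ w, H z * (Kd (δ n) (w - z) : ℂ) := by
      rw [integral_const_mul, ← Kd_integral (hδ n) z, ← integral_complex_ofReal, mul_comm]
    have j : Integrable (fun w => H z * (Kd (δ n) (w - z) : ℂ)) :=
      (Kd_shift_integrable (hδ n) z).ofReal.const_mul _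
    rw [this, ← integral_sub (Kd_mul_integrable hH z) j]
    simp only [sub_mul]
  rw [e1]
  have e2 : ∫ w, (H w - H z) * (Kd (δ n) (w - z) : ℂ)
      = ∫ w in closedBall z (δ n), (H w - H z) * (Kd (δ n) (w - z) : ℂ) := by
    rw [setIntegral_eq_integral_of_forall_compl_eq_zero]
    intro w hw
    rw [Kd_supp (hδ n) (by simpa [dist_eq_norm] using hw)]; simp
  rw [e2, setAverage_eq, smul_eq_mul]
  have hi : IntegrableOn (fun w => ‖H w - H z‖) (closedBall z (δ n)) :=
    (hH.integrableOn.sub (integrableOn_const measure_closedBall_lt_top.ne)).norm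
  calc _ ≤ ∫ w in closedBall z (δ n), ‖H w - H z‖ * (C * (δ n)⁻¹ ^ 2) := by
        refine norm_integral_le_of_norm_le (hi.mul_const _) ?_
        filter_upwards with w
        rw [norm_mul, norm_real]
        gcongr
        exact Kd_bound hC _
    _ = _ := by
        rw [integral_mul_const]
        have : (volume : Measure ℂ).real (closedBall z (δ n)) = (δ n) ^ 2 * Real.pi := by
          rw [measureReal_def, Complex.volume_closedBall]
          simp [ENNReal.toReal_ofReal, (hδ n).le]
        rw [this]
        have := (hδ n).ne'
        field_simp

lemma hol_rep {H : ℂ → ℂ} (hH : Integrable H) {z0 : ℂ} {r : ℝ} (hr : 0 < r)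
    (hW : Wk H 0 (ball z0 r)) : ∀ᵐ z, z ∈ ball z0 (r/2) →
    ((∫ w, K1 w : ℝ) : ℂ) * H z = ∫ w, H w * (Kd (r/2) (w - z) : ℂ) := by
  filter_upwards [mollify_lim hH] with z hz hzb
  have h1 := hz (fun n => (r/2) / (n + 1)) (fun n => by positivity) (by
    have := tendsto_one_div_add_atTop_nhds_zero_nat (𝕜 := ℝ) |>.const_mul (r/2)
    simpa [div_eq_mul_inv] using this)
  refine tendsto_nhds_unique h1 (tendsto_const_nhds.congr fun n => ?_)
  refine hol_const hH hW (by positivity) ?_ ?_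
  · apply div_le_self (by positivity); simp
  · apply closedBall_subset_ball'
    have : dist z z0 < r/2 := hzb
    linarith

lemma fderiv_lin (L : ℂ →L[ℝ] ℝ) (h : ℂ) : L h = h.re * L 1 + h.im * L I := by
  have : h = h.re • (1:ℂ) + h.im • I := by simp [re_add_im]
  conv_lhs => rw [this]
  rw [map_add, map_smul, map_smul, smul_eq_mul, smul_eq_mul]

/-- Taylor estimate for weakly holomorphic functions -/
lemma hol_taylor : ∃ C : ℝ, 0 < C ∧ ∀ (H : ℂ → ℂ) (z0 : ℂ) (r : ℝ), 0 < r → Integrable H →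
    Wk H 0 (ball z0 r) → ∃ c α β : ℂ, ‖α‖ ≤ C * r⁻¹ ^ 3 * ∫ w, ‖H w‖ ∧
      ‖β‖ ≤ C * r⁻¹ ^ 3 * ∫ w, ‖H w‖ ∧ β = I * α ∧ ∀ᵐ z, z ∈ ball z0 (r/2) →
      ‖H z - (c + lfc α β (z - z0))‖ ≤ C * r⁻¹ ^ 4 * ‖z - z0‖ ^ 2 * ∫ w, ‖H w‖ := by
  obtain ⟨C, hCp, hC0, hC1, hC2⟩ := K1_bounds
  have hk := K1_int_pos
  set k := ∫ w, K1 w with hkdef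
  refine ⟨16 * C * k⁻¹, by positivity, fun H z0 r hr hH hW => ?_⟩
  set δ := r/2 with hδdef
  have hδ : 0 < δ := by positivity
  -- derivative kernels
  set D : ℂ → ℂ → ℂ := fun v w => ((δ⁻¹ ^ 3 * fderiv ℝ K1 ((δ⁻¹ : ℝ) * (w - z0)) v : ℝ) : ℂ) with hD
  have hDc : ∀ v, Continuous (D v) := fun v => by
    have := (K1_smooth.continuous_fderiv (by simp)).clm_apply (continuous_const (y := v))
    exact continuous_ofReal.comp (continuous_const.mul (this.comp
      (continuous_const.mul (continuous_id.sub continuous_const))))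
  have hDb : ∀ v w, ‖v‖ = 1 → ‖D v w‖ ≤ C * δ⁻¹ ^ 3 := fun v w hv => by
    rw [hD]; simp only [norm_real, norm_mul]
    rw [mul_comm C]
    have h1 := (fderiv ℝ K1 ((δ⁻¹ : ℝ) * (w - z0))).le_opNorm v
    rw [hv, mul_one] at h1
    have h2 := h1.trans (hC1 _)
    rw [Real.norm_of_nonneg (by positivity)]
    gcongr
  have hDi : ∀ v, ‖v‖ = 1 → Integrable (fun w => H w * D v w) := fun v hv =>
    hH.mul_bdd (c := C * δ⁻¹ ^ 3) (hDc v).aestronglyMeasurable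
      (Eventually.of_forall fun w => hDb v w hv)
  have hDn : ∀ v, ‖v‖ = 1 → ‖(k⁻¹ : ℂ) * -∫ w, H w * D v w‖ ≤ 16 * C * k⁻¹ * r⁻¹ ^ 3 * ∫ w, ‖H w‖ := by
    intro v hv
    have h1 : ‖∫ w, H w * D v w‖ ≤ ∫ w, ‖H w‖ * (C * δ⁻¹ ^ 3) := by
      refine norm_integral_le_of_norm_le (hH.norm.mul_const _) (Eventually.of_forall fun w => ?_)
      rw [norm_mul]
      have := hDb v w hv
      gcongr
    rw [integral_mul_const] at h1
    rw [norm_mul, norm_neg, norm_inv, norm_real, Real.norm_of_nonneg hk.le]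
    have hI : 0 ≤ ∫ w, ‖H w‖ := integral_nonneg fun _ => norm_nonneg _
    calc k⁻¹ * ‖∫ w, H w * D v w‖ ≤ k⁻¹ * ((∫ w, ‖H w‖) * (C * δ⁻¹ ^ 3)) := by gcongr
      _ = 8 * (C * k⁻¹ * r⁻¹ ^ 3 * ∫ w, ‖H w‖) := by rw [hδdef]; field_simp; ring
      _ ≤ 16 * (C * k⁻¹ * r⁻¹ ^ 3 * ∫ w, ‖H w‖) := by
        have : 0 ≤ C * k⁻¹ * r⁻¹ ^ 3 * ∫ w, ‖H w‖ := by positivity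
        linarith
      _ = _ := by ring
  have hrel : (∫ w, H w * D 1 w) + I * (∫ w, H w * D I w) = 0 := by
    have hT : Tst (fun w => ((Kd δ (w - z0) : ℝ) : ℂ)) (ball z0 r) := by
      refine ⟨?_, (Kd_cpt hδ z0).comp_left (g := fun x : ℝ => (x:ℂ)) (by simp), ?_⟩
      · refine ofRealCLM.contDiff.comp ?_
        exact contDiff_const.mul (K1_smooth.comp (contDiff_const.mul (contDiff_id.sub contDiff_const)))
      · refine (closure_minimal ?_ isClosed_closedBall).trans
          (closedBall_subset_ball (show δ < r by rw [hδdef]; linarith))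
        intro w hw
        by_contra h
        exact hw (by simp [Kd_supp hδ (z := w - z0) (by simpa [dist_eq_norm] using h)])
    have hder : ∀ w v, fderiv ℝ (fun w => ((Kd δ (w - z0) : ℝ) : ℂ)) w v = D v w := by
      intro w v
      have h1 : HasFDerivAt (fun w : ℂ => ((δ⁻¹ : ℝ) : ℂ) * (w - z0))
          (((δ⁻¹ : ℝ) : ℂ) • ContinuousLinearMap.id ℝ ℂ) w :=
        ((hasFDerivAt_id w).sub_const z0).const_mul _
      have h2 := ((K1_smooth.differentiable (by simp) (((δ⁻¹ : ℝ) : ℂ) * (w - z0))).hasFDerivAt.comp w h1).const_mul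
        (δ⁻¹ ^ 2)
      have h3 := (ofRealCLM.hasFDerivAt (x := Kd δ (w - z0))).comp w h2
      have e : fderiv ℝ (fun w => ((Kd δ (w - z0) : ℝ) : ℂ)) w = _ := h3.fderiv
      rw [e]
      simp only [hD, ContinuousLinearMap.comp_apply, ContinuousLinearMap.smul_apply, ofRealCLM_apply,
        ContinuousLinearMap.id_apply]
      have e2 : ((δ⁻¹ : ℝ) : ℂ) • v = (δ⁻¹ : ℝ) • v := by simp
      rw [e2, map_smul]; simp; ring
    have := hW _ hT
    simp only [db, hder, Pi.zero_apply, ofReal_zero, zero_mul, add_zero, mul_add] at this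
    have i2 := hDi I (by simp)
    have i3 : Integrable (fun w => H w * (I * D I w)) := by
      refine (i2.const_mul I).congr (Eventually.of_forall fun w => ?_)
      simp only []; ring
    rw [integral_add (hDi 1 (by simp)) i3] at this
    rw [← this, ← integral_const_mul]
    congr 2; ext w; ring
  refine ⟨(k⁻¹ : ℂ) * ∫ w, H w * (Kd δ (w - z0) : ℂ), (k⁻¹ : ℂ) * -∫ w, H w * D 1 w,
    (k⁻¹ : ℂ) * -∫ w, H w * D I w, hDn 1 (by simp), hDn I (by simp), ?_, ?_⟩
  · have : (∫ w, H w * D 1 w) = - (I * (∫ w, H w * D I w)) := eq_neg_of_add_eq_zero_left hrel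
    rw [this]
    have hI := I_mul_I
    linear_combination (-(k⁻¹ : ℂ) * ∫ w, H w * D I w) * hI
  filter_upwards [hol_rep hH hr hW] with z hz hzb
  have hz1 := hz hzb
  have hk' : (k : ℂ) ≠ 0 := by exact_mod_cast hk.ne'
  have e0 : H z = (k⁻¹ : ℂ) * ∫ w, H w * (Kd δ (w - z) : ℂ) := by
    rw [← hz1, ← hkdef]; field_simp
  set h := z - z0 with hh
  have e1 : H z - ((k⁻¹ : ℂ) * (∫ w, H w * (Kd δ (w - z0) : ℂ)) +
      lfc ((k⁻¹ : ℂ) * -∫ w, H w * D 1 w) ((k⁻¹ : ℂ) * -∫ w, H w * D I w) h)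
      = (k⁻¹ : ℂ) * ∫ w, (H w * (Kd δ (w - z) : ℂ) - H w * (Kd δ (w - z0) : ℂ)
        + (h.re * (H w * D 1 w) + h.im * (H w * D I w))) := by
    have i1 := hDi 1 (by simp)
    have i2 := hDi I (by simp)
    have j1 : Integrable (fun w => H w * (Kd δ (w - z) : ℂ) - H w * (Kd δ (w - z0) : ℂ)) :=
      (Kd_mul_integrable hH z).sub (Kd_mul_integrable hH z0)
    have j2 : Integrable (fun w => h.re * (H w * D 1 w) + h.im * (H w * D I w)) :=
      (i1.const_mul _).add (i2.const_mul _)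
    rw [integral_add j1 j2, integral_sub (Kd_mul_integrable hH z)
      (Kd_mul_integrable hH z0), integral_add (i1.const_mul _) (i2.const_mul _),
      integral_const_mul, integral_const_mul, e0, lfc]
    ring
  rw [e1, norm_mul, norm_inv, norm_real, Real.norm_of_nonneg hk.le]
  have h1 : ‖∫ w, (H w * (Kd δ (w - z) : ℂ) - H w * (Kd δ (w - z0) : ℂ)
        + (h.re * (H w * D 1 w) + h.im * (H w * D I w)))‖
        ≤ ∫ w, ‖H w‖ * (C * δ⁻¹ ^ 4 * ‖h‖ ^ 2) := by
    refine norm_integral_le_of_norm_le (hH.norm.mul_const _) (Eventually.of_forall fun w => ?_)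
    obtain ⟨x, hx⟩ : ∃ x : ℂ, (δ⁻¹ : ℝ) * (w - z0) = x := ⟨_, rfl⟩
    have t := hC2 x ((δ⁻¹ : ℝ) * h)
    have ex : x - (δ⁻¹ : ℝ) * h = (δ⁻¹ : ℝ) * (w - z) := by simp only [← hx, hh]; ring
    have ef : fderiv ℝ K1 x ((δ⁻¹ : ℝ) * h) = δ⁻¹ * (h.re * fderiv ℝ K1 x 1 + h.im * fderiv ℝ K1 x I) := by
      rw [fderiv_lin]; simp; ring
    rw [ex, ef] at t
    have e2 : H w * (Kd δ (w - z) : ℂ) - H w * (Kd δ (w - z0) : ℂ)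
        + (h.re * (H w * D 1 w) + h.im * (H w * D I w))
        = H w * ((δ⁻¹ ^ 2 * (K1 ((δ⁻¹ : ℝ) * (w - z)) - K1 x +
          δ⁻¹ * (h.re * fderiv ℝ K1 x 1 + h.im * fderiv ℝ K1 x I)) : ℝ) : ℂ) := by
      simp only [Kd, hD, hx]; push_cast; ring
    rw [e2, norm_mul, norm_real, norm_mul, Real.norm_of_nonneg (show 0 ≤ δ⁻¹ ^ 2 by positivity)]
    rw [Real.norm_eq_abs]
    have e3 : C * ‖((δ⁻¹ : ℝ) : ℂ) * h‖ ^ 2 = C * δ⁻¹ ^ 2 * ‖h‖ ^ 2 := by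
      rw [norm_mul, norm_real, Real.norm_of_nonneg (show 0 ≤ δ⁻¹ by positivity)]; ring
    rw [e3] at t
    have : C * δ⁻¹ ^ 4 * ‖h‖ ^ 2 = δ⁻¹ ^ 2 * (C * δ⁻¹ ^ 2 * ‖h‖ ^ 2) := by ring
    rw [this]
    gcongr
  rw [integral_mul_const] at h1
  calc _ ≤ k⁻¹ * ((∫ w, ‖H w‖) * (C * δ⁻¹ ^ 4 * ‖h‖ ^ 2)) := by gcongr
    _ = _ := by rw [hδdef]; field_simp; ring

end A3

section A4
open Complex MeasureTheory
open scoped ContDiff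

/-- real test functions -/
structure TstR (α : ℂ → ℝ) (U : Set ℂ) : Prop where
  smooth : ContDiff ℝ ∞ α
  cpt : HasCompactSupport α
  supp : tsupport α ⊆ U

lemma TstR.toC {α : ℂ → ℝ} {U : Set ℂ} (h : TstR α U) : Tst (fun z => (α z : ℂ)) U :=
  ⟨ofRealCLM.contDiff.comp h.smooth, h.cpt.comp_left (g := fun x : ℝ => (x:ℂ)) (by simp),
    (closure_mono (Function.support_comp_subset (g := fun x : ℝ => (x:ℂ)) (by simp) α)).trans h.supp⟩

lemma TstR.diff {α : ℂ → ℝ} {U : Set ℂ} (h : TstR α U) : Differentiable ℝ α :=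
  h.smooth.differentiable (by simp)

lemma TstR.fderivC {α : ℂ → ℝ} {U : Set ℂ} (h : TstR α U) (z v : ℂ) :
    fderiv ℝ (fun z => (α z : ℂ)) z v = (fderiv ℝ α z v : ℂ) := by
  have := (ofRealCLM.hasFDerivAt (x := α z)).comp z (h.diff z).hasFDerivAt
  have e : fderiv ℝ (fun z => (α z : ℂ)) z = _ := this.fderiv
  rw [e]; rfl

lemma Tst.re {η : ℂ → ℂ} {U : Set ℂ} (h : Tst η U) : TstR (fun z => (η z).re) U :=
  ⟨reCLM.contDiff.comp h.smooth, h.cpt.comp_left (g := Complex.re) (by simp),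
    (closure_mono (Function.support_comp_subset (g := Complex.re) (by simp) η)).trans h.supp⟩

lemma Tst.im {η : ℂ → ℂ} {U : Set ℂ} (h : Tst η U) : TstR (fun z => (η z).im) U :=
  ⟨imCLM.contDiff.comp h.smooth, h.cpt.comp_left (g := Complex.im) (by simp),
    (closure_mono (Function.support_comp_subset (g := Complex.im) (by simp) η)).trans h.supp⟩

/-- gradient `α_p - i α_y` of a real function -/
def Gr (α : ℂ → ℝ) (z : ℂ) : ℂ := ((fderiv ℝ α z 1 : ℝ) : ℂ) - I * ((fderiv ℝ α z I : ℝ) : ℂ)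

lemma TstR.Gr_eq {α : ℂ → ℝ} {U : Set ℂ} (h : TstR α U) :
    Gr α = fun z => fderiv ℝ (fun z => (α z : ℂ)) z 1 + (-I) * fderiv ℝ (fun z => (α z : ℂ)) z I := by
  ext z; rw [Gr, h.fderivC, h.fderivC]; ring

lemma TstR.Gr_tst {α : ℂ → ℝ} {U : Set ℂ} (h : TstR α U) : Tst (Gr α) U := by
  rw [h.Gr_eq]; exact (h.toC.der 1).add ((h.toC.der I).const_mul _)

lemma TstR.Gr_memLp {α : ℂ → ℝ} {U : Set ℂ} (h : TstR α U) : MemLp (Gr α) 2 (volume.restrict U) :=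
  h.Gr_tst.memLp.restrict U

lemma TstR.db_eq {α : ℂ → ℝ} {U : Set ℂ} (h : TstR α U) (z : ℂ) :
    db (fun z => (α z : ℂ)) z = (starRingEnd ℂ) (Gr α z) := by
  rw [db, h.fderivC, h.fderivC, Gr]; simp

/-- `L²` on a set, as a real Hilbert space -/
abbrev L2U (U : Set ℂ) : Type := Lp ℂ 2 (volume.restrict U : Measure ℂ)

def TstR.gr {α : ℂ → ℝ} {U : Set ℂ} (h : TstR α U) : L2U U := h.Gr_memLp.toLp _

lemma TstR.add {α β : ℂ → ℝ} {U : Set ℂ} (h : TstR α U) (h' : TstR β U) :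
    TstR (fun z => α z + β z) U :=
  ⟨h.smooth.add h'.smooth, h.cpt.add h'.cpt,
    (tsupport_add _ _).trans (Set.union_subset h.supp h'.supp)⟩

lemma TstR.smul {α : ℂ → ℝ} {U : Set ℂ} (h : TstR α U) (c : ℝ) : TstR (fun z => c * α z) U :=
  ⟨contDiff_const.mul h.smooth, h.cpt.mul_left, (tsupport_mul_subset_right).trans h.supp⟩

lemma TstR.Gr_add {α β : ℂ → ℝ} {U : Set ℂ} (h : TstR α U) (h' : TstR β U) (z : ℂ) :
    Gr (fun z => α z + β z) z = Gr α z + Gr β z := by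
  simp only [Gr, fderiv_fun_add (h.diff z) (h'.diff z), add_apply]; push_cast; ring

lemma TstR.Gr_smul {α : ℂ → ℝ} {U : Set ℂ} (h : TstR α U) (c : ℝ) (z : ℂ) :
    Gr (fun z => c * α z) z = c * Gr α z := by
  simp only [Gr, fderiv_const_mul (h.diff z)]; simp; ring

def VU (U : Set ℂ) : Submodule ℝ (L2U U) where
  carrier := {f | ∃ (α : ℂ → ℝ) (h : TstR α U), f = h.gr}
  add_mem' := by
    rintro _ _ ⟨α, h, rfl⟩ ⟨β, h', rfl⟩
    refine ⟨_, h.add h', ?_⟩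
    rw [TstR.gr, TstR.gr, TstR.gr, ← MemLp.toLp_add]
    apply MemLp.toLp_congr
    filter_upwards with z
    rw [h.Gr_add h']; rfl
  zero_mem' := by
    have h : TstR (fun _ => 0) U := ⟨contDiff_const, HasCompactSupport.zero, by simp [tsupport]⟩
    refine ⟨_, h, ?_⟩
    have : (MemLp.zero : MemLp (0 : ℂ → ℂ) 2 (volume.restrict U)).toLp _ = h.gr := by
      apply MemLp.toLp_congr
      filter_upwards with z
      simp [Gr]
    rw [← this]; rfl
  smul_mem' := by
    rintro c _ ⟨α, h, rfl⟩
    refine ⟨_, h.smul c, ?_⟩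
    rw [TstR.gr, TstR.gr, ← MemLp.toLp_const_smul]
    apply MemLp.toLp_congr
    filter_upwards with z
    rw [h.Gr_smul c]; simp

lemma memLp_mul_tst {U : Set ℂ} {F η : ℂ → ℂ} (hF : MemLp F 2 (volume.restrict U)) (hη : Tst η U) :
    Integrable (fun z => F z * η z) ∧ ∫ z, F z * η z = ∫ z in U, F z * η z := by
  have h0 : ∀ z, z ∉ U → F z * η z = 0 := fun z hz => by
    rw [image_eq_zero_of_notMem_tsupport (fun h => hz (hη.supp h)), mul_zero]
  have h1 : IntegrableOn (fun z => F z * η z) U := hF.integrable_mul (hη.memLp.restrict U)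
  refine ⟨?_, (setIntegral_eq_integral_of_forall_compl_eq_zero h0).symm⟩
  rw [← integrableOn_univ]
  exact h1.of_forall_diff_eq_zero MeasurableSet.univ (fun z hz => h0 z hz.2)

lemma gr_inner {U : Set ℂ} {α : ℂ → ℝ} (h : TstR α U) {F : ℂ → ℂ}
    (hF : MemLp F 2 (volume.restrict U)) :
    inner ℝ h.gr (hF.toLp F) = (∫ z, F z * db (fun z => (α z : ℂ)) z).re := by
  rw [L2.inner_def]
  obtain ⟨h1, h2⟩ := memLp_mul_tst hF h.toC.db
  rw [h2, ← reCLM_apply, ← ContinuousLinearMap.integral_comp_comm _ h1.integrableOn]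
  apply integral_congr_ae
  filter_upwards [hF.coeFn_toLp, h.Gr_memLp.coeFn_toLp] with z e1 e2
  rw [TstR.gr, e1, e2, h.db_eq, Complex.inner, mul_comm]; rfl

/-- curl-free property -/
def CurlFree (F : ℂ → ℂ) (U : Set ℂ) : Prop :=
  ∀ α : ℂ → ℝ, TstR α U → (∫ z, F z * db (fun z => (α z : ℂ)) z).im = 0

lemma Wk_iff {U : Set ℂ} {F : ℂ → ℂ} {E : ℂ → ℝ} (hF : MemLp F 2 (volume.restrict U))
    (hE : MemLp (fun z => (E z : ℂ)) 2 (volume.restrict U)) :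
    Wk F E U ↔ CurlFree F U ∧ ∀ (α : ℂ → ℝ) (h : TstR α U),
      inner ℝ h.gr (hF.toLp F + hE.toLp _) = 0 := by
  have key : ∀ (α : ℂ → ℝ) (h : TstR α U),
      (∫ z, (F z * db (fun z => (α z : ℂ)) z + (E z : ℂ) * fderiv ℝ (fun z => (α z : ℂ)) z 1)).im =
        (∫ z, F z * db (fun z => (α z : ℂ)) z).im ∧
      (∫ z, (F z * db (fun z => (α z : ℂ)) z + (E z : ℂ) * fderiv ℝ (fun z => (α z : ℂ)) z 1)).re =
        inner ℝ h.gr (hF.toLp F + hE.toLp _) := by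
    intro α h
    have i1 := (memLp_mul_tst hF h.toC.db).1
    have i2 := (memLp_mul_tst hE (h.toC.der 1)).1
    have i3 := (memLp_mul_tst hE h.toC.db).1
    rw [integral_add i1 i2, inner_add_right, gr_inner, gr_inner]
    have e : ∫ z, (E z : ℂ) * fderiv ℝ (fun z => (α z : ℂ)) z 1 =
        ((∫ z, E z * fderiv ℝ α z 1 : ℝ) : ℂ) := by
      rw [← integral_complex_ofReal]; simp only [h.fderivC]; push_cast; rfl
    have e2 : (∫ z, (E z : ℂ) * db (fun z => (α z : ℂ)) z).re = ∫ z, E z * fderiv ℝ α z 1 := by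
      rw [← reCLM_apply, ← ContinuousLinearMap.integral_comp_comm _ i3]
      apply integral_congr_ae
      filter_upwards with z
      rw [db, h.fderivC, h.fderivC]; simp
    rw [e, e2]; simp
  constructor
  · intro hW
    refine ⟨fun α h => ?_, fun α h => ?_⟩
    · rw [← (key α h).1, hW _ h.toC]; rfl
    · rw [← (key α h).2, hW _ h.toC]; rfl
  · rintro ⟨hc, ho⟩ η hη
    have hR : ∀ (α : ℂ → ℝ) (h : TstR α U), ∫ z, (F z * db (fun z => (α z : ℂ)) z +
        (E z : ℂ) * fderiv ℝ (fun z => (α z : ℂ)) z 1) = 0 := fun α h =>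
      Complex.ext ((key α h).2.trans (ho α h)) ((key α h).1.trans (hc α h))
    have h1 := hR _ hη.re
    have h2 := hR _ hη.im
    have ed : ∀ z v, fderiv ℝ η z v = fderiv ℝ (fun z => ((η z).re : ℂ)) z v
        + I * fderiv ℝ (fun z => ((η z).im : ℂ)) z v := by
      intro z v
      have : η = fun z => ((η z).re : ℂ) + I * ((η z).im : ℂ) := by
        ext z; rw [mul_comm, re_add_im]
      conv_lhs => rw [this]
      rw [fderiv_fun_add (hη.re.toC.diff z) ((hη.im.toC.const_mul I).diff z),
        fderiv_const_mul (hη.im.toC.diff z)]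
      simp
    have : ∀ z, F z * db η z + (E z : ℂ) * fderiv ℝ η z 1 =
       (F z * db (fun z => ((η z).re : ℂ)) z + (E z : ℂ) * fderiv ℝ (fun z => ((η z).re : ℂ)) z 1) +
       I * (F z * db (fun z => ((η z).im : ℂ)) z +
        (E z : ℂ) * fderiv ℝ (fun z => ((η z).im : ℂ)) z 1) := by
      intro z
      rw [db, db, db, ed z 1, ed z I]; ring
    simp only [this]
    have j : ∀ (α : ℂ → ℝ) (h : TstR α U), Integrable (fun z => F z * db (fun z => (α z : ℂ)) z +
        (E z : ℂ) * fderiv ℝ (fun z => (α z : ℂ)) z 1) := fun α h =>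
      (memLp_mul_tst hF h.toC.db).1.add (memLp_mul_tst hE (h.toC.der 1)).1
    rw [integral_add (j _ hη.re) ((j _ hη.im).const_mul I), integral_const_mul, h1, h2]
    simp

/-- elements of the closure of gradients are curl free -/
lemma curl_closure {U : Set ℂ} {f : L2U U} (hf : f ∈ (VU U).topologicalClosure) :
    CurlFree f U := by
  intro α h
  -- the functional f ↦ Im ∫ f db α is inner product with i·gr
  have hT : MemLp (fun z => I * Gr α z) 2 (volume.restrict U) := h.Gr_memLp.const_mul I
  have key : ∀ g : L2U U, (∫ z, g z * db (fun z => (α z : ℂ)) z).im = inner ℝ (hT.toLp _) g := by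
    intro g
    rw [L2.inner_def]
    obtain ⟨h1, h2⟩ := memLp_mul_tst (Lp.memLp g) h.toC.db
    rw [h2, ← imCLM_apply, ← ContinuousLinearMap.integral_comp_comm _ h1.integrableOn]
    apply integral_congr_ae
    filter_upwards [hT.coeFn_toLp] with z e2
    rw [e2, h.db_eq, Complex.inner]; simp
    ring
  rw [key]
  have hcl : IsClosed {g : L2U U | inner ℝ (hT.toLp _) g = 0} :=
    isClosed_eq (continuous_const.inner continuous_id) continuous_const
  have : (VU U : Set (L2U U)) ⊆ {g : L2U U | inner ℝ (hT.toLp _) g = 0} := by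
    rintro _ ⟨β, h', rfl⟩
    simp only [Set.mem_setOf_eq]
    rw [← key]
    have e : ∫ z, (h'.gr z) * db (fun z => (α z : ℂ)) z = ∫ z, Gr β z * db (fun z => (α z : ℂ)) z := by
      rw [(memLp_mul_tst (Lp.memLp h'.gr) h.toC.db).2, (memLp_mul_tst h'.Gr_memLp h.toC.db).2]
      apply integral_congr_ae
      filter_upwards [h'.Gr_memLp.coeFn_toLp] with z e2
      rw [TstR.gr, e2]
    rw [e, ← imCLM_apply,
      ← ContinuousLinearMap.integral_comp_comm _ (memLp_mul_tst h'.Gr_memLp h.toC.db).1]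
    have c := h'.toC.curl h.toC 1 I
    have e3 : ∀ z, imCLM (Gr β z * db (fun z => (α z : ℂ)) z) =
        fderiv ℝ β z 1 * fderiv ℝ α z I - fderiv ℝ β z I * fderiv ℝ α z 1 := by
      intro z; rw [Gr, db, h.fderivC, h.fderivC]; simp; ring
    simp only [e3]
    simp only [h'.fderivC, h.fderivC] at c
    have i : ∀ v w, Integrable (fun z => fderiv ℝ β z v * fderiv ℝ α z w) := by
      intro v w
      have := (memLp_mul_tst ((h'.toC.der v).memLp.restrict U) (h.toC.der w)).1
      simp only [h'.fderivC, h.fderivC] at this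
      simpa using this.re
    rw [integral_sub (i 1 I) (i I 1), sub_eq_zero]
    have c' : ((∫ z, fderiv ℝ β z 1 * fderiv ℝ α z I : ℝ) : ℂ) = ((∫ z, fderiv ℝ β z I * fderiv ℝ α z 1 : ℝ) : ℂ) := by
      rw [← integral_complex_ofReal, ← integral_complex_ofReal]; push_cast; exact c
    exact_mod_cast c'
  exact (closure_minimal this hcl) hf

end A4

section A5
open Complex MeasureTheory
open scoped ContDiff

lemma L2_norm_sq {U : Set ℂ} {F : ℂ → ℂ} (hF : MemLp F 2 (volume.restrict U)) :
    ‖hF.toLp F‖ ^ 2 = ∫ z in U, ‖F z‖ ^ 2 := by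
  rw [← real_inner_self_eq_norm_sq, L2.inner_def]
  apply integral_congr_ae
  filter_upwards [hF.coeFn_toLp] with z e1
  rw [e1, real_inner_self_eq_norm_sq]

lemma Wk.congr {U : Set ℂ} {F F' : ℂ → ℂ} {E E' : ℂ → ℝ} (h : Wk F E U)
    (hF : ∀ z ∈ U, F z = F' z) (hE : ∀ z ∈ U, E z = E' z) : Wk F' E' U := by
  intro η hη
  rw [← h η hη]
  congr 1; ext z
  by_cases hz : z ∈ U
  · rw [hF z hz, hE z hz]
  · have h1 : z ∉ tsupport η := fun h => hz (hη.supp h)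
    have h2 : z ∉ tsupport (db η) := by
      intro h
      exact hz (hη.db.supp h)
    have h3 := image_eq_zero_of_notMem_tsupport h2
    have h4 : fderiv ℝ η z 1 = 0 := by
      have := image_eq_zero_of_notMem_tsupport (f := fun z => fderiv ℝ η z 1)
        (fun h => hz ((hη.der 1).supp h))
      exact this
    rw [h3, h4]; simp

lemma lemZ {U : Set ℂ} {F : ℂ → ℂ} {E : ℂ → ℝ} (hF : MemLp F 2 (volume.restrict U))
    (hE : MemLp (fun z => (E z : ℂ)) 2 (volume.restrict U)) (hW : Wk F E U) :
    ∃ Z : ℂ → ℂ, MemLp Z 2 (volume.restrict U) ∧ ∫ z in U, ‖Z z‖ ^ 2 ≤ ∫ z in U, E z ^ 2 ∧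
      Wk (fun z => F z - Z z) 0 U := by
  obtain ⟨hc, ho⟩ := (Wk_iff hF hE).1 hW
  set K := (VU U).topologicalClosure with hK
  haveI : CompleteSpace K := (VU U).isClosed_topologicalClosure.completeSpace_coe
  set f := hF.toLp F
  set e := hE.toLp _
  set z : L2U U := K.starProjection f with hz
  have hperp : f + e ∈ Kᗮ := by
    rw [hK, Submodule.orthogonal_closure, Submodule.mem_orthogonal]
    rintro _ ⟨α, h, rfl⟩
    exact ho α h
  have hze : z = - K.starProjection e := by
    have := (Submodule.starProjection_apply_eq_zero_iff K).2 hperp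
    rw [map_add] at this
    exact eq_neg_of_add_eq_zero_left this
  have hzn : ‖z‖ ≤ ‖e‖ := by
    rw [hze, norm_neg]; exact K.norm_starProjection_apply_le e
  have hzK : z ∈ K := Submodule.starProjection_apply_mem K f
  have hZ : MemLp (z : ℂ → ℂ) 2 (volume.restrict U) := Lp.memLp z
  have hZt : hZ.toLp _ = z := Lp.toLp_coeFn z hZ
  refine ⟨z, hZ, ?_, ?_⟩
  · have h1 := L2_norm_sq hZ
    rw [hZt] at h1
    have h2 : ‖e‖ ^ 2 = _ := L2_norm_sq hE
    simp only [norm_real, Real.norm_eq_abs, sq_abs] at h2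
    rw [← h1, ← h2]; gcongr
  · have h0 : MemLp (fun z => (((0 : ℂ → ℝ) z : ℝ) : ℂ)) 2 (volume.restrict U) := by
      simp
    have hFZ : MemLp (fun w => F w - z w) 2 (volume.restrict U) := hF.sub hZ
    rw [Wk_iff hFZ h0]
    refine ⟨fun α h => ?_, fun α h => ?_⟩
    · have i1 := (memLp_mul_tst hF h.toC.db).1
      have i2 := (memLp_mul_tst hZ h.toC.db).1
      simp only [sub_mul]
      rw [integral_sub i1 i2, sub_im, hc α h, curl_closure hzK α h, sub_zero]
    · have e1 : hFZ.toLp _ = f - z := by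
        have : hFZ.toLp _ = hF.toLp _ - hZ.toLp _ := rfl
        rw [this, hZt]
      have e2 : h0.toLp _ = 0 := by
        rw [Lp.eq_zero_iff_ae_eq_zero]
        filter_upwards [h0.coeFn_toLp] with w hw
        rw [hw]; simp
      rw [e1, e2, add_zero]
      have h3 : f - z ∈ Kᗮ := Submodule.sub_starProjection_mem_orthogonal f
      exact (Submodule.mem_orthogonal _ _).1 h3 _ (Submodule.le_topologicalClosure _ ⟨α, h, rfl⟩)

lemma cs_aux {U : Set ℂ} {h : ℂ → ℝ} {V : ℝ} (hV : 0 < V) (hU : volume.real U = V)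
    (hi : IntegrableOn h U) (hi2 : IntegrableOn (fun z => h z ^ 2) U) :
    (∫ z in U, h z) ^ 2 ≤ V * ∫ z in U, h z ^ 2 := by
  set t := (∫ z in U, h z) / V
  haveI : IsFiniteMeasure (volume.restrict U) := by
    constructor
    rw [Measure.restrict_apply_univ]
    by_contra hh
    have : volume U = ⊤ := by simpa using hh
    rw [measureReal_def, this] at hU
    simp at hU; linarith
  have h0 : 0 ≤ ∫ z in U, (h z - t) ^ 2 := integral_nonneg fun z => sq_nonneg _
  have e : ∀ z, (h z - t) ^ 2 = h z ^ 2 - (2 * t * h z - t ^ 2) := fun z => by ring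
  simp only [e] at h0
  have j : IntegrableOn (fun z => 2 * t * h z - t ^ 2) U :=
    (Integrable.const_mul hi (2 * t)).sub (integrable_const _)
  rw [integral_sub hi2 j, integral_sub (Integrable.const_mul hi (2 * t)) (integrable_const _), integral_const_mul,
    setIntegral_const, hU] at h0
  have ht : (∫ z in U, h z) = t * V := by simp only [t]; field_simp
  rw [ht] at h0 ⊢
  simp only [smul_eq_mul] at h0
  nlinarith

lemma vol_ball (z : ℂ) {r : ℝ} (hr : 0 ≤ r) : volume.real (ball z r) = Real.pi * r ^ 2 := by
  rw [measureReal_def, Complex.volume_ball]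
  simp [ENNReal.toReal_mul, hr]; ring


lemma memLp_sq {U : Set ℂ} {F : ℂ → ℂ} (hF : MemLp F 2 (volume.restrict U)) :
    IntegrableOn (fun z => ‖F z‖ ^ 2) U := by
  have := hF.integrable_norm_pow (p := 2) (by norm_num)
  exact this

lemma memLp_const_ball (c : ℂ) (z0 : ℂ) (r : ℝ) : MemLp (fun _ => c) 2 (volume.restrict (ball z0 r)) := by
  haveI : IsFiniteMeasure (volume.restrict (ball z0 r)) := ⟨by
    rw [Measure.restrict_apply_univ]; exact measure_ball_lt_top⟩
  exact memLp_const c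

lemma memLp_cont_ball {f : ℂ → ℂ} (hf : Continuous f) (z0 : ℂ) (r : ℝ) :
    MemLp f 2 (volume.restrict (ball z0 r)) := by
  haveI : IsFiniteMeasure (volume.restrict (ball z0 r)) := ⟨by
    rw [Measure.restrict_apply_univ]; exact measure_ball_lt_top⟩
  obtain ⟨C, hC⟩ := (isCompact_closedBall z0 r).exists_bound_of_continuousOn hf.continuousOn
  refine MemLp.of_bound hf.aestronglyMeasurable C ?_
  rw [ae_restrict_iff' measurableSet_ball]
  exact Eventually.of_forall fun z hz => hC z (ball_subset_closedBall hz)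

/-- decay lemma -/
lemma decay : ∃ C : ℝ, 0 < C ∧ ∀ (F : ℂ → ℂ) (E : ℂ → ℝ) (z0 : ℂ) (r : ℝ), 0 < r →
    MemLp F 2 (volume.restrict (ball z0 r)) →
    MemLp (fun z => (E z : ℂ)) 2 (volume.restrict (ball z0 r)) → Wk F E (ball z0 r) →
    ∃ c α : ℂ,
      ‖c‖ ^ 2 * r ^ 2 ≤ C * ((∫ z in ball z0 r, ‖F z‖ ^ 2) + ∫ z in ball z0 r, E z ^ 2) ∧
      ‖α‖ ^ 2 * r ^ 4 ≤ C * ((∫ z in ball z0 r, ‖F z‖ ^ 2) + ∫ z in ball z0 r, E z ^ 2) ∧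
      ∀ ρ, 0 < ρ → ρ ≤ r / 2 → ∫ z in ball z0 ρ, ‖F z - (c + α * (z - z0))‖ ^ 2 ≤
        C * ((ρ / r) ^ 6 * (∫ z in ball z0 r, ‖F z‖ ^ 2) + ∫ z in ball z0 r, E z ^ 2) := by
  obtain ⟨C, hC, hol⟩ := hol_taylor
  refine ⟨1000 * (C ^ 2 + 1), by positivity, fun F E z0 r hr hF hE hW => ?_⟩
  obtain ⟨Z, hZ, hZE, hWH⟩ := lemZ hF hE hW
  set n := ∫ z in ball z0 r, ‖F z‖ ^ 2 with hn
  set m := ∫ z in ball z0 r, E z ^ 2 with hm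
  have hn0 : 0 ≤ n := integral_nonneg fun z => by positivity
  have hm0 : 0 ≤ m := integral_nonneg fun z => by positivity
  have hFZ : MemLp (fun z => F z - Z z) 2 (volume.restrict (ball z0 r)) := hF.sub hZ
  set H : ℂ → ℂ := (ball z0 r).indicator (fun z => F z - Z z) with hH
  haveI : IsFiniteMeasure (volume.restrict (ball z0 r)) := ⟨by
    rw [Measure.restrict_apply_univ]; exact measure_ball_lt_top⟩
  have hHi : Integrable H := by
    rw [hH, integrable_indicator_iff measurableSet_ball]
    exact hFZ.integrable (by norm_num)
  have hHW : Wk H 0 (ball z0 r) := hWH.congr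
    (fun z hz => by rw [hH, Set.indicator_of_mem hz]) (fun _ _ => rfl)
  obtain ⟨c, α, β, hα, -, rfl, hT⟩ := hol H z0 r hr hHi hHW
  set J := ∫ w, ‖H w‖ with hJ
  have hJ0 : 0 ≤ J := integral_nonneg fun z => norm_nonneg _
  have hpi := Real.pi_pos
  have hpi4 : Real.pi < 4 := Real.pi_lt_four
  have hJ2 : J ^ 2 ≤ 4 * r ^ 2 * (2 * n + 2 * m) := by
    have e : J = ∫ w in ball z0 r, ‖F w - Z w‖ := by
      rw [hJ, ← integral_indicator measurableSet_ball]
      congr 1; ext w; rw [hH, norm_indicator_eq_indicator_norm]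
    have h1 := cs_aux (h := fun w => ‖F w - Z w‖) (by positivity) (vol_ball z0 hr.le)
      (hFZ.integrable (by norm_num)).norm (memLp_sq hFZ)
    rw [← e] at h1
    have h2 : ∫ w in ball z0 r, ‖F w - Z w‖ ^ 2 ≤ 2 * n + 2 * m := by
      have : ∫ w in ball z0 r, ‖F w - Z w‖ ^ 2 ≤ ∫ w in ball z0 r, (2 * ‖F w‖ ^ 2 + 2 * ‖Z w‖ ^ 2) := by
        refine integral_mono (memLp_sq hFZ) (((memLp_sq hF).const_mul 2).add ((memLp_sq hZ).const_mul 2)) ?_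
        intro w
        have := norm_sub_le (F w) (Z w)
        have := norm_nonneg (F w - Z w)
        simp only []
        nlinarith [sq_nonneg (‖F w‖ - ‖Z w‖)]
      rw [integral_add ((memLp_sq hF).const_mul 2) ((memLp_sq hZ).const_mul 2),
        integral_const_mul, integral_const_mul] at this
      linarith
    have h3 : 0 ≤ ∫ w in ball z0 r, ‖F w - Z w‖ ^ 2 := integral_nonneg fun z => by positivity
    calc J ^ 2 ≤ Real.pi * r ^ 2 * ∫ w in ball z0 r, ‖F w - Z w‖ ^ 2 := h1
      _ ≤ 4 * r ^ 2 * (2 * n + 2 * m) := by gcongr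
  have hαb : ‖α‖ ^ 2 * r ^ 4 ≤ 8 * C ^ 2 * (n + m) := by
    have h1 : ‖α‖ ^ 2 ≤ (C * r⁻¹ ^ 3 * J) ^ 2 := by gcongr
    calc ‖α‖ ^ 2 * r ^ 4 ≤ (C * r⁻¹ ^ 3 * J) ^ 2 * r ^ 4 := by gcongr
      _ = C ^ 2 * r⁻¹ ^ 2 * J ^ 2 := by field_simp
      _ ≤ C ^ 2 * r⁻¹ ^ 2 * (4 * r ^ 2 * (2 * n + 2 * m)) := by gcongr
      _ = _ := by field_simp; ring
  have hlf : ∀ z, lfc α (I * α) z = α * z := fun z => by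
    rw [lfc]; conv_rhs => rw [← re_add_im z]
    ring
  have hLc : Continuous (fun z => c + α * (z - z0)) := by fun_prop
  have hdec : ∀ ρ, 0 < ρ → ρ ≤ r / 2 → ∫ z in ball z0 ρ, ‖F z - (c + α * (z - z0))‖ ^ 2 ≤
        2 * m + 64 * C ^ 2 * ((ρ / r) ^ 6 * (n + m)) := by
    intro ρ hρ hρr
    have hsub : ball z0 ρ ⊆ ball z0 r := ball_subset_ball (by linarith)
    have hmle := Measure.restrict_mono hsub (le_refl (volume : Measure ℂ))
    have hF' := hF.mono_measure hmle
    have hZ' := hZ.mono_measure hmle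
    have hL' := memLp_cont_ball hLc z0 ρ
    have i1 : IntegrableOn (fun z => ‖F z - (c + α * (z - z0))‖ ^ 2) (ball z0 ρ) :=
      memLp_sq (hF'.sub hL')
    have i2 : IntegrableOn (fun z => 2 * ‖Z z‖ ^ 2) (ball z0 ρ) := (memLp_sq hZ').const_mul 2
    have i3 : IntegrableOn (fun _ : ℂ => 2 * (C * r⁻¹ ^ 4 * ρ ^ 2 * J) ^ 2) (ball z0 ρ) :=
      integrableOn_const measure_ball_lt_top.ne
    have hle : ∫ z in ball z0 ρ, ‖F z - (c + α * (z - z0))‖ ^ 2 ≤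
        ∫ z in ball z0 ρ, (2 * ‖Z z‖ ^ 2 + 2 * (C * r⁻¹ ^ 4 * ρ ^ 2 * J) ^ 2) := by
      refine setIntegral_mono_ae_restrict i1 (i2.add i3) ?_
      rw [EventuallyLE, ae_restrict_iff' measurableSet_ball]
      filter_upwards [hT] with z hz hzρ
      have h1 := hz (ball_subset_ball hρr hzρ)
      rw [hlf, hH, Set.indicator_of_mem (hsub hzρ)] at h1
      have h2 : ‖z - z0‖ ≤ ρ := (mem_ball_iff_norm.1 hzρ).le
      have h3 : C * r⁻¹ ^ 4 * ‖z - z0‖ ^ 2 * J ≤ C * r⁻¹ ^ 4 * ρ ^ 2 * J := by gcongr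
      have h4 : ‖F z - (c + α * (z - z0))‖ ≤ ‖Z z‖ + C * r⁻¹ ^ 4 * ρ ^ 2 * J := by
        have : F z - (c + α * (z - z0)) = Z z + (F z - Z z - (c + α * (z - z0))) := by ring
        rw [this]
        exact (norm_add_le _ _).trans (by linarith)
      have h5 : 0 ≤ C * r⁻¹ ^ 4 * ρ ^ 2 * J := by positivity
      have := norm_nonneg (F z - (c + α * (z - z0)))
      nlinarith [sq_nonneg (‖Z z‖ - C * r⁻¹ ^ 4 * ρ ^ 2 * J)]
    rw [integral_add i2 i3, integral_const_mul, setIntegral_const, vol_ball z0 hρ.le] at hle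
    have hZm : ∫ z in ball z0 ρ, ‖Z z‖ ^ 2 ≤ m :=
      (setIntegral_mono_set (memLp_sq hZ) (Eventually.of_forall fun z => by positivity)
        (HasSubset.Subset.eventuallyLE hsub)).trans hZE
    have h6 : Real.pi * ρ ^ 2 * (2 * (C * r⁻¹ ^ 4 * ρ ^ 2 * J) ^ 2) ≤ 64 * C ^ 2 * ((ρ / r) ^ 6 * (n + m)) := by
      calc Real.pi * ρ ^ 2 * (2 * (C * r⁻¹ ^ 4 * ρ ^ 2 * J) ^ 2)
          = Real.pi * ρ ^ 2 * (2 * (C * r⁻¹ ^ 4 * ρ ^ 2) ^ 2 * J ^ 2) := by ring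
        _ ≤ 4 * ρ ^ 2 * (2 * (C * r⁻¹ ^ 4 * ρ ^ 2) ^ 2 * (4 * r ^ 2 * (2 * n + 2 * m))) := by gcongr
        _ = _ := by field_simp; ring
    rw [smul_eq_mul] at hle
    linarith
  refine ⟨c, α, ?_, ?_, ?_⟩
  · have h1 := hdec (r/2) (by positivity) le_rfl
    have hsub : ball z0 (r/2) ⊆ ball z0 r := ball_subset_ball (by linarith)
    have hmle := Measure.restrict_mono hsub (le_refl (volume : Measure ℂ))
    have hF' := hF.mono_measure hmle
    have hL' := memLp_cont_ball hLc z0 (r/2)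
    have i1 : IntegrableOn (fun z => 3 * ‖F z - (c + α * (z - z0))‖ ^ 2) (ball z0 (r/2)) :=
      (memLp_sq (hF'.sub hL')).const_mul 3
    have i2 : IntegrableOn (fun z => 3 * ‖F z‖ ^ 2) (ball z0 (r/2)) := (memLp_sq hF').const_mul 3
    have i3 : IntegrableOn (fun _ : ℂ => 3 * (‖α‖ * r) ^ 2) (ball z0 (r/2)) :=
      integrableOn_const measure_ball_lt_top.ne
    have i4 : IntegrableOn (fun _ : ℂ => ‖c‖ ^ 2) (ball z0 (r/2)) :=
      integrableOn_const measure_ball_lt_top.ne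
    have hle : ∫ z in ball z0 (r/2), ‖c‖ ^ 2 ≤ ∫ z in ball z0 (r/2),
        (3 * ‖F z - (c + α * (z - z0))‖ ^ 2 + (3 * ‖F z‖ ^ 2 + 3 * (‖α‖ * r) ^ 2)) := by
      refine setIntegral_mono_on i4 (i1.add (i2.add i3)) measurableSet_ball ?_
      intro z hz
      have h2 : ‖z - z0‖ ≤ r := (mem_ball_iff_norm.1 hz).le.trans (by linarith)
      have h3 : ‖c‖ ≤ ‖F z - (c + α * (z - z0))‖ + (‖F z‖ + ‖α‖ * r) := by
        have e : c = -(F z - (c + α * (z - z0))) + (F z - α * (z - z0)) := by ring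
        calc ‖c‖ ≤ ‖F z - (c + α * (z - z0))‖ + ‖F z - α * (z - z0)‖ := by
              conv_lhs => rw [e]
              refine (norm_add_le _ _).trans ?_
              rw [norm_neg]
          _ ≤ _ := by
              have := norm_sub_le (F z) (α * (z - z0))
              rw [norm_mul] at this
              have : ‖α‖ * ‖z - z0‖ ≤ ‖α‖ * r := by gcongr
              linarith
      have := norm_nonneg c
      set x := ‖F z - (c + α * (z - z0))‖
      nlinarith [sq_nonneg (x - ‖F z‖), sq_nonneg (x - ‖α‖ * r), sq_nonneg (‖F z‖ - ‖α‖ * r)]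
    have hn' : ∫ z in ball z0 (r/2), ‖F z‖ ^ 2 ≤ n :=
      setIntegral_mono_set (memLp_sq hF) (Eventually.of_forall fun z => by positivity)
        (HasSubset.Subset.eventuallyLE hsub)
    have j23 : IntegrableOn (fun z => 3 * ‖F z‖ ^ 2 + 3 * (‖α‖ * r) ^ 2) (ball z0 (r/2)) := i2.add i3
    rw [integral_add i1 j23, integral_add i2 i3, integral_const_mul, integral_const_mul,
      setIntegral_const, setIntegral_const, vol_ball z0 (by positivity)] at hle
    simp only [smul_eq_mul] at hle
    have e1 : (r / 2 / r) ^ 6 = 1/64 := by field_simp; norm_num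
    rw [e1] at h1
    have hp3 := Real.pi_gt_three
    have e2 : Real.pi * (r/2)^2 * (3 * (‖α‖ * r) ^ 2) ≤ 4 * (3/4 * (‖α‖ ^ 2 * r ^ 4)) := by
      have : Real.pi * (r/2)^2 * (3 * (‖α‖ * r) ^ 2) = Real.pi * (3/4 * (‖α‖ ^ 2 * r ^ 4)) := by ring
      rw [this]; gcongr
    have e3 : 3 * (r/2)^2 * ‖c‖ ^ 2 ≤ Real.pi * (r/2)^2 * ‖c‖ ^ 2 := by gcongr
    have hC2 := sq_nonneg C
    nlinarith [mul_nonneg hC2 hn0, mul_nonneg hC2 hm0]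
  · have hC2 := sq_nonneg C
    nlinarith [mul_nonneg hC2 hn0, mul_nonneg hC2 hm0]
  · intro ρ hρ hρr
    have h1 := hdec ρ hρ hρr
    have hC2 := sq_nonneg C
    have ht : (ρ / r) ^ 6 ≤ 1 := by
      apply pow_le_one₀ (by positivity)
      rw [div_le_one hr]; linarith
    have ht0 : 0 ≤ (ρ / r) ^ 6 := by positivity
    set t := (ρ / r) ^ 6
    have a1 := mul_nonneg ht0 hn0
    have a2 : t * m ≤ m := by nlinarith
    have a3 : C ^ 2 * (t * m) ≤ C ^ 2 * m := by gcongr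
    nlinarith [mul_nonneg hC2 a1, mul_nonneg hC2 hm0]

end A5

section A6
open Complex MeasureTheory
open scoped ContDiff

lemma Wk.add {U : Set ℂ} {F F' : ℂ → ℂ} {E E' : ℂ → ℝ} (h : Wk F E U) (h' : Wk F' E' U)
    (hF : MemLp F 2 (volume.restrict U)) (hE : MemLp (fun z => (E z : ℂ)) 2 (volume.restrict U))
    (hF' : MemLp F' 2 (volume.restrict U)) (hE' : MemLp (fun z => (E' z : ℂ)) 2 (volume.restrict U)) :
    Wk (fun z => F z + F' z) (fun z => E z + E' z) U := by
  intro η hη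
  have j1 : Integrable (fun z => F z * db η z + (E z : ℂ) * fderiv ℝ η z 1) :=
    (memLp_mul_tst hF hη.db).1.add (memLp_mul_tst hE (hη.der 1)).1
  have j2 : Integrable (fun z => F' z * db η z + (E' z : ℂ) * fderiv ℝ η z 1) :=
    (memLp_mul_tst hF' hη.db).1.add (memLp_mul_tst hE' (hη.der 1)).1
  have : ∫ z, ((F z + F' z) * db η z + ((E z + E' z : ℝ) : ℂ) * fderiv ℝ η z 1) =
    ∫ z, ((F z * db η z + (E z : ℂ) * fderiv ℝ η z 1) + (F' z * db η z + (E' z : ℂ) * fderiv ℝ η z 1)) := by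
    congr 1; ext z; push_cast; ring
  rw [this, integral_add j1 j2, h η hη, h' η hη, add_zero]

lemma Wk_aff (c α : ℂ) (κ e0 e2 : ℝ) (z0 : ℂ) (U : Set ℂ) :
    Wk (fun z => c + α * (z - z0) + κ * ((z - z0).re : ℂ))
      (fun z => e0 + e2 * (z - z0).im - κ * (z - z0).re) U := by
  intro η hη
  have hd1 : ∀ z, HasFDerivAt (fun z : ℂ => c + α * (z - z0) + κ * ((z - z0).re : ℂ))
      (α • ContinuousLinearMap.id ℝ ℂ + (κ : ℂ) • (ofRealCLM.comp reCLM)) z := by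
    intro z
    have a1 : HasFDerivAt (fun z : ℂ => α * (z - z0)) (α • ContinuousLinearMap.id ℝ ℂ) z :=
      ((hasFDerivAt_id z).sub_const z0).const_mul _
    have a2 : HasFDerivAt (fun z : ℂ => ((z - z0).re : ℂ)) (ofRealCLM.comp reCLM) z :=
      ((ofRealCLM.comp reCLM).hasFDerivAt (x := z - z0)).comp z ((hasFDerivAt_id z).sub_const z0)
    exact (a1.const_add c).add (a2.const_mul _)
  have hd2 : ∀ z, HasFDerivAt (fun z : ℂ => ((e0 + e2 * (z - z0).im - κ * (z - z0).re : ℝ) : ℂ))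
      ((e2 : ℂ) • (ofRealCLM.comp imCLM) - (κ : ℂ) • (ofRealCLM.comp reCLM)) z := by
    intro z
    have a1 : HasFDerivAt (fun z : ℂ => ((z - z0).im : ℂ)) (ofRealCLM.comp imCLM) z :=
      ((ofRealCLM.comp imCLM).hasFDerivAt (x := z - z0)).comp z ((hasFDerivAt_id z).sub_const z0)
    have a2 : HasFDerivAt (fun z : ℂ => ((z - z0).re : ℂ)) (ofRealCLM.comp reCLM) z :=
      ((ofRealCLM.comp reCLM).hasFDerivAt (x := z - z0)).comp z ((hasFDerivAt_id z).sub_const z0)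
    have := ((a1.const_mul (e2 : ℂ)).const_add (e0 : ℂ)).sub (a2.const_mul (κ : ℂ))
    refine this.congr_of_eventuallyEq (Eventually.of_forall fun z => ?_)
    simp only [Pi.sub_apply]; push_cast; rfl
  have f1 : ∀ z v, fderiv ℝ (fun z : ℂ => c + α * (z - z0) + κ * ((z - z0).re : ℂ)) z v = α * v + κ * (v.re : ℂ) := by
    intro z v; rw [(hd1 z).fderiv]; simp
  have f2 : ∀ z v, fderiv ℝ (fun z : ℂ => ((e0 + e2 * (z - z0).im - κ * (z - z0).re : ℝ) : ℂ)) z v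
      = e2 * (v.im : ℂ) - κ * (v.re : ℂ) := by
    intro z v; rw [(hd2 z).fderiv]; simp
  have b1 := fun v => ibp_aux isOpen_univ (fun z _ => (hd1 z).differentiableAt) v
    (by simp only [f1]; exact continuousOn_const) (hη.smooth.of_le (by simp)) hη.cpt (Set.subset_univ _)
  have b2 := ibp_aux isOpen_univ (fun z _ => (hd2 z).differentiableAt) 1
    (by simp only [f2]; exact continuousOn_const) (hη.smooth.of_le (by simp)) hη.cpt (Set.subset_univ _)
  have e : ∀ z, (c + α * (z - z0) + κ * ((z - z0).re : ℂ)) * db η z +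
      ((e0 + e2 * (z - z0).im - κ * (z - z0).re : ℝ) : ℂ) * fderiv ℝ η z 1 =
      ((c + α * (z - z0) + κ * ((z - z0).re : ℂ)) * fderiv ℝ η z 1 +
      I * ((c + α * (z - z0) + κ * ((z - z0).re : ℂ)) * fderiv ℝ η z I)) +
      ((e0 + e2 * (z - z0).im - κ * (z - z0).re : ℝ) : ℂ) * fderiv ℝ η z 1 := by
    intro z; rw [db]; ring
  simp only [e]
  have j : Integrable (fun z => (c + α * (z - z0) + κ * ((z - z0).re : ℂ)) * fderiv ℝ η z 1 +
      I * ((c + α * (z - z0) + κ * ((z - z0).re : ℂ)) * fderiv ℝ η z I)) :=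
    (b1 1).2.1.add ((b1 I).2.1.const_mul I)
  rw [integral_add j b2.2.1]
  rw [integral_add (b1 1).2.1 ((b1 I).2.1.const_mul I), integral_const_mul,
    (b1 1).2.2, (b1 I).2.2, b2.2.2]
  simp only [f1, f2, integral_const_mul]
  simp
  have := I_mul_I
  linear_combination (-α * ∫ z, η z) * this

/-- centre value of an affine function -/
lemma aff_center (c : ℂ) (A : ℂ →L[ℝ] ℂ) (z1 : ℂ) {d : ℝ} (hd : 0 ≤ d) :
    ‖c‖ ^ 2 * (Real.pi * d ^ 2) ≤ ∫ z in ball z1 d, ‖c + A (z - z1)‖ ^ 2 := by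
  have hc : ∀ s : ℂ →L[ℝ] ℂ, IntegrableOn (fun z => ‖c + s (z - z1)‖ ^ 2) (ball z1 d) := fun s =>
    memLp_sq (memLp_cont_ball (by fun_prop) z1 d)
  have h1 : ∫ z in ball z1 d, ‖c + A (z - z1)‖ ^ 2 = ∫ z in ball z1 d, ‖c + (-A) (z - z1)‖ ^ 2 := by
    rw [← integral_indicator measurableSet_ball, ← integral_indicator measurableSet_ball,
      ← integral_sub_left_eq_self _ volume (2 * z1)]
    congr 1; ext z
    have e : 2 * z1 - z - z1 = -(z - z1) := by ring
    have : (2 * z1 - z ∈ ball z1 d) ↔ z ∈ ball z1 d := by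
      rw [mem_ball_iff_norm, mem_ball_iff_norm, e, norm_neg]
    by_cases hz : z ∈ ball z1 d
    · rw [Set.indicator_of_mem (this.2 hz), Set.indicator_of_mem hz, e]; simp
    · rw [Set.indicator_of_notMem (fun h => hz (this.1 h)), Set.indicator_of_notMem hz]
  have h2 : ∫ z in ball z1 d, 2 * ‖c‖ ^ 2 ≤ ∫ z in ball z1 d, (‖c + A (z - z1)‖ ^ 2 + ‖c + (-A) (z - z1)‖ ^ 2) := by
    refine integral_mono (integrableOn_const measure_ball_lt_top.ne) ((hc A).add (hc (-A))) ?_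
    intro z
    have := parallelogram_law_with_norm ℝ c (A (z - z1))
    simp only [neg_apply, ← sub_eq_add_neg]
    nlinarith [sq_nonneg ‖A (z - z1)‖]
  rw [integral_add (hc A) (hc (-A)), ← h1, setIntegral_const, vol_ball z1 hd, smul_eq_mul] at h2
  linarith

lemma cmp_aux {F : ℂ → ℂ} {z0 z1 c0 c1 : ℂ} {A0 A1 : ℂ →L[ℝ] ℂ} {d X : ℝ} (hd : 0 < d) (hz : ‖z1 - z0‖ ≤ d)
    (hF : ContinuousOn F (ball z0 (2 * d)))
    (hF2 : MemLp F 2 (volume.restrict (ball z0 (2 * d))))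
    (h0 : ∫ z in ball z0 (2 * d), ‖F z - (c0 + A0 (z - z0))‖ ^ 2 ≤ X)
    (h1 : ∫ z in ball z1 d, ‖F z - (c1 + A1 (z - z1))‖ ^ 2 ≤ X) :
    ‖c0 + A0 (z1 - z0) - c1‖ ^ 2 * (Real.pi * d ^ 2) ≤ 4 * X := by
  have hsub : ball z1 d ⊆ ball z0 (2 * d) := by
    intro z hz'
    rw [mem_ball_iff_norm] at *
    have : z - z0 = (z - z1) + (z1 - z0) := by ring
    rw [this]; exact (norm_add_le _ _).trans_lt (by linarith)
  have hmle := Measure.restrict_mono hsub (le_refl (volume : Measure ℂ))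
  have m0 : MemLp (fun z => F z - (c0 + A0 (z - z0))) 2 (volume.restrict (ball z0 (2*d))) :=
    hF2.sub (memLp_cont_ball (by fun_prop) z0 _)
  have m1 : MemLp (fun z => F z - (c1 + A1 (z - z1))) 2 (volume.restrict (ball z1 d)) :=
    (hF2.mono_measure hmle).sub (memLp_cont_ball (by fun_prop) z1 _)
  have h0' : ∫ z in ball z1 d, ‖F z - (c0 + A0 (z - z0))‖ ^ 2 ≤ X :=
    (setIntegral_mono_set (memLp_sq m0) (Eventually.of_forall fun z => by positivity)
        (HasSubset.Subset.eventuallyLE hsub)).trans h0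
  have key := aff_center (c0 + A0 (z1 - z0) - c1) (A0 - A1) z1 hd.le
  refine key.trans ?_
  have i0 := (memLp_sq (m0.mono_measure hmle)).const_mul 2
  have i1 := (memLp_sq m1).const_mul 2
  have : ∫ z in ball z1 d, ‖c0 + A0 (z1 - z0) - c1 + (A0 - A1) (z - z1)‖ ^ 2 ≤
      ∫ z in ball z1 d, (2 * ‖F z - (c0 + A0 (z - z0))‖ ^ 2 + 2 * ‖F z - (c1 + A1 (z - z1))‖ ^ 2) := by
    refine integral_mono (memLp_sq (memLp_cont_ball (by fun_prop) z1 d)) (i0.add i1) ?_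
    intro z
    have e : c0 + A0 (z1 - z0) - c1 + (A0 - A1) (z - z1) =
      (F z - (c1 + A1 (z - z1))) - (F z - (c0 + A0 (z - z0))) := by
      have : z - z0 = (z - z1) + (z1 - z0) := by ring
      rw [this, map_add, sub_apply]; ring
    simp only [e]
    have := norm_sub_le (F z - (c1 + A1 (z - z1))) (F z - (c0 + A0 (z - z0)))
    have h3 := norm_nonneg ((F z - (c1 + A1 (z - z1))) - (F z - (c0 + A0 (z - z0))))
    nlinarith [sq_nonneg (‖F z - (c1 + A1 (z - z1))‖ - ‖F z - (c0 + A0 (z - z0))‖)]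
  rw [integral_add i0 i1, integral_const_mul, integral_const_mul] at this
  linarith

lemma rec_aux {a : ℕ → ℝ} {q M : ℝ} (hq : 0 < q) (hM : 0 ≤ M)
    (h : ∀ k, a (k+1) ≤ q / 2 * a k + M * q ^ k) (h0 : 0 ≤ a 0) (k : ℕ) :
    a k ≤ (a 0 + 2 * M / q) * q ^ k := by
  induction k with
  | zero => simp; positivity
  | succ k ih =>
    calc a (k+1) ≤ q / 2 * a k + M * q ^ k := h k
      _ ≤ q / 2 * ((a 0 + 2 * M / q) * q ^ k) + M * q ^ k := by gcongr
      _ = (a 0 / 2 + 2 * M / q) * q ^ (k+1) := by field_simp; ring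
      _ ≤ _ := by gcongr; linarith

/-- the approximating constants converge to the value -/
lemma const_lim {F : ℂ → ℂ} {z0 c : ℂ} {A : ℂ →L[ℝ] ℂ} {R : ℝ} (hR : 0 < R) (hF : ContinuousOn F (ball z0 R))
    (hF2 : MemLp F 2 (volume.restrict (ball z0 R)))
    {C : ℝ} {n : ℕ} (hn : 3 ≤ n) 
    (h : ∀ r, 0 < r → r ≤ R → ∫ z in ball z0 r, ‖F z - (c + A (z - z0))‖ ^ 2 ≤ C * r ^ n) : c = F z0 := by
  by_contra hne
  have hpos : 0 < ‖c - F z0‖ := norm_pos_iff.2 (sub_ne_zero.2 hne)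
  set N := ‖c - F z0‖ with hN
  obtain ⟨ρ, hρ, hball⟩ := Metric.continuousAt_iff.1 (hF.continuousAt (ball_mem_nhds z0 hR)) (N / 8) (by positivity)
  have hpi := Real.pi_gt_three
  obtain ⟨d, hd, hd1, hd2, hd3, hd4⟩ : ∃ d, 0 < d ∧ 2 * d ≤ R ∧ 2 * d < ρ ∧ 2 * d ≤ 1 ∧ (|C| + 1) * (32 * d) ≤ N ^ 2 := by
    refine ⟨min (min (R / 2) (ρ / 4)) (min (1/2) (N ^ 2 / ((|C| + 1) * 32))), by positivity, ?_, ?_, ?_, ?_⟩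
    · have := min_le_left (min (R / 2) (ρ / 4)) (min (1/2) (N ^ 2 / ((|C| + 1) * 32)))
      have := min_le_left (R/2) (ρ/4)
      linarith
    · have := min_le_left (min (R / 2) (ρ / 4)) (min (1/2) (N ^ 2 / ((|C| + 1) * 32)))
      have := min_le_right (R/2) (ρ/4)
      linarith
    · have := min_le_right (min (R / 2) (ρ / 4)) (min (1/2) (N ^ 2 / ((|C| + 1) * 32)))
      have := min_le_left (1/2) (N ^ 2 / ((|C| + 1) * 32))
      linarith
    · have h1 := min_le_right (min (R / 2) (ρ / 4)) (min (1/2) (N ^ 2 / ((|C| + 1) * 32)))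
      have h2 := h1.trans (min_le_right (1/2) (N ^ 2 / ((|C| + 1) * 32)))
      rw [le_div_iff₀ (by positivity)] at h2
      linarith
  have hs : ball z0 (2 * d) ⊆ ball z0 R := ball_subset_ball hd1
  have hpow : (2 * d) ^ n ≤ (2 * d) ^ 3 := pow_le_pow_of_le_one (by positivity) hd3 hn
  have h1 : ∫ z in ball z0 (2 * d), ‖F z - (c + A (z - z0))‖ ^ 2 ≤ |C| * (8 * d ^ 3) + N ^ 2 / 64 * (Real.pi * d ^ 2) := by
    have := h (2 * d) (by positivity) hd1
    have h3 : C * (2 * d) ^ n ≤ |C| * (8 * d ^ 3) := by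
      calc C * (2 * d) ^ n ≤ |C| * (2 * d) ^ n := by gcongr; exact le_abs_self C
        _ ≤ |C| * (2 * d) ^ 3 := by gcongr
        _ = _ := by ring
    have : 0 ≤ N ^ 2 / 64 * (Real.pi * d ^ 2) := by positivity
    linarith
  have h2 : ∫ z in ball z0 d, ‖F z - (F z0 + (0 : ℂ →L[ℝ] ℂ) (z - z0))‖ ^ 2 ≤ |C| * (8 * d ^ 3) + N ^ 2 / 64 * (Real.pi * d ^ 2) := by
    have : ∫ z in ball z0 d, ‖F z - (F z0 + (0 : ℂ →L[ℝ] ℂ) (z - z0))‖ ^ 2 ≤ ∫ z in ball z0 d, (N / 8) ^ 2 := by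
      refine setIntegral_mono_on ?_ (integrableOn_const measure_ball_lt_top.ne) measurableSet_ball ?_
      · refine memLp_sq ((hF2.mono_measure (Measure.restrict_mono (ball_subset_ball (by linarith)) le_rfl)).sub
          (memLp_cont_ball (by fun_prop) z0 _))
      · intro z hz
        have : dist z z0 < ρ := by rw [mem_ball] at hz; linarith
        have := (hball this).le
        rw [dist_eq_norm] at this
        simp only [ContinuousLinearMap.zero_apply, add_zero]
        gcongr
    rw [setIntegral_const, vol_ball z0 hd.le, smul_eq_mul] at this
    have : 0 ≤ |C| * (8 * d ^ 3) := by positivity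
    linarith
  have := cmp_aux hd (by simp; exact hd.le) (hF.mono hs) (hF2.mono_measure (Measure.restrict_mono hs le_rfl)) h1 h2
  rw [sub_self, map_zero, add_zero, ← hN] at this
  have h5 : |C| * (32 * d) ≤ N ^ 2 := by
    have : 0 < d := hd
    linarith
  have h6 : |C| * (32 * d) * d ^ 2 ≤ N ^ 2 * d ^ 2 := by gcongr
  have h7 : 3 * (N ^ 2 * d ^ 2) ≤ Real.pi * (N ^ 2 * d ^ 2) := by gcongr
  have h8 : 0 < N ^ 2 * d ^ 2 := by positivity
  nlinarith

end A6

section A7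
open Complex MeasureTheory
open scoped ContDiff

lemma memLp_bdd {F : ℂ → ℂ} {z0 : ℂ} {R B : ℝ} (hF : ContinuousOn F (ball z0 R)) (hB : ∀ z ∈ ball z0 R, ‖F z‖ ≤ B) :
    MemLp F 2 (volume.restrict (ball z0 R)) := by
  haveI : IsFiniteMeasure (volume.restrict (ball z0 R)) := ⟨by rw [Measure.restrict_apply_univ]; exact measure_ball_lt_top⟩
  refine MemLp.of_bound (hF.aestronglyMeasurable measurableSet_ball) B ?_
  rw [ae_restrict_iff' measurableSet_ball]
  exact Eventually.of_forall hB

lemma sq_add_le {x y : ℂ} : ‖x + y‖ ^ 2 ≤ 2 * ‖x‖ ^ 2 + 2 * ‖y‖ ^ 2 := by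
  have := norm_add_le x y
  nlinarith [norm_nonneg (x + y), sq_nonneg (‖x‖ - ‖y‖)]

lemma sqInt_add {F G : ℂ → ℂ} {z0 : ℂ} {r t : ℝ} (hr : 0 ≤ r) (hF : MemLp F 2 (volume.restrict (ball z0 r)))
    (hG : Continuous G) (ht : 0 ≤ t) (hGb : ∀ z ∈ ball z0 r, ‖G z‖ ≤ t) :
    ∫ z in ball z0 r, ‖F z + G z‖ ^ 2 ≤ 2 * (∫ z in ball z0 r, ‖F z‖ ^ 2) + 8 * t ^ 2 * r ^ 2 := by
  have hG2 := memLp_cont_ball hG z0 r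
  have i0 := (memLp_sq hF).const_mul 2
  have i1 : IntegrableOn (fun _ : ℂ => 2 * t ^ 2) (ball z0 r) := integrableOn_const measure_ball_lt_top.ne
  have : ∫ z in ball z0 r, ‖F z + G z‖ ^ 2 ≤ ∫ z in ball z0 r, (2 * ‖F z‖ ^ 2 + 2 * t ^ 2) := by
    refine setIntegral_mono_on (memLp_sq (hF.add hG2)) (i0.add i1) measurableSet_ball ?_
    intro z hz
    have := sq_add_le (x := F z) (y := G z)
    have := hGb z hz
    have : ‖G z‖ ^ 2 ≤ t ^ 2 := by gcongr
    linarith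
  rw [integral_add i0 i1, integral_const_mul, setIntegral_const, vol_ball z0 hr, smul_eq_mul] at this
  have hpi := Real.pi_lt_d2
  have : Real.pi * r ^ 2 * (2 * t ^ 2) ≤ 4 * r ^ 2 * (2 * t ^ 2) := by gcongr; linarith
  linarith

/-- Campanato iteration -/
lemma camp {r s D M B : ℝ} (hr : 0 < r) (hs : 0 < s) (hs2 : s ≤ 1 / 2) (hD : 0 ≤ D) (hM : 0 ≤ M) (hB : 0 ≤ B)
    {h : ℕ} (hh : 7 ≤ h) :
    ∃ C > 0, ∀ (F : ℂ → ℂ) (z0 : ℂ) (S : Set (ℂ × (ℂ →L[ℝ] ℂ))) (x0 : ℂ × (ℂ →L[ℝ] ℂ)),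
      (h = 10 ∨ ∀ x ∈ S, x.2 = 0) → ContinuousOn F (ball z0 r) → MemLp F 2 (volume.restrict (ball z0 r)) → x0 ∈ S →
      ‖x0.2‖ ≤ B → (∫ z in ball z0 r, ‖F z - (x0.1 + x0.2 (z - z0))‖ ^ 2 ≤ B) →
      (∀ k : ℕ, ∀ x ∈ S, ∃ x' ∈ S,
        ‖x'.1 - x.1‖ ^ 2 * (s ^ (4 * k)) ^ 2 ≤ D * ((∫ z in ball z0 (r * s ^ (4 * k)), ‖F z - (x.1 + x.2 (z - z0))‖ ^ 2) + s ^ (2 * h * k)) ∧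
        ‖x'.2 - x.2‖ ^ 2 * (s ^ (4 * k)) ^ 4 ≤ D * ((∫ z in ball z0 (r * s ^ (4 * k)), ‖F z - (x.1 + x.2 (z - z0))‖ ^ 2) + s ^ (2 * h * k)) ∧
        (∫ z in ball z0 (r * s ^ (4 * (k + 1))), ‖F z - (x'.1 + x'.2 (z - z0))‖ ^ 2) ≤
          s ^ (2 * h) / 2 * (∫ z in ball z0 (r * s ^ (4 * k)), ‖F z - (x.1 + x.2 (z - z0))‖ ^ 2) + M * s ^ (2 * h * k)) →
      ∃ A : ℂ →L[ℝ] ℂ, ‖A‖ ≤ C ∧ ((∀ x ∈ S, x.2 = 0) → A = 0) ∧ ∀ ρ, 0 < ρ → ρ ≤ r → (∫ z in ball z0 ρ, ‖F z - (F z0 + A (z - z0))‖ ^ 2) ^ 2 ≤ C * ρ ^ h := by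
  set B1 := B + 2 * M / s ^ (2 * h) with hB1
  set D1 := √(D * (B1 + 1)) with hD1
  have hB1' : 0 ≤ B1 := by positivity
  have hD1' : 0 ≤ D1 := by positivity
  set C1 := 2 * B1 + 8 * (2 * D1 + 2 * D1 * r) ^ 2 * r ^ 2 with hC1
  have hC1' : 0 ≤ C1 := by positivity
  set C2 := C1 ^ 2 / (r * s ^ 4) ^ h with hC2
  refine ⟨B + 2 * D1 + C2 + 1, by positivity, ?_⟩
  intro F z0 S x0 hh2 hF hF2 hx0 hxB hn0 step
  choose! st hstS hst1 hst2 hst3 using step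
  let x : ℕ → ℂ × (ℂ →L[ℝ] ℂ) := fun k => Nat.rec x0 (fun k y => st k y) k
  have hxs : ∀ k, x (k + 1) = st k (x k) := fun k => rfl
  have hxS : ∀ k, x k ∈ S := by
    intro k
    induction k with
    | zero => exact hx0
    | succ k ih => rw [hxs]; exact hstS k _ ih
  set n : ℕ → ℝ := fun k => ∫ z in ball z0 (r * s ^ (4 * k)), ‖F z - ((x k).1 + (x k).2 (z - z0))‖ ^ 2 with hn
  have hn1 : ∀ k, n k ≤ B1 * (s ^ (2 * h)) ^ k := by
    intro k
    have hnn0 : n 0 ≤ B := by simpa [hn, x] using hn0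
    have := rec_aux (a := n) (q := s ^ (2 * h)) (M := M) (by positivity) hM (fun k => by
      have := hst3 k (x k) (hxS k)
      rw [← hxs, pow_mul s (2 * h) k] at this
      exact this) (by simp only [hn]; positivity) k
    refine this.trans ?_
    rw [hB1]; gcongr
  have hsk : ∀ m k : ℕ, s ^ (m * k) ≤ 1 := fun m k => pow_le_one₀ hs.le (by linarith)
  have dif : ∀ k, D * (n k + s ^ (2 * h * k)) ≤ (D1 * (s ^ h) ^ k) ^ 2 := by
    intro k
    have := hn1 k
    rw [mul_pow, hD1, Real.sq_sqrt (by positivity)]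
    have e : ((s ^ h) ^ k) ^ 2 = s ^ (2 * h * k) := by rw [← pow_mul, ← pow_mul]; congr 1; ring
    rw [e, mul_assoc D]
    refine mul_le_mul_of_nonneg_left ?_ hD
    rw [← pow_mul] at this
    linarith
  have d1 : ∀ k, dist (x k).1 (x (k+1)).1 ≤ D1 * (s ^ (h - 4)) ^ k := by
    intro k
    have h1 := (hst1 k _ (hxS k)).trans (dif k)
    rw [← hxs, ← mul_pow] at h1
    have h2 := abs_le_of_sq_le_sq' h1 (by positivity)
    rw [dist_comm, dist_eq_norm]
    have e : (s ^ h) ^ k = (s ^ (h - 4)) ^ k * s ^ (4 * k) := by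
      rw [← pow_mul, ← pow_mul, ← pow_add]; congr 1
      obtain ⟨m, rfl⟩ := Nat.exists_eq_add_of_le hh
      have : 7 + m - 4 = 3 + m := by omega
      rw [this]; ring
    rw [e, ← mul_assoc] at h2
    exact le_of_mul_le_mul_right h2.2 (by positivity)
  have d2 : ∀ k, dist (x k).2 (x (k+1)).2 ≤ D1 * (s ^ 2) ^ k := by
    intro k
    rcases hh2 with h10 | h0
    · have h1 := (hst2 k _ (hxS k)).trans (dif k)
      have e0 : (s ^ (4 * k)) ^ 4 = ((s ^ (4 * k)) ^ 2) ^ 2 := by ring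
      rw [← hxs, e0, ← mul_pow] at h1
      have h2 := abs_le_of_sq_le_sq' h1 (by positivity)
      rw [dist_comm, dist_eq_norm]
      have e : (s ^ h) ^ k = (s ^ 2) ^ k * (s ^ (4 * k)) ^ 2 := by
        rw [h10, ← pow_mul, ← pow_mul, ← pow_mul, ← pow_add]; congr 1; ring
      rw [e, ← mul_assoc] at h2
      exact le_of_mul_le_mul_right h2.2 (by positivity)
    · rw [h0 _ (hxS k), h0 _ (hxS (k+1)), dist_self]; positivity
  have hq1 : s ^ (h - 4) ≤ 1 / 2 := by
    calc s ^ (h - 4) ≤ s ^ 1 := pow_le_pow_of_le_one hs.le (by linarith) (by omega)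
      _ ≤ 1 / 2 := by simpa using hs2
  have hq2 : s ^ 2 ≤ 1 / 2 := by nlinarith
  obtain ⟨c, hc⟩ := cauchySeq_tendsto_of_complete (cauchySeq_of_le_geometric _ D1 (by linarith : s ^ (h-4) < 1) d1)
  obtain ⟨A, hA⟩ := cauchySeq_tendsto_of_complete (cauchySeq_of_le_geometric _ D1 (by linarith : s ^ 2 < 1) d2)
  have l1 : ∀ k, ‖(x k).1 - c‖ ≤ 2 * D1 * (s ^ (h-4)) ^ k := by
    intro k
    rw [← dist_eq_norm]
    refine (dist_le_of_le_geometric_of_tendsto _ D1 (by linarith : s ^ (h-4) < 1) d1 hc k).trans ?_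
    rw [div_le_iff₀ (by linarith)]
    have : 0 ≤ D1 * (s ^ (h-4)) ^ k := by positivity
    nlinarith
  have l2 : ∀ k, ‖(x k).2 - A‖ ≤ 2 * D1 * (s ^ 2) ^ k := by
    intro k
    rw [← dist_eq_norm]
    refine (dist_le_of_le_geometric_of_tendsto _ D1 (by linarith : s ^ 2 < 1) d2 hA k).trans ?_
    rw [div_le_iff₀ (by linarith)]
    have : 0 ≤ D1 * (s ^ 2) ^ k := by positivity
    nlinarith
  have l2' : ∀ k, ‖(x k).2 - A‖ * s ^ (4 * k) ≤ 2 * D1 * (s ^ (h-4)) ^ k := by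
    intro k
    rcases hh2 with h10 | h0
    · have e : (s ^ (h-4)) ^ k = (s ^ 2) ^ k * s ^ (4 * k) := by
        rw [h10, ← pow_mul, ← pow_mul, ← pow_add]; congr 1; ring
      rw [e, ← mul_assoc]
      exact mul_le_mul_of_nonneg_right (l2 k) (by positivity)
    · have : A = 0 := tendsto_nhds_unique hA (by
        have : (fun k => (x k).2) = fun k => 0 := funext fun k => h0 _ (hxS k)
        rw [this]; exact tendsto_const_nhds)
      rw [this, h0 _ (hxS k)]; simp; positivity
  have hrk : ∀ k, r * s ^ (4 * k) ≤ r := fun k => mul_le_of_le_one_right hr.le (hsk 4 k)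
  have main : ∀ k, ∫ z in ball z0 (r * s ^ (4 * k)), ‖F z - (c + A (z - z0))‖ ^ 2 ≤ C1 * (s ^ (2 * h)) ^ k := by
    intro k
    have m1 : MemLp (fun z => F z - ((x k).1 + (x k).2 (z - z0))) 2 (volume.restrict (ball z0 (r * s ^ (4 * k)))) :=
      (hF2.mono_measure (Measure.restrict_mono (ball_subset_ball (hrk k)) le_rfl)).sub (memLp_cont_ball (by fun_prop) z0 _)
    have := sqInt_add (t := (2 * D1 + 2 * D1 * r) * (s ^ (h-4)) ^ k) (G := fun z => ((x k).1 - c) + ((x k).2 - A) (z - z0))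
      (by positivity) m1 (by fun_prop) (by positivity) (by
        intro z hz
        rw [mem_ball_iff_norm] at hz
        refine (norm_add_le _ _).trans ?_
        have h1 := l1 k
        have h2 : ‖((x k).2 - A) (z - z0)‖ ≤ 2 * D1 * r * (s ^ (h-4)) ^ k := by
          refine (ContinuousLinearMap.le_opNorm _ _).trans ?_
          calc ‖(x k).2 - A‖ * ‖z - z0‖ ≤ ‖(x k).2 - A‖ * (r * s ^ (4 * k)) := by gcongr
            _ = (‖(x k).2 - A‖ * s ^ (4 * k)) * r := by ring
            _ ≤ (2 * D1 * (s ^ (h-4)) ^ k) * r := mul_le_mul_of_nonneg_right (l2' k) hr.le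
            _ = _ := by ring
        linarith)
    have e : ∀ z, F z - ((x k).1 + (x k).2 (z - z0)) + (((x k).1 - c) + ((x k).2 - A) (z - z0)) = F z - (c + A (z - z0)) := by
      intro z; rw [sub_apply]; ring
    simp only [e] at this
    refine this.trans ?_
    have h1 := hn1 k
    simp only [hn] at h1
    have e2 : 8 * ((2 * D1 + 2 * D1 * r) * (s ^ (h-4)) ^ k) ^ 2 * (r * s ^ (4 * k)) ^ 2 =
      8 * (2 * D1 + 2 * D1 * r) ^ 2 * r ^ 2 * (s ^ (2 * h)) ^ k := by
      have : (s ^ (2 * h)) ^ k = ((s ^ (h-4)) ^ k) ^ 2 * (s ^ (4 * k)) ^ 2 := by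
        rw [← pow_mul, ← pow_mul, ← pow_mul, ← pow_mul, ← pow_add]; congr 1
        obtain ⟨m, rfl⟩ := Nat.exists_eq_add_of_le hh
        have : 7 + m - 4 = 3 + m := by omega
        rw [this]; ring
      rw [this]; ring
    rw [e2, hC1, add_mul]
    linarith
  have fin : ∀ ρ, 0 < ρ → ρ ≤ r → (∫ z in ball z0 ρ, ‖F z - (c + A (z - z0))‖ ^ 2) ^ 2 ≤ C2 * ρ ^ h := by
    intro ρ hρ hρr
    obtain ⟨k, hk1, hk2⟩ := exists_nat_pow_near_of_lt_one (x := ρ / r) (y := s ^ 4) (by positivity)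
      (by rw [div_le_one hr]; exact hρr) (by positivity) (pow_lt_one₀ hs.le (by linarith) (by norm_num))
    rw [lt_div_iff₀ hr] at hk1
    rw [div_le_iff₀ hr, ← pow_mul] at hk2
    have m1 : MemLp (fun z => F z - (c + A (z - z0))) 2 (volume.restrict (ball z0 (r * s ^ (4 * k)))) :=
      (hF2.mono_measure (Measure.restrict_mono (ball_subset_ball (hrk k)) le_rfl)).sub (memLp_cont_ball (by fun_prop) z0 _)
    have h1 : ∫ z in ball z0 ρ, ‖F z - (c + A (z - z0))‖ ^ 2 ≤ C1 * (s ^ (2 * h)) ^ k :=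
      (setIntegral_mono_set (memLp_sq m1) (Eventually.of_forall fun z => by positivity)
        (HasSubset.Subset.eventuallyLE (ball_subset_ball (by linarith)))).trans (main k)
    have h2 : (C1 * (s ^ (2 * h)) ^ k) ^ 2 ≤ C2 * ρ ^ h := by
      have e : (C1 * (s ^ (2 * h)) ^ k) ^ 2 = C2 * ((s ^ 4) ^ (k+1) * r) ^ h := by
        rw [hC2, div_mul_eq_mul_div, eq_div_iff (by positivity)]
        rw [mul_pow, mul_assoc]; congr 1
        rw [mul_pow, mul_pow]
        have : ((s ^ (2 * h)) ^ k) ^ 2 * (s ^ 4) ^ h = ((s ^ 4) ^ (k+1)) ^ h := by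
          simp only [← pow_mul, ← pow_add]; congr 1; ring
        rw [← this]; ring
      rw [e]; gcongr
    refine le_trans ?_ h2
    gcongr
  have hc0 : c = F z0 := by
    refine const_lim (A := A) (C := √(C2 * r ^ (h - 6))) (n := 3) hr hF hF2 le_rfl ?_
    intro ρ hρ hρr
    refine abs_le_of_sq_le_sq' ?_ (by positivity) |>.2
    refine (fin ρ hρ hρr).trans ?_
    rw [mul_pow, Real.sq_sqrt (by positivity), ← pow_mul]
    have : ρ ^ h = ρ ^ (h - 6) * ρ ^ (3 * 2) := by rw [← pow_add]; congr 1; omega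
    rw [this, ← mul_assoc]
    gcongr
  refine ⟨A, ?_, ?_, ?_⟩
  · have h1 := l2 0
    simp only [pow_zero, mul_one] at h1
    have h2 : ‖A‖ ≤ ‖(x 0).2‖ + ‖(x 0).2 - A‖ := by
      have := norm_sub_le (x 0).2 ((x 0).2 - A); simpa using this
    have : ‖(x 0).2‖ ≤ B := hxB
    have : 0 ≤ C2 := by positivity
    linarith
  · intro h0
    refine tendsto_nhds_unique hA ?_
    have : (fun k => (x k).2) = fun k => 0 := funext fun k => h0 _ (hxS k)
    rw [this]; exact tendsto_const_nhds
  · intro ρ hρ hρr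
    rw [← hc0]
    refine (fin ρ hρ hρr).trans ?_
    gcongr
    have : 0 ≤ C2 := by positivity
    linarith

lemma camp2 {F : ℂ → ℂ} {z0 z1 : ℂ} {A0 A1 : ℂ →L[ℝ] ℂ} {C r : ℝ} (hC : 0 ≤ C) {h : ℕ} (hh : 4 ≤ h)
    (hz : 2 * ‖z1 - z0‖ ≤ r)
    (hF : ContinuousOn F (ball z0 r)) (hF2 : MemLp F 2 (volume.restrict (ball z0 r)))
    (h0 : ∀ ρ, 0 < ρ → ρ ≤ r → (∫ z in ball z0 ρ, ‖F z - (F z0 + A0 (z - z0))‖ ^ 2) ^ 2 ≤ C * ρ ^ h)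
    (h1 : ∀ ρ, 0 < ρ → ρ ≤ r → (∫ z in ball z1 ρ, ‖F z - (F z1 + A1 (z - z1))‖ ^ 2) ^ 2 ≤ C * ρ ^ h) :
    ‖F z1 - F z0 - A0 (z1 - z0)‖ ^ 4 ≤ 16 * 2 ^ h * C * ‖z1 - z0‖ ^ (h - 4) := by
  rcases eq_or_ne z1 z0 with rfl | hne
  · simp; positivity
  have hd : 0 < ‖z1 - z0‖ := norm_pos_iff.2 (sub_ne_zero.2 hne)
  set d := ‖z1 - z0‖ with hdd
  have hs : ball z0 (2 * d) ⊆ ball z0 r := ball_subset_ball hz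
  have k0 := Real.le_sqrt_of_sq_le (h0 (2 * d) (by positivity) hz)
  have k1 := Real.le_sqrt_of_sq_le (h1 d (by positivity) (by linarith))
  have k2 : √(C * d ^ h) ≤ √(C * (2 * d) ^ h) := by
    apply Real.sqrt_le_sqrt; gcongr; linarith
  have := cmp_aux hd le_rfl (hF.mono hs) (hF2.mono_measure (Measure.restrict_mono hs le_rfl)) k0 (k1.trans k2)
  have e : F z0 + A0 (z1 - z0) - F z1 = -(F z1 - F z0 - A0 (z1 - z0)) := by ring
  rw [e, norm_neg] at this
  set N := ‖F z1 - F z0 - A0 (z1 - z0)‖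
  have h3 : (N ^ 2 * d ^ 2) ≤ 4 * √(C * (2 * d) ^ h) := by
    refine le_trans ?_ this
    have := Real.pi_gt_three
    have : 0 ≤ N ^ 2 * d ^ 2 := by positivity
    nlinarith
  have h4 : (N ^ 2 * d ^ 2) ^ 2 ≤ (4 * √(C * (2 * d) ^ h)) ^ 2 := by gcongr
  rw [mul_pow 4, Real.sq_sqrt (by positivity)] at h4
  have h5 : N ^ 4 * d ^ 4 ≤ (16 * 2 ^ h * C * d ^ (h - 4)) * d ^ 4 := by
    have : d ^ h = d ^ (h - 4) * d ^ 4 := by rw [← pow_add]; congr 1; omega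
    rw [mul_pow 2 d h, this] at h4
    linarith
  exact le_of_mul_le_mul_right h5 (by positivity)

end A7

section A8
open Complex MeasureTheory
open scoped ContDiff

lemma step1 : ∃ C : ℝ, 1 ≤ C ∧ ∀ (F : ℂ → ℂ) (E : ℂ → ℝ) (z0 : ℂ) (r : ℝ), 0 < r →
    MemLp F 2 (volume.restrict (ball z0 r)) →
    MemLp (fun z => (E z : ℂ)) 2 (volume.restrict (ball z0 r)) → Wk F E (ball z0 r) →
    ∀ (c α : ℂ) (κ e0 e2 n m : ℝ), (∫ z in ball z0 r, ‖F z - (c + α * (z - z0) + κ * ((z - z0).re : ℂ))‖ ^ 2) ≤ n →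
    (∫ z in ball z0 r, (E z - (e0 + e2 * (z - z0).im - κ * (z - z0).re)) ^ 2) ≤ m → 
    ∃ c' α' : ℂ, 
      ‖c'‖ ^ 2 * r ^ 2 ≤ C * (n + m) ∧ ‖α'‖ ^ 2 * r ^ 4 ≤ C * (n + m) ∧ 
      ∀ ρ, 0 < ρ → ρ ≤ r / 2 → ∫ z in ball z0 ρ, ‖F z - (c + α * (z - z0) + κ * ((z - z0).re : ℂ)) - (c' + α' * (z - z0))‖ ^ 2 ≤
        C * ((ρ / r) ^ 6 * n + m) := by
  obtain ⟨C, hC, H⟩ := decay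
  refine ⟨C + 1, by linarith, ?_⟩
  intro F E z0 r hr hF hE hW c α κ e0 e2 n m hn hm
  have mL := memLp_cont_ball (f := fun z => -c + (-α) * (z - z0) + ((-κ : ℝ) : ℂ) * ((z - z0).re : ℂ)) (by fun_prop) z0 r
  have mE := memLp_cont_ball (f := fun z => ((-e0 + (-e2) * (z - z0).im - (-κ) * (z - z0).re : ℝ) : ℂ)) (by fun_prop) z0 r
  have W := hW.add (Wk_aff (-c) (-α) (-κ) (-e0) (-e2) z0 (ball z0 r)) hF hE mL mE
  have e1 : ∀ z, F z + (-c + -α * (z - z0) + ((-κ : ℝ) : ℂ) * ((z - z0).re : ℂ)) = F z - (c + α * (z - z0) + κ * ((z - z0).re : ℂ)) := by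
    intro z; push_cast; ring
  have e2 : ∀ z, E z + (-e0 + -e2 * (z - z0).im - -κ * (z - z0).re) = E z - (e0 + e2 * (z - z0).im - κ * (z - z0).re) := by
    intro z; ring
  simp only [e1, e2] at W
  obtain ⟨c', α', h1, h2, h3⟩ := H _ _ z0 r hr (by simp only [← e1]; exact hF.add mL) (by 
    simp only [← e2]; push_cast [ofReal_add]; push_cast at mE; exact hE.add mE) W
  have n0 : 0 ≤ n := le_trans (integral_nonneg fun z => by positivity) hn
  have m0 : 0 ≤ m := le_trans (integral_nonneg fun z => by positivity) hm
  refine ⟨c', α', h1.trans ?_, h2.trans ?_, fun ρ hρ hρr => (h3 ρ hρ hρr).trans ?_⟩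
  · exact mul_le_mul (by linarith) (by linarith) (add_nonneg (integral_nonneg fun z => by positivity) (integral_nonneg fun z => by positivity)) (by linarith)
  · exact mul_le_mul (by linarith) (by linarith) (add_nonneg (integral_nonneg fun z => by positivity) (integral_nonneg fun z => by positivity)) (by linarith)
  · refine mul_le_mul (by linarith) ?_ (add_nonneg (mul_nonneg (by positivity) (integral_nonneg fun z => by positivity)) (integral_nonneg fun z => by positivity)) (by linarith)
    gcongr

/-- choice of a good point -/
lemma mbound {F : ℂ → ℂ} {E : ℂ → ℝ} {z0 c : ℂ} {r ε K : ℝ} (hr : 0 < r) (hε : 0 ≤ ε) (hK : 0 ≤ K)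
    (hF : MemLp F 2 (volume.restrict (ball z0 r)))
    (hE : MemLp (fun z => (E z : ℂ)) 2 (volume.restrict (ball z0 r)))
    (hH : ∀ z ∈ ball z0 r, ∀ z' ∈ ball z0 r, |E z - E z'| ≤ ε * ‖F z - F z'‖ + K * ‖z - z'‖) :
    ∃ e : ℝ, ∫ z in ball z0 r, (E z - e) ^ 2 ≤ 8 * ε ^ 2 * (∫ z in ball z0 r, ‖F z - c‖ ^ 2) + 32 * K ^ 2 * r ^ 4 := by
  have i0 := memLp_sq (hF.sub (memLp_const_ball c z0 r))
  have i0' : IntegrableOn (fun z => ‖F z - c‖ ^ 2) (ball z0 r) := i0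
  obtain ⟨z1, hz1, hz1'⟩ := exists_le_setAverage (μ := volume) (s := ball z0 r) (measure_ball_pos _ _ hr).ne' measure_ball_lt_top.ne i0'
  rw [setAverage_eq, vol_ball z0 hr.le, smul_eq_mul] at hz1'
  set n := ∫ z in ball z0 r, ‖F z - c‖ ^ 2 with hn
  refine ⟨E z1, ?_⟩
  have pw : ∀ z ∈ ball z0 r, (E z - E z1) ^ 2 ≤ 4 * ε ^ 2 * ‖F z - c‖ ^ 2 + (4 * ε ^ 2 * ‖F z1 - c‖ ^ 2 + 8 * K ^ 2 * r ^ 2) := by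
    intro z hz
    have h1 := hH z hz z1 hz1
    have h2 : ‖z - z1‖ ≤ 2 * r := by
      rw [mem_ball_iff_norm] at hz hz1
      have : z - z1 = (z - z0) - (z1 - z0) := by ring
      rw [this]; exact (norm_sub_le _ _).trans (by linarith)
    have h3 : ‖F z - F z1‖ ≤ ‖F z - c‖ + ‖F z1 - c‖ := by
      have : F z - F z1 = (F z - c) - (F z1 - c) := by ring
      rw [this]; exact norm_sub_le _ _
    have h4 : |E z - E z1| ≤ ε * (‖F z - c‖ + ‖F z1 - c‖) + K * (2 * r) := by
      refine h1.trans ?_; gcongr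
    have h5 : (E z - E z1) ^ 2 ≤ (ε * (‖F z - c‖ + ‖F z1 - c‖) + K * (2 * r)) ^ 2 := by
      rw [← sq_abs]; gcongr
    nlinarith [sq_nonneg (ε * (‖F z - c‖ + ‖F z1 - c‖) - K * (2 * r)), sq_nonneg (ε * (‖F z - c‖ - ‖F z1 - c‖))]
  have i1 := i0'.const_mul (4 * ε ^ 2)
  have i2 : IntegrableOn (fun _ : ℂ => 4 * ε ^ 2 * ‖F z1 - c‖ ^ 2 + 8 * K ^ 2 * r ^ 2) (ball z0 r) := integrableOn_const measure_ball_lt_top.ne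
  have iE : IntegrableOn (fun z => (E z - E z1) ^ 2) (ball z0 r) := by
    have := memLp_sq (hE.sub (memLp_const_ball (E z1 : ℂ) z0 r))
    refine this.congr (Eventually.of_forall fun z => ?_)
    simp only [Pi.sub_apply]
    rw [← ofReal_sub, norm_real, Real.norm_eq_abs, sq_abs]
  have := setIntegral_mono_on iE (i1.add i2) measurableSet_ball pw
  refine this.trans ?_
  rw [integral_add' i1 i2, integral_const_mul, setIntegral_const, vol_ball z0 hr.le, smul_eq_mul, ← hn]
  have hpi := Real.pi_lt_d2
  have hpr : 0 < Real.pi * r ^ 2 := by positivity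
  have h6 : (Real.pi * r ^ 2) * ‖F z1 - c‖ ^ 2 ≤ n := by
    have := mul_le_mul_of_nonneg_left hz1' hpr.le
    rwa [mul_inv_cancel_left₀ hpr.ne'] at this
  have h7 : (Real.pi * r ^ 2) * (8 * K ^ 2 * r ^ 2) ≤ (4 * r ^ 2) * (8 * K ^ 2 * r ^ 2) := by gcongr; linarith
  nlinarith [mul_le_mul_of_nonneg_left h6 (by positivity : 0 ≤ 4 * ε ^ 2)]

lemma R0 : ∃ ε : ℝ, 0 < ε ∧ ∀ (F : ℂ → ℂ) (E : ℂ → ℝ) (zs : ℂ) (R B K : ℝ), 0 < R → 0 ≤ K → 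
    ContinuousOn F (ball zs R) → ContinuousOn E (ball zs R) → (∀ z ∈ ball zs R, ‖F z‖ ≤ B) → (∀ z ∈ ball zs R, |E z| ≤ B) →
    Wk F E (ball zs R) →
    (∀ z ∈ ball zs R, ∀ z' ∈ ball zs R, |E z - E z'| ≤ ε * ‖F z - F z'‖ + K * ‖z - z'‖) →
    ∃ C, ∀ z ∈ ball zs (R / 8), ∀ z' ∈ ball zs (R / 8), ‖F z - F z'‖ ^ 4 ≤ C * ‖z - z'‖ ^ 3 := by
  obtain ⟨C, hC, H⟩ := step1
  set s : ℝ := 1 / (200 * C) with hs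
  have hs0 : 0 < s := by positivity
  have hsC : C * s = 1 / 200 := by rw [hs]; field_simp
  have hs1 : s ≤ 1 / 200 := by
    nlinarith
  set ε := s ^ 8 with hε
  have hε0 : 0 < ε := by positivity
  refine ⟨ε, hε0, ?_⟩
  intro F E zs R B K hR hK hF hE hFB hEB hW hH
  have hB : 0 ≤ B := (norm_nonneg _).trans (hFB zs (mem_ball_self hR))
  have hEm : ContinuousOn (fun z => (E z : ℂ)) (ball zs R) := continuous_ofReal.comp_continuousOn hE
  have hEB' : ∀ z ∈ ball zs R, ‖(E z : ℂ)‖ ≤ B := by intro z hz; rw [norm_real, Real.norm_eq_abs]; exact hEB z hz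
  set r := R / 2 with hrr
  have hr : 0 < r := by positivity
  obtain ⟨C', hC', cp⟩ := camp (r := r) (s := s) (D := C * (2 + 32 * K ^ 2 * r ^ 4) * (1 + 1 / r ^ 2)) (M := 20 * C * (32 * K ^ 2 * r ^ 4)) 
    (B := 4 * r ^ 2 * B ^ 2) (h := 7) hr hs0 (by linarith) (by positivity) (by positivity) (by positivity) le_rfl
  have key : ∀ z0 ∈ ball zs (R / 8), ∀ ρ, 0 < ρ → ρ ≤ r → (∫ z in ball z0 ρ, ‖F z - (F z0 + (0 : ℂ →L[ℝ] ℂ) (z - z0))‖ ^ 2) ^ 2 ≤ C' * ρ ^ 7 := by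
    intro z0 hz0
    have hsub : ball z0 r ⊆ ball zs R := by
      intro z hz
      rw [mem_ball] at *
      have := dist_triangle z z0 zs
      linarith
    have hFr := memLp_bdd (hF.mono hsub) (fun z hz => hFB z (hsub hz))
    have hEr := memLp_bdd (hEm.mono hsub) (fun z hz => hEB' z (hsub hz))
    obtain ⟨A, -, hA0, hA⟩ := cp F z0 {x | x.2 = 0} 0 (Or.inr fun x hx => hx) (hF.mono hsub) hFr rfl (by simp; positivity) (by
      have : ∫ z in ball z0 r, ‖F z‖ ^ 2 ≤ ∫ z in ball z0 r, B ^ 2 := by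
        refine setIntegral_mono_on (memLp_sq hFr) (integrableOn_const measure_ball_lt_top.ne) measurableSet_ball ?_
        intro z hz
        have := hFB z (hsub hz)
        gcongr
      rw [setIntegral_const, vol_ball z0 hr.le, smul_eq_mul] at this
      simp only [Prod.fst_zero, Prod.snd_zero, ContinuousLinearMap.zero_apply, add_zero, sub_zero]
      refine this.trans ?_
      have := Real.pi_lt_d2
      gcongr; linarith) (by
      rintro k ⟨c, A⟩ (rfl : A = 0)
      simp only [ContinuousLinearMap.zero_apply, add_zero]
      have hsk : s ^ (4 * k) ≤ 1 := pow_le_one₀ hs0.le (by linarith)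
      set t := s ^ (4 * k) with ht
      have ht0 : 0 < t := by positivity
      have hrt : r * t ≤ r := mul_le_of_le_one_right hr.le hsk
      have hsub2 : ball z0 (r * t) ⊆ ball z0 r := ball_subset_ball hrt
      have mF := hFr.mono_measure (Measure.restrict_mono hsub2 (le_refl (volume : Measure ℂ)))
      have mE := hEr.mono_measure (Measure.restrict_mono hsub2 (le_refl (volume : Measure ℂ)))
      set n := ∫ z in ball z0 (r * t), ‖F z - c‖ ^ 2 with hn
      have hn0 : 0 ≤ n := integral_nonneg fun z => by positivity
      obtain ⟨e, he⟩ := mbound (c := c) (by positivity : 0 < r * t) hε0.le hK mF mE 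
        (fun z hz z' hz' => hH z (hsub (hsub2 hz)) z' (hsub (hsub2 hz')))
      set m := 8 * ε ^ 2 * n + 32 * K ^ 2 * (r * t) ^ 4 with hm
      obtain ⟨c', α', h1, h2, h3⟩ := H F E z0 (r * t) (by positivity) mF mE (hW.mono (hsub2.trans hsub)) c 0 0 e 0 n m
        (by simp [hn]) (by simpa using he)
      have htk : t ^ 4 ≤ s ^ (2 * 7 * k) := by
        rw [ht, ← pow_mul]; exact pow_le_pow_of_le_one hs0.le (by linarith) (by omega)
      set w := s ^ (2 * 7 * k) with hw
      have hw0 : 0 < w := by positivity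
      have hmb : m ≤ 8 * ε ^ 2 * n + 32 * K ^ 2 * r ^ 4 * w := by
        rw [hm, mul_pow, ← mul_assoc]; gcongr
      have hε2 : ε ^ 2 ≤ 1 / 100 := by
        rw [hε, ← pow_mul]
        calc s ^ (8 * 2) ≤ s ^ 1 := pow_le_pow_of_le_one hs0.le (by linarith) (by norm_num)
          _ ≤ 1 / 100 := by rw [pow_one]; linarith
      have hnm : n + m ≤ (2 + 32 * K ^ 2 * r ^ 4) * (n + w) := by
        have h0 : 0 ≤ 32 * K ^ 2 * r ^ 4 := by positivity
        nlinarith [mul_nonneg h0 hn0, mul_le_mul_of_nonneg_right hε2 hn0]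
      refine ⟨(c + c', 0), rfl, ?_, ?_, ?_⟩
      · simp only [add_sub_cancel_left]
        have h5 : (‖c'‖ ^ 2 * t ^ 2) * r ^ 2 ≤ C * ((2 + 32 * K ^ 2 * r ^ 4) * (n + w)) := by
          calc (‖c'‖ ^ 2 * t ^ 2) * r ^ 2 = ‖c'‖ ^ 2 * (r * t) ^ 2 := by ring
            _ ≤ C * (n + m) := h1
            _ ≤ _ := by gcongr
        have h6 : ‖c'‖ ^ 2 * t ^ 2 ≤ C * ((2 + 32 * K ^ 2 * r ^ 4) * (n + w)) * (1 / r ^ 2) := by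
          rw [mul_one_div, le_div_iff₀ (by positivity)]; exact h5
        refine h6.trans ?_
        have : 0 ≤ C * (2 + 32 * K ^ 2 * r ^ 4) * (n + w) := by positivity
        linarith
      · simp only [sub_self, norm_zero]
        have : 0 ≤ C * (2 + 32 * K ^ 2 * r ^ 4) * (1 + 1 / r ^ 2) * (n + w) := by positivity
        simpa using this
      · simp only [ContinuousLinearMap.zero_apply, add_zero]
        have e1 : r * s ^ (4 * (k + 1)) = r * t * s ^ 4 := by rw [ht]; ring
        rw [e1]
        set ρ := r * t * s ^ 4 with hρ
        have hs4 : s ^ 4 ≤ 1 / 2 := by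
          calc s ^ 4 ≤ s ^ 1 := pow_le_pow_of_le_one hs0.le (by linarith) (by norm_num)
            _ ≤ 1 / 2 := by rw [pow_one]; linarith
        have hρ0 : 0 < ρ := by positivity
        have hρ1 : ρ ≤ r * t / 2 := by rw [hρ, div_eq_mul_one_div]; gcongr
        have h4 := h3 ρ hρ0 hρ1
        have e2 : ρ / (r * t) = s ^ 4 := by rw [hρ]; field_simp
        rw [e2] at h4
        simp only [zero_mul, add_zero, ofReal_zero] at h4
        have mF' : MemLp (fun z => F z - c - (c' + α' * (z - z0))) 2 (volume.restrict (ball z0 ρ)) := by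
          refine ((mF.mono_measure (Measure.restrict_mono (ball_subset_ball (by linarith [mul_pos hr ht0])) le_rfl)).sub (memLp_const_ball _ _ _)).sub
            (memLp_cont_ball (by fun_prop) _ _)
        have h5 := sqInt_add (t := ‖α'‖ * ρ) (G := fun z => α' * (z - z0)) hρ0.le mF' (by fun_prop) (by positivity) (by
          intro z hz
          rw [norm_mul]
          rw [mem_ball_iff_norm] at hz
          gcongr)
        have e3 : ∀ z, F z - c - (c' + α' * (z - z0)) + α' * (z - z0) = F z - (c + c') := by intro z; ring
        simp only [e3] at h5
        refine h5.trans ?_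
        have h6 : (‖α'‖ * ρ) ^ 2 * ρ ^ 2 ≤ s ^ 16 * (C * (n + m)) := by
          calc (‖α'‖ * ρ) ^ 2 * ρ ^ 2 = s ^ 16 * (‖α'‖ ^ 2 * (r * t) ^ 4) := by rw [hρ]; ring
            _ ≤ _ := by gcongr
        have hm0 : 0 ≤ m := by positivity
        have h7 : (s ^ 4) ^ 6 ≤ s ^ 16 := by
          rw [← pow_mul]; exact pow_le_pow_of_le_one hs0.le (by linarith) (by norm_num)
        have h7' : (s ^ 4) ^ 6 * n ≤ s ^ 16 * n := by gcongr
        have h8 : s ^ 16 ≤ 1 := pow_le_one₀ hs0.le (by linarith)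
        have h9 : s ^ 16 * (C * (n + m)) ≤ C * (s ^ 16 * n + m) := by
          have : s ^ 16 * (C * m) ≤ 1 * (C * m) := by gcongr
          linarith
        have h10 : C * ((s ^ 4) ^ 6 * n + m) ≤ C * (s ^ 16 * n + m) := by gcongr
        have h11 : 2 * (∫ z in ball z0 ρ, ‖F z - c - (c' + α' * (z - z0))‖ ^ 2) + 8 * (‖α'‖ * ρ) ^ 2 * ρ ^ 2 ≤ 10 * (C * (s ^ 16 * n + m)) := by
          linarith
        refine h11.trans ?_
        have h12 : ε ^ 2 = s ^ 16 := by rw [hε]; ring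
        rw [h12] at hmb
        have h13 : 10 * (C * (s ^ 16 * n + m)) ≤ 90 * (C * s) * (s ^ 15 * n) + 10 * C * (32 * K ^ 2 * r ^ 4 * w) := by
          have := mul_le_mul_of_nonneg_left hmb (by positivity : 0 ≤ 10 * C)
          linarith
        rw [hsC] at h13
        have h14 : s ^ 15 * n ≤ s ^ 14 * n := by
          refine mul_le_mul_of_nonneg_right ?_ hn0
          exact pow_le_pow_of_le_one hs0.le (by linarith) (by norm_num)
        have h15 : 0 ≤ C * (32 * K ^ 2 * r ^ 4) * w := by positivity
        have h16 : 0 ≤ s ^ 14 * n := by positivity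
        norm_num
        linarith)
    rw [hA0 fun x hx => hx] at hA
    exact hA
  refine ⟨16 * 2 ^ 7 * C', ?_⟩
  intro z1 hz1 z0 hz0
  have hd : 2 * ‖z1 - z0‖ ≤ r := by
    rw [mem_ball_iff_norm] at hz1 hz0
    have : z1 - z0 = (z1 - zs) - (z0 - zs) := by ring
    rw [this]
    have := norm_sub_le (z1 - zs) (z0 - zs)
    linarith
  have hsub : ball z0 r ⊆ ball zs R := by
    intro z hz
    rw [mem_ball] at *
    have := dist_triangle z z0 zs
    linarith
  have := camp2 hC'.le (by norm_num) hd (hF.mono hsub) (memLp_bdd (hF.mono hsub) (fun z hz => hFB z (hsub hz))) (key z0 hz0) (key z1 hz1)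
  simpa using this

end A8

section A9
open Complex MeasureTheory
open scoped ContDiff

def affL (α : ℂ) (κ : ℝ) : ℂ →L[ℝ] ℂ := α • ContinuousLinearMap.id ℝ ℂ + (κ : ℂ) • (ofRealCLM.comp reCLM)

lemma affL_apply (α : ℂ) (κ : ℝ) (h : ℂ) : affL α κ h = α * h + κ * (h.re : ℂ) := by simp [affL]

lemma affL_norm (α : ℂ) (κ : ℝ) : ‖affL α κ‖ ≤ ‖α‖ + |κ| := by
  refine ContinuousLinearMap.opNorm_le_bound _ (by positivity) fun h => ?_
  rw [affL_apply]
  refine (norm_add_le _ _).trans ?_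
  rw [norm_mul, norm_mul, norm_real, norm_real, Real.norm_eq_abs, Real.norm_eq_abs]
  have := abs_re_le_norm h
  have : |κ| * |h.re| ≤ |κ| * ‖h‖ := by gcongr
  linarith

lemma affL_add (α α' : ℂ) (κ κ' : ℝ) : affL (α + α') (κ + κ') = affL α κ + affL α' κ' := by
  ext h <;> simp [affL] <;> ring

set_option maxHeartbeats 1000000 in
lemma R1 : ∃ ε : ℝ, 0 < ε ∧ ∀ (F : ℂ → ℂ) (E : ℂ → ℝ) (zs : ℂ) (R B K : ℝ), 0 < R → 0 ≤ K → 
    ContinuousOn F (ball zs R) → ContinuousOn E (ball zs R) → (∀ z ∈ ball zs R, ‖F z‖ ≤ B) → (∀ z ∈ ball zs R, |E z| ≤ B) →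
    Wk F E (ball zs R) →
    (∀ z0 ∈ ball zs (R / 8), ∃ a l1 l2 e0 : ℝ, |a| ≤ ε ∧ |l1| ≤ B ∧ ∀ z ∈ ball zs R, 
      (E z - (e0 + l1 * (z - z0).re + l2 * (z - z0).im + a * (F z).re)) ^ 2 ≤ K * ‖z - z0‖ ^ 3) →
    ∃ C > 0, ∃ A : ℂ → (ℂ →L[ℝ] ℂ), (∀ z0 ∈ ball zs (R / 8), ‖A z0‖ ≤ C) ∧ ∀ z0 ∈ ball zs (R / 8), ∀ z1 ∈ ball zs (R / 8),
      ‖F z1 - F z0 - A z0 (z1 - z0)‖ ^ 2 ≤ C * ‖z1 - z0‖ ^ 3 := by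
  obtain ⟨C, hC, H⟩ := step1
  set s : ℝ := 1 / (200 * C) with hs
  have hs0 : 0 < s := by positivity
  have hsC : C * s = 1 / 200 := by rw [hs]; field_simp
  have hs1 : s ≤ 1 / 200 := by
    nlinarith
  set ε := s ^ 12 with hε
  have hε0 : 0 < ε := by positivity
  have hεle : ε ≤ 1 / 200 := by
    rw [hε]
    calc s ^ 12 ≤ s ^ 1 := pow_le_pow_of_le_one hs0.le (by linarith) (by norm_num)
      _ ≤ _ := by rw [pow_one]; linarith
  refine ⟨ε, hε0, ?_⟩
  intro F E zs R B K hR hK hF hE hFB hEB hW hH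
  have hB : 0 ≤ B := (norm_nonneg _).trans (hFB zs (mem_ball_self hR))
  have hEm : ContinuousOn (fun z => (E z : ℂ)) (ball zs R) := continuous_ofReal.comp_continuousOn hE
  have hEB' : ∀ z ∈ ball zs R, ‖(E z : ℂ)‖ ≤ B := by intro z hz; rw [norm_real, Real.norm_eq_abs]; exact hEB z hz
  set r := R / 2 with hrr
  have hr : 0 < r := by positivity
  obtain ⟨C', hC', cp⟩ := camp (r := r) (s := s) (D := C * (2 + 8 * K * r ^ 5) * (1 + 1 / r ^ 2 + 4 / r ^ 4)) (M := 20 * C * (8 * K * r ^ 5)) 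
    (B := 4 * r ^ 2 * (B + 2 * B * r) ^ 2 + 2 * B) (h := 10) hr hs0 (by linarith) (by positivity) (by positivity) (by positivity) (by norm_num)
  have key : ∀ z0 ∈ ball zs (R / 8), ∃ A : ℂ →L[ℝ] ℂ, ‖A‖ ≤ C' ∧ ∀ ρ, 0 < ρ → ρ ≤ r → (∫ z in ball z0 ρ, ‖F z - (F z0 + A (z - z0))‖ ^ 2) ^ 2 ≤ C' * ρ ^ 10 := by
    intro z0 hz0
    obtain ⟨a, l1, l2, e0, ha, hl1, hEe⟩ := hH z0 hz0
    have hsub : ball z0 r ⊆ ball zs R := by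
      intro z hz
      rw [mem_ball] at *
      have := dist_triangle z z0 zs
      linarith
    have hFr := memLp_bdd (hF.mono hsub) (fun z hz => hFB z (hsub hz))
    have hEr := memLp_bdd (hEm.mono hsub) (fun z hz => hEB' z (hsub hz))
    have ha2 := abs_le.1 ha
    have h1a : 1 / 2 ≤ 1 + a := by linarith
    have hκb : |-l1 / (1 + a)| ≤ 2 * B := by
      rw [abs_div, abs_neg, abs_of_pos (by linarith : 0 < 1 + a), div_le_iff₀ (by linarith)]
      nlinarith
    have hA0 := affL_norm 0 (-l1 / (1 + a))
    rw [norm_zero, zero_add] at hA0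
    obtain ⟨A, hA1, -, hA⟩ := cp F z0 {x | ∃ α : ℂ, ∃ κ : ℝ, x.2 = affL α κ ∧ κ * (1 + a) = - l1 - a * α.re}
      (0, affL 0 (-l1 / (1 + a))) (Or.inl rfl) (hF.mono hsub) hFr
      ⟨0, -l1 / (1 + a), rfl, by rw [div_mul_cancel₀ _ (by linarith)]; simp⟩ (by
        have : 0 ≤ 4 * r ^ 2 * (B + 2 * B * r) ^ 2 := by positivity
        simp only; linarith) (by
      have m1 : MemLp (fun z => F z - (0 + affL 0 (-l1 / (1 + a)) (z - z0))) 2 (volume.restrict (ball z0 r)) := 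
        hFr.sub (memLp_cont_ball (by fun_prop) _ _)
      have : ∫ z in ball z0 r, ‖F z - (0 + affL 0 (-l1 / (1 + a)) (z - z0))‖ ^ 2 ≤ ∫ z in ball z0 r, (B + 2 * B * r) ^ 2 := by
        refine setIntegral_mono_on (memLp_sq m1) (integrableOn_const measure_ball_lt_top.ne) measurableSet_ball ?_
        intro z hz
        have h1 := hFB z (hsub hz)
        have h2 : ‖affL 0 (-l1 / (1 + a)) (z - z0)‖ ≤ 2 * B * r := by
          refine (ContinuousLinearMap.le_opNorm _ _).trans ?_
          rw [mem_ball_iff_norm] at hz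
          gcongr
          linarith
        have h3 := norm_sub_le (F z) (0 + affL 0 (-l1 / (1 + a)) (z - z0))
        rw [zero_add] at h3 ⊢
        gcongr
        linarith
      rw [setIntegral_const, vol_ball z0 hr.le, smul_eq_mul] at this
      refine this.trans ?_
      have := Real.pi_lt_d2
      have h0 : Real.pi * r ^ 2 * (B + 2 * B * r) ^ 2 ≤ 4 * r ^ 2 * (B + 2 * B * r) ^ 2 := by
        gcongr; linarith
      linarith) (by
      rintro k ⟨c, A⟩ ⟨α, κ, (rfl : A = _), hκ⟩
      simp only [affL_apply]
      have hsk : s ^ (4 * k) ≤ 1 := pow_le_one₀ hs0.le (by linarith)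
      have htk : (s ^ (4 * k)) ^ 5 = s ^ (2 * 10 * k) := by
        rw [← pow_mul]; congr 1; ring
      set t := s ^ (4 * k) with ht
      have ht0 : 0 < t := by positivity
      have hrt : r * t ≤ r := mul_le_of_le_one_right hr.le hsk
      have hsub2 : ball z0 (r * t) ⊆ ball z0 r := ball_subset_ball hrt
      have mF := hFr.mono_measure (Measure.restrict_mono hsub2 (le_refl (volume : Measure ℂ)))
      have mE := hEr.mono_measure (Measure.restrict_mono hsub2 (le_refl (volume : Measure ℂ)))
      set w := s ^ (2 * 10 * k) with hw
      have hw0 : 0 < w := by positivity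
      have mFL : MemLp (fun z => F z - (c + (α * (z - z0) + κ * ((z - z0).re : ℂ)))) 2 (volume.restrict (ball z0 (r * t))) :=
        mF.sub (memLp_cont_ball (by fun_prop) _ _)
      set n := ∫ z in ball z0 (r * t), ‖F z - (c + (α * (z - z0) + κ * ((z - z0).re : ℂ)))‖ ^ 2 with hn
      have hn0 : 0 ≤ n := integral_nonneg fun z => by positivity
      set m := 2 * ε ^ 2 * n + 8 * K * r ^ 5 * w with hm
      have hmI : ∫ z in ball z0 (r * t), (E z - ((e0 + a * c.re) + (l2 - a * α.im) * (z - z0).im - κ * (z - z0).re)) ^ 2 ≤ m := by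
        have i0 := (memLp_sq mFL).const_mul (2 * ε ^ 2)
        have i1 : IntegrableOn (fun _ : ℂ => 2 * K * (r * t) ^ 3) (ball z0 (r * t)) := integrableOn_const measure_ball_lt_top.ne
        have iE : IntegrableOn (fun z => (E z - ((e0 + a * c.re) + (l2 - a * α.im) * (z - z0).im - κ * (z - z0).re)) ^ 2) (ball z0 (r * t)) := by
          have := memLp_sq (mE.sub (memLp_cont_ball (f := fun z => (((e0 + a * c.re) + (l2 - a * α.im) * (z - z0).im - κ * (z - z0).re : ℝ) : ℂ)) (by fun_prop) z0 (r * t)))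
          refine this.congr (Eventually.of_forall fun z => ?_)
          simp only [Pi.sub_apply]
          rw [← ofReal_sub, norm_real, Real.norm_eq_abs, sq_abs]
        have := setIntegral_mono_on iE (i0.add i1) measurableSet_ball (by
          intro z hz
          have h1 := hEe z (hsub (hsub2 hz))
          rw [mem_ball_iff_norm] at hz
          have h2 : K * ‖z - z0‖ ^ 3 ≤ K * (r * t) ^ 3 := by gcongr
          set e1 := E z - (e0 + l1 * (z - z0).re + l2 * (z - z0).im + a * (F z).re)
          set e2 := (F z - (c + (α * (z - z0) + κ * ((z - z0).re : ℂ)))).re with he2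
          have h3 : E z - ((e0 + a * c.re) + (l2 - a * α.im) * (z - z0).im - κ * (z - z0).re) = e1 + a * e2 := by
            have : κ * (z - z0).re = (- l1 - a * α.re - a * κ) * (z - z0).re := by rw [← hκ]; ring
            rw [this, he2, sub_re (F z), add_re c, add_re (α * (z - z0)), mul_re, mul_re]
            simp only [ofReal_re, ofReal_im]
            ring
          have h4 : e2 ^ 2 ≤ ‖F z - (c + (α * (z - z0) + κ * ((z - z0).re : ℂ)))‖ ^ 2 := by
            rw [he2, ← sq_abs]
            have := abs_re_le_norm (F z - (c + (α * (z - z0) + κ * ((z - z0).re : ℂ))))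
            gcongr
          have h5 : a ^ 2 ≤ ε ^ 2 := by rw [← sq_abs]; gcongr
          rw [h3]
          simp only [Pi.add_apply]
          have h6 : a ^ 2 * e2 ^ 2 ≤ ε ^ 2 * ‖F z - (c + (α * (z - z0) + κ * ((z - z0).re : ℂ)))‖ ^ 2 := by gcongr
          nlinarith [sq_nonneg (e1 - a * e2)])
        rw [integral_add' i0 i1, integral_const_mul, setIntegral_const, vol_ball z0 (by positivity), smul_eq_mul, ← hn] at this
        refine this.trans ?_
        have hpi := Real.pi_lt_d2
        have h7 : Real.pi * (r * t) ^ 2 * (2 * K * (r * t) ^ 3) ≤ 4 * (r * t) ^ 2 * (2 * K * (r * t) ^ 3) := by gcongr; linarith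
        have h8 : 4 * (r * t) ^ 2 * (2 * K * (r * t) ^ 3) = 8 * K * r ^ 5 * t ^ 5 := by ring
        rw [hm, ← htk, ← h8]
        linarith
      obtain ⟨c', α', h1, h2, h3⟩ := H F E z0 (r * t) (by positivity) mF mE (hW.mono (hsub2.trans hsub)) c α κ (e0 + a * c.re) (l2 - a * α.im) n m
        (by simp only [add_assoc]; exact hn.ge) hmI
      have hm0 : 0 ≤ m := by positivity
      have hε2 : ε ^ 2 ≤ 1 / 100 := by nlinarith
      have hnm : n + m ≤ (2 + 8 * K * r ^ 5) * (n + w) := by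
        have h0 : 0 ≤ 8 * K * r ^ 5 := by positivity
        nlinarith [mul_nonneg h0 hn0, mul_le_mul_of_nonneg_right hε2 hn0]
      set κ' := - a * α'.re / (1 + a) with hκ'
      have hκ'b : |κ'| ≤ 2 * ε * ‖α'‖ := by
        rw [hκ', abs_div, abs_mul, abs_neg, abs_of_pos (by linarith : 0 < 1 + a), div_le_iff₀ (by linarith)]
        have h0 : |a| * |α'.re| ≤ ε * ‖α'‖ := mul_le_mul ha (abs_re_le_norm α') (abs_nonneg _) hε0.le
        have : 0 ≤ ε * ‖α'‖ := by positivity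
        nlinarith
      have hκ'1 : |κ'| ≤ ‖α'‖ := hκ'b.trans (by nlinarith [norm_nonneg α'])
      refine ⟨(c + c', affL (α + α') (κ + κ')), ⟨_, _, rfl, ?_⟩, ?_, ?_, ?_⟩
      · rw [add_mul, hκ, hκ', div_mul_cancel₀ _ (by linarith), add_re]; ring
      · simp only [add_sub_cancel_left]
        have h5 : (‖c'‖ ^ 2 * t ^ 2) * r ^ 2 ≤ C * ((2 + 8 * K * r ^ 5) * (n + w)) := by
          calc (‖c'‖ ^ 2 * t ^ 2) * r ^ 2 = ‖c'‖ ^ 2 * (r * t) ^ 2 := by ring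
            _ ≤ C * (n + m) := h1
            _ ≤ _ := by gcongr
        have h6 : ‖c'‖ ^ 2 * t ^ 2 ≤ C * ((2 + 8 * K * r ^ 5) * (n + w)) * (1 / r ^ 2) := by
          rw [mul_one_div, le_div_iff₀ (by positivity)]; exact h5
        refine h6.trans ?_
        have : 0 ≤ C * (2 + 8 * K * r ^ 5) * (n + w) := by positivity
        have : 0 ≤ C * (2 + 8 * K * r ^ 5) * (n + w) * (4 / r ^ 4) := by positivity
        linarith
      · have e : affL (α + α') (κ + κ') - affL α κ = affL α' κ' := by rw [affL_add]; simp
        simp only [e]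
        have h4 : ‖affL α' κ'‖ ≤ 2 * ‖α'‖ := (affL_norm _ _).trans (by linarith)
        have h5 : (‖affL α' κ'‖ ^ 2 * t ^ 4) * r ^ 4 ≤ 4 * (C * ((2 + 8 * K * r ^ 5) * (n + w))) := by
          calc (‖affL α' κ'‖ ^ 2 * t ^ 4) * r ^ 4 ≤ ((2 * ‖α'‖) ^ 2 * t ^ 4) * r ^ 4 := by gcongr
            _ = 4 * (‖α'‖ ^ 2 * (r * t) ^ 4) := by ring
            _ ≤ 4 * (C * (n + m)) := by gcongr
            _ ≤ _ := by gcongr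
        have h6 : ‖affL α' κ'‖ ^ 2 * t ^ 4 ≤ (C * ((2 + 8 * K * r ^ 5) * (n + w))) * (4 / r ^ 4) := by
          rw [mul_div_assoc', le_div_iff₀ (by positivity)]; linarith
        refine h6.trans ?_
        have : 0 ≤ C * (2 + 8 * K * r ^ 5) * (n + w) := by positivity
        have : 0 ≤ C * (2 + 8 * K * r ^ 5) * (n + w) * (1 / r ^ 2) := by positivity
        linarith
      · have e1 : r * s ^ (4 * (k + 1)) = r * t * s ^ 4 := by rw [ht]; ring
        rw [e1]
        set ρ := r * t * s ^ 4 with hρ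
        have hs4 : s ^ 4 ≤ 1 / 2 := by
          calc s ^ 4 ≤ s ^ 1 := pow_le_pow_of_le_one hs0.le (by linarith) (by norm_num)
            _ ≤ 1 / 2 := by rw [pow_one]; linarith
        have hρ0 : 0 < ρ := by positivity
        have hρ1 : ρ ≤ r * t / 2 := by rw [hρ, div_eq_mul_one_div]; gcongr
        have h4 := h3 ρ hρ0 hρ1
        have e2 : ρ / (r * t) = s ^ 4 := by rw [hρ]; field_simp
        rw [e2] at h4
        have mF' : MemLp (fun z => F z - (c + α * (z - z0) + κ * ((z - z0).re : ℂ)) - (c' + α' * (z - z0))) 2 (volume.restrict (ball z0 ρ)) := by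
          refine ((mF.mono_measure (Measure.restrict_mono (ball_subset_ball (by linarith [mul_pos hr ht0])) le_rfl)).sub (memLp_cont_ball (by fun_prop) _ _)).sub
            (memLp_cont_ball (by fun_prop) _ _)
        have h5 := sqInt_add (t := |κ'| * ρ) (G := fun z => -(κ' * ((z - z0).re : ℂ))) hρ0.le mF' (by fun_prop) (by positivity) (by
          intro z hz
          rw [norm_neg, norm_mul, norm_real, norm_real, Real.norm_eq_abs, Real.norm_eq_abs]
          rw [mem_ball_iff_norm] at hz
          have := abs_re_le_norm (z - z0)
          gcongr
          linarith)
        have e3 : ∀ z, F z - (c + α * (z - z0) + κ * ((z - z0).re : ℂ)) - (c' + α' * (z - z0)) + -(κ' * ((z - z0).re : ℂ)) = 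
          F z - (c + c' + ((α + α') * (z - z0) + ((κ + κ' : ℝ) : ℂ) * ((z - z0).re : ℂ))) := by intro z; push_cast; ring
        simp only [e3] at h5
        refine h5.trans ?_
        have hs16 : s ^ 16 ≤ 1 := pow_le_one₀ hs0.le (by linarith)
        have h6 : (|κ'| * ρ) ^ 2 * ρ ^ 2 ≤ 4 * ε ^ 2 * (C * (n + m)) := by
          calc (|κ'| * ρ) ^ 2 * ρ ^ 2 ≤ (2 * ε * ‖α'‖ * ρ) ^ 2 * ρ ^ 2 := by gcongr
            _ = s ^ 16 * (4 * ε ^ 2 * (‖α'‖ ^ 2 * (r * t) ^ 4)) := by rw [hρ]; ring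
            _ ≤ 1 * (4 * ε ^ 2 * (C * (n + m))) := by gcongr
            _ = _ := by ring
        have h12 : ε ^ 2 = s ^ 24 := by rw [hε]; ring
        have h7 : (s ^ 4) ^ 6 = s ^ 24 := by ring
        rw [h7] at h4
        rw [h12] at h6 hε2 
        have h9 : s ^ 24 * (C * (n + m)) ≤ C * (s ^ 24 * n + m) := by
          have : s ^ 24 * (C * m) ≤ 1 * (C * m) := by gcongr; linarith
          linarith
        have h11 : 2 * (C * (s ^ 24 * n + m)) + 8 * (4 * s ^ 24 * (C * (n + m))) ≤ 34 * (C * s ^ 24 * n) + 3 * (C * m) := by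
          have : s ^ 24 * (C * m) ≤ (1/100) * (C * m) := by gcongr
          have hcm := mul_nonneg (by linarith : 0 ≤ C) hm0
          linarith
        have h13 : C * m = 2 * (C * s ^ 24 * n) + C * (8 * K * r ^ 5) * w := by rw [hm, h12]; ring
        have h14 : C * s ^ 24 * n ≤ (1 / 200) * (s ^ 20 * n) := by
          calc C * s ^ 24 * n = (C * s) * (s ^ 23 * n) := by ring
            _ ≤ (1/200) * (s ^ 20 * n) := by
              rw [hsC]
              have : s ^ 23 ≤ s ^ 20 := pow_le_pow_of_le_one hs0.le (by linarith) (by norm_num)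
              gcongr
        have h15 : 0 ≤ C * (8 * K * r ^ 5) * w := by positivity
        have h16 : 0 ≤ s ^ 20 * n := by positivity
        rw [show s ^ (2 * 10) = s ^ 20 from rfl]
        linarith)
    exact ⟨A, hA1, hA⟩
  choose! A hA1 hA2 using key
  refine ⟨C' + √(16 * 2 ^ 10 * C'), by positivity, A, fun z0 hz0 => (hA1 z0 hz0).trans (by have := Real.sqrt_nonneg (16 * 2 ^ 10 * C'); linarith), ?_⟩
  intro z0 hz0 z1 hz1
  have hd : 2 * ‖z1 - z0‖ ≤ r := by
    rw [mem_ball_iff_norm] at hz1 hz0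
    have : z1 - z0 = (z1 - zs) - (z0 - zs) := by ring
    rw [this]
    have := norm_sub_le (z1 - zs) (z0 - zs)
    linarith
  have hsub : ball z0 r ⊆ ball zs R := by
    intro z hz
    rw [mem_ball] at *
    have := dist_triangle z z0 zs
    linarith
  have := camp2 hC'.le (by norm_num) hd (hF.mono hsub) (memLp_bdd (hF.mono hsub) (fun z hz => hFB z (hsub hz))) (hA2 z0 hz0) (hA2 z1 hz1)
  have h2 : (‖F z1 - F z0 - A z0 (z1 - z0)‖ ^ 2) ^ 2 ≤ (√(16 * 2 ^ 10 * C') * ‖z1 - z0‖ ^ 3) ^ 2 := by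
    rw [mul_pow, Real.sq_sqrt (by positivity)]
    norm_num at this ⊢
    nlinarith
  have h3 := (abs_le_of_sq_le_sq' h2 (by positivity)).2
  refine h3.trans ?_
  gcongr
  linarith

/-- the derivative field is Hölder -/
lemma holder3 {F : ℂ → ℂ} {A : ℂ → (ℂ →L[ℝ] ℂ)} {zs : ℂ} {R C : ℝ} (hC : 0 ≤ C)
    (h : ∀ z0 ∈ ball zs R, ∀ z1 ∈ ball zs R, ‖F z1 - F z0 - A z0 (z1 - z0)‖ ^ 2 ≤ C * ‖z1 - z0‖ ^ 3) :
    (∀ z ∈ ball zs R, HasFDerivAt F (A z) z) ∧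
    ∀ z0 ∈ ball zs (R / 4), ∀ z1 ∈ ball zs (R / 4), ‖A z0 - A z1‖ ^ 2 ≤ 100 * C * ‖z0 - z1‖ := by
  constructor
  · intro z hz
    rw [hasFDerivAt_iff_isLittleO, Asymptotics.isLittleO_iff]
    intro c hc
    have e1 : ∀ᶠ x in 𝓝 z, x ∈ ball zs R := isOpen_ball.mem_nhds hz
    have e2 : ∀ᶠ x in 𝓝 z, C * ‖x - z‖ ≤ c ^ 2 := by
      have : Tendsto (fun x => C * ‖x - z‖) (𝓝 z) (𝓝 (C * ‖z - z‖)) := (Continuous.tendsto (by fun_prop) z)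
      rw [sub_self, norm_zero, mul_zero] at this
      exact (this.eventually (gt_mem_nhds (by positivity : 0 < c ^ 2))).mono fun x hx => le_of_lt hx
    filter_upwards [e1, e2] with x h1 h2
    refine (abs_le_of_sq_le_sq' ?_ (by positivity)).2
    refine (h z hz x h1).trans ?_
    calc C * ‖x - z‖ ^ 3 = (C * ‖x - z‖) * ‖x - z‖ ^ 2 := by ring
      _ ≤ c ^ 2 * ‖x - z‖ ^ 2 := by gcongr
      _ = _ := by ring
  · intro z0 hz0 z1 hz1
    rcases eq_or_ne z0 z1 with rfl | hne
    · simp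
    set d := ‖z0 - z1‖ with hd
    have hd0 : 0 < d := norm_pos_iff.2 (sub_ne_zero.2 hne)
    have hR : 0 < R := by
      by_contra hR
      have := pos_of_mem_ball hz0; linarith
    rw [mem_ball_iff_norm] at hz0 hz1
    have hdR : d < R / 2 := by
      have : z0 - z1 = (z0 - zs) - (z1 - zs) := by ring
      rw [hd, this]
      have := norm_sub_le (z0 - zs) (z1 - zs)
      linarith
    have b0 : z0 ∈ ball zs R := by rw [mem_ball_iff_norm]; linarith
    have b1 : z1 ∈ ball zs R := by rw [mem_ball_iff_norm]; linarith
    have ex : ∀ {x y : ℝ}, 0 ≤ y → x ^ 2 ≤ C * y ^ 3 → x ≤ √(C * y) * y := by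
      intro x y hy hx
      refine (abs_le_of_sq_le_sq' ?_ (by positivity)).2
      rw [mul_pow, Real.sq_sqrt (by positivity)]; linarith
    have main : ‖A z0 - A z1‖ ≤ 10 * √(C * d) := by
      have key : ∀ v : ℂ, ‖v‖ = d → ‖(A z0 - A z1) v‖ ≤ 10 * √(C * d) * d := by
        intro v hv
        have b2 : z1 + v ∈ ball zs R := by
          rw [mem_ball_iff_norm]
          have : z1 + v - zs = (z1 - zs) + v := by ring
          rw [this]; have := norm_add_le (z1 - zs) v; linarith
        have h1 := ex (norm_nonneg _) (h z1 b1 (z1 + v) b2)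
        have h2 := h z0 b0 (z1 + v) b2
        have h3 := ex (norm_nonneg _) (h z0 b0 z1 b1)
        have n1 : ‖z1 + v - z1‖ = d := by simpa using hv
        have n2 : ‖z1 + v - z0‖ ≤ 2 * d := by
          have : z1 + v - z0 = v - (z0 - z1) := by ring
          rw [this]; have := norm_sub_le v (z0 - z1); linarith
        have n3 : ‖z1 - z0‖ = d := norm_sub_rev _ _
        rw [n1] at h1; rw [n3] at h3
        have h2' : ‖F (z1 + v) - F z0 - A z0 (z1 + v - z0)‖ ≤ 4 * √(C * d) * d := by
          refine (abs_le_of_sq_le_sq' ?_ (by positivity)).2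
          refine h2.trans ?_
          rw [mul_pow, mul_pow, Real.sq_sqrt (by positivity)]
          calc C * ‖z1 + v - z0‖ ^ 3 ≤ C * (2 * d) ^ 3 := by gcongr
            _ ≤ _ := by have : 0 ≤ C * d ^ 3 := by positivity
                        nlinarith
        have e : (A z0 - A z1) v = (F (z1 + v) - F z1 - A z1 (z1 + v - z1)) - (F (z1 + v) - F z0 - A z0 (z1 + v - z0)) + (F z1 - F z0 - A z0 (z1 - z0)) := by
          have e1 : z1 + v - z0 = v + (z1 - z0) := by ring
          rw [e1, map_add, add_sub_cancel_left, sub_apply]; ring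
        rw [e]
        refine (norm_add_le _ _).trans ?_
        have := norm_sub_le (F (z1 + v) - F z1 - A z1 (z1 + v - z1)) (F (z1 + v) - F z0 - A z0 (z1 + v - z0))
        have : 0 ≤ √(C * d) * d := by positivity
        linarith
      refine ContinuousLinearMap.opNorm_le_bound _ (by positivity) fun v => ?_
      rcases eq_or_ne v 0 with rfl | hv
      · simp
      have hv0 : 0 < ‖v‖ := norm_pos_iff.2 hv
      have := key ((d / ‖v‖) • v) (by rw [norm_smul, Real.norm_eq_abs, abs_of_pos (by positivity)]; field_simp)
      rw [map_smul, norm_smul, Real.norm_eq_abs, abs_of_pos (by positivity), div_mul_eq_mul_div, div_le_iff₀ hv0] at this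
      have h2 : d * ‖(A z0 - A z1) v‖ ≤ d * (10 * √(C * d) * ‖v‖) := by linarith
      exact le_of_mul_le_mul_left h2 hd0
    calc ‖A z0 - A z1‖ ^ 2 ≤ (10 * √(C * d)) ^ 2 := by gcongr
      _ = _ := by rw [mul_pow, Real.sq_sqrt (by positivity)]; ring
end A9

section A10
open Complex MeasureTheory
open scoped ContDiff

variable {V W : Type} [NormedAddCommGroup V] [NormedSpace ℝ V] [NormedAddCommGroup W] [NormedSpace ℝ W]

/-- local 1/2-Hölder classes -/
def H0 (f : ℂ → V) (U : Set ℂ) : Prop :=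
  ∀ z ∈ U, ∃ δ > 0, ball z δ ⊆ U ∧ ∃ C, 0 ≤ C ∧ ∀ x ∈ ball z δ, ∀ y ∈ ball z δ, ‖f x - f y‖ ^ 2 ≤ C * ‖x - y‖

def HH : ℕ → (ℂ → V) → Set ℂ → Prop
  | 0, f, U => H0 f U
  | k+1, f, U => H0 f U ∧ (∀ z ∈ U, DifferentiableAt ℝ f z) ∧ ∀ v : ℂ, HH k (fun z => fderiv ℝ f z v) U

lemma HH.h0 {k : ℕ} {f : ℂ → V} {U : Set ℂ} (h : HH k f U) : H0 f U := by
  cases k with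
  | zero => exact h
  | succ k => exact h.1

lemma HH.pred {k : ℕ} {f : ℂ → V} {U : Set ℂ} (h : HH (k+1) f U) : HH k f U := by
  induction k generalizing f with
  | zero => exact h.1
  | succ k ih => exact ⟨h.1, h.2.1, fun v => ih (h.2.2 v)⟩

lemma HH.le {k l : ℕ} (hkl : k ≤ l) {f : ℂ → V} {U : Set ℂ} (h : HH l f U) : HH k f U := by
  induction l, hkl using Nat.le_induction with
  | base => exact h
  | succ l _ ih => exact ih h.pred

lemma H0.cont {f : ℂ → V} {U : Set ℂ} (h : H0 f U) : ContinuousOn f U := by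
  intro z hz
  apply ContinuousAt.continuousWithinAt
  obtain ⟨δ, hδ, -, C, hC, hh⟩ := h z hz
  rw [Metric.continuousAt_iff]
  intro e he
  refine ⟨min δ (e ^ 2 / (C + 1)), by positivity, fun {x} hx => ?_⟩
  have h1 := hh x (mem_ball.2 (hx.trans_le (min_le_left _ _))) z (mem_ball_self hδ)
  have h2 := hx.trans_le (min_le_right _ _)
  rw [lt_div_iff₀ (by positivity)] at h2
  rw [dist_eq_norm] at h2 ⊢
  have : ‖f x - f z‖ ^ 2 < e ^ 2 := by
    nlinarith [norm_nonneg (x - z)]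
  exact lt_of_pow_lt_pow_left₀ 2 he.le this

lemma H0.isOpen {f : ℂ → V} {U : Set ℂ} (h : H0 f U) : IsOpen U := by
  rw [Metric.isOpen_iff]
  intro z hz
  obtain ⟨δ, hδ, hs, -⟩ := h z hz
  exact ⟨δ, hδ, hs⟩

/-- bounded version, on arbitrarily small balls -/
lemma H0.bdd {f : ℂ → V} {U : Set ℂ} (h : H0 f U) {z : ℂ} (hz : z ∈ U) :
    ∃ δ > 0, ball z δ ⊆ U ∧ ∃ C, 0 ≤ C ∧ (∀ x ∈ ball z δ, ‖f x‖ ≤ C) ∧ ∀ x ∈ ball z δ, ∀ y ∈ ball z δ, ‖f x - f y‖ ^ 2 ≤ C * ‖x - y‖ := by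
  obtain ⟨δ, hδ, hs, C, hC, hh⟩ := h z hz
  refine ⟨δ, hδ, hs, C + (‖f z‖ + (C * δ + 1)), by positivity, ?_, ?_⟩
  · intro x hx
    have h1 := hh x hx z (mem_ball_self hδ)
    rw [mem_ball_iff_norm] at hx
    have h2 : ‖f x - f z‖ ^ 2 ≤ C * δ := h1.trans (by gcongr)
    have h3 : ‖f x - f z‖ ≤ C * δ + 1 := by nlinarith [norm_nonneg (f x - f z), sq_nonneg (‖f x - f z‖ - 1)]
    have := norm_sub_norm_le (f x) (f z)
    linarith
  · intro x hx y hy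
    refine (hh x hx y hy).trans ?_
    gcongr
    have : 0 ≤ ‖f z‖ + (C * δ + 1) := by positivity
    linarith

lemma H0.of_lip {f : ℂ → V} {U : Set ℂ} (h : ∀ z ∈ U, ∃ δ > 0, ball z δ ⊆ U ∧ ∃ C, 0 ≤ C ∧ ∀ x ∈ ball z δ, ∀ y ∈ ball z δ, ‖f x - f y‖ ≤ C * ‖x - y‖) : H0 f U := by
  intro z hz
  obtain ⟨δ, hδ, hs, C, hC, hh⟩ := h z hz
  refine ⟨min δ 1, by positivity, (ball_subset_ball (min_le_left _ _)).trans hs, 2 * C ^ 2, by positivity, ?_⟩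
  intro x hx y hy
  have h1 := hh x (ball_subset_ball (min_le_left _ _) hx) y (ball_subset_ball (min_le_left _ _) hy)
  have hx' := ball_subset_ball (min_le_right _ _) hx
  have hy' := ball_subset_ball (min_le_right _ _) hy
  have h2 : ‖x - y‖ ≤ 2 := by
    rw [mem_ball_iff_norm] at hx' hy'
    have : x - y = (x - z) - (y - z) := by ring
    rw [this]; exact (norm_sub_le _ _).trans (by linarith)
  calc ‖f x - f y‖ ^ 2 ≤ (C * ‖x - y‖) ^ 2 := by gcongr
    _ = C ^ 2 * ‖x - y‖ * ‖x - y‖ := by ring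
    _ ≤ C ^ 2 * ‖x - y‖ * 2 := by gcongr
    _ = _ := by ring

lemma H0.congr {f g : ℂ → V} {U : Set ℂ} (h : H0 f U) (hfg : ∀ z ∈ U, f z = g z) : H0 g U := by
  intro z hz
  obtain ⟨δ, hδ, hs, C, hC, hh⟩ := h z hz
  refine ⟨δ, hδ, hs, C, hC, fun x hx y hy => ?_⟩
  rw [← hfg x (hs hx), ← hfg y (hs hy)]; exact hh x hx y hy

lemma HH.congr {k : ℕ} {f g : ℂ → V} {U : Set ℂ} (h : HH k f U) (hfg : ∀ z ∈ U, f z = g z) : HH k g U := by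
  induction k generalizing f g with
  | zero => exact H0.congr h hfg
  | succ k ih =>
    have ev : ∀ z ∈ U, f =ᶠ[𝓝 z] g := fun z hz => by
      filter_upwards [h.1.isOpen.mem_nhds hz] with x hx using hfg x hx
    refine ⟨h.1.congr hfg, fun z hz => (h.2.1 z hz).congr_of_eventuallyEq (ev z hz).symm, fun v => ih (h.2.2 v) fun z hz => ?_⟩
    rw [(ev z hz).fderiv_eq]

lemma H0.mono {f : ℂ → V} {U U' : Set ℂ} (h : H0 f U) (hU : IsOpen U') (hs : U' ⊆ U) : H0 f U' := by
  intro z hz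
  obtain ⟨δ, hδ, hs', C, hC, hh⟩ := h z (hs hz)
  obtain ⟨δ', hδ', hs''⟩ := Metric.isOpen_iff.1 hU z hz
  exact ⟨min δ δ', by positivity, (ball_subset_ball (min_le_right _ _)).trans hs'', C, hC, fun x hx y hy =>
    hh x (ball_subset_ball (min_le_left _ _) hx) y (ball_subset_ball (min_le_left _ _) hy)⟩

lemma HH.mono {k : ℕ} {f : ℂ → V} {U U' : Set ℂ} (h : HH k f U) (hU : IsOpen U') (hs : U' ⊆ U) : HH k f U' := by
  induction k generalizing f with
  | zero => exact H0.mono h hU hs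
  | succ k ih => exact ⟨h.1.mono hU hs, fun z hz => h.2.1 z (hs hz), fun v => ih (h.2.2 v)⟩

lemma HH.clm {k : ℕ} {f : ℂ → V} {U : Set ℂ} (h : HH k f U) (L : V →L[ℝ] W) : HH k (fun z => L (f z)) U := by
  have zero : ∀ {f : ℂ → V}, H0 f U → H0 (fun z => L (f z)) U := by
    intro f h z hz
    obtain ⟨δ, hδ, hs, C, hC, hh⟩ := h z hz
    refine ⟨δ, hδ, hs, ‖L‖ ^ 2 * C, by positivity, fun x hx y hy => ?_⟩
    rw [← map_sub]
    calc ‖L (f x - f y)‖ ^ 2 ≤ (‖L‖ * ‖f x - f y‖) ^ 2 := by gcongr; exact L.le_opNorm _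
      _ = ‖L‖ ^ 2 * ‖f x - f y‖ ^ 2 := by ring
      _ ≤ ‖L‖ ^ 2 * (C * ‖x - y‖) := by gcongr; exact hh x hx y hy
      _ = _ := by ring
  induction k generalizing f with
  | zero => exact zero h
  | succ k ih =>
    refine ⟨zero h.1, fun z hz => L.differentiableAt.comp z (h.2.1 z hz), fun v => (ih (h.2.2 v)).congr fun z hz => ?_⟩
    have := (L.hasFDerivAt.comp z (h.2.1 z hz).hasFDerivAt).fderiv
    have e : (fun z => L (f z)) = L ∘ f := rfl
    rw [e, this]; rfl

lemma HH.add {k : ℕ} {f g : ℂ → V} {U : Set ℂ} (hf : HH k f U) (hg : HH k g U) : HH k (fun z => f z + g z) U := by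
  have zero : ∀ {f g : ℂ → V}, H0 f U → H0 g U → H0 (fun z => f z + g z) U := by
    intro f g hf hg z hz
    obtain ⟨δ, hδ, hs, C, hC, hh⟩ := hf z hz
    obtain ⟨δ', hδ', hs', C', hC', hh'⟩ := hg z hz
    refine ⟨min δ δ', by positivity, (ball_subset_ball (min_le_left _ _)).trans hs, 2 * (C + C'), by positivity, fun x hx y hy => ?_⟩
    have h1 := hh x (ball_subset_ball (min_le_left _ _) hx) y (ball_subset_ball (min_le_left _ _) hy)
    have h2 := hh' x (ball_subset_ball (min_le_right _ _) hx) y (ball_subset_ball (min_le_right _ _) hy)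
    have e : f x + g x - (f y + g y) = (f x - f y) + (g x - g y) := by abel
    have h3 := norm_add_le (f x - f y) (g x - g y)
    rw [e]
    nlinarith [sq_nonneg (‖f x - f y‖ - ‖g x - g y‖), norm_nonneg ((f x - f y) + (g x - g y))]
  induction k generalizing f g with
  | zero => exact zero hf hg
  | succ k ih =>
    refine ⟨zero hf.1 hg.1, fun z hz => (hf.2.1 z hz).add (hg.2.1 z hz), fun v => (ih (hf.2.2 v) (hg.2.2 v)).congr fun z hz => ?_⟩
    rw [fderiv_fun_add (hf.2.1 z hz) (hg.2.1 z hz)]; rfl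

lemma HH.mul {k : ℕ} {f g : ℂ → ℝ} {U : Set ℂ} (hf : HH k f U) (hg : HH k g U) : HH k (fun z => f z * g z) U := by
  have zero : ∀ {f g : ℂ → ℝ}, H0 f U → H0 g U → H0 (fun z => f z * g z) U := by
    intro f g hf hg z hz
    obtain ⟨δ, hδ, hs, C, hC, hb, hh⟩ := hf.bdd hz
    obtain ⟨δ', hδ', hs', C', hC', hb', hh'⟩ := hg.bdd hz
    refine ⟨min δ δ', by positivity, (ball_subset_ball (min_le_left _ _)).trans hs, 2 * (C ^ 2 * C' + C' ^ 2 * C), by positivity, fun x hx y hy => ?_⟩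
    have h1 := hh x (ball_subset_ball (min_le_left _ _) hx) y (ball_subset_ball (min_le_left _ _) hy)
    have h2 := hh' x (ball_subset_ball (min_le_right _ _) hx) y (ball_subset_ball (min_le_right _ _) hy)
    have b1 := hb x (ball_subset_ball (min_le_left _ _) hx)
    have b2 := hb' y (ball_subset_ball (min_le_right _ _) hy)
    have e : f x * g x - f y * g y = f x * (g x - g y) + (f x - f y) * g y := by ring
    rw [Real.norm_eq_abs] at *
    rw [sq_abs] at *
    have q1 : f x ^ 2 ≤ C ^ 2 := by rw [← sq_abs]; gcongr
    have q2 : g y ^ 2 ≤ C' ^ 2 := by rw [← sq_abs]; gcongr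
    have m1 : f x ^ 2 * (g x - g y) ^ 2 ≤ C ^ 2 * (C' * ‖x - y‖) := by gcongr
    have m2 : (f x - f y) ^ 2 * g y ^ 2 ≤ (C * ‖x - y‖) * C' ^ 2 := by gcongr
    rw [e]
    nlinarith [sq_nonneg (f x * (g x - g y) - (f x - f y) * g y)]
  induction k generalizing f g with
  | zero => exact zero hf hg
  | succ k ih =>
    refine ⟨zero hf.1 hg.1, fun z hz => (hf.2.1 z hz).mul (hg.2.1 z hz), fun v => 
      ((ih hf.pred (hg.2.2 v)).add (ih hg.pred (hf.2.2 v))).congr fun z hz => ?_⟩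
    rw [fderiv_fun_mul (hf.2.1 z hz) (hg.2.1 z hz)]; simp

lemma HH.const (k : ℕ) (c : V) {U : Set ℂ} (hU : IsOpen U) : HH k (fun _ => c) U := by
  have zero : ∀ c : V, H0 (fun _ => c) U := fun c => H0.of_lip fun z hz => by
    obtain ⟨δ, hδ, hs⟩ := Metric.isOpen_iff.1 hU z hz
    exact ⟨δ, hδ, hs, 0, le_rfl, fun x _ y _ => by simp⟩
  induction k generalizing c with
  | zero => exact zero c
  | succ k ih => exact ⟨zero c, fun z _ => differentiableAt_const _, fun v => by simpa using ih 0⟩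

lemma HH.im (k : ℕ) {U : Set ℂ} (hU : IsOpen U) : HH k (fun z => z.im) U := by
  have zero : H0 (fun z : ℂ => z.im) U := H0.of_lip fun z hz => by
    obtain ⟨δ, hδ, hs⟩ := Metric.isOpen_iff.1 hU z hz
    refine ⟨δ, hδ, hs, 1, zero_le_one, fun x _ y _ => ?_⟩
    rw [← sub_im, one_mul]; exact abs_im_le_norm _
  cases k with
  | zero => exact zero
  | succ k => 
    refine ⟨zero, fun z _ => imCLM.differentiableAt, fun v => (HH.const k v.im hU).congr fun z _ => ?_⟩
    have : fderiv ℝ (fun z : ℂ => z.im) z = imCLM := imCLM.fderiv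
    rw [this]; rfl

/-- composition with a smooth function -/
lemma HH.comp {k : ℕ} {X : ℂ → ℝ} {U : Set ℂ} (hX : HH k X U) {Ω : Set (ℝ × ℝ)} (hΩ : IsOpen Ω)
    (hm : ∀ z ∈ U, (X z, z.im) ∈ Ω) {N : ℝ × ℝ → ℝ} (hN : ContDiffOn ℝ ∞ N Ω) : HH k (fun z => N (X z, z.im)) U := by
  have zero : ∀ {X : ℂ → ℝ}, H0 X U → (∀ z ∈ U, (X z, z.im) ∈ Ω) → ∀ {N : ℝ × ℝ → ℝ}, ContDiffOn ℝ ∞ N Ω → H0 (fun z => N (X z, z.im)) U := by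
    intro X hX hm N hN z hz
    obtain ⟨K, t, ht, hLip⟩ := ((hN.contDiffAt (hΩ.mem_nhds (hm z hz))).of_le (by simp) : ContDiffAt ℝ 1 N (X z, z.im)).exists_lipschitzOnWith
    have hc : ContinuousAt (fun z => (X z, z.im)) z := 
      (hX.cont.continuousAt (hX.isOpen.mem_nhds hz)).prodMk continuous_im.continuousAt
    obtain ⟨δ1, hδ1, hb1⟩ := Metric.mem_nhds_iff.1 (hc.preimage_mem_nhds ht)
    obtain ⟨δ, hδ, hs, C, hC, hh⟩ := hX z hz
    have hI := (HH.im 0 hX.isOpen : H0 _ U)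
    obtain ⟨δ', hδ', hs', C', hC', hh'⟩ := hI z hz
    refine ⟨min δ1 (min δ δ'), by positivity, ((ball_subset_ball (min_le_right _ _)).trans (ball_subset_ball (min_le_left _ _))).trans hs,
      (K:ℝ) ^ 2 * (C + C'), by positivity, fun x hx y hy => ?_⟩
    have s1 : ball z (min δ1 (min δ δ')) ⊆ ball z δ1 := ball_subset_ball (min_le_left _ _)
    have s2 : ball z (min δ1 (min δ δ')) ⊆ ball z δ := ball_subset_ball ((min_le_right _ _).trans (min_le_left _ _))
    have s3 : ball z (min δ1 (min δ δ')) ⊆ ball z δ' := ball_subset_ball ((min_le_right _ _).trans (min_le_right _ _))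
    have h1 := hh x (s2 hx) y (s2 hy)
    have h2 := hh' x (s3 hx) y (s3 hy)
    have h3 := hLip.dist_le_mul _ (hb1 (s1 hx)) _ (hb1 (s1 hy))
    rw [dist_eq_norm, dist_eq_norm] at h3
    have h4 : ‖((X x, x.im) : ℝ × ℝ) - (X y, y.im)‖ ^ 2 ≤ (C + C') * ‖x - y‖ := by
      rw [Prod.mk_sub_mk, Prod.norm_mk]
      have := mul_nonneg hC (norm_nonneg (x - y))
      have := mul_nonneg hC' (norm_nonneg (x - y))
      rcases max_cases ‖X x - X y‖ ‖x.im - y.im‖ with h | h <;> rw [h.1] <;> linarith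
    calc ‖N (X x, x.im) - N (X y, y.im)‖ ^ 2 ≤ (K * ‖((X x, x.im) : ℝ × ℝ) - (X y, y.im)‖) ^ 2 := by gcongr
      _ = K ^ 2 * ‖((X x, x.im) : ℝ × ℝ) - (X y, y.im)‖ ^ 2 := by ring
      _ ≤ K ^ 2 * ((C + C') * ‖x - y‖) := by gcongr
      _ = _ := by ring
  induction k generalizing X N with
  | zero => exact zero hX hm hN
  | succ k ih =>
    have hNd : ∀ w : ℝ × ℝ, ContDiffOn ℝ ∞ (fun q => fderiv ℝ N q w) Ω := fun w =>
      (hN.fderiv_of_isOpen hΩ (m := ∞) (by simp)).clm_apply contDiffOn_const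
    have hd : ∀ z ∈ U, HasFDerivAt (fun z => N (X z, z.im)) ((fderiv ℝ N (X z, z.im)).comp ((fderiv ℝ X z).prod imCLM)) z := by
      intro z hz
      have h1 : HasFDerivAt N (fderiv ℝ N (X z, z.im)) (X z, z.im) := 
        ((hN.contDiffAt (hΩ.mem_nhds (hm z hz))).differentiableAt (by simp)).hasFDerivAt
      exact HasFDerivAt.comp z h1 ((hX.2.1 z hz).hasFDerivAt.prodMk imCLM.hasFDerivAt)
    refine ⟨zero hX.1 hm hN, fun z hz => (hd z hz).differentiableAt, fun v => ?_⟩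
    refine (((ih hX.pred hm (hNd (1, 0))).mul (hX.2.2 v)).add ((ih hX.pred hm (hNd (0, 1))).mul (HH.const k v.im hX.1.isOpen))).congr fun z hz => ?_
    rw [(hd z hz).fderiv]
    simp only [ContinuousLinearMap.comp_apply, ContinuousLinearMap.prod_apply, imCLM_apply]
    have : ((fderiv ℝ X z v, v.im) : ℝ × ℝ) = (fderiv ℝ X z v) • ((1, 0) : ℝ × ℝ) + v.im • ((0, 1) : ℝ × ℝ) := by simp
    rw [this, map_add, map_smul, map_smul, smul_eq_mul, smul_eq_mul]; ring

lemma HH.contDiffOn {k : ℕ} {f : ℂ → V} {U : Set ℂ} (h : HH k f U) : ContDiffOn ℝ k f U := by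
  induction k generalizing f with
  | zero => simpa using H0.cont h
  | succ k ih =>
    have := (contDiffOn_succ_iff_fderiv_of_isOpen (𝕜 := ℝ) (n := k) (f := f) h.1.isOpen).2 ⟨fun z hz => (h.2.1 z hz).differentiableWithinAt, by simp, ?_⟩
    · exact_mod_cast this
    · have e : ∀ z, fderiv ℝ f z = reCLM.smulRight (fderiv ℝ f z 1) + imCLM.smulRight (fderiv ℝ f z I) := by
        intro z; ext v
        have : v = v.re • (1 : ℂ) + v.im • I := by simp
        conv_lhs => rw [this]
        simp only [map_add, map_smul]; simp
      have : fderiv ℝ f = fun z => reCLM.smulRight (fderiv ℝ f z 1) + imCLM.smulRight (fderiv ℝ f z I) := funext e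
      rw [this]
      exact (contDiffOn_const.smulRight (ih (h.2.2 1))).add (contDiffOn_const.smulRight (ih (h.2.2 I)))

/-- Taylor bound for H1 functions -/
lemma HH.taylor {f : ℂ → V} {U : Set ℂ} (h : HH 1 f U) {z : ℂ} (hz : z ∈ U) :
    ∃ δ > 0, ball z δ ⊆ U ∧ ∃ C, 0 ≤ C ∧ (∀ x ∈ ball z δ, ‖fderiv ℝ f x 1‖ ≤ C ∧ ‖fderiv ℝ f x I‖ ≤ C) ∧ 
      ∀ x ∈ ball z δ, ∀ y ∈ ball z δ, ‖f y - f x - fderiv ℝ f x (y - x)‖ ^ 2 ≤ C * ‖y - x‖ ^ 3 := by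
  obtain ⟨δ, hδ, hs, C, hC, hb, hh⟩ := H0.bdd (h.2.2 1) hz
  obtain ⟨δ', hδ', hs', C', hC', hb', hh'⟩ := H0.bdd (h.2.2 I) hz
  have s1 : ball z (min δ δ') ⊆ ball z δ := ball_subset_ball (min_le_left _ _)
  have s2 : ball z (min δ δ') ⊆ ball z δ' := ball_subset_ball (min_le_right _ _)
  refine ⟨min δ δ', by positivity, s1.trans hs, 2 * (C + C'), by positivity, fun x hx => ⟨(hb x (s1 hx)).trans (by linarith), (hb' x (s2 hx)).trans (by linarith)⟩, ?_⟩
  intro x hx y hy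
  have hconv : Convex ℝ (ball z (min δ δ') ∩ closedBall x ‖y - x‖) := (convex_ball _ _).inter (convex_closedBall _ _)
  have key : ∀ w ∈ ball z (min δ δ') ∩ closedBall x ‖y - x‖, ‖fderiv ℝ f w - fderiv ℝ f x‖ ≤ √(2 * (C + C') * ‖y - x‖) := by
    intro w hw
    have h1 := hh w (s1 hw.1) x (s1 hx)
    have h2 := hh' w (s2 hw.1) x (s2 hx)
    have hw2 : ‖w - x‖ ≤ ‖y - x‖ := by have := hw.2; rwa [mem_closedBall_iff_norm] at this
    set L := fderiv ℝ f w - fderiv ℝ f x with hL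
    have hb : ‖L‖ ≤ ‖L 1‖ + ‖L I‖ := by
      refine ContinuousLinearMap.opNorm_le_bound _ (by positivity) fun v => ?_
      have : v = v.re • (1 : ℂ) + v.im • I := by simp
      conv_lhs => rw [this]
      rw [map_add, map_smul, map_smul]
      refine (norm_add_le _ _).trans ?_
      rw [norm_smul, norm_smul, Real.norm_eq_abs, Real.norm_eq_abs]
      have := abs_re_le_norm v
      have := abs_im_le_norm v
      have : |v.re| * ‖L 1‖ ≤ ‖v‖ * ‖L 1‖ := by gcongr
      have : |v.im| * ‖L I‖ ≤ ‖v‖ * ‖L I‖ := by gcongr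
      linarith
    refine Real.le_sqrt_of_sq_le ?_
    have h1' : ‖L 1‖ ^ 2 ≤ C * ‖y - x‖ := h1.trans (by gcongr)
    have h2' : ‖L I‖ ^ 2 ≤ C' * ‖y - x‖ := h2.trans (by gcongr)
    nlinarith [sq_nonneg (‖L 1‖ - ‖L I‖), norm_nonneg L]
  have := hconv.norm_image_sub_le_of_norm_hasFDerivWithin_le' (f := f) (f' := fderiv ℝ f) (φ := fderiv ℝ f x)
    (fun w hw => (h.2.1 w (hs (s1 hw.1))).hasFDerivAt.hasFDerivWithinAt) key ⟨hx, by simp⟩ ⟨hy, by rw [mem_closedBall_iff_norm]⟩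
  calc ‖f y - f x - fderiv ℝ f x (y - x)‖ ^ 2 ≤ (√(2 * (C + C') * ‖y - x‖) * ‖y - x‖) ^ 2 := by gcongr
    _ = _ := by rw [mul_pow, Real.sq_sqrt (by positivity)]; ring

/-- H1 from affine approximation -/
lemma HH.of_approx {f : ℂ → ℂ} {U : Set ℂ} (hU : IsOpen U) (h : ∀ z ∈ U, ∃ R > 0, ∃ C, 0 ≤ C ∧ ∃ A : ℂ → (ℂ →L[ℝ] ℂ), 
    ∀ z0 ∈ ball z R, ∀ z1 ∈ ball z R, ‖f z1 - f z0 - A z0 (z1 - z0)‖ ^ 2 ≤ C * ‖z1 - z0‖ ^ 3) : HH 1 f U := by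
  have key : ∀ z ∈ U, ∃ R > 0, ball z R ⊆ U ∧ ∃ C, 0 ≤ C ∧ (∀ x ∈ ball z R, DifferentiableAt ℝ f x) ∧ 
      ∀ x ∈ ball z R, ∀ y ∈ ball z R, ‖fderiv ℝ f x - fderiv ℝ f y‖ ^ 2 ≤ C * ‖x - y‖ := by
    intro z hz
    obtain ⟨R, hR, C, hC, A, hA⟩ := h z hz
    obtain ⟨δ, hδ, hs⟩ := Metric.isOpen_iff.1 hU z hz
    obtain ⟨h1, h2⟩ := holder3 hC hA
    have s1 : ball z (min δ (R/4)) ⊆ ball z (R / 4) := ball_subset_ball (min_le_right _ _)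
    have s2 : ball z (R / 4) ⊆ ball z R := ball_subset_ball (by linarith)
    refine ⟨min δ (R / 4), by positivity, (ball_subset_ball (min_le_left _ _)).trans hs, 100 * C, by positivity, 
      fun x hx => (h1 x (s2 (s1 hx))).differentiableAt, fun x hx y hy => ?_⟩
    rw [(h1 x (s2 (s1 hx))).fderiv, (h1 y (s2 (s1 hy))).fderiv]
    exact h2 x (s1 hx) y (s1 hy)
  refine ⟨H0.of_lip fun z hz => ?_, fun z hz => ?_, fun v => ?_⟩
  · obtain ⟨R, hR, hs, C, hC, hd, hh⟩ := key z hz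
    refine ⟨R, hR, hs, ‖fderiv ℝ f z‖ + (C * R + 1), by positivity, fun x hx y hy => ?_⟩
    refine (convex_ball z R).norm_image_sub_le_of_norm_fderiv_le hd ?_ hy hx
    intro w hw
    have h1 := hh w hw z (mem_ball_self hR)
    rw [mem_ball_iff_norm] at hw
    have h2 : ‖fderiv ℝ f w - fderiv ℝ f z‖ ^ 2 ≤ C * R := h1.trans (by gcongr)
    have h3 := norm_sub_norm_le (fderiv ℝ f w) (fderiv ℝ f z)
    nlinarith [sq_nonneg (‖fderiv ℝ f w - fderiv ℝ f z‖ - 1), norm_nonneg (fderiv ℝ f w - fderiv ℝ f z)]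
  · obtain ⟨R, hR, hs, C, hC, hd, hh⟩ := key z hz
    exact hd z (mem_ball_self hR)
  · intro z hz
    obtain ⟨R, hR, hs, C, hC, hd, hh⟩ := key z hz
    refine ⟨R, hR, hs, C * ‖v‖ ^ 2, by positivity, fun x hx y hy => ?_⟩
    have : fderiv ℝ f x v - fderiv ℝ f y v = (fderiv ℝ f x - fderiv ℝ f y) v := rfl
    rw [this]
    calc ‖(fderiv ℝ f x - fderiv ℝ f y) v‖ ^ 2 ≤ (‖fderiv ℝ f x - fderiv ℝ f y‖ * ‖v‖) ^ 2 := by gcongr; exact ContinuousLinearMap.le_opNorm _ _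
      _ = ‖fderiv ℝ f x - fderiv ℝ f y‖ ^ 2 * ‖v‖ ^ 2 := by ring
      _ ≤ (C * ‖x - y‖) * ‖v‖ ^ 2 := by gcongr; exact hh x hx y hy
      _ = _ := by ring
end A10

section A11
open Complex MeasureTheory
open scoped ContDiff

lemma Tst.der_comm {η : ℂ → ℂ} {U : Set ℂ} (h : Tst η U) (v w z : ℂ) :
    fderiv ℝ (fun z => fderiv ℝ η z v) z w = fderiv ℝ (fun z => fderiv ℝ η z w) z v := by
  have hd : DifferentiableAt ℝ (fderiv ℝ η) z :=
    ((h.smooth.fderiv_right (m := ∞) (by simp)).differentiable (by simp)) z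
  rw [fderiv_clm_apply hd (differentiableAt_const _), fderiv_clm_apply hd (differentiableAt_const _)]
  simp only [ContinuousLinearMap.add_apply, ContinuousLinearMap.comp_apply,
    ContinuousLinearMap.flip_apply, fderiv_const, Pi.zero_apply, fderiv_fun_const]
  simp only [ContinuousLinearMap.zero_apply, map_zero, zero_add]
  exact (h.smooth.contDiffAt (x := z)).isSymmSndFDerivAt (by simp; exact WithTop.coe_le_coe.2 le_top) w v

lemma Tst.db_der {η : ℂ → ℂ} {U : Set ℂ} (h : Tst η U) (v z : ℂ) :
    _root_.db (fun z => fderiv ℝ η z v) z = fderiv ℝ (_root_.db η) z v := by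
  have e : fderiv ℝ (_root_.db η) z v = fderiv ℝ (fun z => fderiv ℝ η z 1) z v + I * fderiv ℝ (fun z => fderiv ℝ η z I) z v := by
    have h1 := ((h.der 1).diff z).hasFDerivAt
    have h2 := ((h.der I).diff z).hasFDerivAt
    have h3 := h1.fun_add (h2.const_mul I)
    have : HasFDerivAt (_root_.db η) _ z := h3
    rw [this.fderiv]; simp
  rw [e, _root_.db, h.der_comm v 1, h.der_comm v I]

lemma Wk.der {F : ℂ → ℂ} {E : ℂ → ℝ} {U : Set ℂ} (hF : HH 1 F U) (hE : HH 1 E U) (h : Wk F E U) (v : ℂ) :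
    Wk (fun z => fderiv ℝ F z v) (fun z => fderiv ℝ E z v) U := by
  intro η hη
  have hU := hF.1.isOpen
  have h1 := h _ (hη.der v)
  have hE' : HH 1 (fun z => (E z : ℂ)) U := hE.clm ofRealCLM
  have eE : ∀ z ∈ U, fderiv ℝ (fun z => (E z : ℂ)) z v = (fderiv ℝ E z v : ℂ) := by
    intro z hz
    have := (hE.2.1 z hz).hasFDerivAt
    have h2 := ofRealCLM.hasFDerivAt.comp z this
    have h3 : HasFDerivAt (fun z => (E z : ℂ)) _ z := h2
    rw [h3.fderiv]; simp
  obtain ⟨i1, i2, i3⟩ := ibp_aux hU hF.2.1 v (H0.cont (hF.2.2 v)) (hη.db.smooth.of_le (by simp)) hη.db.cpt hη.db.supp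
  obtain ⟨j1, j2, j3⟩ := ibp_aux hU hE'.2.1 v (H0.cont (hE'.2.2 v)) ((hη.der 1).smooth.of_le (by simp)) (hη.der 1).cpt (hη.der 1).supp
  have e1 : ∀ z, F z * db (fun z => fderiv ℝ η z v) z + (E z : ℂ) * fderiv ℝ (fun z => fderiv ℝ η z v) z 1 =
      F z * fderiv ℝ (db η) z v + (E z : ℂ) * fderiv ℝ (fun z => fderiv ℝ η z 1) z v := by
    intro z; rw [hη.db_der, hη.der_comm v 1]
  simp_rw [e1] at h1
  rw [integral_add i2 j2, i3, j3, ← neg_add, neg_eq_zero, ← integral_add i1 j1] at h1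
  rw [← h1]
  apply integral_congr_ae
  filter_upwards with z
  by_cases hz : z ∈ U
  · rw [eE z hz]
  · rw [image_eq_zero_of_notMem_tsupport (fun h => hz ((hη.der 1).supp h)), mul_zero, mul_zero]

lemma fderiv_apply_split {V : Type} [NormedAddCommGroup V] [NormedSpace ℝ V] (L : ℂ →L[ℝ] V) (h : ℂ) :
    L h = h.re • L 1 + h.im • L I := by
  have : h = h.re • (1 : ℂ) + h.im • I := by simp
  conv_lhs => rw [this]
  simp only [map_add, map_smul]

set_option maxHeartbeats 1000000 in
lemma lin0 : ∃ ε : ℝ, 0 < ε ∧ ∀ (U : Set ℂ) (F : ℂ → ℂ) (a b : ℂ → ℝ), H0 F U → HH 1 a U → HH 1 b U → (∀ z ∈ U, |a z| ≤ ε) →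
    Wk F (fun z => a z * (F z).re + b z) U → HH 1 F U := by
  obtain ⟨ε, hε, H⟩ := R1
  refine ⟨ε, hε, fun U F a b hF ha hb hae hw => HH.of_approx hF.isOpen fun zs hzs => ?_⟩
  obtain ⟨δ1, hδ1, hs1, C1, hC1, hp1, hT1⟩ := ha.taylor hzs
  obtain ⟨δ2, hδ2, hs2, C2, hC2, hp2, hT2⟩ := hb.taylor hzs
  obtain ⟨δ3, hδ3, hs3, C3, hC3, hp3, hT3⟩ := hF.bdd hzs
  obtain ⟨δ4, hδ4, hs4, C4, hC4, hp4, hT4⟩ := hb.h0.bdd hzs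
  obtain ⟨R, hR, r1, r2, r3, r4⟩ : ∃ R > 0, R ≤ δ1 ∧ R ≤ δ2 ∧ R ≤ δ3 ∧ R ≤ δ4 :=
    ⟨min (min δ1 δ2) (min δ3 δ4), by positivity, (min_le_left _ _).trans (min_le_left _ _), (min_le_left _ _).trans (min_le_right _ _),
      (min_le_right _ _).trans (min_le_left _ _), (min_le_right _ _).trans (min_le_right _ _)⟩
  have q1 := ball_subset_ball (x := zs) r1
  have q2 := ball_subset_ball (x := zs) r2
  have q3 := ball_subset_ball (x := zs) r3
  have q4 := ball_subset_ball (x := zs) r4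
  have hsub : ball zs R ⊆ U := q1.trans hs1
  set K : ℝ := 3 * (C1 * C3 ^ 2 + C2 + 2 * (C1 * (2 * R) + 4 * C1 ^ 2) * C3) with hK
  obtain ⟨C, hC, A, -, hA⟩ := H F (fun z => a z * (F z).re + b z) zs R (C3 + (ε * C3 + C4) + (C1 * C3 + C2)) K hR (by positivity)
    (hF.cont.mono hsub) (((ha.h0.cont.mul (continuous_re.comp_continuousOn hF.cont)).add hb.h0.cont).mono hsub)
    (fun z hz => (hp3 z (q3 hz)).trans (by nlinarith [mul_nonneg hε.le hC3, mul_nonneg hC1 hC3]))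
    (fun z hz => by
      have h1 := hae z (hsub hz)
      have h2 := (abs_re_le_norm (F z)).trans (hp3 z (q3 hz))
      have h3 := hp4 z (q4 hz)
      rw [Real.norm_eq_abs] at h3
      calc |a z * (F z).re + b z| ≤ |a z| * |(F z).re| + |b z| := (abs_add_le _ _).trans (by rw [abs_mul])
        _ ≤ ε * C3 + C4 := by gcongr
        _ ≤ _ := by nlinarith [mul_nonneg hC1 hC3]) (hw.mono hsub) (fun z0 hz0 => by
      have hz0' : z0 ∈ ball zs R := ball_subset_ball (by linarith) hz0
      have hX0 := (abs_re_le_norm (F z0)).trans (hp3 z0 (q3 hz0'))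
      obtain ⟨da1, daI⟩ := hp1 z0 (q1 hz0')
      obtain ⟨db1, dbI⟩ := hp2 z0 (q2 hz0')
      rw [Real.norm_eq_abs] at da1 daI db1 dbI
      refine ⟨a z0, fderiv ℝ a z0 1 * (F z0).re + fderiv ℝ b z0 1, fderiv ℝ a z0 I * (F z0).re + fderiv ℝ b z0 I, b z0, hae z0 (hsub hz0'), ?_, fun z hz => ?_⟩
      · calc _ ≤ |fderiv ℝ a z0 1| * |(F z0).re| + |fderiv ℝ b z0 1| := (abs_add_le _ _).trans (by rw [abs_mul])
          _ ≤ C1 * C3 + C2 := by gcongr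
          _ ≤ _ := by nlinarith [mul_nonneg hε.le hC3]
      · have t1 := hT1 z0 (q1 hz0') z (q1 hz)
        have t2 := hT2 z0 (q2 hz0') z (q2 hz)
        have t3 := hT3 z (q3 hz) z0 (q3 hz0')
        rw [fderiv_apply_split, Real.norm_eq_abs, sq_abs] at t1 t2
        have hr : ‖z - z0‖ ≤ 2 * R := by
          rw [mem_ball_iff_norm] at hz hz0'
          have : z - z0 = (z - zs) - (z0 - zs) := by ring
          rw [this]; exact (norm_sub_le _ _).trans (by linarith)
        have hre := abs_re_le_norm (z - z0)
        have him := abs_im_le_norm (z - z0)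
        have t3' : ((F z).re - (F z0).re) ^ 2 ≤ C3 * ‖z - z0‖ := by
          refine le_trans ?_ t3
          rw [← sub_re, ← sq_abs]; gcongr; exact abs_re_le_norm _
        simp only [smul_eq_mul] at t1 t2
        generalize hdr : (z - z0).re = hx at *
        generalize hdi : (z - z0).im = hy at *
        generalize ‖z - z0‖ = r at *
        have hr0 : 0 ≤ r := (abs_nonneg _).trans hre
        set A1 := fderiv ℝ a z0 1
        set A2 := fderiv ℝ a z0 I
        set B1 := fderiv ℝ b z0 1
        set B2 := fderiv ℝ b z0 I
        set ρa := a z - a z0 - (hx * A1 + hy * A2) with hρa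
        set ρb := b z - b z0 - (hx * B1 + hy * B2) with hρb
        have elin : |hx * A1 + hy * A2| ≤ 2 * C1 * r := by
          calc _ ≤ |hx| * |A1| + |hy| * |A2| := (abs_add_le _ _).trans (by rw [abs_mul, abs_mul])
            _ ≤ r * C1 + r * C1 := by gcongr
            _ = _ := by ring
        have ea : (a z - a z0) ^ 2 ≤ 2 * (C1 * (2 * R) + 4 * C1 ^ 2) * r ^ 2 := by
          have e1 : a z - a z0 = ρa + (hx * A1 + hy * A2) := by rw [hρa]; ring
          have e2 : (hx * A1 + hy * A2) ^ 2 ≤ (2 * C1 * r) ^ 2 := by rw [← sq_abs]; gcongr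
          have e3 : C1 * r ^ 3 ≤ C1 * (2 * R) * r ^ 2 := by
            calc C1 * r ^ 3 = C1 * r * r ^ 2 := by ring
              _ ≤ C1 * (2 * R) * r ^ 2 := by gcongr
          rw [e1]
          have e4 := sq_nonneg (ρa - (hx * A1 + hy * A2))
          linarith
        have f1 : (ρa * (F z0).re) ^ 2 ≤ C1 * r ^ 3 * C3 ^ 2 := by
          rw [mul_pow]; 
          have : (F z0).re ^ 2 ≤ C3 ^ 2 := by rw [← sq_abs]; gcongr
          gcongr
        have f2 : ((a z - a z0) * ((F z).re - (F z0).re)) ^ 2 ≤ 2 * (C1 * (2 * R) + 4 * C1 ^ 2) * r ^ 2 * (C3 * r) := by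
          rw [mul_pow]; gcongr
        have e : a z * (F z).re + b z - (b z0 + (A1 * (F z0).re + B1) * hx + (A2 * (F z0).re + B2) * hy + a z0 * (F z).re) =
          ρa * (F z0).re + ρb + (a z - a z0) * ((F z).re - (F z0).re) := by rw [hρa, hρb]; ring
        rw [e]
        have sq3 : ∀ x y w : ℝ, (x + y + w) ^ 2 ≤ 3 * (x ^ 2 + y ^ 2 + w ^ 2) := fun x y w => by
          nlinarith [sq_nonneg (x - y), sq_nonneg (y - w), sq_nonneg (x - w)]
        refine (sq3 _ _ _).trans ?_
        rw [hK]
        linarith)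
  exact ⟨R / 8, by positivity, C, hC.le, A, hA⟩

lemma linReg : ∃ ε : ℝ, 0 < ε ∧ ∀ (k : ℕ) (U : Set ℂ) (F : ℂ → ℂ) (a b : ℂ → ℝ), H0 F U → HH (k+1) a U → HH (k+1) b U → (∀ z ∈ U, |a z| ≤ ε) →
    Wk F (fun z => a z * (F z).re + b z) U → HH (k+1) F U := by
  obtain ⟨ε, hε, H⟩ := lin0
  refine ⟨ε, hε, fun k => ?_⟩
  induction k with
  | zero => exact H
  | succ k ih =>
    intro U F a b hF ha hb hae hw
    have hFk := ih U F a b hF ha.pred hb.pred hae hw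
    refine ⟨hF, hFk.2.1, fun v => ?_⟩
    have hre : HH (k+1) (fun z => (F z).re) U := hFk.clm reCLM
    have hE : HH (k+1) (fun z => a z * (F z).re + b z) U := (ha.pred.mul hre).add hb.pred
    have hw' := Wk.der (hFk.le (by omega)) (hE.le (by omega)) hw v
    refine ih U _ a (fun z => fderiv ℝ a z v * (F z).re + fderiv ℝ b z v) (hFk.2.2 v).h0 ha.pred (((ha.2.2 v).mul hre).add (hb.2.2 v)) hae ?_
    refine Wk.congr hw' (fun z _ => rfl) fun z hz => ?_
    have h1 := ((ha.2.1 z hz).hasFDerivAt.fun_mul (reCLM.hasFDerivAt.comp z (hFk.2.1 z hz).hasFDerivAt)).fun_add (hb.2.1 z hz).hasFDerivAt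
    have h2 : HasFDerivAt (fun z => a z * (F z).re + b z) _ z := h1
    rw [h2.fderiv]; simp; ring

end A11

section A12
open Complex MeasureTheory
open scoped ContDiff

/-- local quantitative facts about a smooth function of two variables -/
lemma smooth_local {N : ℝ × ℝ → ℝ} {Ω : Set (ℝ × ℝ)} (hΩ : IsOpen Ω) (hN : ContDiffOn ℝ ∞ N Ω) {p : ℝ × ℝ} (hp : p ∈ Ω)
    (hq : fderiv ℝ N p (1, 0) = 0) {ε : ℝ} (hε : 0 < ε) :
    ∃ r > 0, ∃ K, 0 ≤ K ∧ ball p r ⊆ Ω ∧ (∀ x ∈ ball p r, |fderiv ℝ N x (1, 0)| ≤ ε) ∧ (∀ x ∈ ball p r, |N x| ≤ K) ∧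
      (∀ x ∈ ball p r, |fderiv ℝ N x (0,1)| ≤ K) ∧
      (∀ x ∈ ball p r, ∀ y ∈ ball p r, |N x - N y| ≤ ε * |x.1 - y.1| + K * |x.2 - y.2|) ∧
      (∀ x ∈ ball p r, ∀ y ∈ ball p r, |N y - N x - fderiv ℝ N x (y - x)| ≤ K * ‖y - x‖ ^ 2) := by
  have hd : ContDiffOn ℝ ∞ (fderiv ℝ N) Ω := hN.fderiv_of_isOpen hΩ (by simp)
  obtain ⟨L, t, ht, hL⟩ := ((hd.contDiffAt (hΩ.mem_nhds hp)).of_le (by simp) : ContDiffAt ℝ 1 _ p).exists_lipschitzOnWith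
  have hc : ContinuousAt (fun x => fderiv ℝ N x (1, 0)) p := (hd.continuousOn.continuousAt (hΩ.mem_nhds hp)).clm_apply continuousAt_const
  have hc2 : ContinuousAt (fun x => fderiv ℝ N x (0, 1)) p := (hd.continuousOn.continuousAt (hΩ.mem_nhds hp)).clm_apply continuousAt_const
  have hc3 : ContinuousAt N p := (hN.continuousOn.continuousAt (hΩ.mem_nhds hp))
  have ev : ∀ᶠ x in 𝓝 p, x ∈ Ω ∧ x ∈ t ∧ |fderiv ℝ N x (1, 0)| < ε ∧ |fderiv ℝ N x (0, 1)| < |fderiv ℝ N p (0, 1)| + 1 ∧ |N x| < |N p| + 1 := by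
    refine Filter.Eventually.and (hΩ.mem_nhds hp) (Filter.Eventually.and ht (Filter.Eventually.and ?_ (Filter.Eventually.and ?_ ?_)))
    · exact hc.abs.eventually_lt continuousAt_const (by rw [hq]; simpa using hε)
    · exact hc2.abs.eventually_lt continuousAt_const (by linarith)
    · exact hc3.abs.eventually_lt continuousAt_const (by linarith)
  obtain ⟨r, hr, hb⟩ := Metric.mem_nhds_iff.1 ev
  have hdiff : ∀ x ∈ ball p r, HasFDerivAt N (fderiv ℝ N x) x := fun x hx =>
    ((hN.contDiffAt (hΩ.mem_nhds (hb hx).1)).differentiableAt (by simp)).hasFDerivAt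
  refine ⟨r, hr, max (L:ℝ) (|fderiv ℝ N p (0, 1)| + |N p| + 1), by positivity, fun x hx => (hb hx).1, fun x hx => (hb hx).2.2.1.le, fun x hx => ?_, fun x hx => ?_, ?_, ?_⟩
  · refine (hb hx).2.2.2.2.le.trans (le_trans ?_ (le_max_right _ _)); linarith [abs_nonneg (fderiv ℝ N p (0, 1))]
  · refine (hb hx).2.2.2.1.le.trans (le_trans ?_ (le_max_right _ _)); linarith [abs_nonneg (N p)]
  · rintro ⟨x1, x2⟩ hx ⟨y1, y2⟩ hy
    have hm : ((y1, x2) : ℝ × ℝ) ∈ ball p r := by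
      rw [mem_ball, Prod.dist_eq, max_lt_iff] at hx hy ⊢
      exact ⟨hy.1, hx.2⟩
    have s1 : |N (x1, x2) - N (y1, x2)| ≤ ε * |x1 - y1| := by
      have hcv : Convex ℝ {s : ℝ | (s, x2) ∈ ball p r} := by
        intro s hs s' hs' α β hα hβ hαβ
        have := (convex_ball p r) hs hs' hα hβ hαβ
        simp only [Prod.smul_mk, Prod.mk_add_mk, smul_eq_mul, ← add_mul, hαβ, one_mul] at this
        simpa using this
      have := hcv.norm_image_sub_le_of_norm_hasDerivWithin_le (f := fun s => N (s, x2)) (f' := fun s => fderiv ℝ N (s, x2) (1, 0)) (C := ε) (x := y1) (y := x1) (fun s hs => ?_) (fun s hs => ?_) hm hx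
      · simpa using this
      · have h1 : HasDerivAt (fun s : ℝ => ((s, x2) : ℝ × ℝ)) (1, 0) s := (hasDerivAt_id s).prodMk (hasDerivAt_const s x2)
        exact ((hdiff _ hs).comp_hasDerivAt s h1).hasDerivWithinAt
      · exact (hb hs).2.2.1.le
    have s2 : |N (y1, x2) - N (y1, y2)| ≤ (|fderiv ℝ N p (0, 1)| + 1) * |x2 - y2| := by
      have hcv : Convex ℝ {s : ℝ | (y1, s) ∈ ball p r} := by
        intro s hs s' hs' α β hα hβ hαβ
        have := (convex_ball p r) hs hs' hα hβ hαβ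
        simp only [Prod.smul_mk, Prod.mk_add_mk, smul_eq_mul, ← add_mul, hαβ, one_mul] at this
        simpa using this
      have := hcv.norm_image_sub_le_of_norm_hasDerivWithin_le (f := fun s => N (y1, s)) (f' := fun s => fderiv ℝ N (y1, s) (0, 1)) (C := |fderiv ℝ N p (0, 1)| + 1) (x := y2) (y := x2) (fun s hs => ?_) (fun s hs => ?_) hy hm
      · simpa using this
      · have h1 : HasDerivAt (fun s : ℝ => ((y1, s) : ℝ × ℝ)) (0, 1) s := (hasDerivAt_const s y1).prodMk (hasDerivAt_id s)
        exact ((hdiff _ hs).comp_hasDerivAt s h1).hasDerivWithinAt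
      · exact (hb hs).2.2.2.1.le
    have s3 : (|fderiv ℝ N p (0, 1)| + 1) * |x2 - y2| ≤ max (L:ℝ) (|fderiv ℝ N p (0, 1)| + |N p| + 1) * |x2 - y2| := by
      gcongr; refine le_trans ?_ (le_max_right _ _); linarith [abs_nonneg (N p)]
    have := abs_sub_le (N (x1, x2)) (N (y1, x2)) (N (y1, y2))
    simp only
    linarith
  · intro x hx y hy
    have hcv : Convex ℝ (ball p r ∩ closedBall x ‖y - x‖) := (convex_ball _ _).inter (convex_closedBall _ _)
    have := hcv.norm_image_sub_le_of_norm_hasFDerivWithin_le' (f := N) (f' := fderiv ℝ N) (φ := fderiv ℝ N x) (C := L * ‖y - x‖) (x := x) (y := y)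
      (fun w hw => (hdiff w hw.1).hasFDerivWithinAt) (fun w hw => ?_) ⟨hx, by simp⟩ ⟨hy, by simp [dist_eq_norm]⟩
    · rw [Real.norm_eq_abs] at this
      refine this.trans ?_
      rw [mul_assoc, ← sq]; gcongr; exact le_max_left _ _
    · have h1 := hL.norm_sub_le (hb hw.1).2.1 (hb hx).2.1
      refine h1.trans ?_
      gcongr; have := hw.2; rwa [mem_closedBall, dist_eq_norm] at this

lemma fderiv_split2 (L : ℝ × ℝ →L[ℝ] ℝ) (x y : ℝ) : L (x, y) = x * L (1, 0) + y * L (0, 1) := by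
  have : ((x, y) : ℝ × ℝ) = x • (1, 0) + y • (0, 1) := by simp
  rw [this, map_add, map_smul, map_smul]; simp

set_option maxHeartbeats 1000000 in
theorem nonlinReg {F : ℂ → ℂ} {zs : ℂ} {R : ℝ} (hR : 0 < R) (hF : ContinuousOn F (ball zs R)) {N : ℝ × ℝ → ℝ} {Ω : Set (ℝ × ℝ)}
    (hΩ : IsOpen Ω) (hN : ContDiffOn ℝ ∞ N Ω) (hp : ((F zs).re, zs.im) ∈ Ω) (hq : fderiv ℝ N ((F zs).re, zs.im) (1, 0) = 0)
    (hw : Wk F (fun z => N ((F z).re, z.im)) (ball zs R)) : ContDiffAt ℝ ∞ F zs := by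
  obtain ⟨ε0, hε0, H0'⟩ := R0
  obtain ⟨ε1, hε1, H1⟩ := R1
  obtain ⟨ε2, hε2, H2⟩ := linReg
  set ε := min ε0 (min ε1 ε2) with hεd
  have hε : 0 < ε := by positivity
  have le0 : ε ≤ ε0 := min_le_left _ _
  have le1 : ε ≤ ε1 := (min_le_right _ _).trans (min_le_left _ _)
  have le2 : ε ≤ ε2 := (min_le_right _ _).trans (min_le_right _ _)
  obtain ⟨r, hr, K, hK, hbΩ, hNq, hNK, hNy, hLip, hTay⟩ := smooth_local hΩ hN hp hq hε
  have hFc : ContinuousAt F zs := hF.continuousAt (ball_mem_nhds _ hR)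
  have hmc : ContinuousAt (fun z => ((F z).re, z.im)) zs := (continuous_re.continuousAt.comp hFc).prodMk continuous_im.continuousAt
  have ev : ∀ᶠ z in 𝓝 zs, z ∈ ball zs R ∧ ((F z).re, z.im) ∈ ball ((F zs).re, zs.im) r ∧ ‖F z‖ < ‖F zs‖ + 1 :=
    Filter.Eventually.and (ball_mem_nhds _ hR) (Filter.Eventually.and (hmc.preimage_mem_nhds (ball_mem_nhds _ hr)) (hFc.norm.eventually_lt continuousAt_const (by linarith)))
  obtain ⟨R1, hR1, hb⟩ := Metric.mem_nhds_iff.1 ev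
  set G : ℂ → ℝ × ℝ := fun z => ((F z).re, z.im) with hG
  set E : ℂ → ℝ := fun z => N ((F z).re, z.im) with hE
  have hsub1 : ball zs R1 ⊆ ball zs R := fun z hz => (hb hz).1
  have hGm : ∀ z ∈ ball zs R1, G z ∈ ball ((F zs).re, zs.im) r := fun z hz => (hb hz).2.1
  have hF1 : ContinuousOn F (ball zs R1) := hF.mono hsub1
  have hGc : ContinuousOn G (ball zs R1) := (continuous_re.comp_continuousOn hF1).prodMk continuous_im.continuousOn
  have hEc : ContinuousOn E (ball zs R1) := hN.continuousOn.comp hGc (fun z hz => hbΩ (hGm z hz))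
  set B := ‖F zs‖ + 1 + K with hB
  have hFB : ∀ z ∈ ball zs R1, ‖F z‖ ≤ B := fun z hz => by have := (hb hz).2.2; rw [hB]; linarith
  have hEB : ∀ z ∈ ball zs R1, |E z| ≤ B := fun z hz => by have := hNK _ (hGm z hz); rw [hB]; linarith [norm_nonneg (F zs)]
  obtain ⟨C, hC⟩ := H0' F E zs R1 B K hR1 hK hF1 hEc hFB hEB (hw.mono hsub1) (fun z hz z' hz' => by
    refine (hLip _ (hGm z hz) _ (hGm z' hz')).trans ?_
    simp only [hG]
    rw [← sub_re, ← sub_im]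
    have := abs_re_le_norm (F z - F z')
    have := abs_im_le_norm (z - z')
    gcongr)
  have hC' : ∀ z ∈ ball zs (R1 / 8), ∀ z' ∈ ball zs (R1 / 8), ‖F z - F z'‖ ^ 4 ≤ |C| * ‖z - z'‖ ^ 3 := fun z hz z' hz' =>
    (hC z hz z' hz').trans (by gcongr; exact le_abs_self C)
  set R2 := R1 / 8 with hR2
  have hR20 : 0 < R2 := by positivity
  have hsub2 : ball zs R2 ⊆ ball zs R1 := ball_subset_ball (by rw [hR2]; linarith)
  obtain ⟨C1, hC1, A, -, hA⟩ := H1 F E zs R2 B (2 * K ^ 2 * (|C| + 2 * R2)) hR20 (by positivity) (hF1.mono hsub2) (hEc.mono hsub2) (fun z hz => hFB z (hsub2 hz))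
    (fun z hz => hEB z (hsub2 hz)) (hw.mono (hsub2.trans hsub1)) (fun z0 hz0 => by
      have hz0' : z0 ∈ ball zs R2 := ball_subset_ball (by linarith) hz0
      refine ⟨fderiv ℝ N (G z0) (1, 0), 0, fderiv ℝ N (G z0) (0, 1), E z0 - fderiv ℝ N (G z0) (1, 0) * (F z0).re, (hNq _ (hGm _ (hsub2 hz0'))).trans le1, ?_, fun z hz => ?_⟩
      · rw [abs_zero, hB]; positivity
      · have h1 := hTay _ (hGm _ (hsub2 hz0')) _ (hGm _ (hsub2 hz))
        have h2 : G z - G z0 = ((F z - F z0).re, (z - z0).im) := by simp [hG]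
        rw [h2, fderiv_split2] at h1
        have hr : ‖z - z0‖ ≤ 2 * R2 := by
          rw [mem_ball_iff_norm] at hz hz0'
          have : z - z0 = (z - zs) - (z0 - zs) := by ring
          rw [this]; exact (norm_sub_le _ _).trans (by linarith)
        have h3 : ‖(((F z - F z0).re, (z - z0).im) : ℝ × ℝ)‖ ^ 2 ≤ ‖F z - F z0‖ ^ 2 + ‖z - z0‖ ^ 2 := by
          have a1 := abs_re_le_norm (F z - F z0)
          have a2 := abs_im_le_norm (z - z0)
          rw [Prod.norm_def]
          rcases max_cases ‖(F z - F z0).re‖ ‖(z - z0).im‖ with h | h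
          · rw [h.1, Real.norm_eq_abs]
            have : |(F z - F z0).re| ^ 2 ≤ ‖F z - F z0‖ ^ 2 := by gcongr
            nlinarith [sq_nonneg ‖z - z0‖]
          · rw [h.1, Real.norm_eq_abs]
            have : |(z - z0).im| ^ 2 ≤ ‖z - z0‖ ^ 2 := by gcongr
            nlinarith [sq_nonneg ‖F z - F z0‖]
        have h4 := hC' z hz z0 hz0'
        have e : E z - (E z0 - fderiv ℝ N (G z0) (1, 0) * (F z0).re + 0 * (z - z0).re + fderiv ℝ N (G z0) (0, 1) * (z - z0).im + fderiv ℝ N (G z0) (1, 0) * (F z).re) =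
          N (G z) - N (G z0) - ((F z - F z0).re * fderiv ℝ N (G z0) (1, 0) + (z - z0).im * fderiv ℝ N (G z0) (0, 1)) := by
          rw [show (F z - F z0).re = (F z).re - (F z0).re from sub_re _ _]; simp only [hE, hG]; ring
        rw [e, ← sq_abs]
        have h5 : K * ‖(((F z - F z0).re, (z - z0).im) : ℝ × ℝ)‖ ^ 2 ≤ K * (‖F z - F z0‖ ^ 2 + ‖z - z0‖ ^ 2) := by gcongr
        calc _ ≤ (K * (‖F z - F z0‖ ^ 2 + ‖z - z0‖ ^ 2)) ^ 2 := by gcongr; exact h1.trans h5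
          _ ≤ 2 * K ^ 2 * (‖F z - F z0‖ ^ 4 + ‖z - z0‖ ^ 4) := by
            have : (‖F z - F z0‖ ^ 2 + ‖z - z0‖ ^ 2) ^ 2 ≤ 2 * (‖F z - F z0‖ ^ 4 + ‖z - z0‖ ^ 4) := by
              nlinarith [sq_nonneg (‖F z - F z0‖ ^ 2 - ‖z - z0‖ ^ 2)]
            calc _ = K ^ 2 * (‖F z - F z0‖ ^ 2 + ‖z - z0‖ ^ 2) ^ 2 := by ring
              _ ≤ K ^ 2 * (2 * (‖F z - F z0‖ ^ 4 + ‖z - z0‖ ^ 4)) := by gcongr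
              _ = _ := by ring
          _ ≤ 2 * K ^ 2 * (|C| * ‖z - z0‖ ^ 3 + 2 * R2 * ‖z - z0‖ ^ 3) := by
            have : ‖z - z0‖ ^ 4 = ‖z - z0‖ * ‖z - z0‖ ^ 3 := by ring
            rw [this]; gcongr
          _ = _ := by ring)
  set U := ball zs (R2 / 8) with hU
  have hUs : U ⊆ ball zs R1 := (ball_subset_ball (by linarith)).trans hsub2
  have hF1' : HH 1 F U := by
    refine HH.of_approx isOpen_ball fun z hz => ?_
    obtain ⟨δ, hδ, hs⟩ := Metric.isOpen_iff.1 (isOpen_ball (x := zs) (ε := R2 / 8)) z hz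
    exact ⟨δ, hδ, C1, hC1.le, A, fun z0 h0 z1 h1 => hA z0 (hs h0) z1 (hs h1)⟩
  have hall : ∀ k, HH (k+1) F U := by
    intro k
    induction k with
    | zero => exact hF1'
    | succ k ih =>
      refine ⟨ih.h0, ih.2.1, fun v => ?_⟩
      have hre : HH (k+1) (fun z => (F z).re) U := ih.clm reCLM
      have hm : ∀ z ∈ U, ((F z).re, z.im) ∈ Ω := fun z hz => hbΩ (hGm z (hUs hz))
      have hEk : HH (k+1) E U := hre.comp hΩ hm hN
      have hd : ContDiffOn ℝ ∞ (fderiv ℝ N) Ω := hN.fderiv_of_isOpen hΩ (by simp)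
      have ha : HH (k+1) (fun z => fderiv ℝ N ((F z).re, z.im) (1, 0)) U := hre.comp (N := fun x => fderiv ℝ N x (1, 0)) hΩ hm (hd.clm_apply contDiffOn_const)
      have hb' : HH (k+1) (fun z => fderiv ℝ N ((F z).re, z.im) (0, 1)) U := hre.comp (N := fun x => fderiv ℝ N x (0, 1)) hΩ hm (hd.clm_apply contDiffOn_const)
      have hw' := Wk.der (ih.le (by omega)) (hEk.le (by omega)) (hw.mono (hUs.trans hsub1)) v
      refine H2 k U _ _ (fun z => fderiv ℝ N ((F z).re, z.im) (0, 1) * v.im) (ih.2.2 v).h0 ha (hb'.mul (HH.const _ _ isOpen_ball)) (fun z hz => (hNq _ (hGm _ (hUs hz))).trans le2) ?_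
      refine Wk.congr hw' (fun z _ => rfl) fun z hz => ?_
      have h1 : HasFDerivAt (fun z => (F z).re) (reCLM.comp (fderiv ℝ F z)) z := reCLM.hasFDerivAt.comp z (ih.2.1 z hz).hasFDerivAt
      have h2 : HasFDerivAt (fun z : ℂ => z.im) imCLM z := imCLM.hasFDerivAt
      have h3 : HasFDerivAt N (fderiv ℝ N ((F z).re, z.im)) ((F z).re, z.im) := ((hN.contDiffAt (hΩ.mem_nhds (hm z hz))).differentiableAt (by simp)).hasFDerivAt
      have h4 : HasFDerivAt E _ z := h3.comp z (h1.prodMk h2)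
      rw [h4.fderiv]
      simp only [ContinuousLinearMap.comp_apply, ContinuousLinearMap.prod_apply, reCLM_apply, imCLM_apply]
      rw [fderiv_split2]; ring
  rw [contDiffAt_infty]
  intro n
  exact ((hall n).pred.contDiffOn).contDiffAt (ball_mem_nhds _ (by positivity))

end A12

section B0
open Complex MeasureTheory
open scoped ContDiff

lemma inner_split (p x : ℂ) : ⟪p, x⟫ = p.re * x.re + p.im * x.im := by
  rw [Complex.inner]; simp; ring

lemma fderiv_eq_inner {E : Type} [NormedAddCommGroup E] [InnerProductSpace ℝ E] [CompleteSpace E] {f : E → ℝ} {p : E} (v : E) : fderiv ℝ f p v = ⟪v, gradient f p⟫ := by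
  rw [real_inner_comm, gradient, InnerProductSpace.toDual_symm_apply]

lemma gradient_ineq {E : Type} [NormedAddCommGroup E] [InnerProductSpace ℝ E] [CompleteSpace E] {f : E → ℝ}
    (hf : ConvexOn ℝ Set.univ f) {p : E} (hd : DifferentiableAt ℝ f p) (p' : E) :
    f p + ⟪p' - p, gradient f p⟫ ≤ f p' := by
  have hc : ConvexOn ℝ Set.univ (fun t : ℝ => f (p + t • (p' - p))) := by
    have := hf.comp_affineMap (AffineMap.lineMap p p')
    refine this.congr ?_
    intro t _
    simp [AffineMap.lineMap_apply, add_comm]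
  have hd1 : HasDerivAt (fun t : ℝ => f (p + t • (p' - p))) (fderiv ℝ f p (p' - p)) 0 := by
    have h1 : HasDerivAt (fun t : ℝ => p + t • (p' - p)) (p' - p) 0 := by
      simpa using ((hasDerivAt_id (0:ℝ)).smul_const (p' - p)).const_add p
    have h2 : HasFDerivAt f (fderiv ℝ f p) (p + (0:ℝ) • (p' - p)) := by simpa using hd.hasFDerivAt
    exact h2.comp_hasDerivAt (0:ℝ) h1
  have := hc.le_slope_of_hasDerivAt (x := 0) (y := 1) (Set.mem_univ _) (Set.mem_univ _) one_pos hd1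
  rw [slope_def_field] at this
  simp at this
  rw [← fderiv_eq_inner]
  simp only [map_sub]; linarith

lemma gradient_unique {f : ℂ → ℝ} {p x : ℂ} (hd : DifferentiableAt ℝ f p) (h : ∀ p', f p + ⟪p' - p, x⟫ ≤ f p') :
    gradient f p = x := by
  have hmin : IsLocalMin (fun p' => f p' - ⟪p' - p, x⟫) p := by
    refine Filter.Eventually.of_forall fun p' => ?_
    have := h p'
    simp only [sub_self, inner_zero_left, sub_zero]; linarith
  have h1 : HasFDerivAt (fun p' => f p' - ⟪p' - p, x⟫) (fderiv ℝ f p - (innerSL ℝ x)) p := by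
    refine hd.hasFDerivAt.fun_sub ?_
    have : HasFDerivAt (fun p' : ℂ => innerSL ℝ x (p' - p)) (innerSL ℝ x) p := by
      have h := (innerSL ℝ x).hasFDerivAt.comp p ((hasFDerivAt_id p).sub_const p)
      exact h
    refine this.congr_of_eventuallyEq (Filter.Eventually.of_forall fun p' => ?_)
    beta_reduce; rw [innerSL_apply_apply, real_inner_comm]
  have h2 := hmin.hasFDerivAt_eq_zero h1
  have h3 : fderiv ℝ f p = innerSL ℝ x := sub_eq_zero.1 h2
  rw [gradient, h3]
  exact (InnerProductSpace.toDual ℝ ℂ).symm_apply_apply x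

lemma norm_subgrad_le {f : ℂ → ℝ} (hL : LipschitzWith 1 f) {p x : ℂ} (h : ∀ p', f p + ⟪p' - p, x⟫ ≤ f p') : ‖x‖ ≤ 1 := by
  have h1 := h (p + x)
  have h2 := hL.norm_sub_le (p + x) p
  simp only [add_sub_cancel_left, real_inner_self_eq_norm_sq, NNReal.coe_one, one_mul, Real.norm_eq_abs] at h1 h2
  have := le_abs_self (f (p + x) - f p)
  by_contra hx
  push Not at hx
  nlinarith

lemma norm_gradient_le {f : ℂ → ℝ} (hL : LipschitzWith 1 f) (p : ℂ) : ‖gradient f p‖ ≤ 1 := by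
  rw [gradient, LinearIsometryEquiv.norm_map]
  simpa using norm_fderiv_le_of_lipschitz ℝ hL

lemma measurable_gradient (f : ℂ → ℝ) : Measurable (gradient f) := by
  have : Measurable (fderiv ℝ f) := measurable_fderiv ℝ f
  exact (InnerProductSpace.toDual ℝ ℂ).symm.continuous.measurable.comp this

/-- gradients of convergent convex functions converge -/
lemma gradient_tendsto {f : ℕ → ℂ → ℝ} {g : ℂ → ℝ} (hf : ∀ n, ConvexOn ℝ Set.univ (f n)) 
    (hlim : ∀ p, Tendsto (fun n => f n p) atTop (𝓝 (g p))) {p : ℂ} (hd : ∀ n, DifferentiableAt ℝ (f n) p) (hdg : DifferentiableAt ℝ g p) :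
    Tendsto (fun n => gradient (f n) p) atTop (𝓝 (gradient g p)) := by
  have key : ∀ v : ℂ, ∀ e > 0, ∀ᶠ n in atTop, ⟪v, gradient (f n) p⟫ < ⟪v, gradient g p⟫ + e := by
    intro v e he
    have h1 : HasDerivAt (fun t : ℝ => g (p + t • v)) (fderiv ℝ g p v) 0 := by
      have h1 : HasDerivAt (fun t : ℝ => p + t • v) v 0 := by
        simpa using ((hasDerivAt_id (0:ℝ)).smul_const v).const_add p
      have h2 : HasFDerivAt g (fderiv ℝ g p) (p + (0:ℝ) • v) := by simpa using hdg.hasFDerivAt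
      exact h2.comp_hasDerivAt (0:ℝ) h1
    rw [hasDerivAt_iff_tendsto_slope] at h1
    have h2 := (h1.mono_left (nhdsWithin_mono 0 (show Set.Ioi (0:ℝ) ⊆ {0}ᶜ from fun x hx => ne_of_gt hx))).eventually_lt_const (show fderiv ℝ g p v < fderiv ℝ g p v + e by linarith)
    obtain ⟨t, ht, ht0⟩ := (h2.and self_mem_nhdsWithin).exists
    have ht0 : 0 < t := ht0
    rw [slope_def_field] at ht
    simp only [sub_zero, zero_smul, add_zero] at ht
    have h3 : Tendsto (fun n => (f n (p + t • v) - f n p) / t) atTop (𝓝 ((g (p + t • v) - g p) / t)) := ((hlim _).sub (hlim _)).div_const t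
    filter_upwards [h3.eventually_lt_const ht] with n hn
    have h4 := gradient_ineq (hf n) (hd n) (p + t • v)
    rw [add_sub_cancel_left, inner_smul_left] at h4
    simp only [conj_trivial] at h4
    rw [← fderiv_eq_inner (f := g)]
    refine lt_of_le_of_lt ?_ hn
    rw [le_div_iff₀ ht0]; linarith
  have key2 : ∀ v : ℂ, Tendsto (fun n => ⟪v, gradient (f n) p⟫) atTop (𝓝 ⟪v, gradient g p⟫) := by
    intro v
    rw [Metric.tendsto_nhds]
    intro e he
    filter_upwards [key v e he, key (-v) e he] with n h1 h2
    rw [inner_neg_left, inner_neg_left] at h2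
    rw [Real.dist_eq, abs_lt]; constructor <;> linarith
  have kr := key2 1
  have ki := key2 I
  simp only [inner_split, one_re, one_im, I_re, I_im, one_mul, zero_mul, add_zero, zero_add] at kr ki
  have := ((continuous_ofReal.tendsto _).comp kr).add (((continuous_ofReal.tendsto _).comp ki).mul_const I)
  simpa [Function.comp_def, re_add_im] using this

lemma ae_diff {f : ℂ → ℝ} (hL : LipschitzWith 1 f) : ∀ᵐ p, DifferentiableAt ℝ f p := hL.ae_differentiableAt

/-- weak convergence lemma -/
lemma WC {f : ℕ → ℂ → ℝ} {g : ℂ → ℝ} (hf : ∀ n, ConvexOn ℝ Set.univ (f n)) (hL : ∀ n, LipschitzWith 1 (f n)) (hLg : LipschitzWith 1 g)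
    (hlim : ∀ p, Tendsto (fun n => f n p) atTop (𝓝 (g p))) {M M' : ℝ} (hM : ∀ n p, ‖p‖ - M ≤ f n p) (hM' : ∀ n, f n 0 ≤ M')
    {η : ℂ → ℝ} (hη : Continuous η) (hc : HasCompactSupport η) (hs : tsupport η ⊆ ball 0 1) :
    Tendsto (fun n => ∫ p, η (gradient (f n) p)) atTop (𝓝 (∫ p, η (gradient g p))) := by
  obtain ⟨B, hB⟩ := hη.bounded_above_of_compact_support hc
  obtain ⟨ρ, hρ1, hρ'⟩ := exists_lt_subset_ball (isClosed_tsupport η) hs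
  have hρ : ∀ x, η x ≠ 0 → ‖x‖ ≤ ρ := fun x hx => by
    have := hρ' (subset_tsupport η hx)
    rw [mem_ball_zero_iff] at this; exact this.le
  set Rad := (M' + M) / (1 - ρ) with hRad
  have hintg : Integrable ((closedBall (0:ℂ) Rad).indicator fun _ => B) := 
    (integrable_indicator_iff measurableSet_closedBall).2 (integrableOn_const measure_closedBall_lt_top.ne)
  refine tendsto_integral_of_dominated_convergence _ (fun n => (hη.measurable.comp (measurable_gradient (f n))).aestronglyMeasurable) hintg (fun n => ?_) ?_
  · filter_upwards [ae_diff (hL n)] with p hp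
    by_cases h : η (gradient (f n) p) = 0
    · rw [h, norm_zero]
      apply Set.indicator_nonneg; intro _ _; exact (norm_nonneg _).trans (hB 0)
    · have h1 := hρ _ h
      have h2 := gradient_ineq (hf n) hp 0
      have h3 := hM n p
      have h4 := hM' n
      have h5 := real_inner_le_norm p (gradient (f n) p)
      have h6 : ‖p‖ * ‖gradient (f n) p‖ ≤ ‖p‖ * ρ := by gcongr
      rw [zero_sub, inner_neg_left] at h2
      have hm : p ∈ closedBall (0:ℂ) Rad := by
        rw [mem_closedBall_zero_iff, hRad, le_div_iff₀ (by linarith)]; linarith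
      rw [Set.indicator_of_mem hm]; exact hB _
  · filter_upwards [ae_all_iff.2 fun n => ae_diff (hL n), ae_diff hLg] with p hp hg
    exact (hη.tendsto _).comp (gradient_tendsto hf hlim hp hg)

end B0

section B1
open Complex MeasureTheory
open scoped ContDiff

/-- upper envelope data: boundary values `φ` on the circle and values `h` at the nodes `x` -/
structure IsEnv {ι : Type} (φ : ℂ → ℝ) (x : ι → ℂ) (h : ι → ℝ) (f : ℂ → ℝ) : Prop where
  bd : ∀ p, ∀ z ∈ sphere (0:ℂ) 1, ⟪p, z⟫ - φ z ≤ f p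
  node : ∀ p i, ⟪p, x i⟫ - h i ≤ f p
  att : ∀ p, (∃ z ∈ sphere (0:ℂ) 1, f p = ⟪p, z⟫ - φ z) ∨ ∃ i, f p = ⟪p, x i⟫ - h i

lemma exists_env {ι : Type} [Finite ι] {φ : ℂ → ℝ} (hφ : LowerSemicontinuousOn φ (sphere (0:ℂ) 1)) (x : ι → ℂ) (h : ι → ℝ) :
    ∃ f, IsEnv φ x h f := by
  have h1 : ∀ p : ℂ, ∃ z ∈ sphere (0:ℂ) 1, ∀ z' ∈ sphere (0:ℂ) 1, ⟪p, z'⟫ - φ z' ≤ ⟪p, z⟫ - φ z := by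
    intro p
    have hl : LowerSemicontinuousOn (fun z => φ z + (- ⟪p, z⟫)) (sphere (0:ℂ) 1) := by
      refine hφ.add (Continuous.lowerSemicontinuous ?_ |>.lowerSemicontinuousOn _)
      fun_prop
    obtain ⟨z, hz, hm⟩ := hl.exists_isMinOn (NormedSpace.sphere_nonempty.2 zero_le_one) (isCompact_sphere _ _)
    refine ⟨z, hz, fun z' hz' => ?_⟩
    have := hm hz'
    simp only [Set.mem_setOf_eq] at this
    linarith
  choose Z hZ hZm using h1
  have h2 : ∀ p : ℂ, ∃ o : Option ι, ∀ o' : Option ι, (o'.elim (⟪p, Z p⟫ - φ (Z p)) fun i => ⟪p, x i⟫ - h i) ≤ (o.elim (⟪p, Z p⟫ - φ (Z p)) fun i => ⟪p, x i⟫ - h i) :=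
    fun p => Finite.exists_max _
  choose o ho using h2
  refine ⟨fun p => (o p).elim (⟪p, Z p⟫ - φ (Z p)) fun i => ⟪p, x i⟫ - h i, fun p z hz => (hZm p z hz).trans (ho p none), fun p i => ho p (some i), fun p => ?_⟩
  cases hop : o p with
  | none => left; exact ⟨Z p, hZ p, by simp [hop]⟩
  | some i => right; exact ⟨i, by simp [hop]⟩

def envv {ι : Type} (φ : ℂ → ℝ) (x : ι → ℂ) (h : ι → ℝ) : ℂ → ℝ := by
  classical exact if H : ∃ f, IsEnv φ x h f then H.choose else 0

lemma envv_spec {ι : Type} [Finite ι] {φ : ℂ → ℝ} (hφ : LowerSemicontinuousOn φ (sphere (0:ℂ) 1)) (x : ι → ℂ) (h : ι → ℝ) : IsEnv φ x h (envv φ x h) := by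
  have H := exists_env hφ x h
  unfold envv
  rw [dif_pos H]; exact H.choose_spec

variable {ι : Type} {φ : ℂ → ℝ} {x : ι → ℂ} {h : ι → ℝ} {f : ℂ → ℝ}

/-- every value is attained by an affine minorant with slope in the closed disc -/
lemma IsEnv.sub (H : IsEnv φ x h f) (hx : ∀ i, ‖x i‖ < 1) (p : ℂ) : ∃ t, ‖t‖ ≤ 1 ∧ ∀ p', f p + ⟪p' - p, t⟫ ≤ f p' := by
  rcases H.att p with ⟨z, hz, e⟩ | ⟨i, e⟩
  · refine ⟨z, by simpa using hz.le, fun p' => ?_⟩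
    rw [e, inner_sub_left]; linarith [H.bd p' z hz]
  · refine ⟨x i, (hx i).le, fun p' => ?_⟩
    rw [e, inner_sub_left]; linarith [H.node p' i]

lemma convex_of_sub {f : ℂ → ℝ} (H : ∀ p, ∃ t : ℂ, ∀ p', f p + ⟪p' - p, t⟫ ≤ f p') : ConvexOn ℝ Set.univ f := by
  refine ⟨convex_univ, fun p _ q _ α β hα hβ hαβ => ?_⟩
  obtain ⟨t, ht⟩ := H (α • p + β • q)
  have h1 := mul_le_mul_of_nonneg_left (ht p) hα
  have h2 := mul_le_mul_of_nonneg_left (ht q) hβ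
  have e : α * ⟪p - (α • p + β • q), t⟫ + β * ⟪q - (α • p + β • q), t⟫ = 0 := by
    have : β = 1 - α := by linarith
    subst this
    simp only [inner_sub_left, inner_add_left, inner_smul_left, conj_trivial]; ring
  have e2 : α * f (α • p + β • q) + β * f (α • p + β • q) = f (α • p + β • q) := by rw [← add_mul, hαβ, one_mul]
  simp only [smul_eq_mul]
  linarith

lemma lip_of_sub {f : ℂ → ℝ} (H : ∀ p, ∃ t : ℂ, ‖t‖ ≤ 1 ∧ ∀ p', f p + ⟪p' - p, t⟫ ≤ f p') : LipschitzWith 1 f := by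
  have key : ∀ p q, f p - f q ≤ ‖p - q‖ := by
    intro p q
    obtain ⟨t, ht1, ht⟩ := H p
    have h1 := ht q
    have h2 := real_inner_le_norm (p - q) t
    have h3 : ‖p - q‖ * ‖t‖ ≤ ‖p - q‖ * 1 := by gcongr
    have h4 : ⟪q - p, t⟫ = - ⟪p - q, t⟫ := by rw [← inner_neg_left, neg_sub]
    linarith
  refine LipschitzWith.of_dist_le_mul fun p q => ?_
  rw [Real.dist_eq, dist_eq_norm, NNReal.coe_one, one_mul, abs_le]
  have := key q p
  rw [norm_sub_rev] at this
  exact ⟨by linarith, key p q⟩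

lemma IsEnv.convex (H : IsEnv φ x h f) (hx : ∀ i, ‖x i‖ < 1) : ConvexOn ℝ Set.univ f :=
  convex_of_sub fun p => let ⟨t, _, ht⟩ := H.sub hx p; ⟨t, ht⟩

lemma IsEnv.lip (H : IsEnv φ x h f) (hx : ∀ i, ‖x i‖ < 1) : LipschitzWith 1 f := lip_of_sub (H.sub hx)

lemma IsEnv.lower (H : IsEnv φ x h f) {M : ℝ} (hM : ∀ z ∈ sphere (0:ℂ) 1, |φ z| ≤ M) (p : ℂ) : ‖p‖ - M ≤ f p := by
  by_cases hp : p = 0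
  · have h1 : (1:ℂ) ∈ sphere (0:ℂ) 1 := by simp
    have := H.bd p 1 h1
    have h2 := hM 1 h1
    rw [hp] at this ⊢
    simp only [inner_zero_left, norm_zero] at *
    linarith [le_abs_self (φ 1)]
  · have hp' : 0 < ‖p‖ := norm_pos_iff.2 hp
    have h1 : (‖p‖⁻¹ • p : ℂ) ∈ sphere (0:ℂ) 1 := by
      rw [mem_sphere_zero_iff_norm, norm_smul, norm_inv, norm_norm, inv_mul_cancel₀ hp'.ne']
    have := H.bd p _ h1
    have h2 := hM _ h1
    rw [inner_smul_right, real_inner_self_eq_norm_sq, sq, ← mul_assoc, inv_mul_cancel₀ hp'.ne', one_mul] at this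
    linarith [le_abs_self (φ (‖p‖⁻¹ • p))]

/-- cells -/
def cell (x : ι → ℂ) (h : ι → ℝ) (f : ℂ → ℝ) (i : ι) : Set ℂ := {p | f p = ⟪p, x i⟫ - h i}

lemma IsEnv.cell_grad (H : IsEnv φ x h f) {i : ι} {p : ℂ} (hp : p ∈ cell x h f i) (hd : DifferentiableAt ℝ f p) : gradient f p = x i := by
  have e : f p = ⟪p, x i⟫ - h i := hp
  refine gradient_unique hd fun p' => ?_
  rw [e, inner_sub_left]; linarith [H.node p' i]

lemma IsEnv.nocell_grad (H : IsEnv φ x h f) {p : ℂ} (hp : ∀ i, p ∉ cell x h f i) (hd : DifferentiableAt ℝ f p) : ‖gradient f p‖ = 1 := by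
  rcases H.att p with ⟨z, hz, e⟩ | ⟨i, e⟩
  · rw [gradient_unique (x := z) hd]
    · simpa using hz
    · intro p'
      rw [e, inner_sub_left]; linarith [H.bd p' z hz]
  · exact absurd e (hp i)

lemma IsEnv.cell_closed (H : IsEnv φ x h f) (hx : ∀ i, ‖x i‖ < 1) (i : ι) : IsClosed (cell x h f i) :=
  isClosed_eq (H.lip hx).continuous (by fun_prop)

lemma IsEnv.cell_bdd (H : IsEnv φ x h f) {M : ℝ} (hM : ∀ z ∈ sphere (0:ℂ) 1, |φ z| ≤ M) (i : ι) {p : ℂ} (hp : p ∈ cell x h f i) : (1 - ‖x i‖) * ‖p‖ ≤ M - h i := by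
  have e : f p = ⟪p, x i⟫ - h i := hp
  have h1 := H.lower hM p
  have h2 := real_inner_le_norm p (x i)
  linarith

lemma IsEnv.cell_fin (H : IsEnv φ x h f) {M : ℝ} (hM : ∀ z ∈ sphere (0:ℂ) 1, |φ z| ≤ M) (hx : ∀ i, ‖x i‖ < 1) (i : ι) : volume (cell x h f i) < ⊤ := by
  refine lt_of_le_of_lt (measure_mono (t := closedBall (0:ℂ) ((M - h i) / (1 - ‖x i‖))) fun p hp => ?_) measure_closedBall_lt_top
  have := H.cell_bdd hM i hp
  have h0 : 0 < 1 - ‖x i‖ := by linarith [hx i]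
  rw [mem_closedBall_zero_iff, le_div_iff₀ h0]; linarith

/-- cell areas -/
def ar (x : ι → ℂ) (h : ι → ℝ) (f : ℂ → ℝ) (i : ι) : ℝ := (volume (cell x h f i)).toReal

lemma IsEnv.integral [Fintype ι] (H : IsEnv φ x h f) {M : ℝ} (hM : ∀ z ∈ sphere (0:ℂ) 1, |φ z| ≤ M) (hx : ∀ i, ‖x i‖ < 1) (hinj : Function.Injective x)
    {η : ℂ → ℝ} (hs : ∀ z, 1 ≤ ‖z‖ → η z = 0) : ∫ p, η (gradient f p) = ∑ i, η (x i) * ar x h f i := by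
  classical
  have e : ∀ᵐ p, η (gradient f p) = ∑ i, (cell x h f i).indicator (fun _ => η (x i)) p := by
    filter_upwards [ae_diff (H.lip hx)] with p hp
    by_cases hc : ∃ i, p ∈ cell x h f i
    · obtain ⟨i, hi⟩ := hc
      rw [H.cell_grad hi hp, Finset.sum_eq_single i]
      · rw [Set.indicator_of_mem hi]
      · intro j _ hj
        rw [Set.indicator_of_notMem]
        intro hj'
        exact hj (hinj ((H.cell_grad hj' hp).symm.trans (H.cell_grad hi hp)))
      · simp
    · push Not at hc
      rw [hs _ (H.nocell_grad hc hp).ge, Finset.sum_eq_zero]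
      intro i _
      rw [Set.indicator_of_notMem (hc i)]
  rw [integral_congr_ae e, integral_finset_sum]
  · refine Finset.sum_congr rfl fun i _ => ?_
    rw [integral_indicator (H.cell_closed hx i).measurableSet, setIntegral_const, smul_eq_mul, mul_comm]; rfl
  · intro i _
    exact (integrable_indicator_iff (H.cell_closed hx i).measurableSet).2 (integrableOn_const (H.cell_fin hM hx i).ne)

/-- tent functions -/
lemma exists_tent [Finite ι] (hx : ∀ i, ‖x i‖ < 1) (hinj : Function.Injective x) (i : ι) : ∃ η : ℂ → ℝ, Continuous η ∧ HasCompactSupport η ∧ tsupport η ⊆ ball 0 1 ∧ η (x i) = 1 ∧ ∀ j ≠ i, η (x j) = 0 := by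
  have ho : IsOpen (ball (0:ℂ) 1 ∩ (x '' {j | j ≠ i})ᶜ) := isOpen_ball.inter (Set.toFinite _).isClosed.isOpen_compl
  have hm : x i ∈ ball (0:ℂ) 1 ∩ (x '' {j | j ≠ i})ᶜ := by
    refine ⟨by simpa using hx i, ?_⟩
    rintro ⟨j, hj, e⟩; exact hj (hinj e)
  obtain ⟨η, hη1, hη2, hη3⟩ := exists_tsupport_one_of_isOpen_isClosed ho
    ((isCompact_closedBall (0:ℂ) 1).of_isClosed_subset isClosed_closure (closure_minimal (fun p hp => ball_subset_closedBall hp.1) isClosed_closedBall))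
    (isClosed_singleton (x := x i)) (Set.singleton_subset_iff.2 hm)
  refine ⟨η, η.continuous, ?_, hη1.trans Set.inter_subset_left, hη2 rfl, fun j hj => ?_⟩
  · exact (isCompact_closedBall (0:ℂ) 1).of_isClosed_subset (isClosed_tsupport _) ((hη1.trans Set.inter_subset_left).trans ball_subset_closedBall)
  · by_contra hne
    exact (hη1 (subset_tsupport _ hne)).2 ⟨j, hj, rfl⟩

lemma IsEnv.mono {h' : ι → ℝ} {f' : ℂ → ℝ} (H : IsEnv φ x h f) (H' : IsEnv φ x h' f') {c : ℝ} (hc : 0 ≤ c) (hh : ∀ i, h' i ≤ h i + c) (p : ℂ) : f p ≤ f' p + c := by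
  rcases H.att p with ⟨z, hz, e⟩ | ⟨i, e⟩
  · linarith [H'.bd p z hz]
  · linarith [H'.node p i, hh i]

lemma tsupp_van {η : ℂ → ℝ} (hs : tsupport η ⊆ ball 0 1) (z : ℂ) (hz : 1 ≤ ‖z‖) : η z = 0 := by
  by_contra hne
  have := hs (subset_tsupport η hne)
  rw [mem_ball_zero_iff] at this; linarith

lemma ar_cont [Fintype ι] (hφ : LowerSemicontinuousOn φ (sphere (0:ℂ) 1)) {M : ℝ} (hM : ∀ z ∈ sphere (0:ℂ) 1, |φ z| ≤ M) (hx : ∀ i, ‖x i‖ < 1) (hinj : Function.Injective x) (i : ι) :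
    Continuous fun h : ι → ℝ => ar x h (envv φ x h) i := by
  obtain ⟨η, h1, h2, h3, h4, h5⟩ := exists_tent hx hinj i
  have e : ∀ h : ι → ℝ, ar x h (envv φ x h) i = ∫ p, η (gradient (envv φ x h) p) := by
    intro h
    rw [(envv_spec hφ x h).integral hM hx hinj (tsupp_van h3), Finset.sum_eq_single i, h4, one_mul]
    · intro j _ hj; rw [h5 j hj, zero_mul]
    · simp
  simp_rw [e]
  rw [continuous_iff_seqContinuous]
  intro u h hu
  have hlim : ∀ p, Tendsto (fun n => envv φ x (u n) p) atTop (𝓝 (envv φ x h p)) := by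
    intro p
    have hd : Tendsto (fun n => dist (u n) h) atTop (𝓝 0) := tendsto_iff_dist_tendsto_zero.1 hu
    rw [tendsto_iff_dist_tendsto_zero]
    refine squeeze_zero (fun _ => dist_nonneg) (fun n => ?_) hd
    have hh : ∀ j, |u n j - h j| ≤ dist (u n) h := fun j => by rw [← Real.dist_eq]; exact dist_le_pi_dist _ _ j
    have k1 := (envv_spec hφ x (u n)).mono (envv_spec hφ x h) (c := dist (u n) h) dist_nonneg (fun j => by linarith [neg_abs_le (u n j - h j), hh j]) p
    have k2 := (envv_spec hφ x h).mono (envv_spec hφ x (u n)) (c := dist (u n) h) dist_nonneg (fun j => by linarith [le_abs_self (u n j - h j), hh j]) p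
    rw [Real.dist_eq, abs_le]; constructor <;> linarith
  obtain ⟨M', hM'⟩ := (hlim 0).bddAbove_range
  exact WC (fun n => (envv_spec hφ x _).convex hx) (fun n => (envv_spec hφ x _).lip hx) ((envv_spec hφ x _).lip hx) hlim
    (fun n p => (envv_spec hφ x _).lower hM p) (fun n => hM' ⟨n, rfl⟩) h1 h2 h3

end B1

section B2
open Complex MeasureTheory
open scoped ContDiff

variable {ι : Type} {φ : ℂ → ℝ} {x : ι → ℂ}

def h0 (x : ι → ℂ) (i : ι) : ℝ := - √(1 - ‖x i‖ ^ 2)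

lemma cs_sqrt {C : ℝ} (hC : 0 ≤ C) {w y : ℂ} (hy : ‖y‖ ≤ 1) : ⟪w, y⟫ + C * √(1 - ‖y‖ ^ 2) ≤ √(C ^ 2 + ‖w‖ ^ 2) := by
  have h1 := real_inner_le_norm w y
  have hs : 0 ≤ 1 - ‖y‖ ^ 2 := by nlinarith [norm_nonneg y]
  have h2 := Real.sq_sqrt hs
  set s := √(1 - ‖y‖ ^ 2)
  have hs0 : 0 ≤ s := Real.sqrt_nonneg _
  refine le_trans (add_le_add_left h1 _) (Real.le_sqrt_of_sq_le ?_)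
  have : C ^ 2 + ‖w‖ ^ 2 - (‖w‖ * ‖y‖ + C * s) ^ 2 = (C * ‖y‖ - ‖w‖ * s) ^ 2 := by
    have : s ^ 2 = 1 - ‖y‖ ^ 2 := h2
    linear_combination (- C ^ 2 - ‖w‖ ^ 2) * this
  nlinarith [sq_nonneg (C * ‖y‖ - ‖w‖ * s)]

open scoped Pointwise in
lemma vol_affine (S : Set ℂ) (a : ℂ) {C : ℝ} (hC : 0 ≤ C) : volume ((fun p => a + C • p) '' S) = ENNReal.ofReal (C ^ 2) * volume S := by
  have e : (fun p : ℂ => a + C • p) '' S = (fun p => a + p) '' (C • S) := by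
    rw [← Set.image_smul, Set.image_image]
  rw [e, Set.image_add_left, measure_preimage_add, Measure.addHaar_smul, Complex.finrank_real_complex, abs_of_nonneg (by positivity)]

lemma ar_mono [Fintype ι] (hφ : LowerSemicontinuousOn φ (sphere (0:ℂ) 1)) {M : ℝ} (hM : ∀ z ∈ sphere (0:ℂ) 1, |φ z| ≤ M) (hx : ∀ i, ‖x i‖ < 1) 
    {h h' : ι → ℝ} (hh : ∀ i, h i ≤ h' i) (i : ι) (e : h i = h' i) : ar x h (envv φ x h) i ≤ ar x h' (envv φ x h') i := by
  refine ENNReal.toReal_mono ((envv_spec hφ x h').cell_fin hM hx i).ne (measure_mono fun p hp => ?_)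
  have hp : envv φ x h p = ⟪p, x i⟫ - h i := hp
  have h1 := (envv_spec hφ x h').mono (envv_spec hφ x h) le_rfl (fun j => by linarith [hh j]) p
  have h2 := (envv_spec hφ x h').node p i
  show envv φ x h' p = ⟪p, x i⟫ - h' i
  linarith

lemma ar_affine [Fintype ι] (hφ : LowerSemicontinuousOn φ (sphere (0:ℂ) 1)) {M : ℝ} (hM : ∀ z ∈ sphere (0:ℂ) 1, |φ z| ≤ M) (hx : ∀ i, ‖x i‖ < 1)
    {C : ℝ} (hC : 0 ≤ C) (a : ℂ) (c : ℝ) (hl : ∀ z ∈ sphere (0:ℂ) 1, ⟪a, z⟫ + c ≤ φ z) {f0 : ℂ → ℝ} (H0 : IsEnv (fun _ => 0) x (h0 x) f0) (i : ι) :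
    C ^ 2 * ar x (h0 x) f0 i ≤ ar x (fun i => ⟪a, x i⟫ + c + C * h0 x i) (envv φ x (fun i => ⟪a, x i⟫ + c + C * h0 x i)) i := by
  have H := envv_spec hφ x (fun i => ⟪a, x i⟫ + c + C * h0 x i)
  have e : C ^ 2 * ar x (h0 x) f0 i = (volume ((fun p => a + C • p) '' (cell x (h0 x) f0 i))).toReal := by
    rw [vol_affine _ _ hC, ENNReal.toReal_mul, ENNReal.toReal_ofReal (by positivity)]; rfl
  rw [e]
  refine ENNReal.toReal_mono (H.cell_fin hM hx i).ne (measure_mono ?_)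
  rintro _ ⟨p0, hp0, rfl⟩
  have hp0 : f0 p0 = ⟪p0, x i⟫ - h0 x i := hp0
  refine le_antisymm ?_ (H.node _ i)
  have hp1 : C * f0 p0 = C * ⟪p0, x i⟫ - C * h0 x i := by rw [hp0]; ring
  rcases H.att (a + C • p0) with ⟨z, hz, e⟩ | ⟨j, e⟩
  · beta_reduce
    rw [e]
    have h1 := mul_le_mul_of_nonneg_left (H0.bd p0 z hz) hC
    have h2 := hl z hz
    simp only [inner_add_left, inner_smul_left, conj_trivial]
    linarith
  · beta_reduce
    rw [e]
    have h1 := mul_le_mul_of_nonneg_left (H0.node p0 j) hC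
    simp only [inner_add_left, inner_smul_left, conj_trivial]
    linarith

lemma affine_le {a y : ℂ} {c M : ℝ} (h : ∀ z ∈ sphere (0:ℂ) 1, ⟪a, z⟫ + c ≤ M) (hy : ‖y‖ ≤ 1) : ⟪a, y⟫ + c ≤ M := by
  by_cases ha : a = 0
  · have := h 1 (by simp)
    rw [ha] at this ⊢
    simpa using this
  · have hp' : 0 < ‖a‖ := norm_pos_iff.2 ha
    have h1 : (‖a‖⁻¹ • a : ℂ) ∈ sphere (0:ℂ) 1 := by
      rw [mem_sphere_zero_iff_norm, norm_smul, norm_inv, norm_norm, inv_mul_cancel₀ hp'.ne']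
    have := h _ h1
    rw [inner_smul_right, real_inner_self_eq_norm_sq, sq, ← mul_assoc, inv_mul_cancel₀ hp'.ne', one_mul] at this
    have h2 := real_inner_le_norm a y
    have h3 : ‖a‖ * ‖y‖ ≤ ‖a‖ * 1 := by gcongr
    linarith

set_option maxHeartbeats 1000000 in
lemma discrete [Fintype ι] (hφ : LowerSemicontinuousOn φ (sphere (0:ℂ) 1)) {M : ℝ} (hM : ∀ z ∈ sphere (0:ℂ) 1, |φ z| ≤ M) (hx : ∀ i, ‖x i‖ < 1) (hinj : Function.Injective x)
    {ψ : ℂ → ℝ} {A C : ℝ} (hA : 0 < A) (hψ : ∀ z, ‖z‖ < 1 → A ≤ ψ z) (hC : 0 ≤ C) (hCA : 1 ≤ C ^ 2 * A) :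
    ∃ f : ℂ → ℝ, ConvexOn ℝ Set.univ f ∧ LipschitzWith 1 f ∧ (∀ p, ‖p‖ - M ≤ f p) ∧ (∀ p, ∀ z ∈ sphere (0:ℂ) 1, ⟪p, z⟫ - φ z ≤ f p) ∧
      (∀ (a : ℂ) (c : ℝ), (∀ z ∈ sphere (0:ℂ) 1, ⟪a, z⟫ + c ≤ φ z) → ∀ p, f p ≤ - c + √(C ^ 2 + ‖p - a‖ ^ 2)) ∧
      ∀ η : ℂ → ℝ, (∀ z, 1 ≤ ‖z‖ → η z = 0) → ∫ p, η (gradient f p) = ∫ p, η (gradient (envv (fun _ => 0) x (h0 x)) p) / ψ (gradient (envv (fun _ => 0) x (h0 x)) p) := by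
  classical
  have hφ0 : LowerSemicontinuousOn (fun _ : ℂ => (0:ℝ)) (sphere (0:ℂ) 1) := continuousOn_const.lowerSemicontinuousOn
  have H0 := envv_spec hφ0 x (h0 x)
  set f0 := envv (fun _ => 0) x (h0 x) with hf0
  set m : ι → ℝ := fun i => ar x (h0 x) f0 i / ψ (x i) with hm
  have hψi : ∀ i, 0 < ψ (x i) := fun i => hA.trans_le (hψ _ (hx i))
  have har : ∀ i, 0 ≤ ar x (h0 x) f0 i := fun i => ENNReal.toReal_nonneg
  have hm0 : ∀ i, 0 ≤ m i := fun i => div_nonneg (har i) (hψi i).le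
  have hmC : ∀ i, m i ≤ C ^ 2 * ar x (h0 x) f0 i := by
    intro i
    rw [hm]; beta_reduce
    rw [div_le_iff₀ (hψi i)]
    have h1 : C ^ 2 * A ≤ C ^ 2 * ψ (x i) := mul_le_mul_of_nonneg_left (hψ _ (hx i)) (by positivity)
    nlinarith [har i, mul_nonneg (har i) (sub_nonneg.2 (hCA.trans h1))]
  set S : Set (ι → ℝ) := {h | ∀ i, m i ≤ ar x h (envv φ x h) i} with hS
  have hlS : ∀ (a : ℂ) (c : ℝ), (∀ z ∈ sphere (0:ℂ) 1, ⟪a, z⟫ + c ≤ φ z) → (fun i => ⟪a, x i⟫ + c + C * h0 x i) ∈ S :=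
    fun a c hl i => (hmC i).trans (ar_affine hφ hM hx hC a c hl H0 i)
  have hlM : ∀ (a : ℂ) (c : ℝ), (∀ z ∈ sphere (0:ℂ) 1, ⟪a, z⟫ + c ≤ φ z) → ∀ i, ⟪a, x i⟫ + c + C * h0 x i ≤ M := by
    intro a c hl i
    have h1 := affine_le (fun z hz => (hl z hz).trans ((le_abs_self _).trans (hM z hz))) (hx i).le
    have h2 : 0 ≤ C * √(1 - ‖x i‖ ^ 2) := by positivity
    unfold h0; linarith
  set hlow : ι → ℝ := fun i => ⟪(0:ℂ), x i⟫ + (-M) + C * h0 x i with hhlow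
  have hl0 : ∀ z ∈ sphere (0:ℂ) 1, ⟪(0:ℂ), z⟫ + (-M) ≤ φ z := fun z hz => by
    rw [inner_zero_left]; linarith [neg_abs_le (φ z), hM z hz]
  set K : Set (ι → ℝ) := S ∩ Set.Icc hlow (fun _ => M + 1) with hK
  have hScl : IsClosed S := by
    rw [hS, Set.setOf_forall]
    exact isClosed_iInter fun i => isClosed_le continuous_const (ar_cont hφ hM hx hinj i)
  have hKc : IsCompact K := isCompact_Icc.inter_left hScl
  have hKne : K.Nonempty := ⟨hlow, hlS 0 (-M) hl0, le_rfl, fun i => (hlM 0 (-M) hl0 i).trans (by linarith)⟩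
  obtain ⟨h, ⟨hhS, hh1, hh2⟩, hmax⟩ := hKc.exists_isMaxOn hKne (f := fun h : ι → ℝ => ∑ i, h i) (by fun_prop)
  have hmax' : ∀ h' ∈ K, ∑ i, h' i ≤ ∑ i, h i := fun h' hh' => hmax hh'
  have Hf := envv_spec hφ x h
  -- equality of areas
  have heq : ∀ i, ar x h (envv φ x h) i = m i := by
    intro i
    refine le_antisymm ?_ (hhS i)
    by_contra hlt
    push Not at hlt
    have hne : (cell x h (envv φ x h) i).Nonempty := by
      by_contra hem
      rw [Set.not_nonempty_iff_eq_empty] at hem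
      rw [ar, hem] at hlt
      simp at hlt
      linarith [hm0 i]
    obtain ⟨p, hp⟩ := hne
    have hhM : h i ≤ M := by
      have := Hf.cell_bdd hM i hp
      nlinarith [hx i, norm_nonneg p]
    have hcont : Continuous fun ε : ℝ => ar x (Function.update h i (h i + ε)) (envv φ x (Function.update h i (h i + ε))) i :=
      (ar_cont hφ hM hx hinj i).comp (continuous_const.update i (by fun_prop))
    have hev : ∀ᶠ ε in 𝓝 (0:ℝ), m i < ar x (Function.update h i (h i + ε)) (envv φ x (Function.update h i (h i + ε))) i := by
      have := hcont.tendsto 0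
      refine this.eventually_const_lt ?_
      simpa using hlt
    obtain ⟨r, hr, hr'⟩ := Metric.eventually_nhds_iff.1 hev
    set ε := min (r / 2) 1 with hε
    have hε0 : 0 < ε := lt_min (by linarith) one_pos
    have h1 := hr' (y := ε) (by rw [dist_zero_right, Real.norm_eq_abs, abs_of_pos hε0]; linarith [min_le_left (r/2) 1])
    have hup : ∀ j, h j ≤ Function.update h i (h i + ε) j := by
      intro j
      by_cases hj : j = i
      · subst hj; simp [hε0.le]
      · simp [hj]
    have h2 : Function.update h i (h i + ε) ∈ K := by
      refine ⟨fun j => ?_, fun j => (hh1 j).trans (hup j), fun j => ?_⟩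
      · by_cases hj : j = i
        · subst hj; exact h1.le
        · exact (hhS j).trans (ar_mono hφ hM hx hup j (by simp [hj]))
      · by_cases hj : j = i
        · subst hj; simp; linarith [min_le_right (r/2) 1]
        · simpa [hj] using hh2 j
    have h3 := hmax' _ h2
    have h4 : ∑ j, h j < ∑ j, Function.update h i (h i + ε) j :=
      Finset.sum_lt_sum (fun j _ => hup j) ⟨i, Finset.mem_univ _, by simp [hε0]⟩
    linarith
  have hdom : ∀ (a : ℂ) (c : ℝ), (∀ z ∈ sphere (0:ℂ) 1, ⟪a, z⟫ + c ≤ φ z) → ∀ i, ⟪a, x i⟫ + c + C * h0 x i ≤ h i := by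
    intro a c hl i
    set hh := fun i => ⟪a, x i⟫ + c + C * h0 x i with hhd
    have hmem := hlS a c hl
    have h1 : hh ⊔ h ∈ K := by
      refine ⟨fun j => ?_, fun j => (hh1 j).trans le_sup_right, fun j => sup_le ((hlM a c hl j).trans (by simp)) (hh2 j)⟩
      rcases le_total (hh j) (h j) with hc | hc
      · exact (hhS j).trans (ar_mono hφ hM hx (fun k => le_sup_right) j (sup_eq_right.2 hc).symm)
      · exact (hmem j).trans (ar_mono hφ hM hx (fun k => le_sup_left) j (sup_eq_left.2 hc).symm)
    by_contra hlt
    push Not at hlt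
    have h3 := hmax' _ h1
    have h4 : ∑ j, h j < ∑ j, (hh ⊔ h) j :=
      Finset.sum_lt_sum (fun j _ => le_sup_right) ⟨i, Finset.mem_univ _, lt_of_lt_of_le hlt le_sup_left⟩
    linarith
  refine ⟨envv φ x h, Hf.convex hx, Hf.lip hx, Hf.lower hM, Hf.bd, ?_, ?_⟩
  · intro a c hl p
    rcases Hf.att p with ⟨z, hz, e⟩ | ⟨i, e⟩
    · have h1 := hl z hz
      have hz1 : ‖z‖ = 1 := by simpa using hz
      have h2 := cs_sqrt hC (w := p - a) (y := z) hz1.le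
      rw [hz1] at h2
      simp only [one_pow, sub_self, Real.sqrt_zero, mul_zero, add_zero, inner_sub_left] at h2
      rw [e]; linarith
    · have h1 := hdom a c hl i
      have h2 := cs_sqrt hC (w := p - a) (y := x i) (hx i).le
      rw [inner_sub_left] at h2
      unfold h0 at h1
      rw [e]; linarith
  · intro η hη
    rw [Hf.integral hM hx hinj hη]
    have := H0.integral (M := 0) (by simp) hx hinj (η := fun z => η z / ψ z) (fun z hz => by simp [hη z hz])
    rw [this]
    refine Finset.sum_congr rfl fun i _ => ?_
    rw [heq i, hm]; beta_reduce; ring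

end B2

section B3
open Complex MeasureTheory
open scoped ContDiff

lemma lip_le {f : ℂ → ℝ} (hL : LipschitzWith 1 f) (p q : ℂ) : |f p - f q| ≤ dist p q := by
  have := hL.dist_le_mul p q
  rwa [Real.dist_eq, NNReal.coe_one, one_mul] at this

/-- compactness for 1-Lipschitz functions -/
lemma lip_subseq {f : ℕ → ℂ → ℝ} (hL : ∀ n, LipschitzWith 1 (f n)) {lo up : ℂ → ℝ} (hlo : ∀ n p, lo p ≤ f n p) (hup : ∀ n p, f n p ≤ up p) :
    ∃ σ : ℕ → ℕ, StrictMono σ ∧ ∃ g : ℂ → ℝ, LipschitzWith 1 g ∧ ∀ p, Tendsto (fun n => f (σ n) p) atTop (𝓝 (g p)) := by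
  obtain ⟨d, hd⟩ := TopologicalSpace.exists_dense_seq ℂ
  have hc : IsCompact (Set.univ.pi fun k : ℕ => Set.Icc (lo (d k)) (up (d k))) := isCompact_univ_pi fun k => isCompact_Icc
  obtain ⟨a, -, σ, hσ, ha⟩ := hc.tendsto_subseq (x := fun n k => f n (d k)) (fun n k _ => ⟨hlo n _, hup n _⟩)
  rw [tendsto_pi_nhds] at ha
  have hcau : ∀ p, CauchySeq fun n => f (σ n) p := by
    intro p
    rw [Metric.cauchySeq_iff]
    intro e he
    obtain ⟨k, hk⟩ := hd.exists_dist_lt p (show 0 < e / 3 by linarith)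
    obtain ⟨N, hN⟩ := Metric.cauchySeq_iff.1 (ha k).cauchySeq (e / 3) (by linarith)
    refine ⟨N, fun m hm n hn => ?_⟩
    have h1 := hN m hm n hn
    have h2 := lip_le (hL (σ m)) p (d k)
    have h3 := lip_le (hL (σ n)) p (d k)
    simp only [Function.comp_apply, Real.dist_eq] at h1 ⊢
    rw [abs_lt] at *
    rw [abs_le] at *
    constructor <;> linarith [h1.1, h1.2, h2.1, h2.2, h3.1, h3.2]
  choose g hg using fun p => cauchySeq_tendsto_of_complete (hcau p)
  refine ⟨σ, hσ, g, ?_, hg⟩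
  refine LipschitzWith.of_dist_le_mul fun p q => ?_
  exact le_of_tendsto' ((hg p).dist (hg q)) fun n => (hL (σ n)).dist_le_mul p q

/-- hyperboloid -/
def hyp (p : ℂ) : ℝ := √(1 + ‖p‖ ^ 2)

lemma hyp_pos (p : ℂ) : 0 < hyp p := Real.sqrt_pos.2 (by positivity)

lemma hyp_sq (p : ℂ) : hyp p ^ 2 = 1 + ‖p‖ ^ 2 := Real.sq_sqrt (by positivity)

lemma hyp_grad (p : ℂ) : HasGradientAt hyp ((hyp p)⁻¹ • p) p := by
  rw [hasGradientAt_iff_hasFDerivAt]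
  have h1 : HasFDerivAt (fun p : ℂ => 1 + ‖p‖ ^ 2) (2 • (innerSL ℝ p)) p := by
    simpa using (hasStrictFDerivAt_norm_sq p).hasFDerivAt.const_add 1
  have h2 := h1.sqrt (by positivity)
  refine h2.congr_fderiv ?_
  ext v
  all_goals
    simp only [hyp, InnerProductSpace.toDual_apply_apply, inner_smul_left]
    simp [innerSL_apply_apply]
    field_simp

lemma hyp_sub (p p' : ℂ) : hyp p + ⟪p' - p, (hyp p)⁻¹ • p⟫ ≤ hyp p' := by
  have h1 : ‖(hyp p)⁻¹ • p‖ ^ 2 = 1 - (hyp p)⁻¹ ^ 2 := by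
    rw [norm_smul, mul_pow, norm_inv, Real.norm_eq_abs, abs_of_pos (hyp_pos p)]
    have := hyp_sq p
    have := hyp_pos p
    field_simp; linarith
  have h0 : ‖(hyp p)⁻¹ • p‖ ≤ 1 := by
    have : 0 ≤ (hyp p)⁻¹ ^ 2 := by positivity
    nlinarith [norm_nonneg ((hyp p)⁻¹ • p)]
  have h2 := cs_sqrt (C := 1) zero_le_one (w := p') h0
  rw [h1, sub_sub_cancel, Real.sqrt_sq (inv_nonneg.2 (hyp_pos p).le), one_pow] at h2
  refine le_trans (le_of_eq ?_) h2
  rw [inner_sub_left, inner_smul_right, inner_smul_right, real_inner_self_eq_norm_sq]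
  have := hyp_sq p
  have := hyp_pos p
  field_simp; linarith

lemma hyp_norm_lt (p : ℂ) : ‖(hyp p)⁻¹ • p‖ < 1 := by
  rw [norm_smul, norm_inv, Real.norm_eq_abs, abs_of_pos (hyp_pos p), inv_mul_lt_iff₀ (hyp_pos p), mul_one]
  exact Real.lt_sqrt_of_sq_lt (by linarith)

lemma hyp_lip : LipschitzWith 1 hyp := lip_of_sub fun p => ⟨_, (hyp_norm_lt p).le, hyp_sub p⟩

/-- test functions divided by positive weight -/
lemma div_cont {η ψ : ℂ → ℝ} (hη : Continuous η) (hs : tsupport η ⊆ ball 0 1) (hψ : ContinuousOn ψ (ball 0 1)) (hpos : ∀ z, ‖z‖ < 1 → 0 < ψ z) :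
    Continuous fun z => η z / ψ z := by
  rw [continuous_iff_continuousAt]
  intro z
  by_cases hz : z ∈ tsupport η
  · have hz' := hs hz
    exact hη.continuousAt.div (hψ.continuousAt (isOpen_ball.mem_nhds hz')) (hpos z (by simpa using hz')).ne'
  · have : (fun z => η z / ψ z) =ᶠ[𝓝 z] fun _ => 0 := by
      filter_upwards [(isClosed_tsupport η).isOpen_compl.mem_nhds hz] with w hw
      rw [image_eq_zero_of_notMem_tsupport hw, zero_div]
    exact continuousAt_const.congr this.symm

set_option maxHeartbeats 1000000 in
lemma exists_weak0 {φ : ℂ → ℝ} (hφ : LowerSemicontinuousOn φ (sphere (0:ℂ) 1)) {M : ℝ} (hM : ∀ z ∈ sphere (0:ℂ) 1, |φ z| ≤ M)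
    {ψ : ℂ → ℝ} {A C : ℝ} (hA : 0 < A) (hψc : ContinuousOn ψ (ball 0 1)) (hψ : ∀ z, ‖z‖ < 1 → A ≤ ψ z) (hC : 0 ≤ C) (hCA : 1 ≤ C ^ 2 * A) :
    ∃ f : ℂ → ℝ, ConvexOn ℝ Set.univ f ∧ LipschitzWith 1 f ∧ (∀ p, ‖p‖ - M ≤ f p) ∧ (∀ p, ∀ z ∈ sphere (0:ℂ) 1, ⟪p, z⟫ - φ z ≤ f p) ∧
      (∀ (a : ℂ) (c : ℝ), (∀ z ∈ sphere (0:ℂ) 1, ⟪a, z⟫ + c ≤ φ z) → ∀ p, f p ≤ - c + √(C ^ 2 + ‖p - a‖ ^ 2)) ∧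
      ∀ η : ℂ → ℝ, Continuous η → HasCompactSupport η → tsupport η ⊆ ball 0 1 → ∫ p, η (gradient f p) = ∫ p, η (gradient hyp p) / ψ (gradient hyp p) := by
  classical
  obtain ⟨d, hd⟩ := TopologicalSpace.exists_dense_seq (ball (0:ℂ) 1)
  set s : ℕ → Finset ℂ := fun n => (Finset.range n).image (fun k => (d k : ℂ)) with hs
  have hsx : ∀ n, ∀ i : s n, ‖(i:ℂ)‖ < 1 := by
    intro n i
    obtain ⟨k, -, hk⟩ := Finset.mem_image.1 i.2
    rw [← hk]; exact mem_ball_zero_iff.1 (d k).2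
  have hφ0 : LowerSemicontinuousOn (fun _ : ℂ => (0:ℝ)) (sphere (0:ℂ) 1) := continuousOn_const.lowerSemicontinuousOn
  choose f f1 f2 f3 f4 f5 f6 using fun n => discrete hφ hM (hsx n) Subtype.val_injective hA hψ hC hCA
  set f0 : ℕ → ℂ → ℝ := fun n => envv (fun _ => 0) (Subtype.val : s n → ℂ) (h0 Subtype.val) with hf0
  have H0 : ∀ n, IsEnv (fun _ => 0) (Subtype.val : s n → ℂ) (h0 Subtype.val) (f0 n) := fun n => envv_spec hφ0 _ _
  have hle : ∀ n p, f0 n p ≤ hyp p := by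
    intro n p
    rcases (H0 n).att p with ⟨z, hz, e⟩ | ⟨i, e⟩
    · have hz1 : ‖z‖ = 1 := by simpa using hz
      have h2 := cs_sqrt zero_le_one (w := p) (y := z) hz1.le
      rw [hz1] at h2
      simp only [one_pow, sub_self, Real.sqrt_zero, mul_zero, add_zero] at h2
      rw [e, hyp]; linarith
    · have h2 := cs_sqrt zero_le_one (w := p) (y := i) (hsx n i).le
      rw [one_pow] at h2
      rw [e, hyp, h0]; linarith
  have hlim0 : ∀ p, Tendsto (fun n => f0 n p) atTop (𝓝 (hyp p)) := by
    intro p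
    rw [tendsto_order]
    refine ⟨fun b hb => ?_, fun b hb => Filter.Eventually.of_forall fun n => (hle n p).trans_lt hb⟩
    set y : ball (0:ℂ) 1 := ⟨(hyp p)⁻¹ • p, by simpa using hyp_norm_lt p⟩ with hy
    have hcon : Continuous fun y : ball (0:ℂ) 1 => ⟪p, (y:ℂ)⟫ + √(1 - ‖(y:ℂ)‖ ^ 2) := by fun_prop
    have hyv : ⟪p, (y:ℂ)⟫ + √(1 - ‖(y:ℂ)‖ ^ 2) = hyp p := by
      have h1 : ‖(hyp p)⁻¹ • p‖ ^ 2 = 1 - (hyp p)⁻¹ ^ 2 := by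
        rw [norm_smul, mul_pow, norm_inv, Real.norm_eq_abs, abs_of_pos (hyp_pos p)]
        have := hyp_sq p
        have := hyp_pos p
        field_simp; linarith
      rw [hy]; dsimp only
      rw [h1, sub_sub_cancel, Real.sqrt_sq (inv_nonneg.2 (hyp_pos p).le), inner_smul_right, real_inner_self_eq_norm_sq]
      have := hyp_sq p
      have := hyp_pos p
      field_simp; linarith
    have hop : IsOpen {y : ball (0:ℂ) 1 | b < ⟪p, (y:ℂ)⟫ + √(1 - ‖(y:ℂ)‖ ^ 2)} := isOpen_lt continuous_const hcon
    obtain ⟨_, hk, k, rfl⟩ := hd.inter_open_nonempty _ hop ⟨y, by rw [Set.mem_setOf_eq, hyv]; exact hb⟩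
    filter_upwards [eventually_gt_atTop k] with n hn
    have := (H0 n).node p ⟨(d k : ℂ), Finset.mem_image.2 ⟨k, Finset.mem_range.2 hn, rfl⟩⟩
    rw [h0] at this
    have hk' : b < ⟪p, (d k : ℂ)⟫ + √(1 - ‖(d k : ℂ)‖ ^ 2) := hk
    dsimp only at this
    linarith
  have hl0 : ∀ z ∈ sphere (0:ℂ) 1, ⟪(0:ℂ), z⟫ + (-M) ≤ φ z := fun z hz => by
    rw [inner_zero_left]; linarith [neg_abs_le (φ z), hM z hz]
  obtain ⟨σ, hσ, g, hg1, hg2⟩ := lip_subseq f2 f3 (fun n p => f5 n 0 (-M) hl0 p)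
  have hσt := hσ.tendsto_atTop
  have hgc : ConvexOn ℝ Set.univ g := by
    refine ⟨convex_univ, fun p _ q _ α β hα hβ hαβ => ?_⟩
    exact le_of_tendsto_of_tendsto' (hg2 _) (((hg2 p).const_smul α).add ((hg2 q).const_smul β)) fun n => (f1 (σ n)).2 trivial trivial hα hβ hαβ
  refine ⟨g, hgc, hg1, fun p => ge_of_tendsto' (hg2 p) fun n => f3 _ p, fun p z hz => ge_of_tendsto' (hg2 p) fun n => f4 _ p z hz, fun a c hl p => le_of_tendsto' (hg2 p) fun n => f5 _ a c hl p, ?_⟩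
  intro η hη hc hsu
  have t1 := WC (fun n => f1 (σ n)) (fun n => f2 (σ n)) hg1 hg2 (fun n => f3 (σ n)) (fun n => f5 (σ n) 0 (-M) hl0 0) hη hc hsu
  have hsup : tsupport (fun z => η z / ψ z) ⊆ tsupport η := by
    refine closure_mono fun z hz => ?_
    rw [Function.mem_support] at hz ⊢
    intro h; rw [h, zero_div] at hz; exact hz rfl
  have t2 := WC (f := fun n => f0 (σ n)) (g := hyp) (fun n => (H0 (σ n)).convex (hsx _)) (fun n => (H0 (σ n)).lip (hsx _)) hyp_lip (fun p => (hlim0 p).comp hσt)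
    (fun n => (H0 (σ n)).lower (M := 0) (by simp)) (fun n => hle _ 0) (div_cont hη hsu hψc fun z hz => hA.trans_le (hψ z hz))
    (hc.of_isClosed_subset (isClosed_tsupport _) hsup) (hsup.trans hsu)
  refine tendsto_nhds_unique t1 (t2.congr fun n => ?_)
  exact (f6 (σ n) η (tsupp_van hsu)).symm

end B3

section B4
open Complex MeasureTheory
open scoped ContDiff

def invhyp (x : ℂ) : ℂ := (√(1 - ‖x‖ ^ 2))⁻¹ • x

lemma invhyp_deriv {x : ℂ} (hx : ‖x‖ < 1) : HasFDerivAt invhyp ((√(1 - ‖x‖ ^ 2))⁻¹ • ContinuousLinearMap.id ℝ ℂ + ((√(1 - ‖x‖ ^ 2))⁻¹ ^ 3 • innerSL ℝ x).smulRight x) x := by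
  have h0 : 0 < 1 - ‖x‖ ^ 2 := by nlinarith [norm_nonneg x]
  have hs : 0 < √(1 - ‖x‖ ^ 2) := Real.sqrt_pos.2 h0
  have h1 : HasFDerivAt (fun p : ℂ => 1 - ‖p‖ ^ 2) (-(2 • (innerSL ℝ x))) x := by
    simpa using (hasStrictFDerivAt_norm_sq x).hasFDerivAt.const_sub 1
  have h2 := (h1.sqrt h0.ne')
  have h3 := (hasDerivAt_inv hs.ne').comp_hasFDerivAt x h2
  have h4 := HasFDerivAt.smul h3 (hasFDerivAt_id x)
  refine h4.congr_fderiv ?_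
  ext v
  all_goals
    simp [innerSL_apply_apply]
    try field_simp
    try simp

lemma det_formula (s c : ℝ) (x : ℂ) : (s • ContinuousLinearMap.id ℝ ℂ + (c • innerSL ℝ x).smulRight x : ℂ →L[ℝ] ℂ).det = s ^ 2 + s * c * ‖x‖ ^ 2 := by
  rw [ContinuousLinearMap.det, ← LinearMap.det_toMatrix Complex.basisOneI, Matrix.det_fin_two]
  simp only [LinearMap.toMatrix_apply]
  rw [← Complex.normSq_eq_norm_sq, Complex.normSq_apply]
  simp [innerSL_apply_apply, inner_split]
  ring

lemma cov_hyp (F : ℂ → ℝ) : ∫ p, F (gradient hyp p) = ∫ x in ball (0:ℂ) 1, F x / (1 - ‖x‖ ^ 2) ^ 2 := by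
  have hg : ∀ p, gradient hyp p = (hyp p)⁻¹ • p := fun p => (hyp_grad p).gradient
  have hinv : ∀ x ∈ ball (0:ℂ) 1, gradient hyp (invhyp x) = x := by
    intro x hx
    rw [mem_ball_zero_iff] at hx
    have h0 : 0 < 1 - ‖x‖ ^ 2 := by nlinarith [norm_nonneg x]
    have hs : 0 < √(1 - ‖x‖ ^ 2) := Real.sqrt_pos.2 h0
    have h2 := Real.sq_sqrt h0.le
    have : hyp (invhyp x) = (√(1 - ‖x‖ ^ 2))⁻¹ := by
      rw [hyp, invhyp, norm_smul, norm_inv, Real.norm_eq_abs, abs_of_pos hs]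
      rw [Real.sqrt_eq_iff_mul_self_eq (by positivity) (by positivity)]
      field_simp; linarith
    rw [hg, this, invhyp, inv_inv, smul_smul, mul_inv_cancel₀ hs.ne', one_smul]
  have himg : invhyp '' ball (0:ℂ) 1 = Set.univ := by
    rw [Set.eq_univ_iff_forall]
    intro p
    refine ⟨(hyp p)⁻¹ • p, by simpa using hyp_norm_lt p, ?_⟩
    have h1 : 1 - ‖(hyp p)⁻¹ • p‖ ^ 2 = (hyp p)⁻¹ ^ 2 := by
      rw [norm_smul, mul_pow, norm_inv, Real.norm_eq_abs, abs_of_pos (hyp_pos p)]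
      have := hyp_sq p
      have := hyp_pos p
      field_simp; linarith
    rw [invhyp, h1, Real.sqrt_sq (inv_nonneg.2 (hyp_pos p).le), inv_inv, smul_smul, mul_inv_cancel₀ (hyp_pos p).ne', one_smul]
  have hinj : Set.InjOn invhyp (ball (0:ℂ) 1) := fun x hx y hy e => by
    rw [← hinv x hx, ← hinv y hy, e]
  have := integral_image_eq_integral_abs_det_fderiv_smul volume (measurableSet_ball (x := (0:ℂ)) (ε := 1))
    (fun x hx => (invhyp_deriv (mem_ball_zero_iff.1 hx)).hasFDerivWithinAt) hinj (fun p => F (gradient hyp p))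
  rw [himg, Measure.restrict_univ] at this
  rw [this]
  refine setIntegral_congr_fun measurableSet_ball fun x hx => ?_
  beta_reduce
  rw [hinv x hx, det_formula]
  rw [mem_ball_zero_iff] at hx
  have h0 : 0 < 1 - ‖x‖ ^ 2 := by nlinarith [norm_nonneg x]
  have hs : 0 < √(1 - ‖x‖ ^ 2) := Real.sqrt_pos.2 h0
  have h2 := Real.sq_sqrt h0.le
  set s := √(1 - ‖x‖ ^ 2)
  have e : s⁻¹ ^ 2 + s⁻¹ * s⁻¹ ^ 3 * ‖x‖ ^ 2 = 1 / (1 - ‖x‖ ^ 2) ^ 2 := by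
    rw [← h2]
    have h3 : ‖x‖ ^ 2 = 1 - s ^ 2 := by linarith
    rw [h3]; field_simp; ring
  rw [e, abs_of_pos (by positivity), smul_eq_mul]; ring

/-- weak solutions -/
structure WS (g f : ℂ → ℝ) : Prop where
  gs : ContDiffOn ℝ ∞ g (ball 0 1)
  gl : ∃ c > 0, ∀ x ∈ ball (0:ℂ) 1, c / (1 - ‖x‖ ^ 2) ^ 2 ≤ g x
  conv : ConvexOn ℝ Set.univ f
  lip : LipschitzWith 1 f
  low : ∃ M, ∀ p, ‖p‖ - M ≤ f p
  int : ∀ η : ℂ → ℝ, Continuous η → HasCompactSupport η → tsupport η ⊆ ball 0 1 → ∫ p, η (gradient f p) = ∫ x, η x * g x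

lemma exists_weak {φ : ℂ → ℝ} (hφ : LowerSemicontinuousOn φ (sphere (0:ℂ) 1)) {M : ℝ} (hM : ∀ z ∈ sphere (0:ℂ) 1, |φ z| ≤ M)
    {ψ : ℂ → ℝ} {A B C : ℝ} (hA : 0 < A) (hψc : ContDiffOn ℝ ∞ ψ (ball 0 1)) (hψ : ∀ z, ‖z‖ < 1 → A ≤ ψ z) (hψB : ∀ z, ‖z‖ < 1 → ψ z ≤ B) (hC : 0 ≤ C) (hCA : 1 ≤ C ^ 2 * A) :
    ∃ f : ℂ → ℝ, WS (fun x => 1 / (ψ x * (1 - ‖x‖ ^ 2) ^ 2)) f ∧ (∀ p, ∀ z ∈ sphere (0:ℂ) 1, ⟪p, z⟫ - φ z ≤ f p) ∧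
      (∀ (a : ℂ) (c : ℝ), (∀ z ∈ sphere (0:ℂ) 1, ⟪a, z⟫ + c ≤ φ z) → ∀ p, f p ≤ - c + √(C ^ 2 + ‖p - a‖ ^ 2)) := by
  obtain ⟨f, h1, h2, h3, h4, h5, h6⟩ := exists_weak0 hφ hM hA hψc.continuousOn hψ hC hCA
  have hpos : ∀ x ∈ ball (0:ℂ) 1, 0 < 1 - ‖x‖ ^ 2 := fun x hx => by
    rw [mem_ball_zero_iff] at hx
    nlinarith [norm_nonneg x]
  have hψp : ∀ x ∈ ball (0:ℂ) 1, 0 < ψ x := fun x hx => hA.trans_le (hψ x (mem_ball_zero_iff.1 hx))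
  have hB : 0 < B := hA.trans_le ((hψ 0 (by simp)).trans (hψB 0 (by simp)))
  refine ⟨f, ⟨?_, ⟨B⁻¹, by positivity, fun x hx => ?_⟩, h1, h2, ⟨M, h3⟩, fun η hη hc hs => ?_⟩, h4, h5⟩
  · refine contDiffOn_const.div (hψc.mul ((contDiffOn_const.sub (contDiff_norm_sq ℝ).contDiffOn).pow 2)) fun x hx => ?_
    have := hpos x hx
    have := hψp x hx
    positivity
  · have i1 := hpos x hx
    have i2 := hψp x hx
    have i3 := hψB x (mem_ball_zero_iff.1 hx)
    beta_reduce
    rw [inv_eq_one_div, div_div]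
    gcongr
  · rw [h6 η hη hc hs, cov_hyp (fun x => η x / ψ x), setIntegral_eq_integral_of_forall_compl_eq_zero]
    · refine integral_congr_ae (Filter.Eventually.of_forall fun x => ?_)
      beta_reduce; rw [div_div, mul_one_div]
    · intro x hx
      rw [tsupp_van hs x (by simpa using hx)]; simp

end B4

section B5
open Complex MeasureTheory
open scoped ContDiff

/-- subgradients -/
def SubG (f : ℂ → ℝ) (p x : ℂ) : Prop := ∀ p', f p + ⟪p' - p, x⟫ ≤ f p'

variable {f g : ℂ → ℝ}

lemma sub_closed (hf : Continuous f) {u y : ℕ → ℂ} {p x : ℂ} (hu : Tendsto u atTop (𝓝 p)) (hy : Tendsto y atTop (𝓝 x)) (h : ∀ n, SubG f (u n) (y n)) : SubG f p x := by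
  intro p'
  have h1 : Tendsto (fun n => f (u n) + ⟪p' - u n, y n⟫) atTop (𝓝 (f p + ⟪p' - p, x⟫)) :=
    ((hf.tendsto p).comp hu).add ((hu.const_sub p').inner hy)
  exact le_of_tendsto' h1 fun n => h n p'

lemma sub_exists (hL : LipschitzWith 1 f) (hf : ConvexOn ℝ Set.univ f) (p : ℂ) : ∃ x, SubG f p x := by
  have hd : Dense {q | DifferentiableAt ℝ f q} := Measure.dense_of_ae (ae_diff hL)
  choose u hu1 hu2 using fun n : ℕ => hd.exists_dist_lt p (show (0:ℝ) < 1 / ((n:ℝ) + 1) by positivity)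
  have hu : Tendsto u atTop (𝓝 p) := by
    rw [tendsto_iff_dist_tendsto_zero]
    refine squeeze_zero (fun _ => dist_nonneg) (fun n => ?_) tendsto_one_div_add_atTop_nhds_zero_nat
    rw [dist_comm]; exact (hu2 n).le
  obtain ⟨x, -, σ, hσ, hx⟩ := (isCompact_closedBall (0:ℂ) 1).tendsto_subseq (x := fun n => gradient f (u n)) (fun n => by simpa using norm_gradient_le hL (u n))
  exact ⟨x, sub_closed hL.continuous (hu.comp hσ.tendsto_atTop) hx fun n => gradient_ineq hf (hu1 _)⟩

lemma sub_near (hL : LipschitzWith 1 f) {p x : ℂ} (hx : ∀ y, SubG f p y → y = x) {e : ℝ} (he : 0 < e) : ∃ d > 0, ∀ p', dist p' p < d → ∀ y, SubG f p' y → dist y x < e := by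
  by_contra hcon
  push Not at hcon
  choose u hu2 y hy1 hy2 using fun n : ℕ => hcon (1 / ((n:ℝ) + 1)) (by positivity)
  have hu : Tendsto u atTop (𝓝 p) := by
    rw [tendsto_iff_dist_tendsto_zero]
    exact squeeze_zero (fun _ => dist_nonneg) (fun n => (hu2 n).le) tendsto_one_div_add_atTop_nhds_zero_nat
  obtain ⟨x', -, σ, hσ, hx'⟩ := (isCompact_closedBall (0:ℂ) 1).tendsto_subseq (x := y) (fun n => by simpa using norm_subgrad_le hL (hy1 n))
  have h1 : SubG f p x' := sub_closed hL.continuous (hu.comp hσ.tendsto_atTop) hx' fun n => hy1 _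
  rw [hx x' h1] at hx'
  have h2 := (tendsto_iff_dist_tendsto_zero.1 hx').eventually_lt_const he
  obtain ⟨n, hn⟩ := h2.exists
  exact absurd hn (not_lt.2 (hy2 _))

lemma diff_of_unique (hL : LipschitzWith 1 f) (hf : ConvexOn ℝ Set.univ f) {p x : ℂ} (hs : SubG f p x) (hx : ∀ y, SubG f p y → y = x) : HasGradientAt f x p := by
  rw [hasGradientAt_iff_hasFDerivAt, hasFDerivAt_iff_isLittleO, Asymptotics.isLittleO_iff]
  intro c hc
  obtain ⟨d, hd, h⟩ := sub_near hL hx hc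
  filter_upwards [ball_mem_nhds p hd] with p' hp'
  obtain ⟨y, hy⟩ := sub_exists hL hf p'
  have h1 := h p' hp' y hy
  have h2 := hy p
  have h3 := hs p'
  have h4 : (InnerProductSpace.toDual ℝ ℂ x) (p' - p) = ⟪p' - p, x⟫ := by rw [InnerProductSpace.toDual_apply_apply, real_inner_comm]
  have h5 : ⟪p - p', y⟫ = - ⟪p' - p, y⟫ := by rw [← inner_neg_left, neg_sub]
  have h6 := real_inner_le_norm (p' - p) (y - x)
  have h7 : ‖p' - p‖ * ‖y - x‖ ≤ ‖p' - p‖ * c := by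
    rw [dist_eq_norm] at h1; gcongr
  rw [inner_sub_right] at h6
  rw [h4, Real.norm_eq_abs, abs_of_nonneg (by linarith)]
  linarith

lemma volume_rect (a b c d : ℝ) : volume (Set.Icc a b ×ℂ Set.Icc c d) = ENNReal.ofReal (b - a) * ENNReal.ofReal (d - c) := by
  have h := Complex.volume_preserving_equiv_real_prod.measure_preimage (s := Set.Icc a b ×ˢ Set.Icc c d) (measurableSet_Icc.prod measurableSet_Icc).nullMeasurableSet
  rw [Measure.volume_eq_prod, Measure.prod_prod, Real.volume_Icc, Real.volume_Icc] at h
  rw [← h]; rfl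

lemma volume_rect' (a b c d : ℝ) : volume (Set.Ioo a b ×ℂ Set.Ioo c d) = ENNReal.ofReal (b - a) * ENNReal.ofReal (d - c) := by
  have h := Complex.volume_preserving_equiv_real_prod.measure_preimage (s := Set.Ioo a b ×ˢ Set.Ioo c d) (measurableSet_Ioo.prod measurableSet_Ioo).nullMeasurableSet
  rw [Measure.volume_eq_prod, Measure.prod_prod, Real.volume_Ioo, Real.volume_Ioo] at h
  rw [← h]; rfl

lemma urys {K U : Set ℂ} (hK : IsCompact K) (hU : IsOpen U) (hKU : K ⊆ U) (hU1 : U ⊆ ball 0 1) : ∃ η : ℂ → ℝ, Continuous η ∧ HasCompactSupport η ∧ tsupport η ⊆ U ∧ (∀ x ∈ K, η x = 1) ∧ ∀ x, 0 ≤ η x ∧ η x ≤ 1 := by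
  obtain ⟨η, hη1, hη2, hη3⟩ := exists_tsupport_one_of_isOpen_isClosed hU
    ((isCompact_closedBall (0:ℂ) 1).of_isClosed_subset isClosed_closure (closure_minimal (fun p hp => ball_subset_closedBall (hU1 hp)) isClosed_closedBall))
    hK.isClosed hKU
  refine ⟨η, η.continuous, ?_, hη1, fun x hx => hη2 hx, hη3⟩
  exact (isCompact_closedBall (0:ℂ) 1).of_isClosed_subset (isClosed_tsupport _) ((hη1.trans hU1).trans ball_subset_closedBall)

lemma WS.gpos (H : WS g f) : ∃ c > 0, ∀ x ∈ ball (0:ℂ) 1, c ≤ g x := by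
  obtain ⟨c, hc, h⟩ := H.gl
  refine ⟨c, hc, fun x hx => le_trans ?_ (h x hx)⟩
  rw [mem_ball_zero_iff] at hx
  have h0 : 0 < 1 - ‖x‖ ^ 2 := by nlinarith [norm_nonneg x]
  rw [le_div_iff₀ (by positivity)]
  have : (1 - ‖x‖ ^ 2) ^ 2 ≤ 1 := pow_le_one₀ h0.le (by nlinarith [norm_nonneg x])
  nlinarith

lemma WS.integ (H : WS g f) {η : ℂ → ℝ} (h1 : Continuous η) (h2 : HasCompactSupport η) (h3 : tsupport η ⊆ ball 0 1) : Integrable fun x => η x * g x := by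
  have hcont : Continuous fun x => η x * g x := by
    rw [continuous_iff_continuousAt]
    intro z
    by_cases hz : z ∈ tsupport η
    · exact h1.continuousAt.mul (H.gs.continuousOn.continuousAt (isOpen_ball.mem_nhds (h3 hz)))
    · have : (fun z => η z * g z) =ᶠ[𝓝 z] fun _ => 0 := by
        filter_upwards [(isClosed_tsupport η).isOpen_compl.mem_nhds hz] with w hw
        rw [image_eq_zero_of_notMem_tsupport hw, zero_mul]
      exact continuousAt_const.congr this.symm
  exact hcont.integrable_of_hasCompactSupport h2.mul_right

lemma WS.grad_integ (H : WS g f) {η : ℂ → ℝ} (hη : Continuous η) (hc : HasCompactSupport η) (hs : tsupport η ⊆ ball 0 1) : Integrable fun p => η (gradient f p) := by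
  obtain ⟨B, hB⟩ := hη.bounded_above_of_compact_support hc
  obtain ⟨ρ, hρ1, hρ'⟩ := exists_lt_subset_ball (isClosed_tsupport η) hs
  obtain ⟨M, hM⟩ := H.low
  have hρ : ∀ x, η x ≠ 0 → ‖x‖ ≤ ρ := fun x hx => by
    have := hρ' (subset_tsupport η hx)
    rw [mem_ball_zero_iff] at this; exact this.le
  set Rad := (f 0 + M) / (1 - ρ) with hRad
  have hintg : Integrable ((closedBall (0:ℂ) Rad).indicator fun _ => B) := 
    (integrable_indicator_iff measurableSet_closedBall).2 (integrableOn_const measure_closedBall_lt_top.ne)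
  refine hintg.mono' (hη.measurable.comp (measurable_gradient f)).aestronglyMeasurable ?_
  filter_upwards [ae_diff H.lip] with p hp
  by_cases h : η (gradient f p) = 0
  · rw [h, norm_zero]
    apply Set.indicator_nonneg; intro _ _; exact (norm_nonneg _).trans (hB 0)
  · have h1 := hρ _ h
    have h2 := gradient_ineq H.conv hp 0
    have h3 := hM p
    have h5 := real_inner_le_norm p (gradient f p)
    have h6 : ‖p‖ * ‖gradient f p‖ ≤ ‖p‖ * ρ := by gcongr
    rw [zero_sub, inner_neg_left] at h2
    have hm : p ∈ closedBall (0:ℂ) Rad := by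
      rw [mem_closedBall_zero_iff, hRad, le_div_iff₀ (by linarith)]; linarith
    rw [Set.indicator_of_mem hm]; exact hB _

lemma mass_lower (H : WS g f) {K U P : Set ℂ} (hK : IsCompact K) (hU : IsOpen U) (hKU : K ⊆ U) (hU1 : U ⊆ ball 0 1) {c : ℝ} (hc : 0 ≤ c) (hg : ∀ x ∈ K, c ≤ g x)
    (hP : MeasurableSet P) (hPf : volume P ≠ ⊤) (hUP : ∀ p, DifferentiableAt ℝ f p → gradient f p ∈ U → p ∈ P) : c * (volume K).toReal ≤ (volume P).toReal := by
  obtain ⟨η, h1, h2, h3, h4, h5⟩ := urys hK hU hKU hU1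
  have e := H.int η h1 h2 (h3.trans hU1)
  have hi := H.integ h1 h2 (h3.trans hU1)
  obtain ⟨c0, hc0, hg0⟩ := H.gpos
  have k1 : c * (volume K).toReal ≤ ∫ x, η x * g x := by
    have : ∫ x, K.indicator (fun _ => c) x = c * (volume K).toReal := by
      rw [integral_indicator hK.measurableSet, setIntegral_const, smul_eq_mul, mul_comm]; rfl
    rw [← this]
    refine integral_mono ((integrable_indicator_iff hK.measurableSet).2 (integrableOn_const hK.measure_lt_top.ne)) hi fun x => ?_
    beta_reduce
    by_cases hx : x ∈ K
    · rw [Set.indicator_of_mem hx, h4 x hx, one_mul]; exact hg x hx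
    · rw [Set.indicator_of_notMem hx]
      by_cases hx1 : x ∈ ball (0:ℂ) 1
      · exact mul_nonneg (h5 x).1 (hc0.le.trans (hg0 x hx1))
      · rw [tsupp_van (h3.trans hU1) x (by simpa using hx1), zero_mul]
  refine k1.trans ?_
  rw [← e]
  have : ∫ x, P.indicator (fun _ => (1:ℝ)) x = (volume P).toReal := by
    rw [integral_indicator hP, setIntegral_const, smul_eq_mul, mul_one]; rfl
  rw [← this]
  refine integral_mono_of_nonneg (Filter.Eventually.of_forall fun x => (h5 _).1) ((integrable_indicator_iff hP).2 (integrableOn_const hPf)) ?_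
  filter_upwards [ae_diff H.lip] with p hp
  by_cases hx : gradient f p ∈ U
  · rw [Set.indicator_of_mem (hUP p hp hx)]; exact (h5 _).2
  · rw [image_eq_zero_of_notMem_tsupport fun h => hx (h3 h)]
    exact Set.indicator_nonneg (fun _ _ => zero_le_one) _

lemma mass_upper (H : WS g f) {K U P : Set ℂ} (hK : IsCompact K) (hU : IsOpen U) (hKU : K ⊆ U) (hU1 : U ⊆ ball 0 1) {c : ℝ} (hc : 0 ≤ c) (hg : ∀ x ∈ U, g x ≤ c)
    (hP : MeasurableSet P) (hPf : volume P ≠ ⊤) (hUP : ∀ p ∈ P, DifferentiableAt ℝ f p → gradient f p ∈ K) : (volume P).toReal ≤ c * (volume U).toReal := by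
  obtain ⟨η, h1, h2, h3, h4, h5⟩ := urys hK hU hKU hU1
  have e := H.int η h1 h2 (h3.trans hU1)
  have hi := H.integ h1 h2 (h3.trans hU1)
  obtain ⟨c0, hc0, hg0⟩ := H.gpos
  have hUf : volume U ≠ ⊤ := (lt_of_le_of_lt (measure_mono hU1) measure_ball_lt_top).ne
  have hgn : ∀ x, 0 ≤ η x * g x := by
    intro x
    by_cases hx1 : x ∈ ball (0:ℂ) 1
    · exact mul_nonneg (h5 x).1 (hc0.le.trans (hg0 x hx1))
    · rw [tsupp_van (h3.trans hU1) x (by simpa using hx1), zero_mul]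
  have k1 : ∫ x, η x * g x ≤ c * (volume U).toReal := by
    have : ∫ x, U.indicator (fun _ => c) x = c * (volume U).toReal := by
      rw [integral_indicator hU.measurableSet, setIntegral_const, smul_eq_mul, mul_comm]; rfl
    rw [← this]
    refine integral_mono hi ((integrable_indicator_iff hU.measurableSet).2 (integrableOn_const hUf)) fun x => ?_
    beta_reduce
    by_cases hx : x ∈ U
    · rw [Set.indicator_of_mem hx]
      have i1 := hg0 x (hU1 hx)
      have i2 := hg x hx
      have i3 := h5 x
      nlinarith
    · rw [Set.indicator_of_notMem hx, image_eq_zero_of_notMem_tsupport fun h => hx (h3 h), zero_mul]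
  refine le_trans ?_ k1
  rw [← e]
  have : ∫ x, P.indicator (fun _ => (1:ℝ)) x = (volume P).toReal := by
    rw [integral_indicator hP, setIntegral_const, smul_eq_mul, mul_one]; rfl
  rw [← this]
  have hintg := H.grad_integ h1 h2 (h3.trans hU1)
  refine integral_mono_ae ((integrable_indicator_iff hP).2 (integrableOn_const hPf)) hintg ?_
  filter_upwards [ae_diff H.lip] with p hp
  by_cases hx : p ∈ P
  · rw [Set.indicator_of_mem hx, h4 _ (hUP p hx hp)]
  · rw [Set.indicator_of_notMem hx]; exact (h5 _).1

end B5

section B6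
open Complex MeasureTheory
open scoped ContDiff

variable {f g : ℂ → ℝ}

lemma inner_mul_unit {w : ℂ} (p x : ℂ) : ⟪w * p, x⟫ = ⟪p, starRingEnd ℂ w * x⟫ := by
  simp only [inner_split, mul_re, mul_im, conj_re, conj_im]; ring

lemma unit_conj {w : ℂ} (hw : ‖w‖ = 1) : starRingEnd ℂ w * w = 1 := by
  rw [mul_comm, Complex.mul_conj, Complex.normSq_eq_norm_sq, hw]; simp

lemma SubG.rot {w : ℂ} (hw : ‖w‖ = 1) {p x : ℂ} (h : SubG f (w * p) x) : SubG (fun p => f (w * p)) p (starRingEnd ℂ w * x) := by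
  intro p'
  have := h (w * p')
  rw [← mul_sub, inner_mul_unit] at this
  exact this

lemma integral_rot {w : ℂ} (hw : ‖w‖ = 1) (F : ℂ → ℝ) : ∫ p, F (w * p) = ∫ p, F p := by
  let a : Circle := ⟨w, by simpa [Submonoid.unitSphere] using hw⟩
  have := (rotation a).measurePreserving.integral_comp (rotation a).toHomeomorph.measurableEmbedding F
  exact this

lemma diff_rot {w p : ℂ} (hd : DifferentiableAt ℝ f (w * p)) : DifferentiableAt ℝ (fun p => f (w * p)) p := by
  have h1 : DifferentiableAt ℝ (fun p : ℂ => w * p) p := (differentiableAt_id).const_mul w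
  exact DifferentiableAt.comp p hd h1

lemma gradient_rot (hf : ConvexOn ℝ Set.univ f) {w p : ℂ} (hw : ‖w‖ = 1) (hd : DifferentiableAt ℝ f (w * p)) : gradient (fun p => f (w * p)) p = starRingEnd ℂ w * gradient f (w * p) :=
  gradient_unique (diff_rot hd) (SubG.rot hw (gradient_ineq hf hd))

lemma norm_unit_mul {w : ℂ} (hw : ‖w‖ = 1) (p : ℂ) : ‖w * p‖ = ‖p‖ := by rw [norm_mul, hw, one_mul]

lemma WS.rot (H : WS g f) {w : ℂ} (hw : ‖w‖ = 1) : WS (fun x => g (w * x)) (fun p => f (w * p)) := by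
  have hw' : ‖starRingEnd ℂ w‖ = 1 := by rw [RCLike.norm_conj, hw]
  have hc1 := unit_conj hw
  have hc2 : w * starRingEnd ℂ w = 1 := by rw [mul_comm, hc1]
  have hsm : ContDiff ℝ ∞ (fun x : ℂ => w * x) := contDiff_const.mul contDiff_id
  have hlip : LipschitzWith 1 (fun p => f (w * p)) := by
    refine LipschitzWith.of_dist_le_mul fun p q => ?_
    have := H.lip.dist_le_mul (w * p) (w * q)
    rwa [dist_eq_norm (w * p), ← mul_sub, norm_unit_mul hw, ← dist_eq_norm] at this
  have hconv : ConvexOn ℝ Set.univ (fun p => f (w * p)) := by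
    have := H.conv.comp_linearMap (LinearMap.mulLeft ℝ w)
    exact this
  refine ⟨?_, ?_, hconv, hlip, ?_, ?_⟩
  · refine H.gs.comp hsm.contDiffOn fun x hx => ?_
    rw [mem_ball_zero_iff] at *; rwa [norm_unit_mul hw]
  · obtain ⟨c, hc, h⟩ := H.gl
    refine ⟨c, hc, fun x hx => ?_⟩
    have := h (w * x) (by rw [mem_ball_zero_iff] at *; rwa [norm_unit_mul hw])
    rwa [norm_unit_mul hw] at this
  · obtain ⟨M, h⟩ := H.low
    refine ⟨M, fun p => ?_⟩
    have := h (w * p)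
    rwa [norm_unit_mul hw] at this
  · intro η h1 h2 h3
    set w' := starRingEnd ℂ w with hwd
    have hη1 : Continuous fun x => η (w' * x) := h1.comp (by fun_prop)
    have hsub : tsupport (fun x => η (w' * x)) ⊆ (fun x => w' * x) ⁻¹' tsupport η := by
      refine closure_minimal (fun x hx => subset_tsupport η hx) ((isClosed_tsupport η).preimage (by fun_prop))
    have hη3 : tsupport (fun x => η (w' * x)) ⊆ ball 0 1 := by
      intro x hx
      have := h3 (hsub hx)
      rw [mem_ball_zero_iff] at *; rwa [norm_unit_mul hw'] at this
    have hη2 : HasCompactSupport fun x => η (w' * x) := 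
      (isCompact_closedBall (0:ℂ) 1).of_isClosed_subset (isClosed_tsupport _) (hη3.trans ball_subset_closedBall)
    have e1 : ∫ p, η (gradient (fun p => f (w * p)) p) = ∫ p, η (w' * gradient f (w * p)) := by
      refine integral_congr_ae ?_
      filter_upwards [ae_diff hlip] with p hp
      have hd : DifferentiableAt ℝ f (w * p) := by
        have := diff_rot (f := fun p => f (w * p)) (w := w') (p := w * p) (by rwa [← mul_assoc, hc1, one_mul])
        simpa only [← mul_assoc, hc2, one_mul] using this
      rw [gradient_rot H.conv hw hd]
    rw [e1, integral_rot hw (fun p => η (w' * gradient f p)), H.int _ hη1 hη2 hη3, ← integral_rot hw]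
    simp only [← mul_assoc, hc1, one_mul]

lemma sub_lt_one (H : WS g f) {p0 e : ℂ} (hs : SubG f p0 e) : ‖e‖ < 1 := by
  refine lt_of_le_of_ne (norm_subgrad_le H.lip hs) fun he => ?_
  obtain ⟨c, hc, hg⟩ := H.gl
  obtain ⟨M, hM⟩ := H.low
  set W := M + ‖p0‖ + f p0 with hW
  set R := 8 / 3 * W with hR
  set s : ℕ → ℝ := fun k => (1 / 4) ^ (k + 1) with hsd
  have hs0 : ∀ k, 0 < s k := fun k => by simp only [hsd]; positivity
  have hs1 : ∀ k, s k ≤ 1 / 4 := fun k => by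
    simp only [hsd]; rw [pow_succ]
    have : ((1:ℝ) / 4) ^ k ≤ 1 := pow_le_one₀ (by norm_num) (by norm_num)
    linarith
  set ctr : ℕ → ℂ := fun k => (1 - s k) • e with hctr
  have hee : ⟪e, e⟫ = 1 := by rw [real_inner_self_eq_norm_sq, he]; norm_num
  have hctrn : ∀ k, ‖ctr k‖ = 1 - s k := fun k => by
    rw [hctr]; beta_reduce
    rw [norm_smul, he, mul_one, Real.norm_eq_abs, abs_of_pos (by linarith [hs1 k])]
  have hballn : ∀ k x, ‖x - ctr k‖ < s k / 4 → ‖x‖ < 1 - 3 / 4 * s k ∧ 1 - 5 / 4 * s k < ‖x‖ := by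
    intro k x hx
    have h1 := norm_sub_norm_le x (ctr k)
    have h2 := norm_sub_norm_le (ctr k) x
    rw [norm_sub_rev] at h2
    rw [hctrn] at *
    constructor <;> linarith
  set P : ℕ → Set ℂ := fun k => (gradient f ⁻¹' ball (ctr k) (s k / 4)) ∩ closedBall p0 R with hP
  have hPm : ∀ k, MeasurableSet (P k) := fun k => (measurable_gradient f measurableSet_ball).inter measurableSet_closedBall
  have hPsub : ∀ k, P k ⊆ closedBall p0 R := fun k => Set.inter_subset_right
  have hPfin : ∀ k, volume (P k) ≠ ⊤ := fun k => (lt_of_le_of_lt (measure_mono (hPsub k)) measure_closedBall_lt_top).ne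
  have hdis : Pairwise (Function.onFun Disjoint P) := by
    have key : ∀ j k, j < k → Disjoint (P j) (P k) := by
      intro j k hjk
      rw [Set.disjoint_left]
      intro p hp hp'
      have h1 := hballn j _ (by rw [← dist_eq_norm]; exact hp.1)
      have h2 := hballn k _ (by rw [← dist_eq_norm]; exact hp'.1)
      have h3 : s k ≤ 1 / 4 * s j := by
        simp only [hsd]
        rw [← pow_succ']
        exact pow_le_pow_of_le_one (by norm_num) (by norm_num) (by omega)
      linarith [hs0 j, h1.1, h2.2]
    intro j k hjk
    rcases lt_or_gt_of_ne hjk with h | h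
    · exact key j k h
    · exact (key k j h).symm
  have hbd : ∀ k p, DifferentiableAt ℝ f p → gradient f p ∈ ball (ctr k) (s k / 4) → p ∈ P k := by
    intro k p hd hp
    refine ⟨hp, ?_⟩
    set x := gradient f p
    have h1 := gradient_ineq H.conv hd p0
    have h2 := hs p
    have h3 := hM p
    have hx : ‖x - ctr k‖ < s k / 4 := by rw [← dist_eq_norm]; exact hp
    have h4 : ‖x - (1 - 2 * s k) • e‖ ≤ 5 / 4 * s k := by
      have : x - (1 - 2 * s k) • e = (x - ctr k) + (s k) • e := by rw [hctr]; module
      rw [this]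
      refine (norm_add_le _ _).trans ?_
      rw [norm_smul, he, mul_one, Real.norm_eq_abs, abs_of_pos (hs0 k)]; linarith
    have h5 := real_inner_le_norm (p - p0) (x - (1 - 2 * s k) • e)
    have h6 : ‖p - p0‖ * ‖x - (1 - 2 * s k) • e‖ ≤ ‖p - p0‖ * (5 / 4 * s k) := by gcongr
    rw [inner_sub_right, inner_smul_right] at h5
    have h7 : ⟪p0 - p, x⟫ = - ⟪p - p0, x⟫ := by rw [← inner_neg_left, neg_sub]
    have h8 := norm_sub_norm_le p p0
    have h8' : ‖p - p0‖ ≤ ‖p‖ + ‖p0‖ := norm_sub_le _ _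
    have h9 := mul_le_mul_of_nonneg_left h2 (show 0 ≤ 1 - 2 * s k by linarith [hs1 k])
    have h10 := mul_le_mul_of_nonneg_left (show ‖p - p0‖ - ‖p0‖ - M ≤ f p by linarith) (show 0 ≤ 2 * s k by linarith [hs0 k])
    have h11 : s k * (3 / 4 * ‖p - p0‖) ≤ s k * (2 * W) := by
      rw [hW]; linarith
    have h12 := le_of_mul_le_mul_left h11 (hs0 k)
    rw [mem_closedBall, dist_eq_norm, hR]; linarith
  set c' : ℝ := c * (4 / 25) * (Real.pi / 64) with hc'
  have hc'0 : 0 < c' := by positivity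
  have hmass : ∀ k, c' ≤ (volume (P k)).toReal := by
    intro k
    have h1 := mass_lower H (K := closedBall (ctr k) (s k / 8)) (U := ball (ctr k) (s k / 4)) (P := P k) (isCompact_closedBall _ _) isOpen_ball
      (closedBall_subset_ball (by linarith [hs0 k])) (fun x hx => by
        rw [mem_ball, dist_eq_norm] at hx
        rw [mem_ball_zero_iff]; linarith [(hballn k x hx).1, hs0 k]) (c := c * (4 / 25) / (s k) ^ 2) (by have := hs0 k; positivity) (fun x hx => by
        have hx' : ‖x - ctr k‖ < s k / 4 := by
          rw [mem_closedBall, dist_eq_norm] at hx; linarith [hs0 k]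
        have h1 := hballn k x hx'
        have hxl : ‖x‖ < 1 := by linarith [hs0 k]
        refine le_trans ?_ (hg x (by rw [mem_ball_zero_iff]; exact hxl))
        have h0 : 0 < 1 - ‖x‖ ^ 2 := by nlinarith [norm_nonneg x]
        have h2 : 1 - ‖x‖ ^ 2 ≤ 5 / 2 * s k := by nlinarith [norm_nonneg x, hs0 k]
        have h3 : (1 - ‖x‖ ^ 2) ^ 2 ≤ (5 / 2 * s k) ^ 2 := pow_le_pow_left₀ h0.le h2 2
        have e : c * (4 / 25) / (s k) ^ 2 = c / (5 / 2 * s k) ^ 2 := by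
          have := hs0 k
          field_simp; norm_num
        rw [e]; gcongr) (hPm k) (hPfin k) (hbd k)
    rw [Complex.volume_closedBall, ENNReal.toReal_mul, ENNReal.toReal_pow, ENNReal.toReal_ofReal (by linarith [hs0 k])] at h1
    refine le_trans (le_of_eq ?_) h1
    rw [hc']
    have := hs0 k
    simp
    field_simp
    norm_num
  have hsum : ∑' k, volume (P k) ≠ ⊤ := by
    rw [← measure_iUnion hdis hPm]
    exact (lt_of_le_of_lt (measure_mono (Set.iUnion_subset hPsub)) measure_closedBall_lt_top).ne
  have ht := ENNReal.tendsto_atTop_zero_of_tsum_ne_top hsum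
  have ht' := (ENNReal.tendsto_toReal ENNReal.zero_ne_top).comp ht
  obtain ⟨k, hk⟩ := (ht'.eventually_lt_const (show (0:ENNReal).toReal < c' by simpa using hc'0)).exists
  exact absurd (hmass k) (not_le.2 hk)

end B6

section B7
open Complex MeasureTheory
open scoped ContDiff

variable {f g : ℂ → ℝ}

set_option maxHeartbeats 1000000 in
lemma core_b (H : WS g f) {p0 xc : ℂ} {r : ℝ} (hr : 0 < r) (s1 : SubG f p0 (xc + r)) (s2 : SubG f p0 (xc - r)) : False := by
  obtain ⟨c, hc, hg⟩ := H.gpos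
  obtain ⟨M, hM⟩ := H.low
  have n1 := sub_lt_one H s1
  have n2 := sub_lt_one H s2
  set ρ := max ‖xc + r‖ ‖xc - r‖ with hρ
  have hρ1 : ρ < 1 := max_lt n1 n2
  have hseg : ∀ t : ℝ, |t| ≤ r → ‖xc + t‖ ≤ ρ := by
    intro t ht
    rw [abs_le] at ht
    have hcv := (convex_closedBall (0:ℂ) ρ) (x := xc + r) (by simp [hρ]) (y := xc - r) (by simp [hρ]) (a := (r + t) / (2 * r)) (b := (r - t) / (2 * r))
      (div_nonneg (by linarith) (by linarith)) (div_nonneg (by linarith) (by linarith)) (by field_simp; ring)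
    rw [mem_closedBall_zero_iff] at hcv
    set α : ℝ := (r + t) / (2 * r) with hα
    set β : ℝ := (r - t) / (2 * r) with hβ
    have h1 : α + β = 1 := by rw [hα, hβ]; field_simp; ring
    have h2 : α * r - β * r = t := by rw [hα, hβ]; field_simp; ring
    have e : xc + t = α • (xc + (r:ℂ)) + β • (xc - (r:ℂ)) := by
      apply Complex.ext
      · simp; linear_combination -h2 - xc.re * h1
      · simp; linear_combination - xc.im * h1
    rw [e]; exact hcv
  have hxc : ‖xc‖ < 1 := by
    have := hseg 0 (by simpa using hr.le)
    simp only [ofReal_zero, add_zero] at this; linarith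
  set F : ℂ → ℝ := fun u => f (p0 + u) - f p0 - ⟪u, xc⟫ with hF
  have F0 : F 0 = 0 := by simp [hF]
  have Fr : ∀ u, r * |u.re| ≤ F u := by
    intro u
    have h1 := s1 (p0 + u)
    have h2 := s2 (p0 + u)
    rw [add_sub_cancel_left, inner_add_right] at h1
    rw [add_sub_cancel_left, inner_sub_right] at h2
    have h3 : ⟪u, (r:ℂ)⟫ = r * u.re := by rw [inner_split]; simp; ring
    rw [h3] at h1 h2
    rcases abs_cases u.re with ⟨h, _⟩ | ⟨h, _⟩ <;> rw [h] <;> simp only [hF] <;> linarith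
  have Fnn : ∀ u, 0 ≤ F u := fun u => (mul_nonneg hr.le (abs_nonneg _)).trans (Fr u)
  have Fconv : ∀ (u v : ℂ) (τ : ℝ), 0 ≤ τ → τ ≤ 1 → F ((1 - τ) • u + τ • v) ≤ (1 - τ) * F u + τ * F v := by
    intro u v τ h0 h1
    have h2 := H.conv.2 (Set.mem_univ (p0 + u)) (Set.mem_univ (p0 + v)) (show 0 ≤ 1 - τ by linarith) h0 (by ring)
    have e : (1 - τ) • (p0 + u) + τ • (p0 + v) = p0 + ((1 - τ) • u + τ • v) := by module
    rw [e] at h2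
    simp only [hF, inner_add_left, inner_smul_left, conj_trivial, smul_eq_mul] at *
    linarith
  have Flip : ∀ u v, F u - F v ≤ 2 * ‖u - v‖ := by
    intro u v
    have h1 := lip_le H.lip (p0 + u) (p0 + v)
    rw [dist_add_left, dist_eq_norm] at h1
    have h2 := real_inner_le_norm (v - u) xc
    have h3 : ‖v - u‖ * ‖xc‖ ≤ ‖v - u‖ * 1 := by gcongr
    rw [inner_sub_left, norm_sub_rev] at h2
    rw [norm_sub_rev] at h3
    have := (abs_le.1 h1).2
    simp only [hF]; linarith
  have Fcont : Continuous F := by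
    have := H.lip.continuous
    simp only [hF]; fun_prop
  -- the last zero on the vertical line
  obtain ⟨T, hT0, hTF, hTm⟩ : ∃ T : ℝ, 0 ≤ T ∧ F (T * I) = 0 ∧ ∀ t > T, 0 < F (t * I) := by
    set Z : Set ℝ := {t | 0 ≤ t ∧ F (t * I) = 0} with hZ
    have hZc : IsClosed Z := by
      refine IsClosed.inter isClosed_Ici (isClosed_eq ?_ continuous_const)
      fun_prop
    have hZne : Z.Nonempty := ⟨0, le_rfl, by simpa using F0⟩
    have hZb : BddAbove Z := by
      refine ⟨(‖p0‖ + M + f p0) / (1 - ‖xc‖), fun t ht => ?_⟩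
      rw [le_div_iff₀ (by linarith)]
      have h1 := ht.2
      simp only [hF] at h1
      have h2 := hM (p0 + t * I)
      have h3 : ‖(t:ℂ) * I‖ = t := by simp [abs_of_nonneg ht.1]
      have h4 := norm_sub_le (p0 + t * I) p0
      rw [add_sub_cancel_left, h3] at h4
      have h5 := real_inner_le_norm ((t:ℂ) * I) xc
      rw [h3] at h5
      linarith
    have hm := hZc.csSup_mem hZne hZb
    refine ⟨sSup Z, hm.1, hm.2, fun t ht => lt_of_le_of_ne (Fnn _) fun h => ?_⟩
    exact absurd (le_csSup hZb ⟨hm.1.trans ht.le, h.symm⟩) (not_le.2 ht)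
  set ε : ℝ := r * √(c / 32) with hε
  have hε0 : 0 < ε := by positivity
  have hε2 : ε ^ 2 = r ^ 2 * (c / 32) := by rw [hε, mul_pow, Real.sq_sqrt (by positivity)]
  set κ := F ((T + ε : ℝ) * I) with hκ
  have hκ0 : 0 < κ := hTm _ (by linarith)
  set δ := min ((1 - ρ) / 2) (min (κ / (8 * ε)) (κ * r / (16 * ε))) with hδ
  have hδ0 : 0 < δ := lt_min (by linarith) (lt_min (by positivity) (by positivity))
  have hδ1 : δ ≤ (1 - ρ) / 2 := min_le_left _ _
  have hδ2 : δ * (8 * ε) ≤ κ := by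
    rw [← le_div_iff₀ (by positivity)]; exact (min_le_right _ _).trans (min_le_left _ _)
  have hδ3 : δ * (16 * ε) ≤ κ * r := by
    rw [← le_div_iff₀ (by positivity)]; exact (min_le_right _ _).trans (min_le_right _ _)
  have hUb : (Set.Ioo (xc.re - r / 2) (xc.re + r / 2) ×ℂ Set.Ioo xc.im (xc.im + δ)) ⊆ ball 0 1 := by
    rintro x ⟨⟨h1, h2⟩, h3, h4⟩
    rw [mem_ball_zero_iff]
    have h5 := hseg (x.re - xc.re) (by rw [abs_le]; constructor <;> linarith)
    have e : x = (xc + (x.re - xc.re : ℝ)) + (x.im - xc.im : ℝ) * I := by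
      apply Complex.ext <;> simp
    rw [e]
    refine lt_of_le_of_lt (norm_add_le _ _) ?_
    have h6 : ‖((x.im - xc.im : ℝ) : ℂ) * I‖ = x.im - xc.im := by
      rw [norm_mul, norm_I, mul_one, Complex.norm_real, Real.norm_eq_abs, abs_of_pos (by linarith)]
    rw [h6]; linarith
  have hm := mass_lower H (K := Set.Icc (xc.re - r / 4) (xc.re + r / 4) ×ℂ Set.Icc (xc.im + δ / 4) (xc.im + 3 * δ / 4))
    (U := Set.Ioo (xc.re - r / 2) (xc.re + r / 2) ×ℂ Set.Ioo xc.im (xc.im + δ))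
    (P := Set.Icc (p0.re - 2 / r * (ε * δ)) (p0.re + 2 / r * (ε * δ)) ×ℂ Set.Icc (p0.im + T) (p0.im + T + ε))
    (isCompact_Icc.reProdIm isCompact_Icc) (isOpen_Ioo.reProdIm isOpen_Ioo)
    (by
      rintro x ⟨⟨h1, h2⟩, h3, h4⟩
      exact ⟨⟨by linarith, by linarith⟩, by linarith, by linarith⟩) hUb hc.le
    (fun x hx => by
      refine hg x (hUb ?_)
      obtain ⟨⟨h1, h2⟩, h3, h4⟩ := hx
      exact ⟨⟨by linarith, by linarith⟩, by linarith, by linarith⟩)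
    (isClosed_Icc.reProdIm isClosed_Icc).measurableSet
    (by rw [volume_rect]; exact ENNReal.mul_ne_top ENNReal.ofReal_ne_top ENNReal.ofReal_ne_top)
    (fun p hd hp => by
      set x := gradient f p
      obtain ⟨⟨h1, h2⟩, h3, h4⟩ := hp
      set ξ1 := x.re - xc.re with hξ1
      set ξ2 := x.im - xc.im with hξ2
      obtain ⟨u, rfl⟩ : ∃ u, p = p0 + u := ⟨p - p0, by ring⟩
      have hsub := gradient_ineq H.conv hd (p0 + T * I)
      have k1 : F u ≤ u.re * ξ1 + (u.im - T) * ξ2 := by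
        have e : p0 + T * I - (p0 + u) = T * I - u := by ring
        rw [e] at hsub
        have e3 : F (T * I) = 0 := hTF
        simp only [hF, inner_split] at e3 hsub ⊢
        simp at e3 hsub ⊢
        rw [hξ1, hξ2]; linarith
      have hu1 : u.re * ξ1 ≤ |u.re| * (r / 2) := by
        refine (le_abs_self _).trans ?_
        rw [abs_mul]
        gcongr
        rw [abs_le]; constructor <;> linarith
      have k2 := Fr u
      have hξ20 : 0 < ξ2 := by linarith
      have hξ2δ : ξ2 ≤ δ := by linarith
      have k3 : 0 ≤ (u.im - T) * ξ2 := by nlinarith [abs_nonneg u.re]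
      have k4 : 0 ≤ u.im - T := by
        by_contra hneg
        push Not at hneg
        nlinarith
      have k5 : (u.im - T) * ξ2 ≤ (u.im - T) * δ := by gcongr
      have k6 : r * |u.re| ≤ 2 * ((u.im - T) * δ) := by linarith
      have k7 : F u ≤ 2 * ((u.im - T) * δ) := by linarith
      have k8 : u.im - T ≤ ε := by
        by_contra hgt
        push Not at hgt
        have hp : 0 < u.im - T := by linarith
        set τ := ε / (u.im - T) with hτ
        have hτ0 : 0 ≤ τ := by positivity
        have hτ1 : τ ≤ 1 := by rw [hτ, div_le_one hp]; exact hgt.le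
        have hτe : τ * (u.im - T) = ε := by rw [hτ]; field_simp
        have j1 := Fconv (T * I) u τ hτ0 hτ1
        rw [hTF, mul_zero, zero_add] at j1
        have j2 : τ * F u ≤ τ * (2 * ((u.im - T) * δ)) := by gcongr
        have j3 : τ * (2 * ((u.im - T) * δ)) = 2 * ε * δ := by rw [← hτe]; ring
        have j4 := Flip ((T + ε : ℝ) * I) ((1 - τ) • (T * I) + τ • u)
        have j5 : ((T + ε : ℝ) * I) - ((1 - τ) • (T * I) + τ • u) = ((- (τ * u.re) : ℝ) : ℂ) := by
          apply Complex.ext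
          · simp
          · simp; linarith
        rw [j5, Complex.norm_real, Real.norm_eq_abs, abs_neg, abs_mul, abs_of_nonneg hτ0] at j4
        have j6 : τ * (r * |u.re|) ≤ τ * (2 * ((u.im - T) * δ)) := by gcongr
        have j7 : r * (κ - 2 * ε * δ) ≤ 2 * (2 * ε * δ) := by
          have : r * (κ - 2 * ε * δ) ≤ r * (2 * (τ * |u.re|)) := by
            apply mul_le_mul_of_nonneg_left _ hr.le; linarith
          linarith
        have j8 : r * (δ * (8 * ε)) ≤ r * κ := mul_le_mul_of_nonneg_left hδ2 hr.le
        have : 0 < r * κ := by positivity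
        linarith
      have k9 : |u.re| ≤ 2 / r * (ε * δ) := by
        rw [div_mul_eq_mul_div, le_div_iff₀ hr]
        have : (u.im - T) * δ ≤ ε * δ := by gcongr
        linarith
      rw [abs_le] at k9
      refine ⟨⟨?_, ?_⟩, ?_, ?_⟩ <;> simp <;> linarith [k9.1, k9.2])
  rw [volume_rect, volume_rect, ENNReal.toReal_mul, ENNReal.toReal_mul, ENNReal.toReal_ofReal (by linarith), ENNReal.toReal_ofReal (by linarith),
    ENNReal.toReal_ofReal (by have : 0 < 2 / r * (ε * δ) := by positivity
                              linarith), ENNReal.toReal_ofReal (by linarith)] at hm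
  have e1 : c * ((xc.re + r / 4 - (xc.re - r / 4)) * (xc.im + 3 * δ / 4 - (xc.im + δ / 4))) = δ * (c * r / 4) := by ring
  have e2 : (p0.re + 2 / r * (ε * δ) - (p0.re - 2 / r * (ε * δ))) * (p0.im + T + ε - (p0.im + T)) = δ * (4 / r * ε ^ 2) := by ring
  rw [e1, e2, hε2] at hm
  have h1 := le_of_mul_le_mul_left hm hδ0
  have e3 : 4 / r * (r ^ 2 * (c / 32)) = c * r / 8 := by field_simp; norm_num
  rw [e3] at h1
  have : 0 < c * r := by positivity
  linarith

lemma exists_rot {v : ℂ} (hv : v ≠ 0) : ∃ w : ℂ, ‖w‖ = 1 ∧ starRingEnd ℂ w * v = (‖v‖ : ℂ) := by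
  have hn : (‖v‖ : ℂ) ≠ 0 := by exact_mod_cast (norm_pos_iff.2 hv).ne'
  refine ⟨v / ‖v‖, ?_, ?_⟩
  · rw [norm_div, Complex.norm_real, norm_norm, div_self (norm_pos_iff.2 hv).ne']
  · rw [map_div₀, Complex.conj_ofReal, div_mul_eq_mul_div, mul_comm, Complex.mul_conj, Complex.normSq_eq_norm_sq]
    push_cast
    rw [sq, mul_div_assoc, div_self hn, mul_one]

lemma sub_unique (H : WS g f) {p x y : ℂ} (hx : SubG f p x) (hy : SubG f p y) : x = y := by
  by_contra hne
  obtain ⟨w, hw, e⟩ := exists_rot (sub_ne_zero.2 hne)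
  have hw2 : w * starRingEnd ℂ w = 1 := by rw [mul_comm, unit_conj hw]
  have hp : w * (starRingEnd ℂ w * p) = p := by rw [← mul_assoc, hw2, one_mul]
  rw [← hp] at hx hy
  have h1 := hx.rot hw
  have h2 := hy.rot hw
  set x' := starRingEnd ℂ w * x
  set y' := starRingEnd ℂ w * y
  have e' : x' - y' = (‖x - y‖ : ℂ) := by rw [← e]; ring
  have hr : 0 < ‖x - y‖ / 2 := by
    have := norm_pos_iff.2 (sub_ne_zero.2 hne); linarith
  refine core_b (H.rot hw) (xc := (x' + y') / 2) hr (p0 := starRingEnd ℂ w * p) ?_ ?_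
  · convert h1 using 1
    push_cast; rw [← e']; ring
  · convert h2 using 1
    push_cast; rw [← e']; ring

lemma WS.hasGrad (H : WS g f) {p x : ℂ} (hx : SubG f p x) : HasGradientAt f x p :=
  diff_of_unique H.lip H.conv hx fun y hy => sub_unique H hy hx

lemma WS.diff (H : WS g f) : Differentiable ℝ f := fun p => by
  obtain ⟨x, hx⟩ := sub_exists H.lip H.conv p
  exact (H.hasGrad hx).differentiableAt

lemma WS.sub_grad (H : WS g f) (p : ℂ) : SubG f p (gradient f p) := gradient_ineq H.conv (H.diff p)

lemma WS.grad_lt (H : WS g f) (p : ℂ) : ‖gradient f p‖ < 1 := sub_lt_one H (H.sub_grad p)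

lemma WS.sub_eq (H : WS g f) {p x : ℂ} (hx : SubG f p x) : gradient f p = x := sub_unique H (H.sub_grad p) hx

lemma WS.grad_cont (H : WS g f) : Continuous (gradient f) := by
  rw [Metric.continuous_iff]
  intro p e he
  obtain ⟨d, hd, h⟩ := sub_near H.lip (p := p) (x := gradient f p) (fun y hy => (H.sub_eq hy).symm) he
  exact ⟨d, hd, fun p' hp' => h p' hp' _ (H.sub_grad p')⟩

end B7

section B8
open Complex MeasureTheory
open scoped ContDiff

variable {f g : ℂ → ℝ}

lemma near_small (H : WS g f) {p x : ℂ} (hx : SubG f p x) {ε : ℝ} (hε : 0 < ε) :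
    ∃ d > 0, ∀ t : ℝ, |t| ≤ d → f (p + t * I) - f p - ⟪t * I, x⟫ ≤ ε * |t| := by
  have h := hasGradientAt_iff_isLittleO_nhds_zero.1 (H.hasGrad hx)
  rw [Asymptotics.isLittleO_iff] at h
  obtain ⟨d, hd, h⟩ := Metric.eventually_nhds_iff.1 (h hε)
  refine ⟨d / 2, by positivity, fun t ht => ?_⟩
  have := h (y := t * I) (by simp; linarith)
  rw [real_inner_comm] at this
  have h2 := (le_abs_self _).trans this
  simpa using h2

set_option maxHeartbeats 1000000 in
lemma core_c (H : WS g f) {pc x : ℂ} {r : ℝ} (hr : 0 < r) (s1 : SubG f (pc + r) x) (s2 : SubG f (pc - r) x) : False := by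
  have hx1 := sub_lt_one H s1
  have hgc : ContinuousAt g x := H.gs.continuousOn.continuousAt (isOpen_ball.mem_nhds (by simpa using hx1))
  obtain ⟨ρ1, hρ1, hb⟩ := Metric.eventually_nhds_iff.1 (hgc.eventually (gt_mem_nhds (lt_add_one (g x))))
  set G := max (g x + 1) 0 with hG
  have hG0 : 0 ≤ G := le_max_right _ _
  set ρ := min ρ1 (1 - ‖x‖) with hρd
  have hρ : 0 < ρ := lt_min hρ1 (by linarith)
  set ε := min (ρ / 16) (r / (8 * (G + 1))) with hεd
  have hε : 0 < ε := lt_min (by positivity) (by positivity)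
  have hε1 : 16 * ε ≤ ρ := by have := min_le_left (ρ / 16) (r / (8 * (G + 1))); linarith
  have hε2 : ε * (8 * (G + 1)) ≤ r := by
    rw [← le_div_iff₀ (by positivity)]; exact min_le_right _ _
  obtain ⟨d1, hd1, D1⟩ := near_small H s1 hε
  obtain ⟨d2, hd2, D2⟩ := near_small H s2 hε
  set δ := min (min d1 d2) r with hδd
  have hδ : 0 < δ := lt_min (lt_min hd1 hd2) hr
  have hδr : δ ≤ r := min_le_right _ _
  have hδ1 : δ ≤ d1 := (min_le_left _ _).trans (min_le_left _ _)
  have hδ2 : δ ≤ d2 := (min_le_left _ _).trans (min_le_right _ _)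
  set F : ℂ → ℝ := fun u => f (pc + u) - f (pc + r) - ⟪u - r, x⟫ with hF
  have Fnn : ∀ u, 0 ≤ F u := by
    intro u
    have h1 := s1 (pc + u)
    rw [add_sub_add_left_eq_sub] at h1
    simp only [hF]; linarith
  have Fr : F r = 0 := by simp [hF]
  have Fr' : F (-r) = 0 := by
    apply le_antisymm _ (Fnn _)
    have h1 := s2 (pc + r)
    have e : -(r:ℂ) - r = - (pc + r - (pc - r)) := by ring
    simp only [hF]
    rw [e, inner_neg_left, ← sub_eq_add_neg]; linarith
  have F1 : ∀ t : ℝ, |t| ≤ δ → F (r + t * I) ≤ ε * δ := by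
    intro t ht
    have := D1 t (ht.trans hδ1)
    simp only [hF]
    rw [add_sub_cancel_left, ← add_assoc]
    have : ε * |t| ≤ ε * δ := by gcongr
    linarith
  have F2 : ∀ t : ℝ, |t| ≤ δ → F (-r + t * I) ≤ ε * δ := by
    intro t ht
    have := D2 t (ht.trans hδ2)
    simp only [hF] at Fr' ⊢
    have e1 : pc + (-r + t * I) = pc - r + t * I := by ring
    have e2 : -r + t * I - r = (-r - r) + t * I := by ring
    rw [← sub_eq_add_neg] at Fr'
    rw [e1, e2, inner_add_left]
    have : ε * |t| ≤ ε * δ := by gcongr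
    linarith
  have FR : ∀ a b : ℝ, |a| ≤ r → |b| ≤ δ → F (a + b * I) ≤ ε * δ := by
    intro a b ha hb
    rw [abs_le] at ha
    set α : ℝ := (r + a) / (2 * r) with hα
    set β : ℝ := (r - a) / (2 * r) with hβ
    have hα0 : 0 ≤ α := div_nonneg (by linarith) (by linarith)
    have hβ0 : 0 ≤ β := div_nonneg (by linarith) (by linarith)
    have h1 : α + β = 1 := by rw [hα, hβ]; field_simp; ring
    have h2 : α * r - β * r = a := by rw [hα, hβ]; field_simp; ring
    have hc := H.conv.2 (Set.mem_univ (pc + (r + b * I))) (Set.mem_univ (pc + (-r + b * I))) hα0 hβ0 h1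
    have e : α • (pc + (r + b * I)) + β • (pc + (-r + b * I)) = pc + (a + b * I) := by
      apply Complex.ext
      · simp; linear_combination h2 + pc.re * h1
      · simp; linear_combination (pc.im + b) * h1
    rw [e] at hc
    have f1 := F1 b hb
    have f2 := F2 b hb
    have e1 : ⟪(a:ℂ) + b * I - r, x⟫ = α * ⟪(r:ℂ) + b * I - r, x⟫ + β * ⟪-(r:ℂ) + b * I - r, x⟫ := by
      simp only [inner_split]; simp
      linear_combination (-x.re) * h2 + (x.re * r - b * x.im) * h1
    have : F (a + b * I) ≤ α * F (r + b * I) + β * F (-r + b * I) := by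
      simp only [hF]
      rw [e1]
      simp only [smul_eq_mul] at hc
      have : (α + β) * f (pc + r) = f (pc + r) := by rw [h1, one_mul]
      linarith
    have g1 : α * F (r + b * I) ≤ α * (ε * δ) := by gcongr
    have g2 : β * F (-r + b * I) ≤ β * (ε * δ) := by gcongr
    have : α * (ε * δ) + β * (ε * δ) = ε * δ := by rw [← add_mul, h1, one_mul]
    linarith
  have hq : ε * δ / r ≤ ε := by rw [div_le_iff₀ hr]; gcongr
  have hq0 : 0 < ε * δ / r := by positivity
  set m := ε * δ / r with hm
  have hUb : ∀ z ∈ Set.Ioo (x.re - 4 * m) (x.re + 4 * m) ×ℂ Set.Ioo (x.im - 4 * ε) (x.im + 4 * ε), ‖z - x‖ < ρ := by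
    intro z hz
    rw [Complex.mem_reProdIm, Set.mem_Ioo, Set.mem_Ioo] at hz
    have h1 : |(z - x).re| ≤ 4 * ε := by rw [abs_le]; simp; constructor <;> linarith [hz.1.1, hz.1.2]
    have h2 : |(z - x).im| ≤ 4 * ε := by rw [abs_le]; simp; constructor <;> linarith [hz.2.1, hz.2.2]
    have := Complex.norm_le_abs_re_add_abs_im (z - x)
    linarith
  have hmass := mass_upper H (K := Set.Icc (x.re - 2 * m) (x.re + 2 * m) ×ℂ Set.Icc (x.im - 2 * ε) (x.im + 2 * ε))
    (U := Set.Ioo (x.re - 4 * m) (x.re + 4 * m) ×ℂ Set.Ioo (x.im - 4 * ε) (x.im + 4 * ε))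
    (P := Set.Icc (pc.re - r / 2) (pc.re + r / 2) ×ℂ Set.Icc (pc.im - δ / 2) (pc.im + δ / 2))
    (isCompact_Icc.reProdIm isCompact_Icc) (isOpen_Ioo.reProdIm isOpen_Ioo)
    (by
      intro z hz
      rw [Complex.mem_reProdIm, Set.mem_Icc, Set.mem_Icc] at hz
      rw [Complex.mem_reProdIm, Set.mem_Ioo, Set.mem_Ioo]
      refine ⟨⟨?_, ?_⟩, ?_, ?_⟩ <;> linarith [hz.1.1, hz.1.2, hz.2.1, hz.2.2])
    (by
      intro z hz
      have h1 := hUb z hz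
      rw [mem_ball_zero_iff]
      have h2 := norm_sub_norm_le z x
      have := min_le_right ρ1 (1 - ‖x‖)
      linarith)
    hG0
    (by
      intro z hz
      have h1 := hUb z hz
      have := hb (y := z) (by rw [dist_eq_norm]; exact h1.trans_le (min_le_left _ _))
      exact this.le.trans (le_max_left _ _))
    ((isCompact_Icc.reProdIm isCompact_Icc).measurableSet) ((isCompact_Icc.reProdIm isCompact_Icc).measure_lt_top.ne)
    (by
      intro p hp _
      rw [Complex.mem_reProdIm, Set.mem_Icc, Set.mem_Icc] at hp
      have hv := H.sub_grad p
      set v := gradient f p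
      have key : ∀ a b : ℝ, |a| ≤ r → |b| ≤ δ → (a - (p - pc).re) * (v - x).re + (b - (p - pc).im) * (v - x).im ≤ ε * δ := by
        intro a b ha hb
        have h1 := FR a b ha hb
        have h2 := hv (pc + (a + b * I))
        have h3 := Fnn (p - pc)
        simp only [hF] at h1 h3
        rw [add_sub_cancel] at h3
        rw [inner_split] at h1 h2 h3
        simp at h1 h2 h3 ⊢
        linarith
      simp only [sub_re, sub_im] at key
      rw [Complex.mem_reProdIm, Set.mem_Icc, Set.mem_Icc]
      have hmr : m * r = ε * δ := by rw [hm]; field_simp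
      have k1 := key (p.re - pc.re + r / 2) (p.im - pc.im) (by rw [abs_le]; constructor <;> linarith [hp.1.1, hp.1.2]) (by rw [abs_le]; constructor <;> linarith [hp.2.1, hp.2.2])
      have k2 := key (p.re - pc.re - r / 2) (p.im - pc.im) (by rw [abs_le]; constructor <;> linarith [hp.1.1, hp.1.2]) (by rw [abs_le]; constructor <;> linarith [hp.2.1, hp.2.2])
      have k3 := key (p.re - pc.re) (p.im - pc.im + δ / 2) (by rw [abs_le]; constructor <;> linarith [hp.1.1, hp.1.2]) (by rw [abs_le]; constructor <;> linarith [hp.2.1, hp.2.2])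
      have k4 := key (p.re - pc.re) (p.im - pc.im - δ / 2) (by rw [abs_le]; constructor <;> linarith [hp.1.1, hp.1.2]) (by rw [abs_le]; constructor <;> linarith [hp.2.1, hp.2.2])
      have j1 : r * (v.re - x.re) ≤ r * (2 * m) := by linarith
      have j2 : r * (-(2 * m)) ≤ r * (v.re - x.re) := by linarith
      have j3 : δ * (v.im - x.im) ≤ δ * (2 * ε) := by linarith
      have j4 : δ * (-(2 * ε)) ≤ δ * (v.im - x.im) := by linarith
      have j1 := le_of_mul_le_mul_left j1 hr
      have j2 := le_of_mul_le_mul_left j2 hr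
      have j3 := le_of_mul_le_mul_left j3 hδ
      have j4 := le_of_mul_le_mul_left j4 hδ
      refine ⟨⟨?_, ?_⟩, ?_, ?_⟩ <;> linarith)
  rw [volume_rect, volume_rect', ENNReal.toReal_mul, ENNReal.toReal_mul, ENNReal.toReal_ofReal (by linarith), ENNReal.toReal_ofReal (by linarith),
    ENNReal.toReal_ofReal (by linarith), ENNReal.toReal_ofReal (by linarith)] at hmass
  have e1 : (pc.re + r / 2 - (pc.re - r / 2)) * (pc.im + δ / 2 - (pc.im - δ / 2)) = δ * r := by ring
  have e2 : G * ((x.re + 4 * m - (x.re - 4 * m)) * (x.im + 4 * ε - (x.im - 4 * ε))) = δ * (64 * G * ε ^ 2 / r) := by rw [hm]; ring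
  rw [e1, e2] at hmass
  have h1 := le_of_mul_le_mul_left hmass hδ
  rw [le_div_iff₀ hr] at h1
  have h2 : (ε * (8 * (G + 1))) * (ε * (8 * (G + 1))) ≤ r * r := mul_le_mul hε2 hε2 (by positivity) hr.le
  have h3 : 0 < ε ^ 2 * (64 * (G ^ 2 + G + 1)) := by positivity
  nlinarith

lemma grad_inj (H : WS g f) {p q x : ℂ} (hp : SubG f p x) (hq : SubG f q x) : p = q := by
  by_contra hne
  obtain ⟨w, hw, e⟩ := exists_rot (sub_ne_zero.2 hne)
  have hw2 : w * starRingEnd ℂ w = 1 := by rw [mul_comm, unit_conj hw]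
  have hp' : ∀ p, w * (starRingEnd ℂ w * p) = p := fun p => by rw [← mul_assoc, hw2, one_mul]
  rw [← hp' p] at hp
  rw [← hp' q] at hq
  have h1 := hp.rot hw
  have h2 := hq.rot hw
  set x' := starRingEnd ℂ w * p
  set y' := starRingEnd ℂ w * q
  have e' : x' - y' = (‖p - q‖ : ℂ) := by rw [← e]; ring
  have hr : 0 < ‖p - q‖ / 2 := by
    have := norm_pos_iff.2 (sub_ne_zero.2 hne); linarith
  refine core_c (H.rot hw) (pc := (x' + y') / 2) hr (x := starRingEnd ℂ w * x) ?_ ?_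
  · convert h1 using 1
    push_cast; rw [← e']; ring
  · convert h2 using 1
    push_cast; rw [← e']; ring

end B8

section B9
open Complex MeasureTheory
open scoped ContDiff

variable {f g : ℂ → ℝ}

lemma WS.strict (H : WS g f) {P P' : ℂ} (hne : P ≠ P') : f P + ⟪P' - P, gradient f P⟫ < f P' := by
  refine lt_of_le_of_ne (H.sub_grad P P') fun e => hne ?_
  refine grad_inj H (H.sub_grad P) (x := gradient f P) ?_
  intro p'
  have := H.sub_grad P p'
  have e2 : p' - P = (p' - P') + (P' - P) := by ring
  rw [e2, inner_add_left] at this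
  linarith

lemma WS.mono (H : WS g f) {P P' : ℂ} (hne : P ≠ P') : 0 < ⟪P' - P, gradient f P' - gradient f P⟫ := by
  have h1 := H.strict hne
  have h2 := H.strict hne.symm
  rw [← neg_sub, inner_neg_left] at h2
  rw [inner_sub_right]; linarith

/-- the open strip -/
def Stp : Set ℂ := {z | |z.im| < 1}

lemma Stp_open : IsOpen Stp := isOpen_lt (by fun_prop) continuous_const

lemma WS.exV (H : WS g f) : ∃ V : ℂ → ℂ, ∀ x, ‖x‖ < 1 → gradient f (V x) = x := by
  have : ∀ x : ℂ, ∃ P, ‖x‖ < 1 → gradient f P = x := by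
    intro x
    by_cases hx : ‖x‖ < 1
    · obtain ⟨M, hM⟩ := H.low
      have hc : Continuous fun p => f p - ⟪p, x⟫ := by
        have := H.lip.continuous; fun_prop
      obtain ⟨P, hP⟩ := hc.exists_forall_le' 0 (by
        filter_upwards [(tendsto_norm_cocompact_atTop (E := ℂ)).eventually_ge_atTop ((M + f 0) / (1 - ‖x‖))] with p hp
        rw [div_le_iff₀ (by linarith)] at hp
        have h1 := real_inner_le_norm p x
        have h2 := hM p
        simp only [inner_zero_left]
        linarith)
      refine ⟨P, fun _ => H.sub_eq fun p' => ?_⟩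
      have := hP p'
      rw [inner_sub_left]; linarith
    · exact ⟨0, fun h => absurd h hx⟩
  exact ⟨_, fun x => (this x).choose_spec⟩

lemma WS.exQ (H : WS g f) : ∃ Q : ℂ → ℝ, ∀ z ∈ Stp, (gradient f (z.re + Q z * I)).im = z.im := by
  have : ∀ z : ℂ, ∃ q : ℝ, z ∈ Stp → (gradient f (z.re + q * I)).im = z.im := by
    intro z
    by_cases hz : z ∈ Stp
    · obtain ⟨M, hM⟩ := H.low
      have hz' := abs_lt.1 (show |z.im| < 1 from hz)
      have hc : Continuous fun q : ℝ => (gradient f (z.re + q * I)).im :=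
        Complex.continuous_im.comp (H.grad_cont.comp (by fun_prop))
      set B := max (M + f z.re) 0 with hB
      have hB0 : 0 ≤ B := le_max_right _ _
      have hB1 : M + f z.re ≤ B := le_max_left _ _
      have key : ∀ q : ℝ, |q| - B ≤ q * (gradient f (z.re + q * I)).im := by
        intro q
        have h1 := H.sub_grad (z.re + q * I) z.re
        rw [inner_split] at h1
        simp at h1
        have h2 := hM (z.re + q * I)
        have h3 := Complex.abs_im_le_norm (z.re + q * I)
        simp at h3
        linarith
      have h1 : ∃ q : ℝ, (gradient f (z.re + q * I)).im ≤ z.im := by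
        set R := (B + 1) / (1 + z.im) with hR
        have hR0 : 0 < R := div_pos (by linarith) (by linarith)
        refine ⟨((-R : ℝ)), ?_⟩
        have := key (-R)
        rw [abs_neg, abs_of_pos hR0] at this
        by_contra hlt
        push Not at hlt
        have : R * (1 + z.im) ≤ B := by nlinarith
        rw [hR, div_mul_cancel₀ _ (by linarith)] at this
        linarith
      have h2 : ∃ q : ℝ, z.im ≤ (gradient f (z.re + q * I)).im := by
        set R := (B + 1) / (1 - z.im) with hR
        have hR0 : 0 < R := div_pos (by linarith) (by linarith)
        refine ⟨R, ?_⟩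
        have := key R
        rw [abs_of_pos hR0] at this
        by_contra hlt
        push Not at hlt
        have : R * (1 - z.im) ≤ B := by nlinarith
        rw [hR, div_mul_cancel₀ _ (by linarith)] at this
        linarith
      obtain ⟨q1, h1⟩ := h1
      obtain ⟨q2, h2⟩ := h2
      obtain ⟨q, hq⟩ := mem_range_of_exists_le_of_exists_ge hc ⟨q1, h1⟩ ⟨q2, h2⟩
      exact ⟨q, fun _ => hq⟩
    · exact ⟨0, fun h => absurd h hz⟩
  exact ⟨_, fun z => (this z).choose_spec⟩

/-- partial Legendre data -/
structure PL (g f Q X : ℂ → ℝ) (V : ℂ → ℂ) : Prop where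
  ws : WS g f
  hQ : ∀ z ∈ Stp, gradient f (z.re + Q z * I) = X z + z.im * I
  hV : ∀ x, ‖x‖ < 1 → gradient f (V x) = x

lemma WS.exPL (H : WS g f) : ∃ Q X V, PL g f Q X V := by
  obtain ⟨V, hV⟩ := H.exV
  obtain ⟨Q, hQ⟩ := H.exQ
  refine ⟨Q, fun z => (gradient f (z.re + Q z * I)).re, V, H, fun z hz => ?_, hV⟩
  rw [← hQ z hz]; exact (Complex.re_add_im _).symm

variable {Q X : ℂ → ℝ} {V : ℂ → ℂ}

lemma PL.lt_iff (L : PL g f Q X V) {z : ℂ} (hz : z ∈ Stp) (q : ℝ) : (gradient f (z.re + q * I)).im < z.im ↔ q < Q z := by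
  by_cases h : q = Q z
  · rw [h, L.hQ z hz]; simp
  · have := L.ws.mono (P := z.re + q * I) (P' := z.re + Q z * I) (by
      intro e; apply h; have := congrArg Complex.im e; simpa using this)
    rw [L.hQ z hz, inner_split] at this
    simp at this
    constructor
    · intro h1; by_contra h2; push Not at h2; nlinarith
    · intro h1; by_contra h2; push Not at h2; nlinarith

lemma PL.gt_iff (L : PL g f Q X V) {z : ℂ} (hz : z ∈ Stp) (q : ℝ) : z.im < (gradient f (z.re + q * I)).im ↔ Q z < q := by
  by_cases h : q = Q z
  · rw [h, L.hQ z hz]; simp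
  · have := L.ws.mono (P := z.re + q * I) (P' := z.re + Q z * I) (by
      intro e; apply h; have := congrArg Complex.im e; simpa using this)
    rw [L.hQ z hz, inner_split] at this
    simp at this
    constructor
    · intro h1; by_contra h2; push Not at h2; nlinarith
    · intro h1; by_contra h2; push Not at h2; nlinarith

lemma PL.contQ (L : PL g f Q X V) : ContinuousOn Q Stp := by
  intro z hz
  apply ContinuousAt.continuousWithinAt
  have hc : ∀ q : ℝ, Continuous fun z : ℂ => (gradient f (z.re + q * I)).im := fun q =>
    Complex.continuous_im.comp (L.ws.grad_cont.comp (by fun_prop))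
  refine tendsto_order.2 ⟨fun q hq => ?_, fun q hq => ?_⟩
  · filter_upwards [Stp_open.mem_nhds hz, ((hc q).continuousAt.eventually_lt Complex.continuous_im.continuousAt ((L.lt_iff hz q).2 hq))] with w hw hw2
    exact (L.lt_iff hw q).1 hw2
  · filter_upwards [Stp_open.mem_nhds hz, (Complex.continuous_im.continuousAt.eventually_lt (hc q).continuousAt ((L.gt_iff hz q).2 hq))] with w hw hw2
    exact (L.gt_iff hw q).1 hw2

lemma PL.contX (L : PL g f Q X V) : ContinuousOn X Stp := by
  have h1 : ContinuousOn (fun z => (gradient f (z.re + Q z * I)).re) Stp := by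
    refine Complex.continuous_re.comp_continuousOn (L.ws.grad_cont.comp_continuousOn ?_)
    have := L.contQ
    fun_prop
  refine h1.congr fun z hz => ?_
  beta_reduce; rw [L.hQ z hz]; simp

lemma PL.norm_lt (L : PL g f Q X V) {z : ℂ} (hz : z ∈ Stp) : ‖(X z : ℂ) + z.im * I‖ < 1 := by
  rw [← L.hQ z hz]; exact L.ws.grad_lt _

lemma PL.V_grad (L : PL g f Q X V) (p : ℂ) : V (gradient f p) = p :=
  grad_inj L.ws (L.ws.sub_grad _) (by rw [L.hV _ (L.ws.grad_lt p)]; exact L.ws.sub_grad p)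

lemma norm_lt_Stp {x : ℂ} (hx : ‖x‖ < 1) : x ∈ Stp := (Complex.abs_im_le_norm x).trans_lt hx

lemma PL.ord (L : PL g f Q X V) {x : ℂ} (hx : ‖x‖ < 1) (p : ℝ) :
    ((V x).re < p ↔ x.re < X (p + x.im * I)) ∧ (p < (V x).re ↔ X (p + x.im * I) < x.re) := by
  set z : ℂ := p + x.im * I with hzd
  have zre : z.re = p := by simp [hzd]
  have zim : z.im = x.im := by simp [hzd]
  have hz : z ∈ Stp := by
    have := norm_lt_Stp hx
    simpa [Stp, zim] using this
  have e1 := L.hQ z hz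
  have e2 := L.hV x hx
  by_cases h : V x = z.re + Q z * I
  · have e3 : x = X z + z.im * I := by rw [← e1, ← h, e2]
    have e4 : x.re = X z := by rw [e3]; simp
    have e5 : (V x).re = p := by rw [h]; simp [zre]
    rw [e4, e5]; simp
  · have := L.ws.mono h
    rw [e1, e2, inner_split] at this
    simp [zre, zim] at this
    refine ⟨⟨?_, ?_⟩, ?_, ?_⟩ <;> intro h1 <;> by_contra h2 <;> push Not at h2 <;> nlinarith

lemma PL.contV (L : PL g f Q X V) : ContinuousOn (fun x => (V x).re) (ball 0 1) := by
  intro x hx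
  apply ContinuousAt.continuousWithinAt
  have hx' : ‖x‖ < 1 := by simpa using hx
  have hS : ∀ p : ℝ, (p : ℂ) + x.im * I ∈ Stp := fun p => by
    have := norm_lt_Stp hx'
    simpa [Stp] using this
  have hc : ∀ p : ℝ, ContinuousAt (fun x : ℂ => X (p + x.im * I)) x := fun p =>
    ContinuousAt.comp (f := fun x : ℂ => (p:ℂ) + x.im * I) (L.contX.continuousAt (Stp_open.mem_nhds (hS p))) (by fun_prop)
  refine tendsto_order.2 ⟨fun p hp => ?_, fun p hp => ?_⟩
  · filter_upwards [isOpen_ball.mem_nhds hx, ((hc p).eventually_lt Complex.continuous_re.continuousAt ((L.ord hx' p).2.1 hp))] with w hw hw2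
    exact (L.ord (by simpa using hw) p).2.2 hw2
  · filter_upwards [isOpen_ball.mem_nhds hx, (Complex.continuous_re.continuousAt.eventually_lt (hc p) ((L.ord hx' p).1.1 hp))] with w hw hw2
    exact (L.ord (by simpa using hw) p).1.2 hw2

/-- the partial Legendre transform is C¹ -/
lemma PL.hasW (L : PL g f Q X V) {z : ℂ} (hz : z ∈ Stp) :
    HasFDerivAt (fun z : ℂ => f (z.re + Q z * I) - Q z * z.im) (X z • Complex.reCLM - Q z • Complex.imCLM) z := by
  have low : ∀ z ∈ Stp, ∀ z' ∈ Stp, (z' - z).re * X z - Q z' * (z' - z).im ≤ f (z'.re + Q z' * I) - Q z' * z'.im - (f (z.re + Q z * I) - Q z * z.im) := by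
    intro z hz z' hz'
    have h := L.ws.sub_grad (z.re + Q z * I) (z'.re + Q z' * I)
    rw [L.hQ z hz, inner_split] at h
    simp at h ⊢
    linarith
  rw [hasFDerivAt_iff_isLittleO, Asymptotics.isLittleO_iff]
  intro c hc
  have hX := (Metric.continuousAt_iff.1 (L.contX.continuousAt (Stp_open.mem_nhds hz))) (c / 2) (by positivity)
  have hQ := (Metric.continuousAt_iff.1 (L.contQ.continuousAt (Stp_open.mem_nhds hz))) (c / 2) (by positivity)
  obtain ⟨d1, hd1, hX⟩ := hX
  obtain ⟨d2, hd2, hQ⟩ := hQ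
  filter_upwards [Stp_open.mem_nhds hz, ball_mem_nhds z hd1, ball_mem_nhds z hd2] with z' hz' h1 h2
  have a1 := hX h1
  have a2 := hQ h2
  have l1 := low z hz z' hz'
  have l2 := low z' hz' z hz
  rw [Real.dist_eq] at a1 a2
  have b1 : |(z' - z).re * (X z' - X z)| ≤ ‖z' - z‖ * (c / 2) := by
    rw [abs_mul]; exact mul_le_mul (Complex.abs_re_le_norm _) a1.le (abs_nonneg _) (norm_nonneg _)
  have b2 : |(z' - z).im * (Q z' - Q z)| ≤ ‖z' - z‖ * (c / 2) := by
    rw [abs_mul]; exact mul_le_mul (Complex.abs_im_le_norm _) a2.le (abs_nonneg _) (norm_nonneg _)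
  rw [abs_le] at b1 b2
  have e1 : (z - z').re = - (z' - z).re := by simp
  have e2 : (z - z').im = - (z' - z).im := by simp
  rw [e1, e2] at l2
  rw [Real.norm_eq_abs, abs_le]
  simp only [ContinuousLinearMap.sub_apply, ContinuousLinearMap.smul_apply, reCLM_apply, imCLM_apply, smul_eq_mul]
  constructor <;> linarith

lemma TstR.intg {α : ℂ → ℝ} (h : TstR α Stp) (v : ℂ) {k : ℂ → ℝ} (hk : ContinuousOn k Stp) : Integrable (fun z => k z * fderiv ℝ α z v) := by
  have hc : Continuous (fun z => fderiv ℝ α z v) := (h.smooth.continuous_fderiv (by simp)).clm_apply continuous_const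
  have hsup : tsupport (fun z => fderiv ℝ α z v) ⊆ tsupport α := (tsupport_fderiv_apply_subset ℝ v)
  have hcs : HasCompactSupport (fun z => fderiv ℝ α z v) := h.cpt.fderiv_apply ℝ v
  apply Continuous.integrable_of_hasCompactSupport _ (hcs.mul_left)
  rw [continuous_iff_continuousAt]
  intro z
  by_cases hz : z ∈ tsupport (fun z => fderiv ℝ α z v)
  · exact ((hk.continuousAt (Stp_open.mem_nhds (h.supp (hsup hz)))).mul hc.continuousAt)
  · have : (fun z => k z * fderiv ℝ α z v) =ᶠ[𝓝 z] fun _ => 0 := by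
      filter_upwards [(isClosed_tsupport _).isOpen_compl.mem_nhds hz] with w hw
      rw [image_eq_zero_of_notMem_tsupport hw, mul_zero]
    exact this.continuousAt

lemma PL.curl (L : PL g f Q X V) {α : ℂ → ℝ} (h : TstR α Stp) :
    ∫ z, (X z * fderiv ℝ α z I + Q z * fderiv ℝ α z 1) = 0 := by
  set W : ℂ → ℂ := fun z => ((f (z.re + Q z * I) - Q z * z.im : ℝ) : ℂ) with hW
  have hd : ∀ z ∈ Stp, HasFDerivAt W (ofRealCLM.comp (X z • Complex.reCLM - Q z • Complex.imCLM)) z := fun z hz =>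
    ofRealCLM.hasFDerivAt.comp z (L.hasW hz)
  have hT := h.toC
  have e0 : ∀ z v, fderiv ℝ (fun z => (α z : ℂ)) z v = (fderiv ℝ α z v : ℂ) := fun z v => h.fderivC z v
  have f1 : ∀ z ∈ Stp, fderiv ℝ W z 1 = X z := fun z hz => by rw [(hd z hz).fderiv]; simp
  have f2 : ∀ z ∈ Stp, fderiv ℝ W z I = - Q z := fun z hz => by rw [(hd z hz).fderiv]; simp
  have b1 := (ibp_aux Stp_open (fun z hz => (hd z hz).differentiableAt) 1
    ((continuous_ofReal.comp_continuousOn L.contX).congr f1) ((hT.der I).smooth.of_le (by simp)) (hT.der I).cpt (hT.der I).supp).2.2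
  have b2 := (ibp_aux Stp_open (fun z hz => (hd z hz).differentiableAt) I
    ((continuous_ofReal.comp_continuousOn L.contQ).neg.congr f2) ((hT.der 1).smooth.of_le (by simp)) (hT.der 1).cpt (hT.der 1).supp).2.2
  have c1 : ∫ z, fderiv ℝ W z 1 * fderiv ℝ (fun z => (α z : ℂ)) z I = ((∫ z, X z * fderiv ℝ α z I : ℝ) : ℂ) := by
    rw [← integral_complex_ofReal]
    congr 1; ext z
    by_cases hz : z ∈ Stp
    · rw [f1 z hz, e0]; push_cast; rfl
    · rw [e0, image_eq_zero_of_notMem_tsupport (f := fun z => fderiv ℝ α z I) fun hh => hz (h.supp (tsupport_fderiv_apply_subset ℝ I hh))]; simp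
  have c2 : ∫ z, fderiv ℝ W z I * fderiv ℝ (fun z => (α z : ℂ)) z 1 = ((- ∫ z, Q z * fderiv ℝ α z 1 : ℝ) : ℂ) := by
    rw [← integral_neg, ← integral_complex_ofReal]
    congr 1; ext z
    by_cases hz : z ∈ Stp
    · rw [f2 z hz, e0]; push_cast; ring
    · rw [e0, image_eq_zero_of_notMem_tsupport (f := fun z => fderiv ℝ α z 1) fun hh => hz (h.supp (tsupport_fderiv_apply_subset ℝ 1 hh))]; simp
  have c3 : (∫ z, W z * fderiv ℝ (fun z => fderiv ℝ (fun z => (α z : ℂ)) z I) z 1) = ∫ z, W z * fderiv ℝ (fun z => fderiv ℝ (fun z => (α z : ℂ)) z 1) z I := by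
    congr 1; ext z
    rw [hT.der_comm I 1 z]
  rw [b1, b2, c1, c2, neg_inj, Complex.ofReal_inj] at c3
  rw [integral_add (h.intg I L.contX) (h.intg 1 L.contQ), c3]; ring

end B9

section B10
open Complex MeasureTheory
open scoped ContDiff

/-- signed indicator of the interval from 0 to Y -/
def sgi (x Y : ℝ) : ℝ := (if x < Y then 1 else 0) - (if x < 0 then 1 else 0)

lemma sgi_int (k : ℝ → ℝ) (Y : ℝ) : ∫ x, sgi x Y * k x = ∫ x in (0:ℝ)..Y, k x := by
  rcases le_total 0 Y with h | h
  · rw [intervalIntegral.integral_of_le h, integral_Ioc_eq_integral_Ioo, ← integral_Ico_eq_integral_Ioo, ← integral_indicator measurableSet_Ico]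
    congr 1; ext x
    simp only [sgi, Set.indicator_apply, Set.mem_Ico]
    by_cases h1 : x < 0
    · simp [h1, h1.trans_le h, not_le.2 h1]
    · simp [h1, not_lt.1 h1]
  · rw [intervalIntegral.integral_of_ge h, integral_Ioc_eq_integral_Ioo, ← integral_Ico_eq_integral_Ioo, ← integral_indicator measurableSet_Ico, ← integral_neg]
    congr 1; ext x
    simp only [sgi, Set.indicator_apply, Set.mem_Ico]
    by_cases h1 : x < Y
    · simp [h1, h1.trans_le h, not_le.2 h1]
    · simp [h1, not_lt.1 h1]

set_option maxHeartbeats 1000000 in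
lemma layer {θ : ℝ → ℝ} (hθ : ContDiff ℝ 1 θ) (hθc : HasCompactSupport θ) {a b : ℝ} (hab : a ≤ b) (hs : ∀ p, p ∉ Set.Icc a b → deriv θ p = 0)
    {Y : ℝ → ℝ} (hY : ContinuousOn Y (Set.Icc a b)) {k η g1 : ℝ → ℝ} {J : Set ℝ} (hJ : J.OrdConnected) (h0 : (0:ℝ) ∈ J)
    (hYJ : ∀ p ∈ Set.Icc a b, Y p ∈ J) (hg : ContinuousOn g1 J) (hη : ∀ x ∈ J, η x = θ (k x)) (hη0 : ∀ x, x ∉ J → η x = 0)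
    (hk : ∀ x ∈ J, ∀ p ∈ Set.Icc a b, (k x < p ↔ x < Y p)) :
    ∫ x, η x * g1 x = - ∫ p, deriv θ p * ∫ s in (0:ℝ)..Y p, g1 s := by
  set Y' : ℝ → ℝ := fun p => Y (max a (min b p)) with hY'
  have hproj : ∀ p, max a (min b p) ∈ Set.Icc a b := fun p => ⟨le_max_left _ _, max_le hab (min_le_left _ _)⟩
  have hYc : Continuous Y' := hY.comp_continuous (by fun_prop) hproj
  have hYe : ∀ p ∈ Set.Icc a b, Y' p = Y p := fun p hp => by simp only [hY']; rw [min_eq_right hp.2, max_eq_right hp.1]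
  have hYJ' : ∀ p, Y' p ∈ J := fun p => hYJ _ (hproj p)
  have hdc : Continuous (deriv θ) := hθ.continuous_deriv le_rfl
  have hdi : Integrable (deriv θ) := hdc.integrable_of_hasCompactSupport hθc.deriv
  have hd0 : ∫ p, deriv θ p = 0 :=
    integral_eq_zero_of_hasDerivAt_of_integrable (fun p => (hθ.differentiable (by simp) p).hasDerivAt) hdi (hθ.continuous.integrable_of_hasCompactSupport hθc)
  obtain ⟨pc, hpc, hc⟩ := isCompact_Icc.exists_isMinOn (Set.nonempty_Icc.2 hab) hY
  obtain ⟨pd, hpd, hd⟩ := isCompact_Icc.exists_isMaxOn (Set.nonempty_Icc.2 hab) hY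
  set c := min 0 (Y pc) with hcd
  set d := max 0 (Y pd) with hdd
  have cJ : c ∈ J := by rcases min_choice 0 (Y pc) with h | h <;> rw [hcd, h] <;> [exact h0; exact hYJ _ hpc]
  have dJ : d ∈ J := by rcases max_choice 0 (Y pd) with h | h <;> rw [hdd, h] <;> [exact h0; exact hYJ _ hpd]
  have hcdJ : Set.Icc c d ⊆ J := hJ.out cJ dJ
  have hYcd : ∀ p, c ≤ Y' p ∧ Y' p ≤ d := fun p =>
    ⟨(min_le_right _ _).trans (hc (hproj p)), le_trans (hd (hproj p)) (le_max_right _ _)⟩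
  have c0 : c ≤ 0 := min_le_left _ _
  have d0 : 0 ≤ d := le_max_left _ _
  have sg0 : ∀ x p, x ∉ Set.Icc c d → sgi x (Y' p) = 0 := by
    intro x p hx
    unfold sgi
    rcases lt_or_ge x c with h | h
    · rw [if_pos (by linarith [hYcd p]), if_pos (by linarith)]; ring
    · have : d < x := by by_contra h2; exact hx ⟨h, not_lt.1 h2⟩
      rw [if_neg (by linarith [hYcd p]), if_neg (by linarith)]; ring
  have s1 : ∀ x, η x = - ∫ p, deriv θ p * sgi x (Y' p) := by
    intro x
    by_cases hx : x ∈ J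
    · have e : ∀ p, deriv θ p * sgi x (Y' p) = (Set.Ioi (k x)).indicator (deriv θ) p - (if x < 0 then 1 else 0) * deriv θ p := by
        intro p
        by_cases hp : p ∈ Set.Icc a b
        · rw [hYe p hp]
          have := hk x hx p hp
          simp only [sgi, Set.indicator_apply, Set.mem_Ioi, this]
          split_ifs <;> ring
        · simp [Set.indicator_apply, hs p hp]
      simp_rw [e]
      rw [integral_sub (hdi.indicator measurableSet_Ioi) (hdi.const_mul _), integral_const_mul, hd0, integral_indicator measurableSet_Ioi,
        hθc.integral_Ioi_deriv_eq hθ, hη x hx]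
      ring
    · rw [hη0 x hx]
      have e : ∀ p, deriv θ p * sgi x (Y' p) = 0 := fun p => by rw [sg0 x p (fun h => hx (hcdJ h)), mul_zero]
      simp [e]
  set g0 := (Set.Icc c d).indicator g1 with hg0
  have hg0i : Integrable g0 := by
    rw [hg0, integrable_indicator_iff measurableSet_Icc]
    exact (hg.mono hcdJ).integrableOn_Icc
  have e1 : ∀ x p, deriv θ p * sgi x (Y' p) * g1 x = sgi x (Y' p) * (g0 x * deriv θ p) := by
    intro x p
    by_cases hx : x ∈ Set.Icc c d
    · rw [hg0, Set.indicator_of_mem hx]; ring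
    · rw [sg0 x p hx]; ring
  have hintg : Integrable (Function.uncurry fun x p => deriv θ p * sgi x (Y' p) * g1 x) (volume.prod volume) := by
    have : Integrable (fun z : ℝ × ℝ => sgi z.1 (Y' z.2) * (g0 z.1 * deriv θ z.2)) (volume.prod volume) := by
      refine (hg0i.mul_prod hdi).bdd_mul (c := 2) ?_ ?_
      · apply Measurable.aestronglyMeasurable
        unfold sgi
        refine Measurable.sub (Measurable.ite (measurableSet_lt measurable_fst (hYc.measurable.comp measurable_snd)) measurable_const measurable_const)
          (Measurable.ite (measurableSet_lt measurable_fst measurable_const) measurable_const measurable_const)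
      · refine Filter.Eventually.of_forall fun z => ?_
        unfold sgi
        split_ifs <;> norm_num
    refine this.congr (Filter.Eventually.of_forall fun z => ?_)
    simp only [Function.uncurry]; rw [e1]
  have e2 : ∀ x, η x * g1 x = - ∫ p, deriv θ p * sgi x (Y' p) * g1 x := fun x => by
    rw [s1 x, integral_mul_const]; ring
  simp_rw [e2]
  rw [integral_neg, integral_integral_swap hintg]
  congr 2; ext p
  have : ∀ x, deriv θ p * sgi x (Y' p) * g1 x = deriv θ p * (sgi x (Y' p) * g1 x) := fun x => by ring
  simp_rw [this]
  rw [integral_const_mul, sgi_int]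
  by_cases hp : p ∈ Set.Icc a b
  · rw [hYe p hp]
  · rw [hs p hp]; ring

/-- primitive in the real direction -/
def prim (g : ℂ → ℝ) (z : ℝ × ℝ) : ℝ := ∫ s in (0:ℝ)..z.1, g (s + z.2 * I)

lemma prim_smooth0 {h : ℂ → ℝ} (hh : ContDiff ℝ ∞ h) (hc : HasCompactSupport h) : ContDiff ℝ ∞ (prim h) := by
  obtain ⟨R, hR⟩ := hc.isCompact.isBounded.subset_closedBall (0:ℂ)
  have hz : ∀ s y : ℝ, R < |s| → h (s + y * I) = 0 := by
    intro s y hs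
    apply image_eq_zero_of_notMem_tsupport
    intro hm
    have h1 := hR hm
    rw [mem_closedBall_zero_iff] at h1
    have h2 := Complex.abs_re_le_norm (s + y * I)
    simp at h2
    linarith
  set u : ℝ → ℝ := (Set.Ici (0:ℝ)).indicator fun _ => 1
  have hu : LocallyIntegrable u volume := (locallyIntegrable_const 1).indicator measurableSet_Ici
  have hC := contDiffOn_convolution_right_with_param (n := ⊤) (𝕜 := ℝ) (μ := (volume : Measure ℝ)) (ContinuousLinearMap.mul ℝ ℝ) (P := ℝ) (G := ℝ) (f := u) (g := fun y s => h (s + y * I)) (s := Set.univ)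
    (k := Set.Icc (-R) R) isOpen_univ isCompact_Icc (by
      intro y s _ hs
      refine hz s y ?_
      by_contra hle
      exact hs (abs_le.1 (not_lt.1 hle))) hu (by
      apply ContDiff.contDiffOn
      refine hh.comp (g := h) (f := fun q : ℝ × ℝ => (q.2 : ℂ) + q.1 * I) ?_
      exact (ofRealCLM.contDiff.comp contDiff_snd).add ((ofRealCLM.contDiff.comp contDiff_fst).mul contDiff_const))
  rw [Set.univ_prod_univ, contDiffOn_univ] at hC
  set C : ℝ × ℝ → ℝ := fun q => (convolution u (fun s => h (s + q.1 * I)) (ContinuousLinearMap.mul ℝ ℝ) volume) q.2 with hCd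
  have hintg : ∀ y : ℝ, Integrable fun s : ℝ => h (s + y * I) := by
    intro y
    apply Continuous.integrable_of_hasCompactSupport (hh.continuous.comp (by fun_prop))
    refine HasCompactSupport.intro (K := Set.Icc (-R) R) isCompact_Icc fun s hs => hz s y ?_
    by_contra hle
    exact hs (abs_le.1 (not_lt.1 hle))
  have hCe : ∀ y x, C (y, x) = ∫ s in Set.Iic x, h (s + y * I) := by
    intro y x
    simp only [hCd]
    rw [convolution_eq_swap, ← integral_indicator measurableSet_Iic]
    congr 1; ext t
    simp only [u, ContinuousLinearMap.mul_apply', Set.indicator_apply, Set.mem_Ici, Set.mem_Iic, sub_nonneg]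
    split_ifs <;> simp
  have e : prim h = fun z => C (z.2, z.1) - C (z.2, 0) := by
    ext z
    rw [hCe, hCe, prim, intervalIntegral.integral_Iic_sub_Iic (hintg _).integrableOn (hintg _).integrableOn]
  rw [e]
  exact (hC.comp (contDiff_snd.prodMk contDiff_fst)).sub (hC.comp (contDiff_snd.prodMk contDiff_const))

def OmD : Set (ℝ × ℝ) := {z | ‖(z.1 : ℂ) + z.2 * I‖ < 1}

lemma OmD_open : IsOpen OmD := isOpen_lt (by fun_prop) continuous_const

lemma seg_norm {x y s : ℝ} (hs : s ∈ Set.uIcc 0 x) : ‖(s : ℂ) + y * I‖ ≤ ‖(x : ℂ) + y * I‖ := by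
  rw [Complex.norm_add_mul_I, Complex.norm_add_mul_I]
  apply Real.sqrt_le_sqrt
  have : s ^ 2 ≤ x ^ 2 := by
    rcases le_total 0 x with h | h
    · rw [Set.uIcc_of_le h] at hs; nlinarith [hs.1, hs.2]
    · rw [Set.uIcc_of_ge h] at hs; nlinarith [hs.1, hs.2]
  linarith

lemma prim_smooth {g : ℂ → ℝ} (hg : ContDiffOn ℝ ∞ g (ball 0 1)) : ContDiffOn ℝ ∞ (prim g) OmD := by
  intro z hz
  apply ContDiffAt.contDiffWithinAt
  obtain ⟨r, hr1, hr2⟩ := exists_between (show ‖(z.1 : ℂ) + z.2 * I‖ < 1 from hz)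
  have hr0 : 0 < r := (norm_nonneg _).trans_lt hr1
  let χ : ContDiffBump (0:ℂ) := ⟨r, (1 + r) / 2, hr0, by linarith⟩
  have hχs : tsupport (χ : ℂ → ℝ) ⊆ ball 0 1 := by
    rw [χ.tsupport_eq]; exact closedBall_subset_ball (by show (1 + r) / 2 < 1; linarith)
  have hs : ContDiff ℝ ∞ fun w => χ w * g w := by
    rw [contDiff_iff_contDiffAt]
    intro w
    by_cases hw : w ∈ tsupport (χ : ℂ → ℝ)
    · exact χ.contDiff.contDiffAt.mul (hg.contDiffAt (isOpen_ball.mem_nhds (hχs hw)))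
    · refine contDiffAt_const (c := 0) |>.congr_of_eventuallyEq ?_
      filter_upwards [(isClosed_tsupport _).isOpen_compl.mem_nhds hw] with v hv
      rw [image_eq_zero_of_notMem_tsupport hv, zero_mul]
  have := prim_smooth0 hs χ.hasCompactSupport.mul_right
  refine this.contDiffAt.congr_of_eventuallyEq ?_
  have ho : IsOpen {z : ℝ × ℝ | ‖(z.1 : ℂ) + z.2 * I‖ < r} := isOpen_lt (by fun_prop) continuous_const
  filter_upwards [ho.mem_nhds hr1] with w hw
  simp only [prim]
  apply intervalIntegral.integral_congr
  intro s hs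
  have h1 := (seg_norm (y := w.2) hs).trans_lt hw
  beta_reduce
  rw [χ.one_of_mem_closedBall (by rw [mem_closedBall_zero_iff]; exact h1.le), one_mul]

lemma prim_deriv {g : ℂ → ℝ} (hg : ContDiffOn ℝ ∞ g (ball 0 1)) {z : ℝ × ℝ} (hz : z ∈ OmD) : fderiv ℝ (prim g) z (1, 0) = g (z.1 + z.2 * I) := by
  have hd : HasFDerivAt (prim g) (fderiv ℝ (prim g) z) z :=
    ((prim_smooth hg).contDiffAt (OmD_open.mem_nhds hz)).differentiableAt (by simp) |>.hasFDerivAt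
  have h1 : HasDerivAt (fun t : ℝ => prim g (t, z.2)) (fderiv ℝ (prim g) z (1, 0)) z.1 :=
    HasFDerivAt.comp_hasDerivAt (f := fun t : ℝ => (t, z.2)) z.1 hd ((hasDerivAt_id z.1).prodMk (hasDerivAt_const z.1 z.2))
  have hcont : ∀ s : ℝ, ‖(s:ℂ) + z.2 * I‖ < 1 → ContinuousAt (fun s : ℝ => g (s + z.2 * I)) s := fun s hs =>
    ContinuousAt.comp (f := fun s : ℝ => (s:ℂ) + z.2 * I) (hg.continuousOn.continuousAt (isOpen_ball.mem_nhds (by simpa using hs))) (by fun_prop)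
  have h2 : HasDerivAt (fun t : ℝ => prim g (t, z.2)) (g (z.1 + z.2 * I)) z.1 := by
    have ho : IsOpen {s : ℝ | ‖(s:ℂ) + z.2 * I‖ < 1} := isOpen_lt (by fun_prop) continuous_const
    refine intervalIntegral.integral_hasDerivAt_right (f := fun s : ℝ => g (s + z.2 * I)) ?_ ?_ (hcont _ hz)
    · apply ContinuousOn.intervalIntegrable
      intro s hs
      exact (hcont s ((seg_norm hs).trans_lt hz)).continuousWithinAt
    · exact ContinuousOn.stronglyMeasurableAtFilter ho (fun s hs => (hcont s hs).continuousWithinAt) _ hz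
  exact h1.unique h2

end B10

section B11
open Complex MeasureTheory
open scoped ContDiff

variable {f g Q X : ℂ → ℝ} {V : ℂ → ℂ}

lemma int_iter {Φ : ℂ → ℝ} (h : Integrable Φ) :
    ∫ z, Φ z = ∫ x : ℝ, ∫ y : ℝ, Φ (x + y * I) := by
  have hp := Complex.volume_preserving_equiv_real_prod.symm
  have e : ∀ z : ℝ × ℝ, Complex.measurableEquivRealProd.symm z = z.1 + z.2 * I := fun z => by
    apply Complex.ext <;> simp [Complex.measurableEquivRealProd]
  rw [← hp.integral_comp Complex.measurableEquivRealProd.symm.measurableEmbedding, Measure.volume_eq_prod, integral_prod]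
  · simp only [e]
  · have := (hp.integrable_comp_emb Complex.measurableEquivRealProd.symm.measurableEmbedding).2 h
    exact this

lemma int_iter' {Φ : ℂ → ℝ} (h : Integrable Φ) :
    ∫ z, Φ z = ∫ y : ℝ, ∫ x : ℝ, Φ (x + y * I) := by
  have hp := Complex.volume_preserving_equiv_real_prod.symm
  have e : ∀ z : ℝ × ℝ, Complex.measurableEquivRealProd.symm z = z.1 + z.2 * I := fun z => by
    apply Complex.ext <;> simp [Complex.measurableEquivRealProd]
  rw [← hp.integral_comp Complex.measurableEquivRealProd.symm.measurableEmbedding, Measure.volume_eq_prod, integral_prod_symm]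
  · simp only [e]
  · have := (hp.integrable_comp_emb Complex.measurableEquivRealProd.symm.measurableEmbedding).2 h
    exact this

lemma line_deriv {α : ℂ → ℝ} (h : ContDiff ℝ ∞ α) (x y : ℝ) :
    deriv (fun t : ℝ => α (t + y * I)) x = fderiv ℝ α (x + y * I) 1 ∧ deriv (fun t : ℝ => α (x + t * I)) y = fderiv ℝ α (x + y * I) I := by
  have hd := (h.differentiable (by simp) (x + y * I)).hasFDerivAt
  constructor
  · refine (HasFDerivAt.comp_hasDerivAt (f := fun t : ℝ => (t:ℂ) + y * I) x hd ?_).deriv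
    exact ofRealCLM.hasDerivAt.add_const _
  · refine (HasFDerivAt.comp_hasDerivAt (f := fun t : ℝ => (x:ℂ) + t * I) y hd ?_).deriv
    have := ((ofRealCLM.hasDerivAt (x := y)).mul_const I).const_add (x:ℂ)
    simpa using this

lemma PL.contG (L : PL g f Q X V) : ContinuousOn (fun z : ℂ => prim g (X z, z.im)) Stp :=
  (prim_smooth L.ws.gs).continuousOn.comp (L.contX.prodMk Complex.continuous_im.continuousOn) fun z hz => L.norm_lt hz

set_option maxHeartbeats 1000000 in
lemma PL.weak (L : PL g f Q X V) {α : ℂ → ℝ} (h : TstR α Stp) :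
    ∫ z, (prim g (X z, z.im) * fderiv ℝ α z 1 - Q z * fderiv ℝ α z I) = 0 := by
  classical
  set η : ℂ → ℝ := fun x => if ‖x‖ < 1 then α ((V x).re + x.im * I) else 0 with hη
  set K : Set ℂ := (fun z : ℂ => (X z : ℂ) + z.im * I) '' tsupport α with hK
  have hKc : IsCompact K := by
    apply h.cpt.isCompact.image_of_continuousOn
    have := L.contX.mono h.supp
    fun_prop
  have hK1 : K ⊆ ball 0 1 := by
    rintro _ ⟨z, hz, rfl⟩
    rw [mem_ball_zero_iff]; exact L.norm_lt (h.supp hz)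
  have hη0 : ∀ x, x ∉ K → η x = 0 := by
    intro x hx
    by_contra hne
    have hx1 : ‖x‖ < 1 := by by_contra hh; exact hne (by simp [hη, hh])
    simp only [hη, if_pos hx1] at hne
    refine hx ⟨_, subset_tsupport α hne, ?_⟩
    have ho := L.ord hx1 (V x).re
    have : X ((V x).re + x.im * I) = x.re := le_antisymm (not_lt.1 fun hh => lt_irrefl _ (ho.1.2 hh)) (not_lt.1 fun hh => lt_irrefl _ (ho.2.2 hh))
    beta_reduce; rw [this]; simp
  have hηc : Continuous η := by
    rw [continuous_iff_continuousAt]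
    intro x
    by_cases hx : x ∈ K
    · have hb : ball (0:ℂ) 1 ∈ 𝓝 x := isOpen_ball.mem_nhds (hK1 hx)
      have : η =ᶠ[𝓝 x] fun x => α ((V x).re + x.im * I) := by
        filter_upwards [hb] with w hw
        simp only [hη]; rw [if_pos (by simpa using hw)]
      refine ContinuousAt.congr ?_ this.symm
      have hv := L.contV.continuousAt hb
      exact h.smooth.continuous.continuousAt.comp (by fun_prop)
    · have : η =ᶠ[𝓝 x] fun _ => 0 := by
        filter_upwards [hKc.isClosed.isOpen_compl.mem_nhds hx] with w hw using hη0 w hw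
      exact this.continuousAt
  have hηs : tsupport η ⊆ K := closure_minimal (fun x hx => by by_contra hh; exact hx (hη0 x hh)) hKc.isClosed
  have hηcs : HasCompactSupport η := hKc.of_isClosed_subset (isClosed_tsupport _) hηs
  have eq := L.ws.int η hηc hηcs (hηs.trans hK1)
  have hi1 := L.ws.grad_integ hηc hηcs (hηs.trans hK1)
  have hi2 := L.ws.integ hηc hηcs (hηs.trans hK1)
  -- supports
  obtain ⟨R0, hR0⟩ := h.cpt.isCompact.isBounded.subset_closedBall (0:ℂ)
  set R := max R0 0 with hRd
  have hRn : 0 ≤ R := le_max_right _ _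
  have hR : ∀ z, R < |z.re| → z ∉ tsupport α := fun z hz hm => by
    have h1 := hR0 hm
    rw [mem_closedBall_zero_iff] at h1
    have := Complex.abs_re_le_norm z
    have : R0 ≤ R := le_max_left _ _
    linarith
  have hr : ∃ r : ℝ, 0 ≤ r ∧ r < 1 ∧ ∀ z, r < |z.im| → z ∉ tsupport α := by
    rcases (tsupport α).eq_empty_or_nonempty with he | hne
    · exact ⟨0, le_rfl, one_pos, fun z _ hz => by rw [he] at hz; exact hz⟩
    · obtain ⟨z0, hz0, hm⟩ := h.cpt.isCompact.exists_isMaxOn hne (f := fun z : ℂ => |z.im|) (by fun_prop)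
      exact ⟨|z0.im|, abs_nonneg _, h.supp hz0, fun z hz hz' => absurd (hm hz') (not_le.2 hz)⟩
  obtain ⟨r, hr0, hr1, hr⟩ := hr
  have hz0 : ∀ v z, z ∉ tsupport α → fderiv ℝ α z v = 0 := fun v z hz =>
    image_eq_zero_of_notMem_tsupport (f := fun z => fderiv ℝ α z v) fun hh => hz (tsupport_fderiv_apply_subset ℝ v hh)
  -- left
  have l1 : ∫ p, η (gradient f p) = - ∫ z, Q z * fderiv ℝ α z I := by
    rw [int_iter hi1, int_iter (h.intg I L.contQ), ← integral_neg]
    congr 1; ext p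
    have hS : ∀ y ∈ Set.Icc (-r) r, (p : ℂ) + y * I ∈ Stp := fun y hy => by
      have := abs_le.2 hy
      simp [Stp]; linarith
    have hcs : HasCompactSupport fun t : ℝ => α (p + t * I) :=
      HasCompactSupport.intro (K := Set.Icc (-r) r) isCompact_Icc fun y hy => image_eq_zero_of_notMem_tsupport (hr _ (by
        by_contra hle; apply hy; rw [Set.mem_Icc, ← abs_le]; simpa using hle))
    have := layer (θ := fun t : ℝ => α (p + t * I)) (a := -r) (b := r) (Y := fun y => Q (p + y * I)) (k := fun q => (gradient f (p + q * I)).im)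
      (η := fun q => η (gradient f (p + q * I))) (g1 := fun _ => 1) (J := Set.univ)
      ((h.smooth.of_le (by simp)).comp (contDiff_const.add (ofRealCLM.contDiff.mul contDiff_const))) hcs (by linarith)
      (fun y hy => by
        rw [(line_deriv h.smooth p y).2]
        refine hz0 _ _ (hr _ ?_)
        by_contra hle; apply hy; rw [Set.mem_Icc, ← abs_le]; simpa using hle)
      (L.contQ.comp (by fun_prop) hS) Set.ordConnected_univ (Set.mem_univ _) (fun _ _ => Set.mem_univ _) continuousOn_const
      (fun q _ => by
        simp only [hη]
        rw [if_pos (L.ws.grad_lt _), L.V_grad]; simp) (fun q hq => absurd (Set.mem_univ q) hq)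
      (fun q _ y hy => by
        have := L.lt_iff (hS y hy) q
        simpa using this)
    simp only [mul_one, intervalIntegral.integral_const, sub_zero, smul_eq_mul] at this
    rw [this]
    congr 2; ext y
    rw [(line_deriv h.smooth p y).2]; ring
  have l2 : ∫ x, η x * g x = - ∫ z, prim g (X z, z.im) * fderiv ℝ α z 1 := by
    rw [int_iter' hi2, int_iter' (h.intg 1 L.contG), ← integral_neg]
    congr 1; ext y
    by_cases hy : |y| < 1
    · have hS : ∀ p : ℝ, (p : ℂ) + y * I ∈ Stp := fun p => by simpa [Stp] using hy
      have hJn : ∀ x : ℝ, ‖(x : ℂ) + y * I‖ < 1 ↔ x ^ 2 + y ^ 2 < 1 := fun x => by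
        rw [Complex.norm_add_mul_I, Real.sqrt_lt' one_pos, one_pow]
      have hcs : HasCompactSupport fun t : ℝ => α (t + y * I) :=
        HasCompactSupport.intro (K := Set.Icc (-R) R) isCompact_Icc fun x hx => image_eq_zero_of_notMem_tsupport (hR _ (by
          by_contra hle; apply hx; rw [Set.mem_Icc, ← abs_le]; simpa using hle))
      have := layer (θ := fun t : ℝ => α (t + y * I)) (a := -R) (b := R) (Y := fun p => X (p + y * I)) (k := fun x => (V (x + y * I)).re)
        (η := fun x => η (x + y * I)) (g1 := fun x => g (x + y * I)) (J := {x : ℝ | ‖(x : ℂ) + y * I‖ < 1})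
        ((h.smooth.of_le (by simp)).comp (ofRealCLM.contDiff.add contDiff_const)) hcs (by linarith)
        (fun x hx => by
          rw [(line_deriv h.smooth x y).1]
          refine hz0 _ _ (hR _ ?_)
          by_contra hle; apply hx; rw [Set.mem_Icc, ← abs_le]; simpa using hle)
        (L.contX.comp (by fun_prop) (fun p _ => hS p)) ⟨fun x hx z hz s hs => by
          simp only [Set.mem_setOf_eq, hJn] at hx hz ⊢
          rcases le_total 0 s with h0 | h0 <;> nlinarith [hs.1, hs.2]⟩
        (by simpa using hy) (fun p _ => by simpa using L.norm_lt (hS p))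
        (L.ws.gs.continuousOn.comp (by fun_prop) fun x hx => by rw [mem_ball_zero_iff]; exact hx)
        (fun x hx => by
          simp only [hη]
          rw [if_pos (show ‖(x : ℂ) + y * I‖ < 1 from hx)]; simp) (fun x hx => by
          simp only [hη]
          rw [if_neg (show ¬ ‖(x : ℂ) + y * I‖ < 1 from hx)])
        (fun x hx p _ => by
          have := (L.ord (show ‖(x : ℂ) + y * I‖ < 1 from hx) p).1
          simpa using this)
      rw [this]
      congr 2; ext p
      rw [(line_deriv h.smooth p y).1]; simp [prim]; ring
    · have e1 : ∀ x : ℝ, η (x + y * I) = 0 := fun x => by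
        simp only [hη]; rw [if_neg]
        intro hh; apply hy
        simpa [Stp] using norm_lt_Stp hh
      have e2 : ∀ x : ℝ, fderiv ℝ α (x + y * I) 1 = 0 := fun x => hz0 _ _ fun hm => hy (by simpa [Stp] using h.supp hm)
      simp [e1, e2]
  rw [integral_sub (h.intg 1 L.contG) (h.intg I L.contQ)]
  linarith

end B11

section B12
open Complex MeasureTheory
open scoped ContDiff

variable {f g Q X : ℂ → ℝ} {V : ℂ → ℂ}

/-- horizontal scaling -/
def scl (m : ℝ) : ℂ →L[ℝ] ℂ := ofRealCLM.comp (m • reCLM) + (imCLM.smulRight I)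

lemma scl_apply (m : ℝ) (z : ℂ) : scl m z = (m * z.re : ℝ) + z.im * I := by
  simp [scl]

/-- horizontal scaling as an equivalence -/
def scle {m : ℝ} (hm : m ≠ 0) : ℂ ≃L[ℝ] ℂ :=
  ContinuousLinearEquiv.equivOfInverse (scl m) (scl m⁻¹)
    (fun z => by simp only [scl_apply]; apply Complex.ext <;> simp [hm])
    (fun z => by simp only [scl_apply]; apply Complex.ext <;> simp [hm])

lemma int_scl {m : ℝ} (hm : m ≠ 0) {Φ : ℂ → ℝ} (h : ∫ z, Φ z = 0) : ∫ z, Φ (scl m z) = 0 := by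
  have hd : LinearMap.det ((scle hm : ℂ ≃ₗ[ℝ] ℂ) : ℂ →ₗ[ℝ] ℂ) ≠ 0 := (LinearEquiv.isUnit_det' _).ne_zero
  have h1 := Measure.map_linearMap_addHaar_eq_smul_addHaar (μ := (volume : Measure ℂ)) hd
  have h2 := (scle hm).toHomeomorph.measurableEmbedding.integral_map (μ := volume) Φ
  have h3 : Measure.map (scle hm).toHomeomorph (volume : Measure ℂ) = Measure.map ((scle hm : ℂ ≃ₗ[ℝ] ℂ) : ℂ →ₗ[ℝ] ℂ) volume := rfl
  rw [h3, h1, integral_smul_measure, h, smul_zero] at h2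
  exact h2.symm

lemma TstR.scl {α : ℂ → ℝ} (h : TstR α Stp) {m : ℝ} (hm : m ≠ 0) : TstR (fun z => α (scl m z)) Stp := by
  refine ⟨h.smooth.comp (_root_.scl m).contDiff, h.cpt.comp_homeomorph (scle hm).toHomeomorph, ?_⟩
  have := tsupport_comp_eq_preimage α (scle hm).toHomeomorph
  rw [show (fun z => α (_root_.scl m z)) = α ∘ (scle hm).toHomeomorph from rfl, this]
  intro z hz
  have := h.supp hz
  have e : (scle hm).toHomeomorph z = _root_.scl m z := rfl
  simpa [Stp, e, scl_apply] using this

lemma fderiv_scl {α : ℂ → ℝ} (h : ContDiff ℝ ∞ α) (m : ℝ) (z : ℂ) :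
    fderiv ℝ (fun z => α (scl m z)) z 1 = m * fderiv ℝ α (scl m z) 1 ∧ fderiv ℝ (fun z => α (scl m z)) z I = fderiv ℝ α (scl m z) I := by
  have := ((h.differentiable (by simp) (scl m z)).hasFDerivAt.comp z (scl m).hasFDerivAt).fderiv
  have e : fderiv ℝ (fun z => α (scl m z)) z = _ := this
  rw [e]
  constructor
  · have : scl m 1 = m • (1:ℂ) := by rw [scl_apply]; simp
    rw [ContinuousLinearMap.comp_apply, this, map_smul, smul_eq_mul]
  · have : scl m I = I := by rw [scl_apply]; simp
    simp [this]

lemma PL.weak_scl (L : PL g f Q X V) {α : ℂ → ℝ} (h : TstR α Stp) {m : ℝ} (hm : m ≠ 0) :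
    (∫ z, (m⁻¹ * prim g (X (scl m z), z.im) * fderiv ℝ α z 1 - Q (scl m z) * fderiv ℝ α z I) = 0) ∧
    (∫ z, (m * X (scl m z) * fderiv ℝ α z I + Q (scl m z) * fderiv ℝ α z 1) = 0) := by
  have hi := h.scl (inv_ne_zero hm)
  have e : ∀ z, scl m⁻¹ (scl m z) = z := fun z => by simp only [scl_apply]; apply Complex.ext <;> simp [hm]
  have im : ∀ z, (scl m z).im = z.im := fun z => by simp [scl_apply]
  constructor
  · have := int_scl hm (L.weak hi)
    simp only [(fderiv_scl h.smooth m⁻¹ _).1, (fderiv_scl h.smooth m⁻¹ _).2, e, im] at this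
    rw [← this]; congr 1; ext z; ring
  · have := int_scl hm (L.curl hi)
    simp only [(fderiv_scl h.smooth m⁻¹ _).1, (fderiv_scl h.smooth m⁻¹ _).2, e] at this
    rw [← mul_zero m, ← this, ← integral_const_mul]; congr 1; ext z; field_simp

lemma PL.cont_scl {k : ℂ → ℝ} (hk : ContinuousOn k Stp) (m : ℝ) : ContinuousOn (fun z => k (scl m z)) Stp :=
  hk.comp (scl m).continuous.continuousOn fun z hz => by simpa [Stp, scl_apply] using hz

lemma cplx_int {a b c d : ℂ → ℝ} (ha : Integrable a) (hb : Integrable b) (hc : Integrable c) (hd : Integrable d)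
    (ha0 : ∫ z, a z = 0) (hb0 : ∫ z, b z = 0) (hc0 : ∫ z, c z = 0) (hd0 : ∫ z, d z = 0) :
    ∫ z, (((a z - b z : ℝ) : ℂ) + ((c z + d z : ℝ) : ℂ) * I) = 0 := by
  have h1 : Integrable fun z => ((a z - b z : ℝ) : ℂ) := (ha.sub hb).ofReal
  have h2 : Integrable fun z => ((c z + d z : ℝ) : ℂ) * I := ((hc.add hd).ofReal).mul_const I
  rw [integral_add h1 h2, integral_mul_const, integral_complex_ofReal, integral_complex_ofReal, integral_sub ha hb, integral_add hc hd,
    ha0, hb0, hc0, hd0]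
  simp

lemma PL.wk (L : PL g f Q X V) {m : ℝ} (hm : m ≠ 0) :
    Wk (fun z => (m * X (scl m z) : ℝ) + Q (scl m z) * I) (fun z => m⁻¹ * prim g (X (scl m z), z.im) - m * X (scl m z)) Stp := by
  intro η hη
  set α := fun z => (η z).re with hα
  set β := fun z => (η z).im with hβ
  have ha : TstR α Stp := hη.re
  have hb : TstR β Stp := hη.im
  have hd : ∀ z v, fderiv ℝ η z v = fderiv ℝ α z v + fderiv ℝ β z v * I := by
    intro z v
    have h1 : fderiv ℝ α z = reCLM.comp (fderiv ℝ η z) := (reCLM.hasFDerivAt.comp z (hη.diff z).hasFDerivAt).fderiv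
    have h2 : fderiv ℝ β z = imCLM.comp (fderiv ℝ η z) := (imCLM.hasFDerivAt.comp z (hη.diff z).hasFDerivAt).fderiv
    rw [h1, h2]; apply Complex.ext <;> simp
  have cX := PL.cont_scl L.contX m
  have cQ := PL.cont_scl L.contQ m
  have cG : ContinuousOn (fun z : ℂ => prim g (X (scl m z), z.im)) Stp := by
    have := PL.cont_scl L.contG m
    simpa [scl_apply] using this
  have cG' : ContinuousOn (fun z : ℂ => m⁻¹ * prim g (X (scl m z), z.im)) Stp := continuousOn_const.mul cG
  have cX' : ContinuousOn (fun z : ℂ => m * X (scl m z)) Stp := continuousOn_const.mul cX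
  have A := L.weak_scl ha hm
  have B := L.weak_scl hb hm
  have i1 : ∀ {γ : ℂ → ℝ}, TstR γ Stp → Integrable fun z => (m⁻¹ * prim g (X (scl m z), z.im) * fderiv ℝ γ z 1 - Q (scl m z) * fderiv ℝ γ z I) :=
    fun h => (h.intg 1 cG').sub (h.intg I cQ)
  have i2 : ∀ {γ : ℂ → ℝ}, TstR γ Stp → Integrable fun z => (m * X (scl m z) * fderiv ℝ γ z I + Q (scl m z) * fderiv ℝ γ z 1) :=
    fun h => (h.intg I cX').add (h.intg 1 cQ)
  have e : ∀ z, ((m * X (scl m z) : ℝ) + Q (scl m z) * I) * db η z + ((m⁻¹ * prim g (X (scl m z), z.im) - m * X (scl m z) : ℝ) : ℂ) * fderiv ℝ η z 1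
      = (((m⁻¹ * prim g (X (scl m z), z.im) * fderiv ℝ α z 1 - Q (scl m z) * fderiv ℝ α z I) - (m * X (scl m z) * fderiv ℝ β z I + Q (scl m z) * fderiv ℝ β z 1) : ℝ) : ℂ)
      + (((m⁻¹ * prim g (X (scl m z), z.im) * fderiv ℝ β z 1 - Q (scl m z) * fderiv ℝ β z I) + (m * X (scl m z) * fderiv ℝ α z I + Q (scl m z) * fderiv ℝ α z 1) : ℝ) : ℂ) * I := by
    intro z
    rw [db, hd, hd]
    apply Complex.ext <;> simp <;> ring
  simp only [e]
  exact cplx_int (i1 ha) (i2 hb) (i1 hb) (i2 ha) A.1 B.2 B.1 A.2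

lemma PL.smoothXQ (L : PL g f Q X V) {z : ℂ} (hz : z ∈ Stp) : ContDiffAt ℝ ∞ X z ∧ ContDiffAt ℝ ∞ Q z := by
  obtain ⟨c, hc0, hc⟩ := L.ws.gpos
  have hg : 0 < g (X z + z.im * I) := hc0.trans_le (hc _ (mem_ball_zero_iff.2 (L.norm_lt hz)))
  set m := Real.sqrt (g (X z + z.im * I)) with hmd
  have hm0 : 0 < m := Real.sqrt_pos.2 hg
  have hm := hm0.ne'
  have hmm : m * m = g (X z + z.im * I) := Real.mul_self_sqrt hg.le
  set zs := scl m⁻¹ z with hzs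
  have ez : scl m zs = z := by simp only [hzs, scl_apply]; apply Complex.ext <;> simp [hm]
  have eim : zs.im = z.im := by simp [hzs, scl_apply]
  have hzS : zs ∈ Stp := by simpa [Stp, eim] using hz
  obtain ⟨R, hR, hb⟩ := Metric.isOpen_iff.1 Stp_open zs hzS
  have cX := PL.cont_scl L.contX m
  have cQ := PL.cont_scl L.contQ m
  set S : ℝ × ℝ →L[ℝ] ℝ × ℝ := (m⁻¹ • ContinuousLinearMap.fst ℝ ℝ ℝ).prod (ContinuousLinearMap.snd ℝ ℝ ℝ) with hS
  have hSa : ∀ w, S w = (m⁻¹ * w.1, w.2) := fun w => rfl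
  set N : ℝ × ℝ → ℝ := fun w => m⁻¹ * prim g (S w) - w.1 with hN
  set F : ℂ → ℂ := fun z => (m * X (scl m z) : ℝ) + Q (scl m z) * I with hF
  have hFre : ∀ w, (F w).re = m * X (scl m w) := fun w => by simp [hF]
  have hSF : ∀ w, S ((F w).re, w.im) = (X (scl m w), w.im) := fun w => by
    rw [hSa, hFre]; simp [hm]
  have hpt : S ((F zs).re, zs.im) = (X z, z.im) := by rw [hSF, ez, eim]
  have hmem : S ((F zs).re, zs.im) ∈ OmD := by rw [hpt]; exact L.norm_lt hz
  have hFs : ContDiffAt ℝ ∞ F zs := by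
    refine nonlinReg hR (ContinuousOn.mono ?_ hb) (N := N) (Ω := S ⁻¹' OmD) (OmD_open.preimage S.continuous) ?_ hmem ?_ ?_
    · exact (continuous_ofReal.comp_continuousOn (continuousOn_const.mul cX)).add ((continuous_ofReal.comp_continuousOn cQ).mul continuousOn_const)
    · exact (contDiffOn_const.mul ((prim_smooth L.ws.gs).comp S.contDiff.contDiffOn (fun _ h => h))).sub contDiff_fst.contDiffOn
    · have hd := ((prim_smooth L.ws.gs).contDiffAt (OmD_open.mem_nhds hmem)).differentiableAt (by simp)
      have h1 : HasFDerivAt N _ ((F zs).re, zs.im) := ((hd.hasFDerivAt.comp _ S.hasFDerivAt).const_mul m⁻¹).sub hasFDerivAt_fst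
      rw [h1.fderiv]
      have e1 : S (1, 0) = m⁻¹ • ((1:ℝ), (0:ℝ)) := by rw [hSa]; simp
      have := prim_deriv L.ws.gs hmem
      simp only [_root_.sub_apply, _root_.smul_apply, ContinuousLinearMap.comp_apply, e1, map_smul, this]
      rw [hpt]; simp only [smul_eq_mul, ContinuousLinearMap.coe_fst', ← hmm]; field_simp; ring
    · have := (L.wk hm).mono hb
      have e : (fun z : ℂ => N ((F z).re, z.im)) = fun z => m⁻¹ * prim g (X (scl m z), z.im) - m * X (scl m z) := by
        ext w; simp only [hN]; rw [hSF, hFre]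
      rw [e]; exact this
  have e : ∀ w, scl m (scl m⁻¹ w) = w := fun w => by simp only [scl_apply]; apply Complex.ext <;> simp [hm]
  have hc : ContDiffAt ℝ ∞ (fun w => F (scl m⁻¹ w)) z := ContDiffAt.comp z hFs (scl m⁻¹).contDiff.contDiffAt
  constructor
  · have : X = fun w => m⁻¹ * (F (scl m⁻¹ w)).re := by
      ext w; rw [hFre, e]; field_simp
    rw [this]
    exact contDiffAt_const.mul (reCLM.contDiff.contDiffAt.comp z hc)
  · have : Q = fun w => (F (scl m⁻¹ w)).im := by
      ext w; simp [hF, e]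
    rw [this]
    exact imCLM.contDiff.contDiffAt.comp z hc

end B12

section B13
open Complex MeasureTheory
open scoped ContDiff

variable {f g Q X : ℂ → ℝ} {V : ℂ → ℂ}

lemma weak_pt {A B : ℂ → ℝ} (hA : ∀ z ∈ Stp, ContDiffAt ℝ ∞ A z) (hB : ∀ z ∈ Stp, ContDiffAt ℝ ∞ B z)
    (hw : ∀ α, TstR α Stp → ∫ z, (A z * fderiv ℝ α z 1 + B z * fderiv ℝ α z I) = 0) {z : ℂ} (hz : z ∈ Stp) :
    fderiv ℝ A z 1 + fderiv ℝ B z I = 0 := by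
  have c0 : ∀ {A : ℂ → ℝ} (v : ℂ), (∀ z ∈ Stp, ContDiffAt ℝ ∞ A z) → ContinuousOn (fun z => fderiv ℝ A z v) Stp := fun v h z hz =>
    (((h z hz).fderiv_right (m := 0) (by simp)).continuousAt.clm_apply continuousAt_const).continuousWithinAt
  have key : ∀ {A : ℂ → ℝ} (v : ℂ), (∀ z ∈ Stp, ContDiffAt ℝ ∞ A z) → ∀ α, TstR α Stp →
      Integrable (fun z => fderiv ℝ A z v * α z) ∧ ∫ z, A z * fderiv ℝ α z v = - ∫ z, fderiv ℝ A z v * α z := by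
    intro A v hA α h
    have hd : ∀ z ∈ Stp, fderiv ℝ (fun z => (A z : ℂ)) z v = (fderiv ℝ A z v : ℂ) := fun z hz => by
      have e : fderiv ℝ (fun z => (A z : ℂ)) z = _ := ((ofRealCLM.hasFDerivAt (x := A z)).comp z ((hA z hz).differentiableAt (by simp)).hasFDerivAt).fderiv
      rw [e]; rfl
    obtain ⟨i1, i2, i3⟩ := ibp_aux Stp_open (f := fun z => (A z : ℂ)) (fun z hz => ofRealCLM.differentiableAt.comp z ((hA z hz).differentiableAt (by simp))) v
      ((continuous_ofReal.comp_continuousOn (c0 v hA)).congr hd) (h.toC.smooth.of_le (by simp)) h.toC.cpt h.toC.supp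
    have e1 : (fun z => fderiv ℝ (fun z => (A z : ℂ)) z v * (α z : ℂ)) = fun z => ((fderiv ℝ A z v * α z : ℝ) : ℂ) := by
      ext z
      by_cases hz : z ∈ Stp
      · rw [hd z hz]; push_cast; rfl
      · have : α z = 0 := image_eq_zero_of_notMem_tsupport fun hh => hz (h.supp hh)
        simp [this]
    simp only [h.fderivC] at i3
    rw [e1] at i1 i3
    refine ⟨by simpa using i1.re, ?_⟩
    have e2 : ∫ z, (A z : ℂ) * (fderiv ℝ α z v : ℂ) = ((∫ z, A z * fderiv ℝ α z v : ℝ) : ℂ) := by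
      rw [← integral_complex_ofReal]; push_cast; rfl
    rw [e2, integral_complex_ofReal] at i3
    exact_mod_cast i3
  have hc := (c0 1 hA).add (c0 I hB)
  have ae := Stp_open.ae_eq_zero_of_integral_contDiff_smul_eq_zero (μ := volume) (hc.locallyIntegrableOn Stp_open.measurableSet) (by
    intro α h1 h2 h3
    have h : TstR α Stp := ⟨h1, h2, h3⟩
    have hk := hw α h
    rw [integral_add (h.intg 1 fun z hz => (hA z hz).continuousAt.continuousWithinAt) (h.intg I fun z hz => (hB z hz).continuousAt.continuousWithinAt),
      (key 1 hA α h).2, (key I hB α h).2] at hk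
    have : ∀ z, α z • (fderiv ℝ A z 1 + fderiv ℝ B z I) = fderiv ℝ A z 1 * α z + fderiv ℝ B z I * α z := fun z => by simp; ring
    rw [show (fun z => α z • ((fun z => fderiv ℝ A z 1) + fun z => fderiv ℝ B z I) z) = fun z => fderiv ℝ A z 1 * α z + fderiv ℝ B z I * α z from funext this]
    rw [integral_add (key 1 hA α h).1 (key I hB α h).1]; linarith)
  have := Measure.eqOn_open_of_ae_eq (μ := volume) (g := fun _ => (0:ℝ)) ((ae_restrict_iff' Stp_open.measurableSet).2 ae) Stp_open hc continuousOn_const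
  exact this hz

lemma PL.Qy (L : PL g f Q X V) {z : ℂ} (hz : z ∈ Stp) : fderiv ℝ Q z I = g (X z + z.im * I) * fderiv ℝ X z 1 := by
  have hG : ∀ z ∈ Stp, ContDiffAt ℝ ∞ (fun z : ℂ => prim g (X z, z.im)) z := fun z hz =>
    ((prim_smooth L.ws.gs).contDiffAt (OmD_open.mem_nhds (L.norm_lt hz))).comp z ((L.smoothXQ hz).1.prodMk imCLM.contDiff.contDiffAt)
  have := weak_pt hG (B := fun z => - Q z) (fun z hz => (L.smoothXQ hz).2.neg) (fun α h => by
    have := L.weak h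
    simpa [sub_eq_add_neg] using this) hz
  have hX := ((L.smoothXQ hz).1.differentiableAt (by simp)).hasFDerivAt
  have hp := (((prim_smooth L.ws.gs).contDiffAt (OmD_open.mem_nhds (show (X z, z.im) ∈ OmD from L.norm_lt hz))).differentiableAt (by simp)).hasFDerivAt
  have e : fderiv ℝ (fun z : ℂ => prim g (X z, z.im)) z = _ := (HasFDerivAt.comp (g := prim g) (f := fun z : ℂ => (X z, z.im)) z hp (hX.prodMk imCLM.hasFDerivAt)).fderiv
  rw [e, fderiv_fun_neg] at this
  have e2 : ((fderiv ℝ X z).prod imCLM) 1 = fderiv ℝ X z 1 • ((1:ℝ), (0:ℝ)) := by simp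
  rw [ContinuousLinearMap.comp_apply, e2, map_smul, prim_deriv L.ws.gs (L.norm_lt hz)] at this
  simp at this
  linarith

lemma PL.grad_eq (L : PL g f Q X V) (P : ℂ) : P.re + (gradient f P).im * I ∈ Stp ∧ Q (P.re + (gradient f P).im * I) = P.im ∧
    X (P.re + (gradient f P).im * I) = (gradient f P).re := by
  set z : ℂ := P.re + (gradient f P).im * I with hzd
  have hre : z.re = P.re := by simp [hzd]
  have him : z.im = (gradient f P).im := by simp [hzd]
  have hz : z ∈ Stp := by simpa [Stp, him] using norm_lt_Stp (L.ws.grad_lt P)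
  have h1 := L.lt_iff hz P.im
  have h2 := L.gt_iff hz P.im
  have hP : (z.re : ℂ) + P.im * I = P := by rw [hre]; exact Complex.re_add_im P
  rw [hP, him] at h1 h2
  have hQ : Q z = P.im := le_antisymm (not_lt.1 fun h => lt_irrefl _ (h1.2 h)) (not_lt.1 fun h => lt_irrefl _ (h2.2 h))
  refine ⟨hz, hQ, ?_⟩
  have := L.hQ z hz
  rw [hQ, hP] at this
  rw [this]; simp

lemma PL.Qy_ne (L : PL g f Q X V) {z : ℂ} (hz : z ∈ Stp) : fderiv ℝ Q z I ≠ 0 := by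
  intro h0
  set E : ℂ := fderiv ℝ X z I + I with hE
  have hE0 : E ≠ 0 := fun h => by have := congrArg Complex.im h; simp [hE] at this
  obtain ⟨w, hw, hwE⟩ := exists_rot hE0
  obtain ⟨Q', X', V', L'⟩ := (L.ws.rot hw).exPL
  have hline : HasDerivAt (fun t : ℝ => z + t * I) I 0 := by
    have := ((ofRealCLM.hasDerivAt (x := (0:ℝ))).mul_const I).const_add z
    simpa using this
  have hz0 : z + ((0:ℝ) : ℂ) * I = z := by simp
  have dQ : HasDerivAt (fun t : ℝ => Q (z + t * I)) 0 0 := by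
    have := HasFDerivAt.comp_hasDerivAt (f := fun t : ℝ => z + t * I) (0:ℝ) (by rw [hz0]; exact ((L.smoothXQ hz).2.differentiableAt (by simp)).hasFDerivAt) hline
    rwa [h0] at this
  have dX : HasDerivAt (fun t : ℝ => X (z + t * I)) (fderiv ℝ X z I) 0 :=
    HasFDerivAt.comp_hasDerivAt (f := fun t : ℝ => z + t * I) (0:ℝ) (by rw [hz0]; exact ((L.smoothXQ hz).1.differentiableAt (by simp)).hasFDerivAt) hline
  set P : ℝ → ℂ := fun t => starRingEnd ℂ w * (z.re + Q (z + t * I) * I) with hP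
  set x : ℝ → ℂ := fun t => starRingEnd ℂ w * (X (z + t * I) + (z.im + t : ℝ) * I) with hx
  have dP : HasDerivAt P 0 0 := by
    have := ((dQ.ofReal_comp.mul_const I).const_add (z.re : ℂ)).const_mul (starRingEnd ℂ w)
    simpa using this
  have dx : HasDerivAt x (‖E‖ : ℂ) 0 := by
    have := (dX.ofReal_comp.add ((((hasDerivAt_id (0:ℝ)).const_add z.im).ofReal_comp).mul_const I)).const_mul (starRingEnd ℂ w)
    rw [← hwE, hE]
    simp only [hx]
    simpa using this
  have hc2 : w * starRingEnd ℂ w = 1 := by rw [mul_comm, unit_conj hw]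
  have grad : ∀ᶠ t in 𝓝 (0:ℝ), gradient (fun p => f (w * p)) (P t) = x t := by
    have : ∀ᶠ t : ℝ in 𝓝 (0:ℝ), z + t * I ∈ Stp := hline.continuousAt.eventually (by beta_reduce; rw [hz0]; exact Stp_open.mem_nhds hz)
    filter_upwards [this] with t ht
    have e : w * P t = z.re + Q (z + t * I) * I := by simp only [hP]; rw [← mul_assoc, hc2, one_mul]
    rw [gradient_rot L.ws.conv hw (L.ws.diff _), e]
    have := L.hQ _ ht
    simp at this
    rw [this]; simp [hx]
  have hS := L'.grad_eq (P 0)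
  rw [grad.self_of_nhds] at hS
  set z' : ℝ → ℂ := fun t => (P t).re + (x t).im * I with hz'
  have dz : HasDerivAt z' 0 0 := by
    have h1 := (reCLM.hasFDerivAt.comp_hasDerivAt (0:ℝ) dP).ofReal_comp
    have h2 := ((imCLM.hasFDerivAt.comp_hasDerivAt (0:ℝ) dx).ofReal_comp).mul_const I
    have := h1.add h2
    simp at this
    exact this
  have d1 := HasFDerivAt.comp_hasDerivAt (f := z') (0:ℝ) ((L'.smoothXQ hS.1).1.differentiableAt (by simp)).hasFDerivAt dz
  have d2 : HasDerivAt (fun t => (x t).re) ‖E‖ 0 := by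
    have := reCLM.hasFDerivAt.comp_hasDerivAt (0:ℝ) dx
    simp at this
    exact this
  have heq : (X' ∘ z') =ᶠ[𝓝 0] fun t => (x t).re := by
    filter_upwards [grad] with t ht
    have := (L'.grad_eq (P t)).2.2
    rw [ht] at this
    exact this
  have := (d1.congr_of_eventuallyEq heq.symm).unique d2
  rw [map_zero] at this
  exact hE0 (norm_eq_zero.1 this.symm)

/-- the equivalence `(p, y) ↦ (p, a p + b y)` -/
lemma exists_equiv (a b : ℝ) (hb : b ≠ 0) : ∃ T : ℂ ≃L[ℝ] ℂ, (∀ v, T v = v.re + (a * v.re + b * v.im : ℝ) * I) := by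
  have hT : ∀ v : ℂ, (reCLM.smulRight (1:ℂ) + (a • reCLM + b • imCLM).smulRight I) v = v.re + (a * v.re + b * v.im : ℝ) * I := fun v => by
    apply Complex.ext <;> simp
  have hT' : ∀ v : ℂ, (reCLM.smulRight (1:ℂ) + ((-a/b) • reCLM + b⁻¹ • imCLM).smulRight I) v = v.re + (-a/b * v.re + b⁻¹ * v.im : ℝ) * I := fun v => by
    apply Complex.ext <;> simp
  refine ⟨ContinuousLinearEquiv.equivOfInverse (reCLM.smulRight (1:ℂ) + (a • reCLM + b • imCLM).smulRight I)
    (reCLM.smulRight (1:ℂ) + ((-a/b) • reCLM + b⁻¹ • imCLM).smulRight I) (fun v => ?_) (fun v => ?_), fun v => hT v⟩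
  · rw [hT, hT']; apply Complex.ext <;> simp; field_simp; ring
  · rw [hT, hT']; apply Complex.ext <;> simp; field_simp; ring

lemma PL.smooth (L : PL g f Q X V) (P : ℂ) : ContDiffAt ℝ ∞ (gradient f) P ∧
    (fderiv ℝ (gradient f) P 1).re * (fderiv ℝ (gradient f) P I).im - (fderiv ℝ (gradient f) P 1).im * (fderiv ℝ (gradient f) P I).re
      = 1 / g (gradient f P) := by
  have cg := L.ws.grad_cont
  set Ψ : OpenPartialHomeomorph ℂ ℂ :=
    { toFun := fun z => z.re + Q z * I
      invFun := fun P => P.re + (gradient f P).im * I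
      source := Stp
      target := Set.univ
      map_source' := fun _ _ => Set.mem_univ _
      map_target' := fun P _ => (L.grad_eq P).1
      left_inv' := fun z hz => by
        rw [L.hQ z hz]; apply Complex.ext <;> simp
      right_inv' := fun P _ => by
        rw [(L.grad_eq P).2.1]; apply Complex.ext <;> simp
      open_source := Stp_open
      open_target := isOpen_univ
      continuousOn_toFun := by
        exact (by fun_prop : Continuous fun z : ℂ => (z.re : ℂ)).continuousOn.add ((continuous_ofReal.comp_continuousOn L.contQ).mul continuousOn_const)
      continuousOn_invFun := by
        have h : Continuous fun P : ℂ => (P.re : ℂ) + (gradient f P).im * I := by fun_prop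
        exact h.continuousOn } with hΨ
  have hsa : ∀ P, Ψ.symm P = P.re + (gradient f P).im * I := fun _ => rfl
  have hΨa : ∀ z, Ψ z = z.re + Q z * I := fun _ => rfl
  set z := Ψ.symm P with hzd
  have hz : z ∈ Stp := (L.grad_eq P).1
  obtain ⟨sX, sQ⟩ := L.smoothXQ hz
  have hQd := (sQ.differentiableAt (by simp)).hasFDerivAt
  have hXd := (sX.differentiableAt (by simp)).hasFDerivAt
  obtain ⟨T, hT⟩ := exists_equiv (fderiv ℝ Q z 1) (fderiv ℝ Q z I) (L.Qy_ne hz)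
  have sp : ∀ (A : ℂ →L[ℝ] ℝ) (v : ℂ), A v = A 1 * v.re + A I * v.im := fun A v => by
    rw [fderiv_apply_split A v]; simp; ring
  have hd : HasFDerivAt Ψ (T : ℂ →L[ℝ] ℂ) z := by
    have h1 : HasFDerivAt Ψ _ z := (ofRealCLM.hasFDerivAt.comp z reCLM.hasFDerivAt).add ((ofRealCLM.hasFDerivAt.comp z hQd).mul_const I)
    refine h1.congr_fderiv ?_
    ext1 v
    rw [ContinuousLinearEquiv.coe_coe, hT]
    apply Complex.ext <;> simp [sp _ v]
  have sΨ : ContDiffAt ℝ ∞ Ψ z := by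
    have : ContDiffAt ℝ ∞ (fun z : ℂ => (z.re : ℂ) + Q z * I) z :=
      (ofRealCLM.contDiff.comp reCLM.contDiff).contDiffAt.add ((ofRealCLM.contDiff.contDiffAt.comp z sQ).mul contDiffAt_const)
    exact this
  have ss := Ψ.contDiffAt_symm (Set.mem_univ P) hd sΨ
  have hθ := (ss.differentiableAt (by simp)).hasFDerivAt
  have eg : gradient f = fun P => ((X (Ψ.symm P) : ℝ) : ℂ) + ((Ψ.symm P).im : ℝ) * I := by
    ext1 P
    rw [hsa, (L.grad_eq P).2.2]; apply Complex.ext <;> simp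
  have hg0 := (ofRealCLM.hasFDerivAt.comp P (hXd.comp P hθ)).add ((ofRealCLM.hasFDerivAt.comp P (imCLM.hasFDerivAt.comp P hθ)).mul_const I)
  have hg : HasFDerivAt (gradient f) _ P := hg0.congr_of_eventuallyEq (Eventually.of_forall fun P => congrFun eg P)
  have hcomp : ∀ v, T (fderiv ℝ Ψ.symm P v) = v := by
    intro v
    have h1 := hd.comp P hθ
    have h2 : (Ψ ∘ Ψ.symm) = id := by ext1 P; exact Ψ.right_inv (Set.mem_univ P)
    rw [h2] at h1
    have := h1.unique (hasFDerivAt_id P)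
    exact congrArg (fun A : ℂ →L[ℝ] ℂ => A v) this
  refine ⟨?_, ?_⟩
  · rw [eg]
    exact (ofRealCLM.contDiff.contDiffAt.comp P (sX.comp P ss)).add ((ofRealCLM.contDiff.contDiffAt.comp P (imCLM.contDiff.contDiffAt.comp P ss)).mul contDiffAt_const)
  · have c1 := hcomp 1
    have cI := hcomp I
    rw [hT] at c1 cI
    set θ1 := fderiv ℝ Ψ.symm P 1
    set θI := fderiv ℝ Ψ.symm P I
    have a1 := congrArg Complex.re c1
    have a2 := congrArg Complex.im c1
    have a3 := congrArg Complex.re cI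
    have a4 := congrArg Complex.im cI
    simp at a1 a2 a3 a4
    rw [hg.fderiv]
    have hXz : (X z : ℂ) + z.im * I = gradient f P := (congrFun eg P).symm
    have hQy := L.Qy hz
    rw [hXz] at hQy
    have hne := L.Qy_ne hz
    have hg0 : g (gradient f P) ≠ 0 := fun h => hne (by rw [hQy, h, zero_mul])
    simp
    change fderiv ℝ X z θ1 * θI.im - θ1.im * fderiv ℝ X z θI = _
    rw [sp (fderiv ℝ X z) θ1, sp (fderiv ℝ X z) θI]
    rw [a1] at a2 ⊢
    rw [a3] at a4 ⊢
    refine eq_inv_of_mul_eq_one_left ?_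
    have : fderiv ℝ X z 1 * g (gradient f P) = fderiv ℝ Q z I := by rw [hQy]; ring
    linear_combination θI.im * this + a4
  
lemma WS.smooth (H : WS g f) : ContDiff ℝ ∞ f ∧ ContDiff ℝ ∞ (gradient f) ∧ ∀ P,
    (fderiv ℝ (gradient f) P 1).re * (fderiv ℝ (gradient f) P I).im - (fderiv ℝ (gradient f) P 1).im * (fderiv ℝ (gradient f) P I).re
      = 1 / g (gradient f P) := by
  obtain ⟨Q, X, V, L⟩ := H.exPL
  have h1 : ContDiff ℝ ∞ (gradient f) := contDiff_iff_contDiffAt.2 fun P => (L.smooth P).1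
  refine ⟨?_, h1, fun P => (L.smooth P).2⟩
  rw [contDiff_infty_iff_fderiv]
  refine ⟨fun P => H.diff P, ?_⟩
  have : fderiv ℝ f = fun P => InnerProductSpace.toDual ℝ ℂ (gradient f P) := by
    ext1 P; simp [gradient]
  rw [this]
  exact (InnerProductSpace.toDual ℝ ℂ).toContinuousLinearEquiv.contDiff.comp h1

end B13

section B14
open scoped ContDiff

/-- the solutions of the Minkowski problem -/
structure Sl (φ ψ f : E2 → ℝ) : Prop where
  sm : ContDiff ℝ ∞ f
  cv : ConvexOn ℝ Set.univ f
  gr : ∀ p : E2, ‖gradient f p‖ < 1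
  det : ∀ p : E2, detHess f p = ψ (gradient f p) * (1 - ‖gradient f p‖ ^ 2) ^ 2
  lim : ∀ z ∈ sphere (0 : E2) 1, Tendsto (fun r : ℝ => r - f (r • z)) atTop (𝓝 (φ z))

variable {φ ψ f : E2 → ℝ}

lemma max_hess {D : E2 → ℝ} (hD : ContDiff ℝ ∞ D) {p : E2} (h : ∀ q, D q ≤ D p) : fderiv ℝ D p = 0 ∧ ∀ v, hess D p v v ≤ 0 := by
  refine ⟨IsLocalMax.fderiv_eq_zero (Eventually.of_forall h), fun v => ?_⟩
  have hl : ∀ t : ℝ, HasDerivAt (fun t : ℝ => p + t • v) v t := fun t => by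
    simpa using ((hasDerivAt_id t).smul_const v).const_add p
  have d1 : ∀ t : ℝ, HasDerivAt (fun t : ℝ => D (p + t • v)) (fderiv ℝ D (p + t • v) v) t := fun t =>
    HasFDerivAt.comp_hasDerivAt (f := fun t : ℝ => p + t • v) t (hD.differentiable (by simp) _).hasFDerivAt (hl t)
  have e1 : deriv (fun t : ℝ => D (p + t • v)) = fun t => fderiv ℝ D (p + t • v) v := funext fun t => (d1 t).deriv
  have d2 : HasDerivAt (fun t : ℝ => fderiv ℝ D (p + t • v) v) (hess D p v v) 0 := by
    have hF := (((hD.fderiv_right (m := ∞) (by simp)).differentiable (by simp)) p).hasFDerivAt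
    have hF' : HasFDerivAt (fderiv ℝ D) (fderiv ℝ (fderiv ℝ D) p) (p + (0:ℝ) • v) := by rw [zero_smul, add_zero]; exact hF
    have h1 : HasDerivAt (fun t : ℝ => fderiv ℝ D (p + t • v)) (fderiv ℝ (fderiv ℝ D) p v) 0 :=
      HasFDerivAt.comp_hasDerivAt (f := fun t : ℝ => p + t • v) (0:ℝ) hF' (hl 0)
    exact (ContinuousLinearMap.apply ℝ ℝ v).hasFDerivAt.comp_hasDerivAt (0:ℝ) h1
  by_contra hpos
  push Not at hpos
  have hmin := isLocalMin_of_deriv_deriv_pos (f := fun t : ℝ => D (p + t • v)) (x₀ := 0) (by rw [e1, d2.deriv]; exact hpos)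
    (by rw [e1]; simp [IsLocalMax.fderiv_eq_zero (Eventually.of_forall h : IsLocalMax D p)]) (d1 0).continuousAt
  have heq : (fun t : ℝ => D (p + t • v)) =ᶠ[𝓝 0] fun _ => D p := by
    filter_upwards [hmin] with t ht
    exact le_antisymm (h _) (by simpa using ht)
  have := heq.deriv.deriv_eq
  rw [e1, d2.deriv] at this
  simp at this
  exact hpos.ne' this

lemma hess_symm (hf : ContDiff ℝ ∞ f) (p v w : E2) : hess f p v w = hess f p w v :=
  second_derivative_symmetric (fun y => (hf.differentiable (by simp) y).hasFDerivAt)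
    (((hf.fderiv_right (m := ∞) (by simp)).differentiable (by simp)) p).hasFDerivAt v w

lemma hess_psd (hf : ContDiff ℝ ∞ f) (hc : ConvexOn ℝ Set.univ f) (p v : E2) : 0 ≤ hess f p v v := by
  have hd := hf.differentiable (by simp)
  set T : E2 → ℝ := fun q => fderiv ℝ f p q - f q with hT
  have eT : fderiv ℝ T = fun q => fderiv ℝ f p - fderiv ℝ f q := by
    ext1 q; exact ((fderiv ℝ f p).hasFDerivAt.sub (hd q).hasFDerivAt).fderiv
  have := (max_hess (D := T) ((fderiv ℝ f p).contDiff.sub hf) (p := p) fun q => by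
    have := gradient_ineq hc (hd p) q
    rw [← fderiv_eq_inner, map_sub] at this
    simp only [hT]; linarith).2 v
  rw [hess, eT, fderiv_const_sub] at this
  simpa [hess] using this

lemma hess_expand (p : E2) (hs : ∀ v w, hess f p v w = hess f p w v) (x : ℝ) :
    hess f p (x • EuclideanSpace.single 0 1 + EuclideanSpace.single 1 1) (x • EuclideanSpace.single 0 1 + EuclideanSpace.single 1 1)
    = hess f p (EuclideanSpace.single 0 1) (EuclideanSpace.single 0 1) * (x * x) + 2 * hess f p (EuclideanSpace.single 0 1) (EuclideanSpace.single 1 1) * x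
      + hess f p (EuclideanSpace.single 1 1) (EuclideanSpace.single 1 1) := by
  have := hs (EuclideanSpace.single 0 1) (EuclideanSpace.single 1 1)
  simp only [hess] at this ⊢
  simp only [map_add, map_smul, _root_.add_apply, _root_.smul_apply, smul_eq_mul]
  rw [← this]; ring

lemma mp {F G : E2 → ℝ} (hF : ContDiff ℝ ∞ F) (hG : ContDiff ℝ ∞ G) (hc : ConvexOn ℝ Set.univ F) {p : E2}
    (h : ∀ q, F q - G q ≤ F p - G p) : fderiv ℝ F p = fderiv ℝ G p ∧ detHess F p ≤ detHess G p := by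
  have dF := hF.differentiable (by simp)
  have dG := hG.differentiable (by simp)
  have dF2 := (hF.fderiv_right (m := ∞) (by simp)).differentiable (by simp)
  have dG2 := (hG.fderiv_right (m := ∞) (by simp)).differentiable (by simp)
  have e : fderiv ℝ (fun q => F q - G q) = fun q => fderiv ℝ F q - fderiv ℝ G q := by
    ext1 q; exact fderiv_fun_sub (dF q) (dG q)
  obtain ⟨h1, h2⟩ := max_hess (hF.sub hG) h
  refine ⟨sub_eq_zero.1 (by rw [← h1, e]), ?_⟩
  have e2 : ∀ v w, hess (fun q => F q - G q) p v w = hess F p v w - hess G p v w := fun v w => by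
    rw [hess, e, fderiv_fun_sub (dF2 p) (dG2 p)]; rfl
  have sF := hess_symm hF p
  have sG := hess_symm hG p
  have pF := hess_psd hF hc p
  have pD : ∀ v, hess F p v v ≤ hess G p v v := fun v => by have := h2 v; rw [e2] at this; linarith
  rw [detHess, detHess, sF (EuclideanSpace.single 1 1) (EuclideanSpace.single 0 1), sG (EuclideanSpace.single 1 1) (EuclideanSpace.single 0 1)]
  have q1 := discrim_le_zero fun x : ℝ => by
    have := pF (x • EuclideanSpace.single 0 1 + EuclideanSpace.single 1 1)
    rwa [hess_expand p sF] at this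
  have q2 := discrim_le_zero (a := hess G p (EuclideanSpace.single 0 1) (EuclideanSpace.single 0 1) - hess F p (EuclideanSpace.single 0 1) (EuclideanSpace.single 0 1))
    (b := 2 * (hess G p (EuclideanSpace.single 0 1) (EuclideanSpace.single 1 1) - hess F p (EuclideanSpace.single 0 1) (EuclideanSpace.single 1 1)))
    (c := hess G p (EuclideanSpace.single 1 1) (EuclideanSpace.single 1 1) - hess F p (EuclideanSpace.single 1 1) (EuclideanSpace.single 1 1)) fun x : ℝ => by
    have := pD (x • EuclideanSpace.single 0 1 + EuclideanSpace.single 1 1)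
    rw [hess_expand p sF, hess_expand p sG] at this
    linarith
  have p0 := pF (EuclideanSpace.single 0 1)
  have p1 := pF (EuclideanSpace.single 1 1)
  have r0 := pD (EuclideanSpace.single 0 1)
  have r1 := pD (EuclideanSpace.single 1 1)
  rw [discrim] at q1 q2
  generalize hess F p (EuclideanSpace.single 0 1) (EuclideanSpace.single 0 1) = a at *
  generalize hess F p (EuclideanSpace.single 0 1) (EuclideanSpace.single 1 1) = b at *
  generalize hess F p (EuclideanSpace.single 1 1) (EuclideanSpace.single 1 1) = c at *
  obtain ⟨a', ha⟩ : ∃ x, hess G p (EuclideanSpace.single 0 1) (EuclideanSpace.single 0 1) = a + x := ⟨_, (add_sub_cancel _ _).symm⟩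
  obtain ⟨b', hb⟩ : ∃ x, hess G p (EuclideanSpace.single 0 1) (EuclideanSpace.single 1 1) = b + x := ⟨_, (add_sub_cancel _ _).symm⟩
  obtain ⟨c', hc'⟩ : ∃ x, hess G p (EuclideanSpace.single 1 1) (EuclideanSpace.single 1 1) = c + x := ⟨_, (add_sub_cancel _ _).symm⟩
  rw [ha, hb, hc'] at q2 ⊢
  rw [ha] at r0
  rw [hc'] at r1
  have ha' : 0 ≤ a' := by linarith
  have hc'' : 0 ≤ c' := by linarith
  have k1 : b ^ 2 ≤ a * c := by nlinarith
  have k2 : b' ^ 2 ≤ a' * c' := by nlinarith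
  have k3 : 2 * (b * b') ≤ a * c' + a' * c := by
    refine le_of_abs_le (abs_le_of_sq_le_sq ?_ (by positivity))
    have : b ^ 2 * b' ^ 2 ≤ a * c * (a' * c') := mul_le_mul k1 k2 (sq_nonneg _) (by positivity)
    nlinarith [sq_nonneg (a * c' - a' * c)]
  nlinarith

lemma Sl.lip (S : Sl φ ψ f) (p q : E2) : f q ≤ f p + ‖q - p‖ := by
  have h := gradient_ineq S.cv (S.sm.differentiable (by simp) q) p
  have h1 := real_inner_le_norm (q - p) (gradient f q)
  have h2 : ⟪p - q, gradient f q⟫ = - ⟪q - p, gradient f q⟫ := by rw [← inner_neg_left, neg_sub]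
  have h3 := mul_le_of_le_one_right (norm_nonneg (q - p)) (S.gr q).le
  linarith

lemma Sl.low (S : Sl φ ψ f) {z : E2} (hz : z ∈ sphere (0 : E2) 1) (p : E2) : ⟪p, z⟫ - φ z ≤ f p := by
  have hz1 : ‖z‖ = 1 := by simpa using hz
  set x : ℝ → E2 := fun t => gradient f (t • z) with hx
  have hlim := S.lim z hz
  have h1 : Tendsto (fun t => ⟪z, x t⟫) atTop (𝓝 1) := by
    have hb : Tendsto (fun t : ℝ => 1 - (t - f (t • z) + f 0) / t) atTop (𝓝 1) := by
      have := (hlim.add_const (f 0)).div_atTop tendsto_id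
      simpa using this.const_sub 1
    refine tendsto_of_tendsto_of_tendsto_of_le_of_le' hb tendsto_const_nhds ?_ (Eventually.of_forall fun t => ?_)
    · filter_upwards [eventually_gt_atTop 0] with t ht
      have := gradient_ineq S.cv (S.sm.differentiable (by simp) (t • z)) 0
      rw [zero_sub, inner_neg_left, real_inner_smul_left] at this
      have e : 1 - (t - f (t • z) + f 0) / t = (f (t • z) - f 0) / t := by field_simp; ring
      rw [e, div_le_iff₀ ht]
      simp only [hx]; linarith
    · have := real_inner_le_norm z (x t)
      rw [hz1, one_mul] at this
      exact this.trans (S.gr _).le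
  have h2 : Tendsto x atTop (𝓝 z) := by
    rw [tendsto_iff_norm_sub_tendsto_zero]
    have h3 : Tendsto (fun t => Real.sqrt (2 - 2 * ⟪z, x t⟫)) atTop (𝓝 0) := by
      have := (Real.continuous_sqrt.tendsto _).comp ((h1.const_mul 2).const_sub 2)
      rw [mul_one, sub_self, Real.sqrt_zero] at this
      exact this
    refine squeeze_zero (fun t => norm_nonneg _) (fun t => Real.le_sqrt_of_sq_le ?_) h3
    rw [norm_sub_sq_real, hz1, real_inner_comm]
    have := S.gr (t • z)
    have : ‖x t‖ ^ 2 ≤ 1 := pow_le_one₀ (norm_nonneg _) this.le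
    linarith
  have h4 : Tendsto (fun t : ℝ => ⟪p, x t⟫ - (t - f (t • z))) atTop (𝓝 (⟪p, z⟫ - φ z)) := (tendsto_const_nhds.inner h2).sub hlim
  refine le_of_tendsto h4 ?_
  filter_upwards [eventually_ge_atTop 0] with t ht
  have h5 := gradient_ineq S.cv (S.sm.differentiable (by simp) (t • z)) (p + t • z)
  have h6 := S.lip p (p + t • z)
  rw [add_sub_cancel_left, norm_smul, hz1, Real.norm_of_nonneg ht] at h6
  rw [add_sub_cancel_right] at h5
  simp only [hx]; linarith

lemma hyp_deriv (C : ℝ) (hC : 0 < C) (c : E2) (d : ℝ) (p : E2) :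
    ContDiff ℝ ∞ (fun q => d + √(C ^ 2 + ‖q - c‖ ^ 2)) ∧
    fderiv ℝ (fun q => d + √(C ^ 2 + ‖q - c‖ ^ 2)) p = (√(C ^ 2 + ‖p - c‖ ^ 2))⁻¹ • innerSL ℝ (p - c) ∧
    detHess (fun q => d + √(C ^ 2 + ‖q - c‖ ^ 2)) p = C ^ 2 / √(C ^ 2 + ‖p - c‖ ^ 2) ^ 4 := by
  have hpos : ∀ q : E2, 0 < C ^ 2 + ‖q - c‖ ^ 2 := fun q => by positivity
  have hn : ∀ q : E2, HasFDerivAt (fun q : E2 => √(C ^ 2 + ‖q - c‖ ^ 2)) ((√(C ^ 2 + ‖q - c‖ ^ 2))⁻¹ • innerSL ℝ (q - c)) q := fun q => by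
    have h1 : HasFDerivAt (fun q : E2 => C ^ 2 + ‖q - c‖ ^ 2) ((2:ℝ) • innerSL ℝ (q - c)) q := by
      have := (((hasFDerivAt_id q).sub_const c).norm_sq).const_add (C ^ 2)
      refine this.congr_fderiv ?_
      ext v; simp
    refine (h1.sqrt (hpos q).ne').congr_fderiv ?_
    rw [smul_smul]; congr 1; field_simp
  have e : fderiv ℝ (fun q => d + √(C ^ 2 + ‖q - c‖ ^ 2)) = fun q => (√(C ^ 2 + ‖q - c‖ ^ 2))⁻¹ • innerSL ℝ (q - c) := by
    ext1 q; exact ((hn q).const_add d).fderiv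
  refine ⟨contDiff_const.add (ContDiff.sqrt (contDiff_const.add ((contDiff_id.sub contDiff_const).norm_sq ℝ)) fun q => (hpos q).ne'), congrFun e p, ?_⟩
  have s0 : √(C ^ 2 + ‖p - c‖ ^ 2) ≠ 0 := (Real.sqrt_pos.2 (hpos p)).ne'
  have hh : ∀ v w : E2, hess (fun q => d + √(C ^ 2 + ‖q - c‖ ^ 2)) p v w =
      (√(C ^ 2 + ‖p - c‖ ^ 2))⁻¹ * ⟪v, w⟫ - ⟪p - c, v⟫ * ⟪p - c, w⟫ / √(C ^ 2 + ‖p - c‖ ^ 2) ^ 3 := fun v w => by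
    have h1 := (hasDerivAt_inv s0).comp_hasFDerivAt p (hn p)
    have h2 : HasFDerivAt (fun q : E2 => innerSL ℝ (q - c)) (innerSL ℝ) p :=
      (innerSL ℝ).hasFDerivAt.comp p ((hasFDerivAt_id p).sub_const c)
    have h3 : fderiv ℝ (fun q => (√(C ^ 2 + ‖q - c‖ ^ 2))⁻¹ • innerSL ℝ (q - c)) p = _ := (h1.smul h2).fderiv
    rw [hess, e, h3]
    simp
    field_simp
    rw [innerSL_apply_apply, inner_sub_left, inner_sub_left]; ring
  have sq : √(C ^ 2 + ‖p - c‖ ^ 2) ^ 2 = C ^ 2 + ‖p - c‖ ^ 2 := Real.sq_sqrt (hpos p).le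
  have nn : ‖p - c‖ ^ 2 = (p - c) 0 ^ 2 + (p - c) 1 ^ 2 := by rw [EuclideanSpace.norm_sq_eq]; simp
  have i : ∀ i, ⟪p - c, EuclideanSpace.single i 1⟫ = (p - c) i := fun i => by simp [EuclideanSpace.inner_single_right]
  rw [detHess, hh, hh, hh, hh, i, i]
  simp only [EuclideanSpace.inner_single_right]
  generalize √(C ^ 2 + ‖p - c‖ ^ 2) = s at *
  simp
  simp at nn
  field_simp
  linear_combination (s ^ 2) * sq + (s ^ 2) * nn

lemma exists_max {D : E2 → ℝ} (hD : Continuous D) (p0 : E2) (R : ℝ) (h : ∀ p, R ≤ ‖p‖ → D p ≤ D p0) : ∃ p, ∀ q, D q ≤ D p :=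
  hD.exists_forall_ge' p0 ((tendsto_norm_cocompact_atTop.eventually_ge_atTop R).mono h)

lemma Sl.grad_norm (S : Sl φ ψ f) (p : E2) : ∀ (v : E2), fderiv ℝ f p = innerSL ℝ v → gradient f p = v := fun v h => by
  rw [gradient, h]; exact (InnerProductSpace.toDual ℝ E2).symm_apply_apply v

lemma Sl.up (S : Sl φ ψ f) {A C : ℝ} (hψ : ∀ z ∈ ball (0:E2) 1, A ≤ ψ z) (hC : 0 < C) (hCA : 1 < C ^ 2 * A) (c : E2) (d : ℝ)
    (h : ∀ z ∈ sphere (0:E2) 1, ⟪c, z⟫ - d ≤ φ z) (p : E2) : f p ≤ d + √(C ^ 2 + ‖p - c‖ ^ 2) := by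
  by_contra hm
  push Not at hm
  set k : E2 → ℝ := fun q => d + √(C ^ 2 + ‖q - c‖ ^ 2) with hk
  set e : ℝ := f p - k p with he
  have he0 : 0 < e := sub_pos.2 hm
  have fc := S.sm.continuous
  obtain ⟨r0, hr0⟩ : ∃ r0 : ℝ, ∀ r, r0 ≤ r → ∀ z ∈ sphere (0:E2) 1, ⟪c, z⟫ - d - e < r - f (r • z) := by
    refine (isCompact_sphere (0:E2) 1).induction_on (p := fun s => ∃ r0 : ℝ, ∀ r, r0 ≤ r → ∀ z ∈ s, ⟪c, z⟫ - d - e < r - f (r • z))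
      ⟨0, by simp⟩ (fun s t hst ⟨r, hr⟩ => ⟨r, fun r' h' z hz => hr r' h' z (hst hz)⟩)
      (fun s t ⟨r, hr⟩ ⟨r', hr'⟩ => ⟨max r r', fun q hq z hz => hz.elim (hr q (le_trans (le_max_left _ _) hq) z) (hr' q (le_trans (le_max_right _ _) hq) z)⟩) ?_
    intro z hz
    obtain ⟨r, hr⟩ := ((S.lim z hz).eventually (lt_mem_nhds (show ⟪c, z⟫ - d - e < φ z by linarith [h z hz]))).exists
    have ho : ∀ᶠ w in 𝓝 z, ⟪c, w⟫ - d - e < r - f (r • w) :=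
      ContinuousAt.eventually_lt (by fun_prop) (by fun_prop) hr
    refine ⟨_, inter_mem_nhdsWithin _ ho, r, fun r' h' w hw => ?_⟩
    have := S.lip (r • w) (r' • w)
    rw [← sub_smul, norm_smul, mem_sphere_zero_iff_norm.1 hw.1, Real.norm_of_nonneg (by linarith)] at this
    have hw2 : ⟪c, w⟫ - d - e < r - f (r • w) := hw.2
    linarith
  obtain ⟨kc, -, -⟩ := hyp_deriv C hC c d p
  obtain ⟨q, hq⟩ := exists_max (D := fun q => f q - k q) (fc.sub kc.continuous) p (max r0 1) fun q hq => by
    have hn : 0 < ‖q‖ := lt_of_lt_of_le one_pos ((le_max_right _ _).trans hq)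
    have hz : ‖q‖⁻¹ • q ∈ sphere (0:E2) 1 := by simp [norm_smul, hn.ne']
    have h1 := hr0 ‖q‖ ((le_max_left _ _).trans hq) _ hz
    rw [smul_smul, mul_inv_cancel₀ hn.ne', one_smul] at h1
    have h2 : ‖q‖ - ⟪c, ‖q‖⁻¹ • q⟫ ≤ √(C ^ 2 + ‖q - c‖ ^ 2) := by
      have h3 := real_inner_le_norm (q - c) (‖q‖⁻¹ • q)
      rw [mem_sphere_zero_iff_norm.1 hz, mul_one, inner_sub_left, real_inner_smul_right, real_inner_self_eq_norm_sq] at h3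
      have h4 : ‖q - c‖ ≤ √(C ^ 2 + ‖q - c‖ ^ 2) := Real.le_sqrt_of_sq_le (by nlinarith)
      have h5 : ‖q‖⁻¹ * ‖q‖ ^ 2 = ‖q‖ := by field_simp
      linarith
    change f q - k q ≤ e
    simp only [hk]; linarith
  obtain ⟨m1, m2⟩ := mp S.sm kc S.cv hq
  obtain ⟨-, k1, k2⟩ := hyp_deriv C hC c d q
  have hpos : 0 < C ^ 2 + ‖q - c‖ ^ 2 := by positivity
  have sq := Real.sq_sqrt hpos.le
  have s0 := Real.sqrt_pos.2 hpos
  have hg := S.grad_norm q ((√(C ^ 2 + ‖q - c‖ ^ 2))⁻¹ • (q - c)) (by rw [m1, k1, map_smul])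
  have hψ' := hψ _ (mem_ball_zero_iff.2 (S.gr q))
  have e1 : 1 - ‖gradient f q‖ ^ 2 = C ^ 2 / √(C ^ 2 + ‖q - c‖ ^ 2) ^ 2 := by
    rw [hg, norm_smul, mul_pow, norm_inv, Real.norm_of_nonneg s0.le]; field_simp; linarith
  rw [S.det, k2, e1] at m2
  generalize √(C ^ 2 + ‖q - c‖ ^ 2) = s at *
  rw [show ψ (gradient f q) * (C ^ 2 / s ^ 2) ^ 2 = ψ (gradient f q) * C ^ 4 / s ^ 4 by rw [div_pow]; ring,
    div_le_div_iff_of_pos_right (by positivity)] at m2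
  have : A * C ^ 4 ≤ ψ (gradient f q) * C ^ 4 := mul_le_mul_of_nonneg_right hψ' (by positivity)
  nlinarith [pow_pos hC 2]

lemma Sl.le {f₁ f₂ : E2 → ℝ} (S₁ : Sl φ ψ f₁) (S₂ : Sl φ ψ f₂) {M A : ℝ} (hM : ∀ z ∈ sphere (0:E2) 1, |φ z| ≤ M)
    (hA : 0 < A) (hψ : ∀ z ∈ ball (0:E2) 1, A ≤ ψ z) (p : E2) : f₂ p ≤ f₁ p := by
  by_contra hlt
  push Not at hlt
  set δ := f₂ p - f₁ p with hδ
  have hδ0 : 0 < δ := sub_pos.2 hlt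
  set C := 1 + 1 / A with hC
  have hC0 : 0 < C := by positivity
  have hCA : 1 < C ^ 2 * A := by
    have : C ^ 2 * A = A + 2 + 1 / A := by rw [hC]; field_simp; ring
    rw [this]; have := one_div_pos.2 hA; linarith
  have c1 := S₁.sm.continuous
  have hG : ContinuousAt (fun l : ℝ => f₂ p - l * f₁ (l⁻¹ • p) - (l - 1) * M) 1 := by
    have : ContinuousAt (fun l : ℝ => l⁻¹) 1 := continuousAt_inv₀ one_ne_zero
    have h2 : ContinuousAt (fun l : ℝ => f₁ (l⁻¹ • p)) 1 := c1.continuousAt.comp (this.smul continuousAt_const)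
    fun_prop
  have hev : ∀ᶠ l : ℝ in 𝓝[>] 1, δ / 2 < f₂ p - l * f₁ (l⁻¹ • p) - (l - 1) * M :=
    (hG.eventually (lt_mem_nhds (by simp; linarith))).filter_mono nhdsWithin_le_nhds
  obtain ⟨l, hl, hl1⟩ := (hev.and self_mem_nhdsWithin).exists
  have hl1 : 1 < l := hl1
  have l0 : 0 < l := by linarith
  set m := l⁻¹ with hm
  have lm : l * m = 1 := mul_inv_cancel₀ l0.ne'
  have m0 : 0 < m := inv_pos.2 l0
  have m1 : m < 1 := inv_lt_one_of_one_lt₀ hl1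
  set G : E2 → ℝ := fun q => l * f₁ (m • q) with hGd
  have sG : ContDiff ℝ ∞ G := contDiff_const.mul (S₁.sm.comp (contDiff_const_smul m))
  obtain ⟨q, hq⟩ := exists_max (D := fun q => f₂ q - G q) (S₂.sm.continuous.sub sG.continuous) p (max 1 (C ^ 2 / δ / (1 - m))) fun q hq => by
    have hn : 0 < ‖q‖ := lt_of_lt_of_le one_pos ((le_max_left _ _).trans hq)
    have h1 := S₂.up hψ hC0 hCA (m • q) (f₁ (m • q)) (fun z hz => by linarith [S₁.low hz (m • q)]) q
    have hz : ‖q‖⁻¹ • q ∈ sphere (0:E2) 1 := by simp [norm_smul, hn.ne']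
    have h2 := S₁.low hz (m • q)
    have h3 := (abs_le.1 (hM _ hz)).2
    rw [real_inner_smul_left, real_inner_smul_right, real_inner_self_eq_norm_sq] at h2
    have h5 : ‖q‖⁻¹ * ‖q‖ ^ 2 = ‖q‖ := by field_simp
    rw [h5] at h2
    have h6 : q - m • q = (1 - m) • q := by rw [sub_smul, one_smul]
    rw [h6, norm_smul, Real.norm_of_nonneg (by linarith)] at h1
    have h7 : √(C ^ 2 + ((1 - m) * ‖q‖) ^ 2) ≤ (1 - m) * ‖q‖ + δ / 2 := by
      have h8 : C ^ 2 / δ ≤ (1 - m) * ‖q‖ := by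
        have := (le_max_right _ _).trans hq
        rw [div_le_iff₀ (by linarith)] at this; linarith
      rw [div_le_iff₀ hδ0] at h8
      refine Real.sqrt_le_iff.2 ⟨by have := mul_pos (sub_pos.2 m1) hn; linarith, ?_⟩
      nlinarith
    have h9 : (l - 1) * (m * ‖q‖ - M) ≤ (l - 1) * f₁ (m • q) := mul_le_mul_of_nonneg_left (by linarith) (by linarith)
    have h10 : (l - 1) * (m * ‖q‖ - M) = (1 - m) * ‖q‖ - (l - 1) * M := by linear_combination ‖q‖ * lm
    simp only [hGd]; linarith
  obtain ⟨k1, k2⟩ := mp S₂.sm sG S₂.cv hq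
  have eG : fderiv ℝ G = fun q => fderiv ℝ f₁ (m • q) := by
    ext1 q
    have h1 := ((S₁.sm.differentiable (by simp) (m • q)).hasFDerivAt.comp q ((hasFDerivAt_id q).const_smul m)).const_mul l
    have : fderiv ℝ G q = _ := h1.fderiv
    rw [this]; ext v; simp [← mul_assoc, lm]
  have eh : ∀ v w, hess G q v w = m * hess f₁ (m • q) v w := fun v w => by
    have h1 := (((S₁.sm.fderiv_right (m := ∞) (by simp)).differentiable (by simp)) (m • q)).hasFDerivAt.comp q ((hasFDerivAt_id q).const_smul m)
    have h2 : fderiv ℝ (fun q => fderiv ℝ f₁ (m • q)) q = _ := h1.fderiv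
    rw [hess, eG, h2]; simp [hess]
  have hd : detHess G q = m ^ 2 * detHess f₁ (m • q) := by
    simp only [detHess, eh]; ring
  have hg : gradient f₂ q = gradient f₁ (m • q) := by
    rw [gradient, gradient, k1, eG]
  rw [hd, S₁.det, S₂.det, hg] at k2
  set x := gradient f₁ (m • q) with hx
  have hx1 : ‖x‖ < 1 := S₁.gr _
  have hp : 0 < ψ x * (1 - ‖x‖ ^ 2) ^ 2 := by
    have := hψ x (mem_ball_zero_iff.2 hx1)
    have : 0 < 1 - ‖x‖ ^ 2 := by nlinarith [norm_nonneg x]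
    have : 0 < ψ x := by linarith
    positivity
  have hm2 : m ^ 2 < 1 := pow_lt_one₀ m0.le m1 two_ne_zero
  have := mul_lt_of_lt_one_left hp hm2
  linarith

end B14

section B15
open Complex
open scoped ContDiff

lemma weak_lim {φ f : ℂ → ℝ} {M C : ℝ} (hφ : LowerSemicontinuousOn φ (sphere (0:ℂ) 1)) (hM : ∀ z ∈ sphere (0:ℂ) 1, |φ z| ≤ M)
    (h1 : ∀ p, ∀ z ∈ sphere (0:ℂ) 1, ⟪p, z⟫ - φ z ≤ f p)
    (h2 : ∀ (a : ℂ) (c : ℝ), (∀ z ∈ sphere (0:ℂ) 1, ⟪a, z⟫ + c ≤ φ z) → ∀ p, f p ≤ - c + √(C ^ 2 + ‖p - a‖ ^ 2))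
    {z : ℂ} (hz : z ∈ sphere (0:ℂ) 1) : Tendsto (fun r : ℝ => r - f (r • z)) atTop (𝓝 (φ z)) := by
  have hz1 : ‖z‖ = 1 := mem_sphere_zero_iff_norm.1 hz
  have hzz : ⟪z, z⟫ = 1 := by rw [real_inner_self_eq_norm_sq, hz1, one_pow]
  refine tendsto_order.2 ⟨fun y hy => ?_, fun y hy => Eventually.of_forall fun r => ?_⟩
  · obtain ⟨y', hy1, hy2⟩ := exists_between hy
    have hM0 : 0 ≤ M := (abs_nonneg _).trans (hM z hz)
    obtain ⟨ε, hε, hb⟩ := Metric.mem_nhdsWithin_iff.1 (hφ z hz y' hy2)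
    set K := 4 * (M + |y'|) / ε ^ 2 with hK
    have hK0 : 0 ≤ K := by positivity
    have key : ∀ w ∈ sphere (0:ℂ) 1, ⟪K • z, w⟫ + (y' - K) ≤ φ w := fun w hw => by
      have hw1 : ‖w‖ = 1 := mem_sphere_zero_iff_norm.1 hw
      have hd := norm_sub_sq_real w z
      rw [hz1, hw1, real_inner_comm] at hd
      rw [real_inner_smul_left]
      by_cases hwz : dist w z < ε
      · have : y' < φ w := hb ⟨mem_ball.2 hwz, hw⟩
        have : K * ⟪z, w⟫ ≤ K := mul_le_of_le_one_right hK0 (by nlinarith [sq_nonneg ‖w - z‖])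
        linarith
      · rw [dist_eq_norm] at hwz
        push Not at hwz
        have h3 : ε ^ 2 ≤ ‖w - z‖ ^ 2 := pow_le_pow_left₀ hε.le hwz 2
        have h4 : K * ε ^ 2 ≤ K * ‖w - z‖ ^ 2 := mul_le_mul_of_nonneg_left h3 hK0
        have h5 : K * ε ^ 2 = 4 * (M + |y'|) := by rw [hK]; field_simp
        rw [hd] at h4
        have h6 := (abs_le.1 (hM w hw)).1
        have h7 := le_abs_self y'
        have h8 := abs_nonneg y'
        linarith
    have h3 := h2 (K • z) (y' - K) key
    filter_upwards [eventually_ge_atTop K, eventually_gt_atTop (K + C ^ 2 / (y' - y))] with r hr hr2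
    have h4 := h3 (r • z)
    rw [← sub_smul, norm_smul, hz1, mul_one, Real.norm_of_nonneg (by linarith)] at h4
    have h5 : √(C ^ 2 + (r - K) ^ 2) < (r - K) + (y' - y) := by
      have h6 : C ^ 2 / (y' - y) < r - K := by linarith
      rw [div_lt_iff₀ (by linarith)] at h6
      rw [Real.sqrt_lt' (by linarith)]
      nlinarith [mul_pos (sub_pos.2 hy1) (sub_pos.2 hy1)]
    linarith
  · have := h1 (r • z) z hz
    rw [real_inner_smul_left, hzz] at this
    linarith

theorem exists_sl {φ ψ : E2 → ℝ} {M A B : ℝ} (hM : ∀ z ∈ sphere (0:E2) 1, |φ z| ≤ M) (hφ : LowerSemicontinuousOn φ (sphere (0:E2) 1))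
    (hA : 0 < A) (hψs : ContDiffOn ℝ ∞ ψ (ball 0 1)) (hψ : ∀ z ∈ ball (0:E2) 1, A ≤ ψ z ∧ ψ z ≤ B) : ∃ f, Sl φ ψ f := by
  set L : ℂ ≃ₗᵢ[ℝ] E2 := Complex.orthonormalBasisOneI.repr with hL
  have L0 : L.symm (EuclideanSpace.single 0 1) = 1 := by simp [hL]
  have L1 : L.symm (EuclideanSpace.single 1 1) = I := by simp [hL]
  have Lre : ∀ z, ⟪L z, EuclideanSpace.single 0 1⟫ = z.re := fun z => by simp [hL, EuclideanSpace.inner_single_right]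
  have Lim : ∀ z, ⟪L z, EuclideanSpace.single 1 1⟫ = z.im := fun z => by simp [hL, EuclideanSpace.inner_single_right]
  have hs : ∀ z ∈ sphere (0:ℂ) 1, L z ∈ sphere (0:E2) 1 := fun z hz => by
    rw [mem_sphere_zero_iff_norm] at hz ⊢; rw [L.norm_map, hz]
  have hb : ∀ z : ℂ, ‖z‖ < 1 → L z ∈ ball (0:E2) 1 := fun z hz => by
    rw [mem_ball_zero_iff, L.norm_map]; exact hz
  have hφ' : LowerSemicontinuousOn (fun z => φ (L z)) (sphere (0:ℂ) 1) := fun z hz y hy =>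
    (L.continuous.continuousWithinAt.tendsto_nhdsWithin hs).eventually (hφ (L z) (hs z hz) y hy)
  have hM' : ∀ z ∈ sphere (0:ℂ) 1, |φ (L z)| ≤ M := fun z hz => hM _ (hs z hz)
  have hC : 1 ≤ (1 + 1 / A) ^ 2 * A := by
    have e : (1 + 1 / A) ^ 2 * A = A + 2 + 1 / A := by field_simp; ring
    rw [e]; have := one_div_pos.2 hA; linarith
  obtain ⟨f, H, h1, h2⟩ := exists_weak (ψ := fun z => ψ (L z)) hφ' hM' hA
    (hψs.comp L.contDiff.contDiffOn fun z hz => hb z (mem_ball_zero_iff.1 hz))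
    (fun z hz => (hψ _ (hb z hz)).1) (fun z hz => (hψ _ (hb z hz)).2) (C := 1 + 1 / A) (by positivity) hC
  obtain ⟨s1, s2, s3⟩ := H.smooth
  have e1 : fderiv ℝ (fun p => f (L.symm p)) = fun p => innerSL ℝ (L (gradient f (L.symm p))) := by
    ext1 p
    have : fderiv ℝ (fun p => f (L.symm p)) p = _ :=
      ((s1.differentiable (by simp) (L.symm p)).hasFDerivAt.comp p L.symm.toContinuousLinearEquiv.hasFDerivAt).fderiv
    rw [this]
    ext v
    change fderiv ℝ f (L.symm p) (L.symm v) = ⟪L (gradient f (L.symm p)), v⟫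
    rw [fderiv_eq_inner, real_inner_comm, ← L.inner_map_map, L.apply_symm_apply]
  have e2 : ∀ p, gradient (fun p => f (L.symm p)) p = L (gradient f (L.symm p)) := fun p => by
    rw [gradient, e1]; exact (InnerProductSpace.toDual ℝ E2).symm_apply_apply _
  have e3 : ∀ p v w, hess (fun p => f (L.symm p)) p v w = ⟪L (fderiv ℝ (gradient f) (L.symm p) (L.symm v)), w⟫ := fun p v w => by
    have h3 := (s2.differentiable (by simp) (L.symm p)).hasFDerivAt.comp p L.symm.toContinuousLinearEquiv.hasFDerivAt
    have h4 := L.toContinuousLinearEquiv.hasFDerivAt.comp p h3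
    have h5 : fderiv ℝ (fun p => innerSL ℝ (L (gradient f (L.symm p)))) p = _ := ((innerSL ℝ).hasFDerivAt.comp p h4).fderiv
    rw [hess, e1, h5]; rfl
  refine ⟨fun p => f (L.symm p), s1.comp L.symm.contDiff, H.conv.comp_linearMap L.symm.toLinearEquiv.toLinearMap, fun p => ?_, fun p => ?_, fun z hz => ?_⟩
  · rw [e2, L.norm_map]; exact H.grad_lt _
  · rw [e2, L.norm_map, detHess, e3, e3, e3, e3, L0, L1, Lre, Lre, Lim, Lim, s3, one_div_one_div]
  · have := weak_lim hφ' hM' h1 h2 (z := L.symm z) (by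
      rw [mem_sphere_zero_iff_norm] at hz ⊢; rw [L.symm.norm_map, hz])
    simpa using this

end B15

/-- **Theorem 1.3 (Minkowski problem in Minkowski space).**
Given `φ : ∂𝔻 → ℝ` bounded and lower semicontinuous and `ψ : 𝔻 → ℝ` smooth with
`0 < a ≤ ψ ≤ b < ∞`, there is a unique smooth convex `f : ℝ² → ℝ` whose graph is a spacelike
entire graph with curvature `−ψ` (read through the Gauss map `∇f`) and with support function
at infinity `φ`. -/
theorem minkowski_problem_lsc
    (φ : E2 → ℝ)
    (hφb : ∃ M : ℝ, ∀ z ∈ sphere (0 : E2) 1, |φ z| ≤ M)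
    (hφl : LowerSemicontinuousOn φ (sphere (0 : E2) 1))
    (ψ : E2 → ℝ) (a b : ℝ) (ha : 0 < a) (hab : a ≤ b)
    (hψs : ContDiffOn ℝ (⊤ : ℕ∞) ψ (ball (0 : E2) 1))
    (hψ : ∀ z ∈ ball (0 : E2) 1, a ≤ ψ z ∧ ψ z ≤ b) :
    ∃! f : E2 → ℝ,
      ContDiff ℝ (⊤ : ℕ∞) f ∧ ConvexOn ℝ Set.univ f ∧
      (∀ p : E2, ‖gradient f p‖ < 1) ∧
      (∀ p : E2, detHess f p = ψ (gradient f p) * (1 - ‖gradient f p‖ ^ 2) ^ 2) ∧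
      (∀ z ∈ sphere (0 : E2) 1,
        Tendsto (fun r : ℝ => r - f (r • z)) atTop (𝓝 (φ z))) := by
  obtain ⟨M, hM⟩ := hφb
  obtain ⟨f, S⟩ := exists_sl hM hφl ha hψs hψ
  refine ⟨f, ⟨S.sm, S.cv, S.gr, S.det, S.lim⟩, fun g hg => ?_⟩
  have T : Sl φ ψ g := ⟨hg.1, hg.2.1, hg.2.2.1, hg.2.2.2.1, hg.2.2.2.2⟩
  have hl : ∀ z ∈ ball (0 : E2) 1, a ≤ ψ z := fun z hz => (hψ z hz).1
  exact funext fun p => le_antisymm (Sl.le S T hM ha hl p) (Sl.le T S hM ha hl p)
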